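/- Let η ∈ {1,2} and let q, r, s be primes with q ≡ 3 (mod 4), r ≡ s ≡ 5 (mod 8), Legendre symbols (q/r) = (q/s) = (−1)^{δ_{η,2}} and (r/s) = 1, let (γ, γ′) be the fundamental solution of X² − ηqrs·Y² = 1, assume 2^{δ_{η,1}}·q·(γ−1) is not a perfect square, and suppose the negative Pell equation x² − rs·y² = −1 has no integer solutions. Set K = ℚ(√(ηq), √(rs)). Then for every integer n ≥ 0, the n-th layer K_n of the cyclotomic ℤ₂-extension of K satisfies 2·h₂(K_n) = h₂(rs)·h₂(ηqrs). -/

import Mathlib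

open IntermediateField NumberField

/-- The `n`-th layer `k(2·cos(2π/2^(n+2)))` of the cyclotomic `ℤ₂`-extension of a
(totally real) subfield of `ℝ`. -/
noncomputable def layer (F : IntermediateField ℚ ℝ) (n : ℕ) : IntermediateField ℚ ℝ :=
  F ⊔ IntermediateField.adjoin ℚ {2 * Real.cos (2 * Real.pi / 2 ^ (n + 2))}

/-- The 2-part of the class number of a subfield of `ℝ` (the largest power of 2 dividing
the cardinality of the class group of its ring of integers). -/
noncomputable def h2 (F : IntermediateField ℚ ℝ) : ℕ :=
  2 ^ ((Nat.card (ClassGroup (NumberField.RingOfIntegers F))).factorization 2)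


section
set_option linter.unusedSectionVars false
open nonZeroDivisors

section
section GroupPart

variable {X G : Type*} [CommGroup X] [CommGroup G]

/-- `x ↦ x / σ x`. -/
def dmH (σ : X →* X) : X →* X where
  toFun x := x / σ x
  map_one' := by simp
  map_mul' x y := by simp [mul_div_mul_comm]

/-- `x ↦ x * σ x`. -/
def nmH (σ : X →* X) : X →* X where
  toFun x := x * σ x
  map_one' := by simp
  map_mul' x y := by simp [mul_mul_mul_comm]

@[simp] lemma dmH_apply (σ : X →* X) (x : X) : dmH σ x = x / σ x := rfl
@[simp] lemma nmH_apply (σ : X →* X) (x : X) : nmH σ x = x * σ x := rfl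

lemma mem_ker_dmH {σ : X →* X} {x : X} : x ∈ (dmH σ).ker ↔ σ x = x := by
  rw [MonoidHom.mem_ker, dmH_apply, div_eq_one, eq_comm]

lemma mem_ker_nmH {σ : X →* X} {x : X} : x ∈ (nmH σ).ker ↔ x * σ x = 1 := by
  rw [MonoidHom.mem_ker, nmH_apply]

/-- The subgroup of elements whose quotient `I / σ I` is principal. -/
def ambW (P : X →* G) (σG : G →* G) : Subgroup G := P.range.comap (dmH σG)

theorem amb_abstract (P : X →* G) (σ : X →* X) (σG : G →* G)
    (hσ : ∀ x, σ (σ x) = x) (hσG : ∀ x, σG (σG x) = x)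
    (hP : ∀ x, P (σ x) = σG (P x))
    (h90 : ∀ x, x * σ x = 1 → ∃ z, x = z / σ z)
    (h90' : ∀ x, P x * σG (P x) = 1 → ∃ J, P x = J / σG J) :
    P.range.relIndex (ambW P σG) * (P.ker.map (dmH σ)).relIndex (P.ker ⊓ (nmH σ).ker)
      = ((dmH σ).ker.map P).relIndex (dmH σG).ker *
        (P.ker.map (nmH σ)).relIndex (P.ker ⊓ (nmH σ).range) := by
  -- first lemma
  have L1 : ((dmH σ).ker.map P).relIndex (P.range ⊓ (dmH σG).ker) =
      (P.ker.map (dmH σ)).relIndex (P.ker ⊓ (nmH σ).ker) := by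
    have e1 : P.range ⊓ (dmH σG).ker = ((dmH σG).ker.comap P).map P := by
      rw [Subgroup.map_comap_eq]
    have e2 : P.ker ⊓ (nmH σ).ker = ((dmH σG).ker.comap P).map (dmH σ) := by
      ext x
      simp only [Subgroup.mem_inf, Subgroup.mem_map, Subgroup.mem_comap, mem_ker_dmH, mem_ker_nmH,
        dmH_apply]
      rw [MonoidHom.mem_ker]
      constructor
      · rintro ⟨h1, h2⟩
        obtain ⟨z, rfl⟩ := h90 x h2
        refine ⟨z, ?_, rfl⟩
        rw [map_div, div_eq_one, hP] at h1
        exact h1.symm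
      · rintro ⟨z, h1, rfl⟩
        refine ⟨?_, ?_⟩
        · rw [map_div, hP, h1, div_self']
        · rw [map_div, hσ]; simp
    rw [e1, e2, ← Subgroup.relIndex_comap, ← Subgroup.relIndex_comap, Subgroup.comap_map_eq,
      Subgroup.comap_map_eq, sup_comm]
  have L2 : (P.range ⊔ (dmH σG).ker).relIndex (ambW P σG) =
      (P.ker.map (nmH σ)).relIndex (P.ker ⊓ (nmH σ).range) := by
    have e0 : P.range ⊔ (dmH σG).ker = (P.range.map (dmH σG)).comap (dmH σG) := by
      rw [Subgroup.comap_map_eq]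
    have e1 : (ambW P σG).map (dmH σG) = (P.ker.comap (nmH σ)).map P := by
      ext I
      simp only [ambW, Subgroup.mem_map, Subgroup.mem_comap, MonoidHom.mem_range,
        MonoidHom.mem_ker, dmH_apply, nmH_apply]
      constructor
      · rintro ⟨J, ⟨x, hx⟩, rfl⟩
        refine ⟨x, ?_, hx⟩
        rw [map_mul, hP, hx, map_div, hσG]; simp
      · rintro ⟨x, h, rfl⟩
        rw [map_mul, hP] at h
        obtain ⟨J, hJ⟩ := h90' x h
        exact ⟨J, ⟨x, hJ⟩, hJ.symm⟩
    have e2 : P.range.map (dmH σG) = (dmH σ).range.map P := by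
      ext I
      simp only [Subgroup.mem_map, MonoidHom.mem_range, dmH_apply]
      constructor
      · rintro ⟨_, ⟨x, rfl⟩, rfl⟩
        exact ⟨_, ⟨x, rfl⟩, by rw [map_div, hP]⟩
      · rintro ⟨_, ⟨x, rfl⟩, rfl⟩
        exact ⟨_, ⟨x, rfl⟩, by rw [map_div, hP]⟩
    have e3 : P.ker ⊓ (nmH σ).range = (P.ker.comap (nmH σ)).map (nmH σ) := by
      rw [Subgroup.map_comap_eq, inf_comm]
    have e4 : (dmH σ).range = (nmH σ).ker := by
      ext x
      simp only [MonoidHom.mem_range, mem_ker_nmH, dmH_apply]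
      constructor
      · rintro ⟨z, rfl⟩
        rw [map_div, hσ]; simp
      · intro h
        obtain ⟨z, hz⟩ := h90 x h
        exact ⟨z, hz.symm⟩
    rw [e0, Subgroup.relIndex_comap, e1, e2, ← Subgroup.relIndex_comap, Subgroup.comap_map_eq, e3,
      ← Subgroup.relIndex_comap, Subgroup.comap_map_eq, e4, sup_comm]
  have hPXW : P.range ⊔ (dmH σG).ker ≤ ambW P σG := by
    refine sup_le ?_ ?_
    · rintro _ ⟨x, rfl⟩
      exact ⟨x / σ x, by rw [map_div, hP]; rfl⟩
    · intro I hI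
      rw [MonoidHom.mem_ker] at hI
      simp only [ambW, Subgroup.mem_comap]
      rw [hI]; exact one_mem _
  have hA : P.range.relIndex (dmH σG).ker * (P.range ⊔ (dmH σG).ker).relIndex (ambW P σG)
      = P.range.relIndex (ambW P σG) := by
    rw [← Subgroup.relIndex_mul_relIndex _ _ _ le_sup_left hPXW, Subgroup.relIndex_sup_left]
  have hB : ((dmH σ).ker.map P).relIndex (P.range ⊓ (dmH σG).ker) * P.range.relIndex (dmH σG).ker
      = ((dmH σ).ker.map P).relIndex (dmH σG).ker := by
    rw [← Subgroup.inf_relIndex_right P.range]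
    refine Subgroup.relIndex_mul_relIndex _ _ _ ?_ inf_le_right
    rintro _ ⟨x, hx, rfl⟩
    refine ⟨⟨x, rfl⟩, ?_⟩
    have hx' : σ x = x := mem_ker_dmH.1 hx
    show P x ∈ (dmH σG).ker
    rw [mem_ker_dmH, ← hP, hx']
  rw [← hA, ← hB, ← L1, ← L2]; ring

theorem herbrand_abstract {E : Type*} [CommGroup E] (σ : E →* E) (hσ : ∀ x, σ (σ x) = x)
    (e : E) (he2 : e * e = 1) (he1 : e ≠ 1) (htor : ∀ x : E, x * x = 1 → x = 1 ∨ x = e)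
    (hσe : σ e = e) (hesq : ∀ x : E, x * x ≠ e) (b : ℕ) (hb : b ≠ 0)
    (hE : (powMonoidHom 2 : E →* E).range.index = b * b)
    (hEp : ((dmH σ).ker.map (powMonoidHom 2)).relIndex (dmH σ).ker = b) :
    (dmH σ).range.relIndex (nmH σ).ker = 2 * (nmH σ).range.relIndex (dmH σ).ker ∧
    (nmH σ).range.relIndex (dmH σ).ker ≠ 0 := by
  set Ep := (dmH σ).ker with hEpdef
  set Em := (nmH σ).ker with hEmdef
  set sq : E →* E := powMonoidHom 2 with hsq
  have hsqa : ∀ x, sq x = x * x := fun x => by simp [hsq, pow_two]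
  have mEp : ∀ x, x ∈ Ep ↔ σ x = x := fun x => mem_ker_dmH
  have mEm : ∀ x, x ∈ Em ↔ x * σ x = 1 := fun x => mem_ker_nmH
  have SEp : Ep.map sq = Ep.map (nmH σ) := by
    ext y; constructor
    · rintro ⟨x, hx, rfl⟩; exact ⟨x, hx, by rw [hsqa, nmH_apply, (mEp x).1 hx]⟩
    · rintro ⟨x, hx, rfl⟩; exact ⟨x, hx, by rw [hsqa, nmH_apply, (mEp x).1 hx]⟩
  have hinv : ∀ x ∈ Em, σ x = x⁻¹ := fun x hx => (inv_eq_of_mul_eq_one_right ((mEm x).1 hx)).symm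
  have SEm : Em.map sq = Em.map (dmH σ) := by
    ext y; constructor
    · rintro ⟨x, hx, rfl⟩; exact ⟨x, hx, by rw [hsqa, dmH_apply, hinv x hx]; simp⟩
    · rintro ⟨x, hx, rfl⟩; exact ⟨x, hx, by rw [hsqa, dmH_apply, hinv x hx]; simp⟩
  set H := Ep ⊔ Em with hH
  have i1 : (Ep.map sq).relIndex (nmH σ).range = H.index := by
    rw [SEp, MonoidHom.range_eq_map, ← Subgroup.relIndex_comap, Subgroup.comap_map_eq,
      Subgroup.relIndex_top_right]
  have i2 : (Em.map sq).relIndex (dmH σ).range = H.index := by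
    rw [SEm, MonoidHom.range_eq_map, ← Subgroup.relIndex_comap, Subgroup.comap_map_eq,
      Subgroup.relIndex_top_right, sup_comm]
  have j1 : H.index * (nmH σ).range.relIndex Ep = b := by
    rw [← i1, Subgroup.relIndex_mul_relIndex, hEp]
    · rw [SEp]; exact Subgroup.map_le_range _ _
    · rintro _ ⟨x, rfl⟩
      rw [mEp, nmH_apply, map_mul, hσ, mul_comm]
  have j2 : H.index * (dmH σ).range.relIndex Em = (Em.map sq).relIndex Em := by
    rw [← i2, Subgroup.relIndex_mul_relIndex]
    · rw [SEm]; exact Subgroup.map_le_range _ _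
    · rintro _ ⟨x, rfl⟩
      rw [mEm, dmH_apply, map_div, hσ]; simp
  have hH0 : H.index ≠ 0 := by
    intro h; rw [h, zero_mul] at j1; exact hb j1.symm
  have hsqH : sq.range ≤ H := by
    rintro _ ⟨x, rfl⟩
    have : sq x = nmH σ x * dmH σ x := by
      rw [hsqa, nmH_apply, dmH_apply, mul_comm x (σ x), mul_assoc, mul_div, mul_div_cancel]
    rw [this]
    refine Subgroup.mul_mem_sup ?_ ?_
    · rw [mEp, nmH_apply, map_mul, hσ, mul_comm]
    · rw [mEm, dmH_apply, map_div, hσ]; simp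
  have hkersq : sq.ker ≤ H := by
    intro x hx
    rw [MonoidHom.mem_ker, hsqa] at hx
    rcases htor x hx with rfl | rfl
    · exact one_mem _
    · exact Subgroup.mem_sup_left ((mEp _).2 hσe)
  have k1 : (H.map sq).relIndex H = b * b := by
    have h1 : (H.map sq).relIndex H * H.index = (H.map sq).index :=
      Subgroup.relIndex_mul_index ((Subgroup.map_le_range _ _).trans hsqH)
    have h2 : (H.map sq).relIndex sq.range * sq.range.index = (H.map sq).index :=
      Subgroup.relIndex_mul_index (Subgroup.map_le_range _ _)
    have h3 : (H.map sq).relIndex sq.range = H.index := by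
      rw [MonoidHom.range_eq_map, ← Subgroup.relIndex_comap, Subgroup.comap_map_eq,
        Subgroup.relIndex_top_right, sup_of_le_left hkersq]
    rw [h3, hE] at h2
    rw [← h2, mul_comm] at h1
    exact Nat.eq_of_mul_eq_mul_left (Nat.pos_of_ne_zero hH0) h1
  have hSp : Ep.map sq ≤ Ep := by
    rintro _ ⟨x, hx, rfl⟩; rw [hsqa]; exact mul_mem hx hx
  have hSm : Em.map sq ≤ Em := by
    rintro _ ⟨x, hx, rfl⟩; rw [hsqa]; exact mul_mem hx hx
  set c := (Em.map sq).relIndex Em with hc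
  have k2 : (Ep.map sq ⊔ Em.map sq).relIndex (Ep.map sq ⊔ Em) *
      (Ep.map sq ⊔ Em).relIndex H = b * b := by
    rw [Subgroup.relIndex_mul_relIndex _ _ _ (sup_le_sup_left hSm _) (sup_le_sup_right hSp _),
      ← Subgroup.map_sup, k1]
  have k3 : (Ep.map sq ⊔ Em.map sq).relIndex (Ep.map sq ⊔ Em) = c := by
    have : Ep.map sq ⊔ Em = (Ep.map sq ⊔ Em.map sq) ⊔ Em := by
      rw [sup_assoc, sup_of_le_right hSm]
    rw [this, Subgroup.relIndex_sup_left, ← Subgroup.inf_relIndex_right, hc]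
    congr 1
    apply le_antisymm
    · rintro y ⟨hy1, hy2⟩
      obtain ⟨_, ⟨u, hu, rfl⟩, _, ⟨v, hv, rfl⟩, rfl⟩ := Subgroup.mem_sup.1 hy1
      have hv' : sq v ∈ Em := hSm ⟨v, hv, rfl⟩
      have hu' : sq u ∈ Em := by
        have := Em.mul_mem hy2 (Em.inv_mem hv')
        simpa using this
      have h1 : sq u * σ (sq u) = 1 := (mEm _).1 hu'
      have h2 : σ (sq u) = sq u := by rw [hsqa, map_mul, (mEp u).1 hu]
      rw [h2] at h1
      rcases htor _ h1 with h | h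
      · rw [h, one_mul]; exact ⟨v, hv, rfl⟩
      · rw [hsqa] at h; exact absurd h (hesq u)
    · exact le_inf le_sup_right hSm
  have k4 : 2 * (Ep.map sq ⊔ Em).relIndex H = b := by
    have e1 : H = (Ep.map sq ⊔ Em) ⊔ Ep := by
      rw [sup_right_comm, sup_of_le_right hSp]
    have e2 : (Ep.map sq ⊔ Em) ⊓ Ep = Ep.map sq ⊔ Subgroup.zpowers e := by
      apply le_antisymm
      · rintro y ⟨hy1, hy2⟩
        obtain ⟨_, ⟨u, hu, rfl⟩, v, hv, rfl⟩ := Subgroup.mem_sup.1 hy1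
        have hu' : sq u ∈ Ep := hSp ⟨u, hu, rfl⟩
        have hv' : v ∈ Ep := by
          have := Ep.mul_mem (Ep.inv_mem hu') hy2
          simpa using this
        have h1 : v * v = 1 := by
          have := (mEm _).1 hv
          rwa [(mEp _).1 hv'] at this
        refine Subgroup.mul_mem_sup ⟨u, hu, rfl⟩ ?_
        rcases htor _ h1 with h | h
        · rw [h]; exact one_mem _
        · rw [h]; exact Subgroup.mem_zpowers e
      · refine le_inf (sup_le_sup_left ?_ _) (sup_le hSp ?_)
        · rw [Subgroup.zpowers_le, mEm, hσe, he2]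
        · rw [Subgroup.zpowers_le, mEp, hσe]
    have e3 : (Ep.map sq).relIndex (Ep.map sq ⊔ Subgroup.zpowers e) = 2 := by
      rw [Subgroup.relIndex_sup_left]
      rw [Subgroup.relIndex_eq_two_iff]
      refine ⟨e, Subgroup.mem_zpowers e, ?_⟩
      have hne : e ∉ Ep.map sq := by
        rintro ⟨u, -, hu⟩; rw [hsqa] at hu; exact hesq u hu
      intro y hy
      have : y = 1 ∨ y = e := by
        apply htor
        obtain ⟨n, rfl⟩ := Subgroup.mem_zpowers_iff.1 hy
        rw [← mul_zpow, he2, one_zpow]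
      rcases this with rfl | rfl
      · rw [one_mul]; exact Or.inr ⟨one_mem _, hne⟩
      · rw [he2]; exact Or.inl ⟨one_mem _, hne⟩
    have e4 : (Ep.map sq ⊔ Em).relIndex H = (Ep.map sq ⊔ Subgroup.zpowers e).relIndex Ep := by
      rw [e1, Subgroup.relIndex_sup_left, ← Subgroup.inf_relIndex_right, e2]
    rw [← e3, e4, Subgroup.relIndex_mul_relIndex _ _ _ le_sup_left, hEp]
    rw [← e2]; exact inf_le_right
  have k5 : c = 2 * b := by
    rw [k3] at k2
    have : c * (2 * (Ep.map sq ⊔ Em).relIndex H) = 2 * b * b := by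
      calc _ = 2 * (c * (Ep.map sq ⊔ Em).relIndex H) := by ring
        _ = _ := by rw [k2]; ring
    rw [k4] at this
    exact Nat.eq_of_mul_eq_mul_right (Nat.pos_of_ne_zero hb) this
  refine ⟨?_, ?_⟩
  · apply Nat.eq_of_mul_eq_mul_left (Nat.pos_of_ne_zero hH0)
    rw [j2, k5, ← j1]; ring
  · intro h; rw [h, mul_zero] at j1; exact hb j1.symm

end GroupPart
end

section
open NumberField

section UnitIndex

variable (K : Type*) [Field K] [NumberField K]

/-- real embeddings kill torsion -/
lemma tors_eq (K : Type*) [Field K] [NumberField K] (φ : K →+* ℝ) (x : (𝓞 K)ˣ)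
    (hx : x ∈ Units.torsion K) : x = 1 ∨ x = -1 := by
  have hf : IsOfFinOrder x := hx
  obtain ⟨n, hn, hn1⟩ := isOfFinOrder_iff_pow_eq_one.1 hf
  have h1 : (φ ((x : 𝓞 K) : K)) ^ n = 1 := by
    rw [← map_pow]
    have : (((x ^ n : (𝓞 K)ˣ) : 𝓞 K) : K) = 1 := by rw [hn1]; simp
    push_cast at this
    rw [this, map_one]
  have h2 : |φ ((x : 𝓞 K) : K)| = 1 := by
    have := congrArg abs h1
    rw [abs_pow, abs_one] at this
    exact (pow_eq_one_iff_of_nonneg (abs_nonneg _) hn.ne').1 this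
  have hinj : Function.Injective (fun y : (𝓞 K)ˣ => φ ((y : 𝓞 K) : K)) := by
    intro a b hab
    have := φ.injective hab
    exact Units.ext (RingOfIntegers.ext this)
  rcases eq_or_eq_neg_of_abs_eq h2 with h | h
  · left; apply hinj; simp [h]
  · right; apply hinj; simp [h]

lemma sq_ne_neg_one (K : Type*) [Field K] [NumberField K] (φ : K →+* ℝ) (x : (𝓞 K)ˣ) :
    x * x ≠ -1 := by
  intro h
  have h1 : (((x * x : (𝓞 K)ˣ) : 𝓞 K) : K) = -1 := by rw [h]; simp
  push_cast at h1
  have := congrArg φ h1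
  rw [map_mul, map_neg, map_one] at this
  nlinarith [mul_self_nonneg (φ ((x : 𝓞 K) : K))]

lemma neg_one_ne_one (K : Type*) [Field K] [NumberField K] (φ : K →+* ℝ) :
    (-1 : (𝓞 K)ˣ) ≠ 1 := by
  intro h
  exact sq_ne_neg_one K φ 1 (by rw [h]; simp)

lemma unit_index [IsTotallyReal K] (φ : K →+* ℝ) :
    (powMonoidHom 2 : (𝓞 K)ˣ →* (𝓞 K)ˣ).range.index = 2 ^ Module.finrank ℚ K := by
  set T := Units.torsion K with hT
  set S := (powMonoidHom 2 : (𝓞 K)ˣ →* (𝓞 K)ˣ).range with hS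
  have h1 : (S ⊔ T).index = 2 ^ (Units.rank K) := by
    have e := AddSubgroup.index_range_nsmul (Additive ((𝓞 K)ˣ ⧸ T)) 2
    rw [Units.finrank_modTorsion] at e
    rw [← e]
    have : S ⊔ T = (powMonoidHom (α := (𝓞 K)ˣ ⧸ T) 2).range.comap
        (QuotientGroup.mk' T) := by
      have : (powMonoidHom (α := (𝓞 K)ˣ ⧸ T) 2).range = S.map (QuotientGroup.mk' T) := by
        ext y
        constructor
        · rintro ⟨x, rfl⟩
          obtain ⟨x, rfl⟩ := QuotientGroup.mk'_surjective T x
          exact ⟨x ^ 2, ⟨x, rfl⟩, rfl⟩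
        · rintro ⟨_, ⟨x, rfl⟩, rfl⟩
          exact ⟨QuotientGroup.mk' T x, rfl⟩
      rw [this, Subgroup.comap_map_eq, QuotientGroup.ker_mk']
    rw [this, Subgroup.index_comap_of_surjective _ (QuotientGroup.mk'_surjective T)]
    rfl
  have h2 : S.relIndex (S ⊔ T) = 2 := by
    rw [Subgroup.relIndex_sup_left, Subgroup.relIndex_eq_two_iff]
    have hne : (-1 : (𝓞 K)ˣ) ∉ S := by
      rintro ⟨x, hx⟩
      rw [powMonoidHom_apply, pow_two] at hx
      exact sq_ne_neg_one K φ x hx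
    refine ⟨-1, Units.mem_torsion .. |>.2 ?_, ?_⟩
    · intro w; rw [Units.val_neg, Units.val_one]; simp [InfinitePlace.apply, map_neg, ← NumberField.InfinitePlace.norm_embedding_eq]
    · intro y hy
      rcases tors_eq K φ y hy with rfl | rfl
      · rw [one_mul]; exact Or.inr ⟨one_mem _, hne⟩
      · have : (-1 : (𝓞 K)ˣ) * -1 = 1 := by simp
        rw [this]; exact Or.inl ⟨one_mem _, hne⟩
  have h3 := Subgroup.relIndex_mul_index (show S ≤ S ⊔ T from le_sup_left)
  rw [h1, h2] at h3
  rw [← h3, Units.rank, IsTotallyReal.finrank]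
  have : 0 < Fintype.card (InfinitePlace K) := Fintype.card_pos
  have h4 := InfinitePlace.card_eq_nrRealPlaces_add_nrComplexPlaces K
  rw [IsTotallyReal.nrComplexPlaces_eq_zero, add_zero] at h4
  rw [← h4, ← pow_succ']
  congr 1
  omega

end UnitIndex
end

section
section ClMap

variable {R R' R'' : Type*} [CommRing R] [IsDedekindDomain R] [CommRing R'] [IsDedekindDomain R']
  [CommRing R''] [IsDedekindDomain R'']

open Classical in
/-- The class of an ideal (and `1` for the zero ideal). -/
noncomputable def cl (I : Ideal R) : ClassGroup R :=
  if h : I = ⊥ then 1 else ClassGroup.mk0 ⟨I, mem_nonZeroDivisors_iff_ne_zero.2 h⟩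

lemma cl_def {I : Ideal R} (h : I ≠ ⊥) :
    cl I = ClassGroup.mk0 ⟨I, mem_nonZeroDivisors_iff_ne_zero.2 h⟩ := dif_neg h

lemma cl_surj (c : ClassGroup R) : ∃ I : Ideal R, I ≠ ⊥ ∧ cl I = c := by
  obtain ⟨I, hI⟩ := ClassGroup.mk0_surjective c
  have h : (I : Ideal R) ≠ ⊥ := mem_nonZeroDivisors_iff_ne_zero.1 I.2
  exact ⟨I, h, by rw [cl_def h]; exact hI⟩

lemma cl_mul {I J : Ideal R} (hI : I ≠ ⊥) (hJ : J ≠ ⊥) : cl (I * J) = cl I * cl J := by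
  have h : I * J ≠ ⊥ := mul_ne_zero hI hJ
  rw [cl_def hI, cl_def hJ, cl_def h, ← map_mul]; rfl

lemma cl_one : cl (1 : Ideal R) = 1 := by
  have h : (1 : Ideal R) ≠ ⊥ := one_ne_zero
  rw [cl_def h]
  exact map_one ClassGroup.mk0

lemma cl_pow {I : Ideal R} (hI : I ≠ ⊥) (n : ℕ) : cl (I ^ n) = cl I ^ n := by
  induction n with
  | zero => rw [pow_zero, pow_zero, cl_one]
  | succ n ih => rw [pow_succ, cl_mul (pow_ne_zero n hI) hI, ih, pow_succ]

lemma cl_eq_one_iff {I : Ideal R} (hI : I ≠ ⊥) : cl I = 1 ↔ I.IsPrincipal := by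
  rw [cl_def hI]; exact ClassGroup.mk0_eq_one_iff _

lemma cl_span {x : R} (hx : x ≠ 0) : cl (Ideal.span {x}) = 1 :=
  (cl_eq_one_iff (by simpa using hx)).2 ⟨x, rfl⟩

lemma cl_eq_iff {I J : Ideal R} (hI : I ≠ ⊥) (hJ : J ≠ ⊥) :
    cl I = cl J ↔ ∃ x y : R, x ≠ 0 ∧ y ≠ 0 ∧ Ideal.span {x} * I = Ideal.span {y} * J := by
  rw [cl_def hI, cl_def hJ, ClassGroup.mk0_eq_mk0_iff]
  exact ⟨fun ⟨x, y, hx, hy, h⟩ => ⟨x, y, hx, hy, h⟩, fun ⟨x, y, hx, hy, h⟩ => ⟨x, y, hx, hy, h⟩⟩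

/-- The map of class groups induced by a multiplicative map of ideals. -/
noncomputable def clMap (f : Ideal R →* Ideal R')
    (h0 : ∀ I, I ≠ ⊥ → f I ≠ ⊥)
    (hf : ∀ x : R, x ≠ 0 → (f (Ideal.span {x})).IsPrincipal) :
    ClassGroup R →* ClassGroup R' :=
  have key : ∀ I J : Ideal R, I ≠ ⊥ → J ≠ ⊥ → cl I = cl J → cl (f I) = cl (f J) := by
    intro I J hI hJ h
    obtain ⟨x, y, hx, hy, h⟩ := (cl_eq_iff hI hJ).1 h
    have h1 := congrArg (fun I => cl (f I)) h
    have hx' : Ideal.span {x} ≠ ⊥ := by simpa using hx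
    have hy' : Ideal.span {y} ≠ ⊥ := by simpa using hy
    simp only [map_mul] at h1
    rwa [cl_mul (h0 _ hx') (h0 _ hI), cl_mul (h0 _ hy') (h0 _ hJ),
      (cl_eq_one_iff (h0 _ hx')).2 (hf x hx), (cl_eq_one_iff (h0 _ hy')).2 (hf y hy), one_mul,
      one_mul] at h1
  { toFun := fun c => cl (f (cl_surj c).choose)
    map_one' := by
      have h := (cl_surj (1 : ClassGroup R)).choose_spec
      rw [key _ 1 h.1 one_ne_zero (h.2.trans cl_one.symm), map_one, cl_one]
    map_mul' := by
      intro a b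
      have h := (cl_surj (a * b)).choose_spec
      have ha := (cl_surj a).choose_spec
      have hb := (cl_surj b).choose_spec
      rw [← cl_mul (h0 _ ha.1) (h0 _ hb.1), ← map_mul]
      apply key _ _ h.1 (mul_ne_zero ha.1 hb.1)
      rw [h.2, cl_mul ha.1 hb.1, ha.2, hb.2] }

lemma clMap_cl (f : Ideal R →* Ideal R')
    (h0 : ∀ I, I ≠ ⊥ → f I ≠ ⊥)
    (hf : ∀ x : R, x ≠ 0 → (f (Ideal.span {x})).IsPrincipal) {I : Ideal R} (hI : I ≠ ⊥) :
    clMap f h0 hf (cl I) = cl (f I) := by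
  have h := (cl_surj (cl I)).choose_spec
  have h3 : cl (f (cl_surj (cl I)).choose) = cl (f I) := by
    have key : ∀ I J : Ideal R, I ≠ ⊥ → J ≠ ⊥ → cl I = cl J → cl (f I) = cl (f J) := by
      intro I J hI hJ h
      obtain ⟨x, y, hx, hy, h⟩ := (cl_eq_iff hI hJ).1 h
      have h1 := congrArg (fun I => cl (f I)) h
      have hx' : Ideal.span {x} ≠ ⊥ := by simpa using hx
      have hy' : Ideal.span {y} ≠ ⊥ := by simpa using hy
      simp only [map_mul] at h1
      rwa [cl_mul (h0 _ hx') (h0 _ hI), cl_mul (h0 _ hy') (h0 _ hJ),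
        (cl_eq_one_iff (h0 _ hx')).2 (hf x hx), (cl_eq_one_iff (h0 _ hy')).2 (hf y hy), one_mul,
        one_mul] at h1
    exact key _ _ h.1 hI h.2
  exact h3

end ClMap

section Maps

variable {K L : Type*} [Field K] [NumberField K] [Field L] [NumberField L] [Algebra K L]

/-- extension of ideals as a monoid hom, for an arbitrary ring hom -/
def idMap {R S : Type*} [CommRing R] [CommRing S] (f : R →+* S) : Ideal R →* Ideal S where
  toFun I := I.map f
  map_one' := by simp [Ideal.one_eq_top, Ideal.map_top]
  map_mul' I J := Ideal.map_mul f I J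

@[simp] lemma idMap_apply {R S : Type*} [CommRing R] [CommRing S] (f : R →+* S) (I : Ideal R) :
    idMap f I = I.map f := rfl

lemma idMap_ne_bot {R S : Type*} [CommRing R] [CommRing S] {f : R →+* S}
    (hf : Function.Injective f) (I : Ideal R) (hI : I ≠ ⊥) : idMap f I ≠ ⊥ := by
  rw [idMap_apply, Ne, Ideal.map_eq_bot_iff_of_injective hf]; exact hI

lemma idMap_span {R S : Type*} [CommRing R] [CommRing S] (f : R →+* S) (x : R) :
    idMap f (Ideal.span {x}) = Ideal.span {f x} := by
  rw [idMap_apply, Ideal.map_span, Set.image_singleton]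

/-- extension of classes -/
noncomputable def jCl (K L : Type*) [Field K] [NumberField K] [Field L] [NumberField L]
    [Algebra K L] : ClassGroup (𝓞 K) →* ClassGroup (𝓞 L) :=
  clMap (idMap (algebraMap (𝓞 K) (𝓞 L)))
    (idMap_ne_bot (FaithfulSMul.algebraMap_injective (𝓞 K) (𝓞 L)))
    (fun x _ => ⟨_, idMap_span _ x⟩)

/-- the ring automorphism of integers -/
noncomputable def sO {L : Type*} [Field L] (σ : L ≃+* L) : 𝓞 L ≃+* 𝓞 L := RingOfIntegers.mapRingEquiv σ

@[simp] lemma sO_coe (σ : L ≃+* L) (x : 𝓞 L) : ((sO σ x : 𝓞 L) : L) = σ (x : L) := rfl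

/-- action on ideals -/
noncomputable def sI (σ : L ≃+* L) : Ideal (𝓞 L) →* Ideal (𝓞 L) := idMap (sO σ : 𝓞 L →+* 𝓞 L)

/-- action on classes -/
noncomputable def aCl (σ : L ≃+* L) : ClassGroup (𝓞 L) →* ClassGroup (𝓞 L) :=
  clMap (sI σ) (idMap_ne_bot (sO σ).injective) (fun x _ => ⟨_, idMap_span _ x⟩)

/-- norm on classes -/
noncomputable def nCl (K L : Type*) [Field K] [NumberField K] [Field L] [NumberField L]
    [Algebra K L] : ClassGroup (𝓞 L) →* ClassGroup (𝓞 K) :=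
  clMap (Ideal.relNorm (𝓞 K) (S := 𝓞 L) : Ideal (𝓞 L) →* Ideal (𝓞 K))
    (fun I hI => by
      exact fun h => hI (Ideal.relNorm_eq_bot_iff.1 h))
    (fun x _ => ⟨_, Ideal.relNorm_singleton _ x⟩)

lemma jCl_cl {I : Ideal (𝓞 K)} (hI : I ≠ ⊥) :
    jCl K L (cl I) = cl (I.map (algebraMap (𝓞 K) (𝓞 L))) := clMap_cl _ _ _ hI

lemma aCl_cl (σ : L ≃+* L) {I : Ideal (𝓞 L)} (hI : I ≠ ⊥) :
    aCl σ (cl I) = cl (sI σ I) := clMap_cl _ _ _ hI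

lemma nCl_cl {I : Ideal (𝓞 L)} (hI : I ≠ ⊥) :
    nCl K L (cl I) = cl (Ideal.relNorm (𝓞 K) I) := clMap_cl _ _ _ hI

lemma mem_sI (σ : L ≃+* L) {I : Ideal (𝓞 L)} {x : 𝓞 L} :
    x ∈ sI σ I ↔ ∃ y ∈ I, sO σ y = x := by
  change x ∈ I.map (sO σ : 𝓞 L →+* 𝓞 L) ↔ _
  rw [Ideal.mem_map_iff_of_surjective (sO σ : 𝓞 L →+* 𝓞 L) (sO σ).surjective]; rfl

lemma sI_ne_bot (σ : L ≃+* L) {I : Ideal (𝓞 L)} (hI : I ≠ ⊥) : sI σ I ≠ ⊥ :=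
  idMap_ne_bot (sO σ).injective I hI

lemma ext_ne_bot {I : Ideal (𝓞 K)} (hI : I ≠ ⊥) : I.map (algebraMap (𝓞 K) (𝓞 L)) ≠ ⊥ :=
  idMap_ne_bot (FaithfulSMul.algebraMap_injective (𝓞 K) (𝓞 L)) I hI

lemma sI_ext (σ : L ≃+* L) (hσ : ∀ a : K, σ (algebraMap K L a) = algebraMap K L a) (I : Ideal (𝓞 K)) :
    sI σ (I.map (algebraMap (𝓞 K) (𝓞 L))) = I.map (algebraMap (𝓞 K) (𝓞 L)) := by
  change (I.map (algebraMap (𝓞 K) (𝓞 L))).map _ = _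
  rw [Ideal.map_map]
  congr 1
  ext x
  exact hσ _

lemma sI_span (σ : L ≃+* L) (x : 𝓞 L) : sI σ (Ideal.span {x}) = Ideal.span {sO σ x} :=
  idMap_span _ x

end Maps
end

section
/-- `L = K(s)` is a quadratic extension with nontrivial automorphism `σ`, `σ s = -s`. -/
structure IsQuad (K L : Type*) [Field K] [Field L] [Algebra K L] (σ : L ≃+* L) (s : L) : Prop where
  s0 : s ≠ 0
  σs : σ s = -s
  fix : ∀ a : K, σ (algebraMap K L a) = algebraMap K L a
  gen : ∀ x : L, ∃ a b : K, x = algebraMap K L a + algebraMap K L b * s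

namespace IsQuad

variable {K L : Type*} [Field K] [NumberField K] [Field L] [NumberField L] [Algebra K L]
  {σ : L ≃+* L} {s : L} (h : IsQuad K L σ s)
include h

lemma invol (x : L) : σ (σ x) = x := by
  obtain ⟨a, b, rfl⟩ := h.gen x
  simp [h.σs, h.fix]

lemma fixed {x : L} (hx : σ x = x) : ∃ a : K, x = algebraMap K L a := by
  obtain ⟨a, b, rfl⟩ := h.gen x
  simp only [map_add, map_mul, h.σs, h.fix] at hx
  have h1 : 2 * (algebraMap K L b * s) = 0 := by linear_combination -hx
  have h2 : algebraMap K L b * s = 0 := by simpa using h1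
  exact ⟨a, by rw [h2, add_zero]⟩

lemma s_nmem (a : K) : s ≠ algebraMap K L a := by
  intro e
  have h1 := h.fix a
  rw [← e, h.σs] at h1
  have : 2 * s = 0 := by linear_combination -h1
  exact h.s0 (by simpa using this)

lemma fixedO {x : 𝓞 L} (hx : sO σ x = x) : ∃ a : 𝓞 K, x = algebraMap (𝓞 K) (𝓞 L) a := by
  obtain ⟨a, ha⟩ := h.fixed (x := (x : L)) (by rw [← sO_coe, hx])
  have hi : IsIntegral ℤ a := by
    have : IsIntegral ℤ (algebraMap K L a) := by rw [← ha]; exact x.2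
    exact (isIntegral_algebraMap_iff (algebraMap K L).injective).1 this
  exact ⟨⟨a, hi⟩, RingOfIntegers.ext ha⟩

lemma involO (x : 𝓞 L) : sO σ (sO σ x) = x := RingOfIntegers.ext (h.invol _)

lemma finrank : Module.finrank K L = 2 := by
  let v : Fin 2 → L := ![1, s]
  have hli : LinearIndependent K v := by
    rw [LinearIndependent.pair_iff]
    intro a b hab
    rw [Algebra.smul_def, Algebra.smul_def, mul_one] at hab
    have h1 := congrArg σ hab
    simp only [map_add, map_mul, h.σs, h.fix, map_zero] at h1
    have h2 : 2 * algebraMap K L a = 0 := by linear_combination hab + h1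
    have h3 : algebraMap K L a = 0 := by simpa using h2
    rw [h3, zero_add] at hab
    refine ⟨by simpa using h3, ?_⟩
    rcases mul_eq_zero.1 hab with h4 | h4
    · simpa using h4
    · exact absurd h4 h.s0
  have hsp : ⊤ ≤ Submodule.span K (Set.range v) := by
    intro x _
    obtain ⟨a, b, rfl⟩ := h.gen x
    have h1 : (1 : L) ∈ Set.range v := ⟨0, rfl⟩
    have h2 : s ∈ Set.range v := ⟨1, rfl⟩
    have := add_mem (Submodule.smul_mem _ a (Submodule.subset_span h1))
      (Submodule.smul_mem _ b (Submodule.subset_span h2))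
    simpa [Algebra.smul_def] using this
  have := Module.finrank_eq_card_basis (Module.Basis.mk hli hsp)
  simpa using this

/-- as an algebra equivalence -/
def alg : L ≃ₐ[K] L := AlgEquiv.ofRingEquiv (f := σ) h.fix

lemma isQE : Algebra.IsQuadraticExtension K L where
  finrank_eq_two' := h.finrank

lemma norm_eq (x : L) : algebraMap K L (Algebra.norm K x) = x * σ x := by
  classical
  have := h.isQE
  have : IsGalois K L := inferInstance
  rw [Algebra.norm_eq_prod_automorphisms]
  have hne : (1 : L ≃ₐ[K] L) ≠ h.alg := by
    intro e
    have := DFunLike.congr_fun e s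
    change s = σ s at this
    rw [h.σs] at this
    have h2 : 2 * s = 0 := by linear_combination this
    exact h.s0 (by simpa using h2)
  have huniv : (Finset.univ : Finset (L ≃ₐ[K] L)) = {1, h.alg} := by
    symm
    apply Finset.eq_univ_of_card
    rw [Finset.card_pair hne, ← Nat.card_eq_fintype_card, IsGalois.card_aut_eq_finrank, h.finrank]
  rw [huniv, Finset.prod_pair hne]
  rfl

lemma h90 (x : L) (hx : x * σ x = 1) : ∃ z : L, z ≠ 0 ∧ x * σ z = z := by
  by_cases h1 : 1 + x = 0
  · refine ⟨s, h.s0, ?_⟩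
    rw [h.σs]; linear_combination -s * h1
  · refine ⟨1 + x, h1, ?_⟩
    rw [map_add, map_one]; linear_combination hx

end IsQuad
end

section
open FractionalIdeal


section Frac

variable {L : Type*} [Field L] [NumberField L]

/-- action on fractional ideals -/
noncomputable def sF (σ : L ≃+* L) : (FractionalIdeal (𝓞 L)⁰ L)ˣ →* (FractionalIdeal (𝓞 L)⁰ L)ˣ :=
  Units.map (ringEquivOfRingEquiv L L (sO σ) : FractionalIdeal (𝓞 L)⁰ L →* FractionalIdeal (𝓞 L)⁰ L)

lemma semil (σ : L ≃+* L) (x : L) :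
    IsFractionRing.ringEquivOfRingEquiv (K := L) (L := L) (sO σ) x = σ x := by
  obtain ⟨a, b, hb, rfl⟩ := IsFractionRing.div_surjective (A := 𝓞 L) x
  rw [map_div₀, map_div₀, IsFractionRing.ringEquivOfRingEquiv_algebraMap, IsFractionRing.ringEquivOfRingEquiv_algebraMap]
  rfl

lemma mem_sF (σ : L ≃+* L) (I : (FractionalIdeal (𝓞 L)⁰ L)ˣ) (x : L) :
    x ∈ (sF σ I : FractionalIdeal (𝓞 L)⁰ L) ↔ ∃ y ∈ (I : FractionalIdeal (𝓞 L)⁰ L), σ y = x := by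
  change x ∈ (ringEquivOfRingEquiv L L (sO σ) (I : FractionalIdeal (𝓞 L)⁰ L)).val ↔ _
  rw [ringEquivOfRingEquiv_apply_val]
  constructor
  · rintro ⟨y, hy, rfl⟩
    exact ⟨y, hy, (semil σ y).symm⟩
  · rintro ⟨y, hy, rfl⟩
    exact ⟨y, hy, semil σ y⟩

lemma sF_span (σ : L ≃+* L) (x : Lˣ) :
    sF σ (toPrincipalIdeal (𝓞 L) L x) = toPrincipalIdeal (𝓞 L) L (Units.map σ x) := by
  ext z
  rw [mem_sF, coe_toPrincipalIdeal, coe_toPrincipalIdeal]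
  simp only [mem_spanSingleton]
  constructor
  · rintro ⟨_, ⟨a, rfl⟩, rfl⟩
    exact ⟨sO σ a, by rw [Algebra.smul_def, Algebra.smul_def, map_mul]; rfl⟩
  · rintro ⟨a, rfl⟩
    refine ⟨((sO σ).symm a) • (x : L), ⟨_, rfl⟩, ?_⟩
    rw [Algebra.smul_def, Algebra.smul_def, map_mul]
    congr 1
    exact congrArg (algebraMap (𝓞 L) L) ((sO σ).apply_symm_apply a)

/-- unit fractional ideal of a nonzero ideal -/
noncomputable def fI (I : Ideal (𝓞 L)) (hI : I ≠ ⊥) : (FractionalIdeal (𝓞 L)⁰ L)ˣ :=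
  FractionalIdeal.mk0 L ⟨I, mem_nonZeroDivisors_iff_ne_zero.2 hI⟩

lemma fI_coe (I : Ideal (𝓞 L)) (hI : I ≠ ⊥) : (fI I hI : FractionalIdeal (𝓞 L)⁰ L) = I := rfl

lemma fI_mul {I J : Ideal (𝓞 L)} (hI : I ≠ ⊥) (hJ : J ≠ ⊥) :
    fI (I * J) (mul_ne_zero hI hJ) = fI I hI * fI J hJ := by
  ext1; simp [fI_coe]

lemma fI_inj {I J : Ideal (𝓞 L)} {hI : I ≠ ⊥} {hJ : J ≠ ⊥} (h : fI I hI = fI J hJ) : I = J := by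
  have := congrArg (fun u : (FractionalIdeal (𝓞 L)⁰ L)ˣ => (u : FractionalIdeal (𝓞 L)⁰ L)) h
  exact coeIdeal_injective this

lemma sF_fI (σ : L ≃+* L) (I : Ideal (𝓞 L)) (hI : I ≠ ⊥) :
    sF σ (fI I hI) = fI (sI σ I) (sI_ne_bot σ hI) := by
  ext z
  rw [mem_sF, fI_coe, fI_coe]
  simp only [mem_coeIdeal]
  constructor
  · rintro ⟨_, ⟨a, ha, rfl⟩, rfl⟩
    exact ⟨sO σ a, (mem_sI σ).2 ⟨a, ha, rfl⟩, rfl⟩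
  · rintro ⟨a, ha, rfl⟩
    obtain ⟨b, hb, rfl⟩ := (mem_sI σ).1 ha
    exact ⟨_, ⟨b, hb, rfl⟩, rfl⟩

lemma frac_rep (I : (FractionalIdeal (𝓞 L)⁰ L)ˣ) : ∃ (a : 𝓞 L) (ha : a ≠ 0) (J : Ideal (𝓞 L))
    (hJ : J ≠ ⊥), fI (Ideal.span {a}) (by simpa using ha) * I = fI J hJ := by
  obtain ⟨a, J, ha, h⟩ := FractionalIdeal.exists_eq_spanSingleton_mul (I : FractionalIdeal (𝓞 L)⁰ L)
  have ha' : algebraMap (𝓞 L) L a ≠ 0 := by simpa using ha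
  have key : (Ideal.span {a} : FractionalIdeal (𝓞 L)⁰ L) * I = J := by
    rw [h, coeIdeal_span_singleton, ← mul_assoc, spanSingleton_mul_spanSingleton,
      mul_inv_cancel₀ ha', spanSingleton_one, one_mul]
  have hJ : J ≠ ⊥ := by
    rintro rfl
    rw [coeIdeal_bot] at key
    rcases mul_eq_zero.1 key with h1 | h1
    · rw [coeIdeal_span_singleton, spanSingleton_eq_zero_iff] at h1
      exact ha' h1
    · exact I.ne_zero h1
  exact ⟨a, ha, J, hJ, by ext1; simpa [fI_coe] using key⟩

lemma mk_fI (I : Ideal (𝓞 L)) (hI : I ≠ ⊥) : ClassGroup.mk L (fI I hI) = cl I := by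
  rw [fI, ClassGroup.mk_mk0, cl_def hI]

lemma mk_sF (σ : L ≃+* L) (I : (FractionalIdeal (𝓞 L)⁰ L)ˣ) :
    ClassGroup.mk L (sF σ I) = aCl σ (ClassGroup.mk L I) := by
  obtain ⟨a, ha, J, hJ, h⟩ := frac_rep I
  have ha0 : Ideal.span {a} ≠ ⊥ := by simpa using ha
  have hσa : sO σ a ≠ 0 := by simpa using ha
  have h1 := congrArg (ClassGroup.mk L) h
  rw [map_mul, mk_fI, mk_fI, cl_span ha, one_mul] at h1
  have h2 := congrArg (fun I => ClassGroup.mk L (sF σ I)) h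
  simp only [map_mul, sF_fI, mk_fI] at h2
  rw [sI_span, cl_span hσa, one_mul] at h2
  rw [h1, h2, aCl_cl σ hJ]

lemma mk_eq_one (I : (FractionalIdeal (𝓞 L)⁰ L)ˣ) :
    ClassGroup.mk L I = 1 ↔ I ∈ (toPrincipalIdeal (𝓞 L) L).range := by
  rw [ClassGroup.mk_eq_one_iff, mem_principal_ideals_iff]
  exact FractionalIdeal.isPrincipal_iff _ |>.trans ⟨fun ⟨x, h⟩ => ⟨x, h.symm⟩, fun ⟨x, h⟩ => ⟨x, h.symm⟩⟩

lemma mk_surj : Function.Surjective (ClassGroup.mk L : (FractionalIdeal (𝓞 L)⁰ L)ˣ →* ClassGroup (𝓞 L)) := by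
  intro c
  obtain ⟨I, hI, rfl⟩ := cl_surj c
  exact ⟨fI I hI, mk_fI I hI⟩

end Frac
end

section
open FractionalIdeal


section AF

variable {K L : Type*} [Field K] [NumberField K] [Field L] [NumberField L] [Algebra K L]
  {σ : L ≃+* L} {s : L}

/-- σ on `Lˣ` -/
def sX (σ : L ≃+* L) : Lˣ →* Lˣ := Units.map (σ : L →* L)

@[simp] lemma sX_coe (σ : L ≃+* L) (x : Lˣ) : (sX σ x : L) = σ x := rfl

/-- σ on units -/
noncomputable def sE (σ : L ≃+* L) : (𝓞 L)ˣ →* (𝓞 L)ˣ := Units.map (sO σ : 𝓞 L →* 𝓞 L)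

@[simp] lemma sE_coe (σ : L ≃+* L) (x : (𝓞 L)ˣ) : ((sE σ x : (𝓞 L)ˣ) : 𝓞 L) = sO σ x := rfl

/-- units into `Lˣ` -/
noncomputable def uX (L : Type*) [Field L] : (𝓞 L)ˣ →* Lˣ :=
  Units.map (algebraMap (𝓞 L) L : 𝓞 L →* L)

@[simp] lemma uX_coe (x : (𝓞 L)ˣ) : (uX L x : L) = ((x : 𝓞 L) : L) := rfl

lemma uX_inj : Function.Injective (uX L) := by
  intro a b hab
  have := congrArg Units.val hab
  exact Units.ext (RingOfIntegers.ext this)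

lemma uX_sE (σ : L ≃+* L) (x : (𝓞 L)ˣ) : uX L (sE σ x) = sX σ (uX L x) := rfl

lemma P_ker : (toPrincipalIdeal (𝓞 L) L).ker = (uX L).range := by
  ext x
  rw [MonoidHom.mem_ker, toPrincipalIdeal_eq_iff, Units.val_one]
  constructor
  · intro hx
    have h1 : (x : L) ∈ (1 : FractionalIdeal (𝓞 L)⁰ L) := by
      rw [← hx]; exact mem_spanSingleton_self _ _
    have h2 : ((x⁻¹ : Lˣ) : L) ∈ (1 : FractionalIdeal (𝓞 L)⁰ L) := by
      have h3 : (1 : L) ∈ spanSingleton (𝓞 L)⁰ (x : L) := by rw [hx]; exact one_mem_one _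
      obtain ⟨z, hz⟩ := (mem_spanSingleton _).1 h3
      rw [Algebra.smul_def] at hz
      rw [mem_one_iff]
      exact ⟨z, by rw [Units.val_inv_eq_inv_val]; exact eq_inv_of_mul_eq_one_left hz⟩
    obtain ⟨a, ha⟩ := (mem_one_iff _).1 h1
    obtain ⟨b, hb⟩ := (mem_one_iff _).1 h2
    have hab : a * b = 1 := by
      apply FaithfulSMul.algebraMap_injective (𝓞 L) L
      rw [map_mul, ha, hb, map_one]; simp
    exact ⟨Units.mkOfMulEqOne a b hab, Units.ext ha⟩
  · rintro ⟨u, rfl⟩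
    apply le_antisymm
    · rw [spanSingleton_le_iff_mem, mem_one_iff]
      exact ⟨u, rfl⟩
    · rw [← spanSingleton_one, spanSingleton_le_iff_mem, mem_spanSingleton]
      refine ⟨((u⁻¹ : (𝓞 L)ˣ) : 𝓞 L), ?_⟩
      rw [Algebra.smul_def, uX_coe]
      change algebraMap (𝓞 L) L _ * algebraMap (𝓞 L) L _ = 1
      rw [← map_mul]; simp

lemma card_amb (σ : L ≃+* L) : (toPrincipalIdeal (𝓞 L) L).range.relIndex
    (ambW (toPrincipalIdeal (𝓞 L) L) (sF σ)) = Nat.card (dmH (aCl σ)).ker := by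
  have hk : (toPrincipalIdeal (𝓞 L) L).range = (ClassGroup.mk (R := 𝓞 L) L).ker := by
    ext I; rw [MonoidHom.mem_ker, mk_eq_one]
  have hW : ambW (toPrincipalIdeal (𝓞 L) L) (sF σ) = (dmH (aCl σ)).ker.comap (ClassGroup.mk L) := by
    ext I
    rw [ambW, hk, Subgroup.mem_comap, Subgroup.mem_comap, MonoidHom.mem_ker, MonoidHom.mem_ker,
      dmH_apply, dmH_apply, map_div, mk_sF]
  rw [hk, Subgroup.relIndex_ker, hW, Subgroup.map_comap_eq_self_of_surjective mk_surj]

/-- extension of fractional ideals -/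
noncomputable def eF (K L : Type*) [Field K] [NumberField K] [Field L] [NumberField L] [Algebra K L] :
    (FractionalIdeal (𝓞 K)⁰ K)ˣ →* (FractionalIdeal (𝓞 L)⁰ L)ˣ :=
  Units.map ((extendedHom (A := 𝓞 K) (K := K) L (𝓞 L)) : FractionalIdeal (𝓞 K)⁰ K →* FractionalIdeal (𝓞 L)⁰ L)

lemma eF_inj : Function.Injective (eF K L) :=
  Units.map_injective (extendedHom_injective (A := 𝓞 K) (K := K) L (𝓞 L))

lemma eF_principal (x : Kˣ) : eF K L (toPrincipalIdeal (𝓞 K) K x) =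
    toPrincipalIdeal (𝓞 L) L (Units.map (algebraMap K L : K →* L) x) := by
  ext1
  rw [coe_toPrincipalIdeal]
  change extendedHom (A := 𝓞 K) (K := K) L (𝓞 L) _ = _
  rw [coe_toPrincipalIdeal, extendedHom_spanSingleton]
  congr 1
  obtain ⟨a, b, hb, hx⟩ := IsFractionRing.div_surjective (A := 𝓞 K) (x : K)
  rw [Units.coe_map, ← hx, map_div₀]
  change _ = algebraMap K L _
  rw [map_div₀]
  unfold IsFractionRing.map
  rw [IsLocalization.map_eq, IsLocalization.map_eq]
  rfl

lemma eF_fI (I : Ideal (𝓞 K)) (hI : I ≠ ⊥) : eF K L (fI I hI) = fI (I.map (algebraMap (𝓞 K) (𝓞 L)))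
    (ext_ne_bot hI) := by
  ext1
  change extendedHom (A := 𝓞 K) (K := K) L (𝓞 L) _ = _
  rw [fI_coe, fI_coe, extendedHom_coeIdeal_eq_map]

lemma sF_eF (h : IsQuad K L σ s) (I : (FractionalIdeal (𝓞 K)⁰ K)ˣ) :
    sF σ (eF K L I) = eF K L I := by
  obtain ⟨a, ha, J, hJ, e⟩ := frac_rep I
  have h1 := congrArg (eF K L) e
  rw [map_mul, eF_fI, eF_fI] at h1
  have h2 := congrArg (sF σ) h1
  rw [map_mul, sF_fI, sF_fI] at h2
  simp only [sI_ext σ h.fix] at h2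
  rw [← h1] at h2
  exact mul_left_cancel h2

/-- index of the extended ideals in the invariant ideals -/
noncomputable def iIdx (K : Type*) {L : Type*} [Field K] [NumberField K] [Field L] [NumberField L]
    [Algebra K L] (σ : L ≃+* L) : ℕ := (eF K L).range.relIndex (dmH (sF σ)).ker

/-- the units of `K` which are norms of elements of `L` -/
noncomputable def nU (K : Type*) {L : Type*} [Field K] [NumberField K] [Field L] [NumberField L]
    [Algebra K L] (σ : L ≃+* L) : Subgroup (𝓞 K)ˣ :=
  (nmH (sX σ)).range.comap ((Units.map (algebraMap K L : K →* L)).comp (uX K))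

lemma mem_nU {u : (𝓞 K)ˣ} : u ∈ nU K σ ↔ ∃ z : L, algebraMap K L u = z * σ z := by
  rw [nU, Subgroup.mem_comap]
  constructor
  · rintro ⟨z, hz⟩
    exact ⟨z, (congrArg Units.val hz).symm⟩
  · rintro ⟨z, hz⟩
    have hz0 : z ≠ 0 := by
      rintro rfl
      rw [zero_mul] at hz
      simp at hz
    exact ⟨Units.mk0 z hz0, Units.ext hz.symm⟩

lemma idx_principal (h : IsQuad K L σ s) :
    ((dmH (sX σ)).ker.map (toPrincipalIdeal (𝓞 L) L)).relIndex (dmH (sF σ)).ker =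
      Nat.card (ClassGroup (𝓞 K)) * iIdx K σ := by
  have e1 : (dmH (sX σ)).ker.map (toPrincipalIdeal (𝓞 L) L) =
      (toPrincipalIdeal (𝓞 K) K).range.map (eF K L) := by
    ext I
    constructor
    · rintro ⟨x, hx, rfl⟩
      have hx1 : σ x = x := congrArg Units.val (mem_ker_dmH.1 hx)
      obtain ⟨a, ha⟩ := h.fixed hx1
      have ha0 : a ≠ 0 := by rintro rfl; rw [map_zero] at ha; exact x.ne_zero ha
      refine ⟨_, ⟨Units.mk0 a ha0, rfl⟩, ?_⟩
      rw [eF_principal]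
      congr 1
      exact Units.ext ha.symm
    · rintro ⟨_, ⟨a, rfl⟩, rfl⟩
      refine ⟨Units.map (algebraMap K L : K →* L) a, mem_ker_dmH.2 (Units.ext (h.fix a)), ?_⟩
      rw [eF_principal]
  have e2 : ((toPrincipalIdeal (𝓞 K) K).range.map (eF K L)).relIndex (eF K L).range =
      Nat.card (ClassGroup (𝓞 K)) := by
    rw [MonoidHom.range_eq_map (eF K L), Subgroup.relIndex_map_map_of_injective _ _ eF_inj,
      Subgroup.relIndex_top_right]
    exact (Nat.card_congr (ClassGroup.equiv (R := 𝓞 K) K).toEquiv).symm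
  rw [e1, ← e2, iIdx, Subgroup.relIndex_mul_relIndex]
  · rw [MonoidHom.range_eq_map (eF K L)]; exact Subgroup.map_mono le_top
  · rintro _ ⟨I, rfl⟩
    exact mem_ker_dmH.2 (sF_eF h I)


lemma E_dm (σ : L ≃+* L) : (toPrincipalIdeal (𝓞 L) L).ker.map (dmH (sX σ)) =
    (dmH (sE σ)).range.map (uX L) := by
  rw [P_ker]
  ext x
  constructor
  · rintro ⟨_, ⟨u, rfl⟩, rfl⟩
    exact ⟨_, ⟨u, rfl⟩, by simp [uX_sE]⟩
  · rintro ⟨_, ⟨u, rfl⟩, rfl⟩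
    exact ⟨_, ⟨u, rfl⟩, by simp [uX_sE]⟩

lemma E_nm (σ : L ≃+* L) : (toPrincipalIdeal (𝓞 L) L).ker.map (nmH (sX σ)) =
    (nmH (sE σ)).range.map (uX L) := by
  rw [P_ker]
  ext x
  constructor
  · rintro ⟨_, ⟨u, rfl⟩, rfl⟩
    exact ⟨_, ⟨u, rfl⟩, by simp [uX_sE]⟩
  · rintro ⟨_, ⟨u, rfl⟩, rfl⟩
    exact ⟨_, ⟨u, rfl⟩, by simp [uX_sE]⟩

lemma E_kn (σ : L ≃+* L) : (toPrincipalIdeal (𝓞 L) L).ker ⊓ (nmH (sX σ)).ker =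
    (nmH (sE σ)).ker.map (uX L) := by
  rw [P_ker]
  ext x
  constructor
  · rintro ⟨⟨u, rfl⟩, h2⟩
    have h2 := mem_ker_nmH.1 h2
    refine ⟨u, mem_ker_nmH.2 ?_, rfl⟩
    apply uX_inj
    rw [map_mul, uX_sE, h2, map_one]
  · rintro ⟨u, hu, rfl⟩
    refine ⟨⟨u, rfl⟩, mem_ker_nmH.2 ?_⟩
    rw [← uX_sE, ← map_mul, mem_ker_nmH.1 hu, map_one]

/-- units inclusion -/
noncomputable def jE (K L : Type*) [Field K] [NumberField K] [Field L] [NumberField L]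
    [Algebra K L] : (𝓞 K)ˣ →* (𝓞 L)ˣ := Units.map (algebraMap (𝓞 K) (𝓞 L) : 𝓞 K →* 𝓞 L)

lemma jE_inj : Function.Injective (jE K L) :=
  Units.map_injective (FaithfulSMul.algebraMap_injective (𝓞 K) (𝓞 L))

lemma jE_range (h : IsQuad K L σ s) : (jE K L).range = (dmH (sE σ)).ker := by
  ext u
  rw [mem_ker_dmH]
  constructor
  · rintro ⟨v, rfl⟩
    exact Units.ext (RingOfIntegers.ext (h.fix _))
  · intro hu
    obtain ⟨a, ha⟩ := h.fixedO (congrArg Units.val hu)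
    have hu' : sE σ u⁻¹ = u⁻¹ := by rw [map_inv, hu]
    obtain ⟨b, hb⟩ := h.fixedO (congrArg Units.val hu')
    have hab : a * b = 1 := by
      apply FaithfulSMul.algebraMap_injective (𝓞 K) (𝓞 L)
      rw [map_mul, ← ha, ← hb, map_one]; simp
    exact ⟨Units.mkOfMulEqOne a b hab, Units.ext ha.symm⟩

lemma E_nr (h : IsQuad K L σ s) : (toPrincipalIdeal (𝓞 L) L).ker ⊓ (nmH (sX σ)).range =
    ((nU K σ).map (jE K L)).map (uX L) := by
  rw [P_ker]
  ext x
  constructor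
  · rintro ⟨⟨u, rfl⟩, ⟨z, hz⟩⟩
    have hu : u ∈ (dmH (sE σ)).ker := by
      rw [mem_ker_dmH]
      apply uX_inj
      rw [uX_sE, ← hz]
      apply Units.ext
      simp [h.invol, mul_comm]
    rw [← jE_range h] at hu
    obtain ⟨v, rfl⟩ := hu
    refine ⟨_, ⟨v, ?_, rfl⟩, rfl⟩
    refine mem_nU.2 ⟨z, ?_⟩
    exact (congrArg Units.val hz).symm
  · rintro ⟨_, ⟨v, hv, rfl⟩, rfl⟩
    refine ⟨⟨_, rfl⟩, ?_⟩
    exact hv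

lemma sE_invol (h : IsQuad K L σ s) (x : (𝓞 L)ˣ) : sE σ (sE σ x) = x :=
  Units.ext (h.involO _)

lemma herbrand (h : IsQuad K L σ s) [IsTotallyReal K] [IsTotallyReal L] (φ : L →+* ℝ) :
    (dmH (sE σ)).range.relIndex (nmH (sE σ)).ker =
      2 * (nmH (sE σ)).range.relIndex (dmH (sE σ)).ker ∧
    (nmH (sE σ)).range.relIndex (dmH (sE σ)).ker ≠ 0 := by
  refine herbrand_abstract (sE σ) (sE_invol h) (-1) (by simp) (neg_one_ne_one L φ) ?_ ?_
    (sq_ne_neg_one L φ) (2 ^ Module.finrank ℚ K) (by positivity) ?_ ?_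
  · intro x hx
    apply tors_eq L φ
    exact isOfFinOrder_iff_pow_eq_one.2 ⟨2, by norm_num, by rw [pow_two, hx]⟩
  · apply Units.ext; simp
  · rw [unit_index L φ, ← Module.finrank_mul_finrank ℚ K L, h.finrank]
    ring
  · rw [← jE_range h, ← unit_index K (φ.comp (algebraMap K L))]
    have : (jE K L).range.map (powMonoidHom 2) =
        (powMonoidHom 2 : (𝓞 K)ˣ →* (𝓞 K)ˣ).range.map (jE K L) := by
      ext x
      constructor
      · rintro ⟨_, ⟨u, rfl⟩, rfl⟩
        exact ⟨_, ⟨u, rfl⟩, by simp⟩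
      · rintro ⟨_, ⟨u, rfl⟩, rfl⟩
        exact ⟨_, ⟨u, rfl⟩, by simp⟩
    rw [this, MonoidHom.range_eq_map (jE K L), Subgroup.relIndex_map_map_of_injective _ _ jE_inj,
      Subgroup.relIndex_top_right]

lemma h90X (h : IsQuad K L σ s) (x : Lˣ) (hx : x * sX σ x = 1) : ∃ z, x = z / sX σ z := by
  obtain ⟨z, hz, e⟩ := h.h90 x (congrArg Units.val hx)
  refine ⟨Units.mk0 z hz, ?_⟩
  rw [eq_div_iff_mul_eq']
  exact Units.ext e

lemma h90F (h : IsQuad K L σ s) (x : Lˣ)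
    (hx : toPrincipalIdeal (𝓞 L) L x * sF σ (toPrincipalIdeal (𝓞 L) L x) = 1) :
    ∃ J, toPrincipalIdeal (𝓞 L) L x = J / sF σ J := by
  have hJ0 : (1 + spanSingleton (𝓞 L)⁰ (x : L) : FractionalIdeal (𝓞 L)⁰ L) ≠ 0 := by
    intro e
    have h1 : (1 : L) ∈ (1 + spanSingleton (𝓞 L)⁰ (x : L) : FractionalIdeal (𝓞 L)⁰ L) := by
      rw [← sup_eq_add]
      exact (le_sup_left : (1 : FractionalIdeal (𝓞 L)⁰ L) ≤ _) (one_mem_one _)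
    rw [e] at h1
    exact one_ne_zero ((mem_zero_iff _).1 h1)
  refine ⟨Units.mk0 _ hJ0, ?_⟩
  rw [eq_div_iff_mul_eq']
  have hu := congrArg Units.val hx
  rw [sF_span, Units.val_mul, Units.val_one] at hu
  ext1
  rw [Units.val_mul, Units.val_mk0]
  have h2 : ((sF σ (Units.mk0 _ hJ0) : (FractionalIdeal (𝓞 L)⁰ L)ˣ) : FractionalIdeal (𝓞 L)⁰ L) =
      1 + (toPrincipalIdeal (𝓞 L) L (Units.map σ x) : FractionalIdeal (𝓞 L)⁰ L) := by
    have h3 := congrArg Units.val (sF_span σ x)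
    rw [← h3]
    change ringEquivOfRingEquiv L L (sO σ) (1 + spanSingleton (𝓞 L)⁰ (x : L)) =
      1 + ringEquivOfRingEquiv L L (sO σ) (toPrincipalIdeal (𝓞 L) L x : FractionalIdeal (𝓞 L)⁰ L)
    rw [map_add, map_one, coe_toPrincipalIdeal]
  rw [h2, mul_add, mul_one, hu, coe_toPrincipalIdeal, add_comm]

/-- Ambiguous class number formula. -/
theorem AF (h : IsQuad K L σ s) [IsTotallyReal K] [IsTotallyReal L] (φ : L →+* ℝ) :
    Nat.card (dmH (aCl σ)).ker * 2 * (nU K σ).index = Nat.card (ClassGroup (𝓞 K)) * iIdx K σ := by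
  have h1 := amb_abstract (toPrincipalIdeal (𝓞 L) L) (sX σ) (sF σ)
    (fun x => Units.ext (h.invol _))
    (fun I => by
      ext z; rw [mem_sF]
      constructor
      · rintro ⟨y, hy, rfl⟩
        obtain ⟨w, hw, rfl⟩ := (mem_sF _ _ _).1 hy
        rwa [h.invol]
      · intro hz
        exact ⟨σ z, (mem_sF _ _ _).2 ⟨z, hz, rfl⟩, h.invol z⟩)
    (fun x => (sF_span σ x).symm) (h90X h) (h90F h)
  obtain ⟨hh, hh0⟩ := herbrand h φ
  rw [card_amb, idx_principal h, E_dm, E_kn, E_nm, E_nr h,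
    Subgroup.relIndex_map_map_of_injective _ _ uX_inj,
    Subgroup.relIndex_map_map_of_injective _ _ uX_inj, hh] at h1
  have hle1 : (nmH (sE σ)).range ≤ (nU K σ).map (jE K L) := by
    have := E_nm σ
    have h3 : (nmH (sE σ)).range.map (uX L) ≤ ((nU K σ).map (jE K L)).map (uX L) := by
      rw [← E_nm, ← E_nr h]
      refine le_inf ?_ (Subgroup.map_le_range _ _)
      rw [P_ker]
      rintro _ ⟨_, ⟨u, rfl⟩, rfl⟩
      exact ⟨u * sE σ u, by rw [map_mul, uX_sE]; rfl⟩
    exact (Subgroup.map_le_map_iff_of_injective uX_inj).1 h3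
  have hle2 : (nU K σ).map (jE K L) ≤ (dmH (sE σ)).ker := by
    rw [← jE_range h]; exact Subgroup.map_le_range _ _
  have h4 := Subgroup.relIndex_mul_relIndex _ _ _ hle1 hle2
  have h5 : ((nU K σ).map (jE K L)).relIndex (dmH (sE σ)).ker = (nU K σ).index := by
    rw [← jE_range h, MonoidHom.range_eq_map, Subgroup.relIndex_map_map_of_injective _ _ jE_inj,
      Subgroup.relIndex_top_right]
  rw [h5] at h4
  have h6 : (nmH (sE σ)).range.relIndex ((nU K σ).map (jE K L)) ≠ 0 := by
    intro e; rw [e, zero_mul] at h4; exact hh0 h4.symm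
  apply Nat.eq_of_mul_eq_mul_right (Nat.pos_of_ne_zero h6)
  rw [← h1, ← h4]; ring

end AF
end

section
section IdealNorm

variable {K L : Type*} [Field K] [NumberField K] [Field L] [NumberField L] [Algebra K L]
  {σ : L ≃+* L} {s : L}

lemma absNorm_sI (σ : L ≃+* L) (I : Ideal (𝓞 L)) : Ideal.absNorm (sI σ I) = Ideal.absNorm I := by
  rw [Ideal.absNorm_apply, Ideal.absNorm_apply, Submodule.cardQuot_apply, Submodule.cardQuot_apply]
  exact (Nat.card_congr (Ideal.quotientEquiv I (sI σ I) (sO σ) rfl).toEquiv).symm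

lemma ext_of_absNorm {I J : Ideal (𝓞 L)} (hI : J ≠ ⊥) (h : J ≤ I)
    (hn : Ideal.absNorm I = Ideal.absNorm J) : J = I := by
  obtain ⟨M, rfl⟩ := Ideal.dvd_iff_le.2 h
  rw [map_mul] at hn
  have h0 : Ideal.absNorm I ≠ 0 := by
    intro h1
    rw [Ideal.absNorm_eq_zero_iff] at h1
    exact hI (by rw [h1, Ideal.bot_mul])
  have h1 : Ideal.absNorm M = 1 := by
    have : Ideal.absNorm I * Ideal.absNorm M = Ideal.absNorm I * 1 := by rw [← hn, mul_one]
    exact Nat.eq_of_mul_eq_mul_left (Nat.pos_of_ne_zero h0) this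
  rw [Ideal.absNorm_eq_one_iff.1 h1, Ideal.mul_top]

/-- the norm of an integer, as an integer -/
lemma intNorm_ext (h : IsQuad K L σ s) (x : 𝓞 L) :
    algebraMap (𝓞 K) (𝓞 L) (Algebra.intNorm (𝓞 K) (𝓞 L) x) = x * sO σ x := by
  apply RingOfIntegers.ext
  have h1 := Algebra.algebraMap_intNorm (A := 𝓞 K) (K := K) (L := L) (B := 𝓞 L) x
  have h2 := h.norm_eq (x : L)
  change algebraMap K L (algebraMap (𝓞 K) K (Algebra.intNorm (𝓞 K) (𝓞 L) x)) = _
  rw [h1]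
  exact h2

lemma finrankO (h : IsQuad K L σ s) : Module.finrank (𝓞 K) (𝓞 L) = 2 := by
  rw [← h.finrank, IsFractionRing.finrank_eq (𝓞 K) K (𝓞 L) L]

lemma absNorm_ext (h : IsQuad K L σ s) (I : Ideal (𝓞 K)) :
    Ideal.absNorm (I.map (algebraMap (𝓞 K) (𝓞 L))) = Ideal.absNorm I ^ 2 := by
  rw [← Ideal.absNorm_relNorm (𝓞 K) (𝓞 L), Ideal.relNorm_algebraMap, map_pow, finrankO h]

theorem relNorm_ext (h : IsQuad K L σ s) (I : Ideal (𝓞 L)) :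
    (Ideal.relNorm (𝓞 K) I).map (algebraMap (𝓞 K) (𝓞 L)) = I * sI σ I := by
  by_cases hI : I = ⊥
  · subst hI
    rw [Ideal.relNorm_bot, Ideal.map_bot, Ideal.bot_mul]
  apply ext_of_absNorm
  · exact ext_ne_bot (fun h => hI (Ideal.relNorm_eq_bot_iff.1 h))
  · rw [Ideal.relNorm_apply, Ideal.map_le_iff_le_comap, Ideal.span_le]
    rintro _ ⟨x, hx, rfl⟩
    rw [SetLike.mem_coe, Ideal.mem_comap, intNorm_ext h]
    exact Ideal.mul_mem_mul hx ((mem_sI σ).2 ⟨x, hx, rfl⟩)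
  · rw [absNorm_ext h, map_mul, absNorm_sI, Ideal.absNorm_relNorm, sq]

lemma ext_inj {I J : Ideal (𝓞 K)}
    (h : I.map (algebraMap (𝓞 K) (𝓞 L)) = J.map (algebraMap (𝓞 K) (𝓞 L))) : I = J := by
  by_cases hI : I = ⊥
  · subst hI
    by_contra hJ
    rw [Ideal.map_bot] at h
    exact ext_ne_bot (L := L) (fun e => hJ e.symm) h.symm
  by_cases hJ : J = ⊥
  · subst hJ
    rw [Ideal.map_bot] at h
    exact absurd h (ext_ne_bot hI)
  apply fI_inj (hI := hI) (hJ := hJ)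
  apply eF_inj (K := K) (L := L)
  rw [eF_fI, eF_fI]
  congr 1

lemma jCl_nCl (h : IsQuad K L σ s) (c : ClassGroup (𝓞 L)) :
    jCl K L (nCl K L c) = c * aCl σ c := by
  obtain ⟨I, hI, rfl⟩ := cl_surj c
  rw [nCl_cl hI, jCl_cl (fun h => hI (Ideal.relNorm_eq_bot_iff.1 h)), relNorm_ext h, aCl_cl _ hI,
    cl_mul hI (sI_ne_bot σ hI)]

lemma relNorm_sI (h : IsQuad K L σ s) (I : Ideal (𝓞 L)) :
    Ideal.relNorm (𝓞 K) (sI σ I) = Ideal.relNorm (𝓞 K) I := by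
  apply ext_inj (L := L)
  rw [relNorm_ext h, relNorm_ext h, mul_comm]
  congr 1
  ext x
  rw [mem_sI]
  constructor
  · rintro ⟨y, hy, rfl⟩
    obtain ⟨z, hz, rfl⟩ := (mem_sI σ).1 hy
    rwa [h.involO]
  · intro hx
    exact ⟨sO σ x, (mem_sI σ).2 ⟨x, hx, rfl⟩, h.involO x⟩

lemma nCl_aCl (h : IsQuad K L σ s) (c : ClassGroup (𝓞 L)) :
    nCl K L (aCl σ c) = nCl K L c := by
  obtain ⟨I, hI, rfl⟩ := cl_surj c
  rw [aCl_cl _ hI, nCl_cl (sI_ne_bot σ hI), nCl_cl hI, relNorm_sI h]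

lemma aCl_comp {σ τ ρ : L ≃+* L} (h : ∀ x, ρ x = τ (σ x)) (c : ClassGroup (𝓞 L)) :
    aCl ρ c = aCl τ (aCl σ c) := by
  obtain ⟨I, hI, rfl⟩ := cl_surj c
  rw [aCl_cl _ hI, aCl_cl _ hI, aCl_cl _ (sI_ne_bot σ hI)]
  congr 1
  ext x
  simp only [mem_sI]
  constructor
  · rintro ⟨y, hy, rfl⟩
    exact ⟨sO σ y, ⟨y, hy, rfl⟩, RingOfIntegers.ext (h _).symm⟩
  · rintro ⟨_, ⟨y, hy, rfl⟩, rfl⟩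
    exact ⟨y, hy, RingOfIntegers.ext (h _)⟩

lemma aCl_id {σ : L ≃+* L} (h : ∀ x, σ x = x) (c : ClassGroup (𝓞 L)) : aCl σ c = c := by
  obtain ⟨I, hI, rfl⟩ := cl_surj c
  rw [aCl_cl _ hI]
  congr 1
  ext x
  simp only [mem_sI]
  constructor
  · rintro ⟨y, hy, rfl⟩
    have : sO σ y = y := RingOfIntegers.ext (h _)
    rwa [this]
  · intro hx
    exact ⟨x, hx, RingOfIntegers.ext (h _)⟩

/-- base change for norms -/
lemma relNorm_baseChange {K' L' : Type*} [Field K'] [NumberField K'] [Field L'] [NumberField L']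
    [Algebra K' L'] [Algebra K K'] [Algebra L L'] [Algebra K L'] [IsScalarTower K K' L']
    [IsScalarTower K L L'] {σ' : L' ≃+* L'} {s' : L'} (h : IsQuad K L σ s) (h' : IsQuad K' L' σ' s')
    (hσ : ∀ x : L, σ' (algebraMap L L' x) = algebraMap L L' (σ x)) (I : Ideal (𝓞 L)) :
    Ideal.relNorm (𝓞 K') (I.map (algebraMap (𝓞 L) (𝓞 L'))) =
      (Ideal.relNorm (𝓞 K) I).map (algebraMap (𝓞 K) (𝓞 K')) := by
  apply ext_inj (L := L')
  rw [relNorm_ext h', Ideal.map_map]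
  have e1 : (algebraMap (𝓞 K') (𝓞 L')).comp (algebraMap (𝓞 K) (𝓞 K')) =
      (algebraMap (𝓞 L) (𝓞 L')).comp (algebraMap (𝓞 K) (𝓞 L)) := by
    ext x
    change algebraMap K' L' (algebraMap K K' x) = algebraMap L L' (algebraMap K L x)
    rw [← IsScalarTower.algebraMap_apply K K' L', ← IsScalarTower.algebraMap_apply K L L']
  rw [e1, ← Ideal.map_map, relNorm_ext h, Ideal.map_mul]
  congr 1
  change (I.map _).map (sO σ' : 𝓞 L' →+* 𝓞 L') = (I.map (sO σ : 𝓞 L →+* 𝓞 L)).map _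
  rw [Ideal.map_map, Ideal.map_map]
  congr 1
  ext x
  exact hσ _

end IdealNorm
end

section
section Grp

variable {G : Type*} [CommGroup G]

lemma card_closure_two (S : Finset G) (hS : ∀ x ∈ S, x ^ 2 = 1) :
    Nat.card (Subgroup.closure (S : Set G)) ∣ 2 ^ S.card := by
  classical
  induction S using Finset.induction_on with
  | empty => simp
  | insert a S ha ih =>
    rw [Finset.card_insert_of_notMem ha, Finset.coe_insert, Set.insert_eq, Subgroup.closure_union,
      pow_succ]
    set B := Subgroup.closure (S : Set G)
    set A := Subgroup.closure ({a} : Set G)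
    have h1 : Nat.card B ∣ 2 ^ S.card := ih (fun x hx => hS x (Finset.mem_insert_of_mem hx))
    have h2 : Nat.card A ∣ 2 := by
      have : A = Subgroup.zpowers a := (Subgroup.zpowers_eq_closure a).symm
      rw [this, Nat.card_zpowers]
      exact orderOf_dvd_of_pow_eq_one (hS a (Finset.mem_insert_self a S))
    have h3 : Nat.card B * B.relIndex (A ⊔ B) = Nat.card (A ⊔ B : Subgroup G) := by
      have := Subgroup.relIndex_mul_relIndex (⊥ : Subgroup G) B (A ⊔ B) bot_le le_sup_right
      rwa [Subgroup.relIndex_bot_left, Subgroup.relIndex_bot_left] at this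
    rw [← h3, Subgroup.relIndex_sup_right]
    exact mul_dvd_mul h1 ((Subgroup.relIndex_dvd_card B A).trans h2)

lemma relIndex_closure_two (H : Subgroup G) (S : Finset G) (hS : ∀ x ∈ S, x ^ 2 ∈ H) :
    H.relIndex (H ⊔ Subgroup.closure (S : Set G)) ∣ 2 ^ S.card := by
  classical
  have h1 := Subgroup.relIndex_ker (QuotientGroup.mk' H)
    (K := H ⊔ Subgroup.closure (S : Set G))
  rw [QuotientGroup.ker_mk'] at h1
  rw [h1, Subgroup.map_sup]
  have h2 : H.map (QuotientGroup.mk' H) = ⊥ := by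
    rw [Subgroup.map_eq_bot_iff, QuotientGroup.ker_mk']
  rw [h2, bot_sup_eq, MonoidHom.map_closure, ← Finset.coe_image]
  refine (card_closure_two _ ?_).trans (pow_dvd_pow 2 Finset.card_image_le)
  intro x hx
  obtain ⟨y, hy, rfl⟩ := Finset.mem_image.1 hx
  rw [← map_pow]
  exact (QuotientGroup.eq_one_iff _).2 (hS y hy)

end Grp

section Ram

variable {K L : Type*} [Field K] [NumberField K] [Field L] [NumberField L] [Algebra K L]
  {σ : L ≃+* L} {s : L}

/-- σ-invariant primes that are not extended from below -/
def RP (K : Type*) {L : Type*} [Field K] [NumberField K] [Field L] [NumberField L] [Algebra K L]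
    (σ : L ≃+* L) : Set (Ideal (𝓞 L)) :=
  {P | P.IsPrime ∧ P ≠ ⊥ ∧ sI σ P = P ∧ ∀ a : Ideal (𝓞 K), P ≠ a.map (algebraMap (𝓞 K) (𝓞 L))}

lemma sI_isPrime (σ : L ≃+* L) {P : Ideal (𝓞 L)} (hP : P.IsPrime) : (sI σ P).IsPrime :=
  Ideal.map_isPrime_of_equiv (sO σ)

lemma mem_sub_of_fix (h : IsQuad K L σ s) (A : Subgroup (FractionalIdeal (𝓞 L)⁰ L)ˣ)
    (hA : (eF K L).range ≤ A) (hR : ∀ P ∈ RP K σ, ∀ hP : P ≠ ⊥, fI P hP ∈ A) :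
    ∀ (n : ℕ) (I : Ideal (𝓞 L)) (hI : I ≠ ⊥), Ideal.absNorm I = n → sI σ I = I → fI I hI ∈ A := by
  intro n
  induction n using Nat.strong_induction_on with
  | _ n ih =>
  intro I hI hn hfix
  have ext_mem : ∀ (a : Ideal (𝓞 K)) (ha : a ≠ ⊥), fI (a.map (algebraMap (𝓞 K) (𝓞 L)))
      (ext_ne_bot ha) ∈ A := by
    intro a ha
    exact hA ⟨fI a ha, eF_fI a ha⟩
  by_cases htop : I = ⊤
  · subst htop
    have := ext_mem ⊤ top_ne_bot
    convert this using 2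
    rw [Ideal.map_top]
  obtain ⟨P, hPm, hle⟩ := Ideal.exists_le_maximal I htop
  have hPp := hPm.isPrime
  obtain ⟨M, rfl⟩ := Ideal.dvd_iff_le.2 hle
  have hP0 : P ≠ ⊥ := fun e => hI (by rw [e, Ideal.bot_mul])
  have hM0 : M ≠ ⊥ := fun e => hI (by rw [e, Ideal.mul_bot])
  have pos : ∀ J : Ideal (𝓞 L), J ≠ ⊥ → 0 < Ideal.absNorm J := fun J hJ =>
    Nat.pos_of_ne_zero (by rwa [Ne, Ideal.absNorm_eq_zero_iff])
  have hP1 : 1 < Ideal.absNorm P := by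
    have h1 := pos P hP0
    have h2 : Ideal.absNorm P ≠ 1 := by rw [Ne, Ideal.absNorm_eq_one_iff]; exact hPp.ne_top
    omega
  have hPprime : Prime P := Ideal.prime_of_isPrime hP0 hPp
  by_cases hs : sI σ P = P
  · have hMfix : sI σ M = M := by
      rw [map_mul, hs] at hfix
      exact mul_left_cancel₀ hP0 hfix
    have h1 : fI M hM0 ∈ A := by
      refine ih (Ideal.absNorm M) ?_ M hM0 rfl hMfix
      rw [← hn, map_mul]
      have := pos M hM0
      nlinarith
    have h2 : fI P hP0 ∈ A := by
      by_cases hr : P ∈ RP K σ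
      · exact hR P hr hP0
      · have : ∃ a : Ideal (𝓞 K), P = a.map (algebraMap (𝓞 K) (𝓞 L)) := by
          by_contra hne
          push Not at hne
          exact hr ⟨hPp, hP0, hs, hne⟩
        obtain ⟨a, rfl⟩ := this
        have ha : a ≠ ⊥ := fun e => hP0 (by rw [e, Ideal.map_bot])
        exact ext_mem a ha
    have := mul_mem h2 h1
    rw [fI_mul hP0 hM0] at *
    exact this
  · have hsp := sI_isPrime σ hPp
    have hsp0 : sI σ P ≠ ⊥ := sI_ne_bot σ hP0
    have hspr : Prime (sI σ P) := Ideal.prime_of_isPrime hsp0 hsp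
    have hd : sI σ P ∣ P * M := by rw [← hfix, map_mul]; exact dvd_mul_right _ _
    have hd2 : sI σ P ∣ M := by
      rcases hspr.dvd_or_dvd hd with h1 | h1
      · exfalso
        have h2 := Ideal.le_of_dvd h1
        exact hs ((hPm.eq_of_le hsp.ne_top h2).symm)
      · exact h1
    obtain ⟨M', rfl⟩ := hd2
    have hM'0 : M' ≠ ⊥ := fun e => hM0 (by rw [e, Ideal.mul_bot])
    have hQ : P * sI σ P = (Ideal.relNorm (𝓞 K) P).map (algebraMap (𝓞 K) (𝓞 L)) :=
      (relNorm_ext h P).symm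
    have hQ0 : P * sI σ P ≠ ⊥ := mul_ne_zero hP0 hsp0
    have hr0 : Ideal.relNorm (𝓞 K) P ≠ ⊥ := fun e => hP0 (Ideal.relNorm_eq_bot_iff.1 e)
    have hM'fix : sI σ M' = M' := by
      rw [← mul_assoc, map_mul, hQ, sI_ext σ h.fix, ← hQ] at hfix
      exact mul_left_cancel₀ hQ0 hfix
    have h1 : fI M' hM'0 ∈ A := by
      refine ih (Ideal.absNorm M') ?_ M' hM'0 rfl hM'fix
      rw [← hn, map_mul, map_mul, absNorm_sI]
      have := pos M' hM'0
      nlinarith [mul_lt_mul'' hP1 hP1 (by norm_num) (by norm_num)]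
    have h2 : fI (P * sI σ P) hQ0 ∈ A := by
      have := ext_mem _ hr0
      convert this using 2
    have := mul_mem h2 h1
    rw [← fI_mul hQ0 hM'0] at this
    convert this using 2
    rw [mul_assoc]

lemma RP_sq (h : IsQuad K L σ s) {P : Ideal (𝓞 L)} (hP : P ∈ RP K σ) :
    P * P = (P.comap (algebraMap (𝓞 K) (𝓞 L))).map (algebraMap (𝓞 K) (𝓞 L)) := by
  obtain ⟨hPp, hP0, hs, hne⟩ := hP
  have h1 := relNorm_ext h P
  rw [hs] at h1
  set p := P.comap (algebraMap (𝓞 K) (𝓞 L)) with hp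
  have hpp : p.IsPrime := hPp.comap _
  have hlo : P.LiesOver p := ⟨rfl⟩
  obtain ⟨f, hf⟩ := Ideal.exists_relNorm_eq_pow_of_isPrime P p
  have hle : p.map (algebraMap (𝓞 K) (𝓞 L)) ≤ P := Ideal.map_comap_le
  obtain ⟨M, hM⟩ := Ideal.dvd_iff_le.2 hle
  have hM1 : M ≠ 1 := by
    rintro rfl
    rw [mul_one] at hM
    exact hne _ hM.symm
  rw [hf, Ideal.map_pow, hM] at h1
  have hPM : P * M ≠ 0 := by
    intro e
    rw [e] at h1
    rcases Nat.eq_zero_or_pos f with hf0 | hf0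
    · rw [hf0, pow_zero] at h1
      apply hPp.ne_top
      rw [Ideal.eq_top_iff_one]
      have h2 : (1 : 𝓞 L) ∈ P * P := by rw [← h1, Ideal.one_eq_top]; trivial
      exact Ideal.mul_le_right h2
    · rw [zero_pow hf0.ne'] at h1
      exact hP0 (by simpa using h1.symm)
  have hnu : ∀ I : Ideal (𝓞 L), I ∣ 1 → I = 1 := fun I hI => by
    rwa [← isUnit_iff_dvd_one, Ideal.isUnit_iff, ← Ideal.one_eq_top] at hI
  have hPnu : P ≠ 1 := fun e => hPp.ne_top (by rw [e, Ideal.one_eq_top])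
  match f, h1 with
  | 0, h1 =>
    rw [pow_zero] at h1
    exact absurd (hnu P ⟨P, h1⟩) hPnu
  | 1, h1 =>
    rw [pow_one] at h1
    rw [hM, h1]
  | (f + 2), h1 =>
    exfalso
    have h2 : P * P * (M * M * (P * M) ^ f) = P * P * 1 := by
      rw [mul_one]; refine Eq.trans ?_ h1; ring
    have h3 := mul_left_cancel₀ (mul_ne_zero hP0 hP0) h2
    exact hM1 (hnu M ⟨M * (P * M) ^ f, by rw [← h3]; ring⟩)

theorem iIdx_dvd (h : IsQuad K L σ s) (C : Finset (Ideal (𝓞 K)))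
    (hC : ∀ P ∈ RP K σ, P.comap (algebraMap (𝓞 K) (𝓞 L)) ∈ C) : iIdx K σ ∣ 2 ^ C.card := by
  classical
  have hinj : Set.InjOn (fun P : Ideal (𝓞 L) => P.comap (algebraMap (𝓞 K) (𝓞 L))) (RP K σ) := by
    intro P hP Q hQ hPQ
    have h1 := RP_sq h hP
    have h2 := RP_sq h hQ
    dsimp only at hPQ
    rw [hPQ, ← h2] at h1
    have h3 : P ∣ Q * Q := ⟨P, h1.symm⟩
    have h4 : P ∣ Q := by
      rcases (Ideal.prime_of_isPrime hP.2.1 hP.1).dvd_or_dvd h3 with h | h <;> exact h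
    have h5 : Q.IsMaximal := hQ.1.isMaximal hQ.2.1
    exact (h5.eq_of_le hP.1.ne_top (Ideal.le_of_dvd h4)).symm
  have hfin : (RP K σ).Finite := by
    refine Set.Finite.of_finite_image ?_ hinj
    exact C.finite_toSet.subset (by rintro _ ⟨P, hP, rfl⟩; exact hC P hP)
  have hcard : hfin.toFinset.card ≤ C.card := by
    apply Finset.card_le_card_of_injOn (fun P => P.comap (algebraMap (𝓞 K) (𝓞 L)))
    · intro P hP
      exact hC P (by simpa using hP)
    · intro P hP Q hQ
      exact hinj (by simpa using hP) (by simpa using hQ)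
  let g : Ideal (𝓞 L) → (FractionalIdeal (𝓞 L)⁰ L)ˣ := fun P =>
    if hP : P ≠ ⊥ then fI P hP else 1
  let S := hfin.toFinset.image g
  have hle : (dmH (sF σ)).ker ≤ (eF K L).range ⊔ Subgroup.closure (S : Set _) := by
    intro I hI
    rw [mem_ker_dmH] at hI
    have key : ∀ (J : Ideal (𝓞 L)) (hJ : J ≠ ⊥), sI σ J = J →
        fI J hJ ∈ (eF K L).range ⊔ Subgroup.closure (S : Set _) := by
      intro J hJ hJs
      refine mem_sub_of_fix h _ le_sup_left ?_ _ J hJ rfl hJs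
      intro P hP hP0
      refine Subgroup.mem_sup_right (Subgroup.subset_closure ?_)
      rw [Finset.mem_coe, Finset.mem_image]
      exact ⟨P, by simpa using hP, by simp [g, hP0]⟩
    obtain ⟨a, ha, J, hJ, e⟩ := frac_rep I
    -- multiply by `σ a`
    have hspan : ∀ x : 𝓞 L, x ≠ 0 → Ideal.span {x} ≠ ⊥ := fun x hx => by
      rwa [Ne, Ideal.span_singleton_eq_bot]
    have hsa : sO σ a ≠ 0 := by
      intro e; exact ha ((sO σ).injective (by rw [e, map_zero]))
    have h0 := mul_ne_zero (hspan a ha) (hspan _ hsa)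
    have hfix0 : sI σ (Ideal.span {a} * Ideal.span {sO σ a}) =
        Ideal.span {a} * Ideal.span {sO σ a} := by
      rw [map_mul, sI_span, sI_span, h.involO, mul_comm]
    have hm0 := key _ h0 hfix0
    have hJ2 : Ideal.span {sO σ a} * J ≠ ⊥ := mul_ne_zero (hspan _ hsa) hJ
    have e2 : fI _ h0 * I = fI _ hJ2 := by
      rw [fI_mul (hspan _ hsa) hJ, ← e, fI_mul (hspan a ha) (hspan _ hsa)]
      rw [mul_left_comm, mul_assoc]
    have hfix : sI σ (Ideal.span {sO σ a} * J) = Ideal.span {sO σ a} * J := by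
      have h1 := congrArg (sF σ) e2
      rw [map_mul, hI, sF_fI, sF_fI] at h1
      have h2 : fI _ (sI_ne_bot σ h0) = fI _ h0 := by congr 1
      rw [h2, e2] at h1
      exact (fI_inj h1).symm
    have hm1 := key _ hJ2 hfix
    have h3 : I = (fI _ h0)⁻¹ * fI _ hJ2 := by rw [← e2]; simp
    rw [h3]
    exact mul_mem (inv_mem hm0) hm1
  have h1 : iIdx K σ ∣ (eF K L).range.relIndex ((eF K L).range ⊔ Subgroup.closure (S : Set _)) := by
    have hle1 : (eF K L).range ≤ (dmH (sF σ)).ker := by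
      rintro _ ⟨I, rfl⟩
      rw [mem_ker_dmH, sF_eF h]
    exact ⟨_, (Subgroup.relIndex_mul_relIndex _ _ _ hle1 hle).symm⟩
  refine h1.trans ((relIndex_closure_two _ S ?_).trans
    (pow_dvd_pow 2 (Finset.card_image_le.trans hcard)))
  intro x hx
  obtain ⟨P, hP, rfl⟩ := Finset.mem_image.1 hx
  have hP' : P ∈ RP K σ := by simpa using hP
  have hP0 := hP'.2.1
  have hg : g P = fI P hP0 := by simp [g, hP0]
  rw [hg, sq, ← fI_mul hP0 hP0]
  have h2 := RP_sq h hP'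
  have hp0 : P.comap (algebraMap (𝓞 K) (𝓞 L)) ≠ ⊥ := by
    intro e
    rw [e, Ideal.map_bot] at h2
    exact mul_ne_zero hP0 hP0 h2
  refine ⟨fI _ hp0, ?_⟩
  rw [eF_fI]
  congr 1
  exact h2.symm

/-- surjectivity on residue fields -/
lemma resid_surj {P : Ideal (𝓞 L)} (hP : P ≠ ⊥)
    (hn : Ideal.absNorm P = Ideal.absNorm (P.comap (algebraMap (𝓞 K) (𝓞 L)))) (x : 𝓞 L) :
    ∃ a : 𝓞 K, x - algebraMap (𝓞 K) (𝓞 L) a ∈ P := by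
  set p := P.comap (algebraMap (𝓞 K) (𝓞 L)) with hp
  let f : 𝓞 K ⧸ p →+* 𝓞 L ⧸ P := Ideal.quotientMap P (algebraMap (𝓞 K) (𝓞 L)) le_rfl
  have hf : Function.Injective f := Ideal.quotientMap_injective
  have hfin : Finite (𝓞 L ⧸ P) := Ring.HasFiniteQuotients.finiteQuotient hP
  have hb : Function.Bijective f := by
    rw [Nat.bijective_iff_injective_and_card]
    refine ⟨hf, ?_⟩
    rw [Ideal.absNorm_apply, Ideal.absNorm_apply, Submodule.cardQuot_apply,
      Submodule.cardQuot_apply] at hn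
    exact hn.symm
  obtain ⟨y, hy⟩ := hb.2 (Ideal.Quotient.mk P x)
  obtain ⟨a, rfl⟩ := Ideal.Quotient.mk_surjective y
  refine ⟨a, ?_⟩
  rw [← Ideal.Quotient.eq, ← hy]
  rfl

lemma RP_absNorm (h : IsQuad K L σ s) {P : Ideal (𝓞 L)} (hP : P ∈ RP K σ) :
    Ideal.absNorm P = Ideal.absNorm (P.comap (algebraMap (𝓞 K) (𝓞 L))) := by
  have h1 := congrArg Ideal.absNorm (RP_sq h hP)
  rw [absNorm_ext h, map_mul, ← sq] at h1
  exact Nat.pow_left_injective (n := 2) (by norm_num) h1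

/-- ramification criterion -/
lemma RP_diff (h : IsQuad K L σ s) {P : Ideal (𝓞 L)} (hP : P ∈ RP K σ) (x : 𝓞 L) :
    sO σ x - x ∈ P := by
  obtain ⟨a, ha⟩ := resid_surj hP.2.1 (RP_absNorm h hP) x
  have h1 : sO σ (x - algebraMap (𝓞 K) (𝓞 L) a) ∈ P := by
    have : sO σ (x - algebraMap (𝓞 K) (𝓞 L) a) ∈ sI σ P := (mem_sI σ).2 ⟨_, ha, rfl⟩
    rwa [hP.2.2.1] at this
  have h2 : sO σ (algebraMap (𝓞 K) (𝓞 L) a) = algebraMap (𝓞 K) (𝓞 L) a :=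
    RingOfIntegers.ext (h.fix a)
  rw [map_sub, h2] at h1
  have := P.sub_mem h1 ha
  convert this using 1
  ring

end Ram
end

section
section TN

variable {K : Type*} [Field K] [NumberField K]

lemma exists_not_mem_pow {p : Ideal (𝓞 K)} (hp : p.IsPrime) {D : 𝓞 K} (hD : D ≠ 0) :
    ∃ k : ℕ, D ∉ p ^ k := by
  by_contra h
  push Not at h
  have h1 := Ideal.iInf_pow_eq_bot_of_isDomain p hp.ne_top
  have h2 : D ∈ ⨅ i : ℕ, p ^ i := by simpa using h
  rw [h1] at h2
  exact hD h2

lemma TN_int {p : Ideal (𝓞 K)} (hp : p.IsPrime) {c z : 𝓞 K} (hc : c ∈ p) (hc2 : c ∉ p ^ 2)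
    (k : ℕ) : ∀ A B D : 𝓞 K, D ∉ p ^ k → z * D ^ 2 = A ^ 2 - c * B ^ 2 →
    ∃ e X : 𝓞 K, e ∉ p ∧ z * e ^ 2 - X ^ 2 ∈ p := by
  have hc0 : c ≠ 0 := fun e => hc2 (by rw [e]; exact Ideal.zero_mem _)
  induction k with
  | zero => intro A B D hD; exact absurd (by simp) hD
  | succ k ih =>
    intro A B D hD e
    by_cases hDp : D ∈ p
    · obtain ⟨M, hM⟩ := Ideal.dvd_iff_le.2 ((Ideal.span_singleton_le_iff_mem p).2 hc)
      have hMp : ¬ M ≤ p := by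
        intro hle
        apply hc2
        rw [← Ideal.span_singleton_le_iff_mem, hM, sq]
        exact Ideal.mul_mono_right hle
      obtain ⟨m, hmM, hmp⟩ := Set.not_subset.1 hMp
      have key : ∀ x ∈ p, ∃ x', m * x = c * x' := by
        intro x hx
        have : x * m ∈ p * M := Ideal.mul_mem_mul hx hmM
        rw [← hM, Ideal.mem_span_singleton] at this
        obtain ⟨x', hx'⟩ := this
        exact ⟨x', by rw [mul_comm, hx']⟩
      have hA : A ∈ p := by
        apply hp.mem_of_pow_mem 2
        have : A ^ 2 = z * D ^ 2 + c * B ^ 2 := by linear_combination -e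
        rw [this]
        exact p.add_mem (p.mul_mem_left _ (by rw [sq]; exact p.mul_mem_left _ hDp))
          (p.mul_mem_right _ hc)
      have hB : B ∈ p := by
        by_contra hB
        have h1 : B * (B * c) ∈ p ^ 2 := by
          have : B * (B * c) = A ^ 2 - z * D ^ 2 := by linear_combination e
          rw [this]
          exact Ideal.sub_mem _ (Ideal.pow_mem_pow hA 2)
            (Ideal.mul_mem_left _ _ (Ideal.pow_mem_pow hDp 2))
        have h2 := (Ideal.IsPrime.mul_mem_pow p h1).resolve_left hB
        exact hc2 ((Ideal.IsPrime.mul_mem_pow p h2).resolve_left hB)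
      obtain ⟨D', hD'⟩ := key D hDp
      obtain ⟨A', hA'⟩ := key A hA
      obtain ⟨B', hB'⟩ := key B hB
      refine ih A' B' D' ?_ ?_
      · intro h1
        apply hD
        have h2 : m * D ∈ p ^ (k + 1) := by
          rw [hD', pow_succ']
          exact Ideal.mul_mem_mul hc h1
        exact (Ideal.IsPrime.mul_mem_pow p h2).resolve_left hmp
      · have h3 : c ^ 2 * (z * D' ^ 2) = c ^ 2 * (A' ^ 2 - c * B' ^ 2) := by
          have : z * (m * D) ^ 2 = (m * A) ^ 2 - c * (m * B) ^ 2 := by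
            linear_combination m ^ 2 * e
          rw [hD', hA', hB'] at this
          linear_combination this
        exact mul_left_cancel₀ (pow_ne_zero 2 hc0) h3
    · refine ⟨D, A, hDp, ?_⟩
      rw [e]
      have : A ^ 2 - c * B ^ 2 - A ^ 2 = -(c * B ^ 2) := by ring
      rw [this]
      exact p.neg_mem (p.mul_mem_right _ hc)

/-- Tame norm residue obstruction. -/
theorem TN {k : Type*} [Field k] (f : 𝓞 K →+* k) {c z : 𝓞 K} (hc : f c = 0)
    (hc2 : c ∉ (RingHom.ker f) ^ 2) (a b : K)
    (e : (z : K) = a ^ 2 - c * b ^ 2) : IsSquare (f z) := by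
  obtain ⟨A, D1, hD1, rfl⟩ := IsFractionRing.div_surjective (A := 𝓞 K) a
  obtain ⟨B, D2, hD2, rfl⟩ := IsFractionRing.div_surjective (A := 𝓞 K) b
  have h1 : D1 ≠ 0 := nonZeroDivisors.ne_zero hD1
  have h2 : D2 ≠ 0 := nonZeroDivisors.ne_zero hD2
  have h1' : algebraMap (𝓞 K) K D1 ≠ 0 := by simpa using h1
  have h2' : algebraMap (𝓞 K) K D2 ≠ 0 := by simpa using h2
  have e2 : z * (D1 * D2) ^ 2 = (A * D2) ^ 2 - c * (B * D1) ^ 2 := by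
    apply RingOfIntegers.ext
    push_cast
    change algebraMap (𝓞 K) K z = _ at e
    change algebraMap (𝓞 K) K z * (algebraMap (𝓞 K) K D1 * algebraMap (𝓞 K) K D2) ^ 2 =
      (algebraMap (𝓞 K) K A * algebraMap (𝓞 K) K D2) ^ 2 -
        algebraMap (𝓞 K) K c * (algebraMap (𝓞 K) K B * algebraMap (𝓞 K) K D1) ^ 2
    rw [e]
    field_simp
  have hp : (RingHom.ker f).IsPrime := RingHom.ker_isPrime f
  obtain ⟨m, hm⟩ := exists_not_mem_pow hp (mul_ne_zero h1 h2)
  obtain ⟨d, X, hd, hX⟩ := TN_int hp (c := c) (z := z) hc hc2 m _ _ _ hm e2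
  rw [RingHom.mem_ker] at hd hX
  refine ⟨f X / f d, ?_⟩
  rw [map_sub, map_mul, map_pow, map_pow] at hX
  field_simp
  linear_combination hX

/-- residue map of a degree one prime -/
lemma residHom {p : Ideal (𝓞 K)} {l : ℕ} [Fact l.Prime] (hp : Ideal.absNorm p = l) :
    ∃ f : 𝓞 K →+* ZMod l, RingHom.ker f = p := by
  have hcard : Nat.card (𝓞 K ⧸ p) = l := by
    rw [← hp, Ideal.absNorm_apply, Submodule.cardQuot_apply]
  have hl : l.Prime := Fact.out
  have hfin : Finite (𝓞 K ⧸ p) := Nat.finite_of_card_ne_zero (by rw [hcard]; exact hl.ne_zero)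
  let _ := Fintype.ofFinite (𝓞 K ⧸ p)
  have e : ZMod l ≃+* 𝓞 K ⧸ p := ZMod.ringEquivOfPrime _ hl (by rw [← Nat.card_eq_fintype_card, hcard])
  refine ⟨(e.symm : 𝓞 K ⧸ p →+* ZMod l).comp (Ideal.Quotient.mk p), ?_⟩
  ext x
  rw [RingHom.mem_ker, RingHom.comp_apply]
  change e.symm _ = 0 ↔ _
  rw [map_eq_zero_iff _ e.symm.injective, Ideal.Quotient.eq_zero_iff_mem]

lemma isPrime_of_absNorm {p : Ideal (𝓞 K)} {l : ℕ} (hl : l.Prime) (hp : Ideal.absNorm p = l) :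
    p.IsPrime := Ideal.isPrime_of_irreducible_absNorm (by rw [hp]; exact hl)

end TN

section Split

variable {K L : Type*} [Field K] [NumberField K] [Field L] [NumberField L] [Algebra K L]
  {σ : L ≃+* L} {s : L}

lemma mem_of_mem_ext {a : Ideal (𝓞 K)} {c : 𝓞 K}
    (h : algebraMap (𝓞 K) (𝓞 L) c ∈ a.map (algebraMap (𝓞 K) (𝓞 L))) : c ∈ a := by
  have h1 : (a ⊔ Ideal.span {c}).map (algebraMap (𝓞 K) (𝓞 L)) = a.map (algebraMap (𝓞 K) (𝓞 L)) := by
    rw [Ideal.map_sup, Ideal.map_span, Set.image_singleton, sup_eq_left,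
      Ideal.span_singleton_le_iff_mem]
    exact h
  have h2 := ext_inj h1
  rw [← h2]
  exact Ideal.mem_sup_right (Ideal.mem_span_singleton_self c)

lemma ext_le {a b : Ideal (𝓞 K)}
    (h : a.map (algebraMap (𝓞 K) (𝓞 L)) ≤ b.map (algebraMap (𝓞 K) (𝓞 L))) : a ≤ b :=
  fun _ hx => mem_of_mem_ext (h (Ideal.mem_map_of_mem _ hx))

lemma coprime_primes {P Q : Ideal (𝓞 L)} (hP : P.IsPrime) (hP0 : P ≠ ⊥) (hQ : Q.IsPrime)
    (hQ0 : Q ≠ ⊥) (hne : P ≠ Q) : IsCoprime P Q := by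
  rw [Ideal.isCoprime_iff_sup_eq]
  exact Ideal.IsMaximal.coprime_of_ne (hP.isMaximal hP0) (hQ.isMaximal hQ0) hne

lemma relNorm_of_ne (h : IsQuad K L σ s) {P : Ideal (𝓞 L)} (hP : P.IsPrime) (hP0 : P ≠ ⊥)
    (hne : sI σ P ≠ P) : Ideal.relNorm (𝓞 K) P = P.comap (algebraMap (𝓞 K) (𝓞 L)) := by
  apply le_antisymm (Ideal.relNorm_le_comap _ _)
  apply ext_le (L := L)
  rw [relNorm_ext h]
  have h1 : (P.comap (algebraMap (𝓞 K) (𝓞 L))).map (algebraMap (𝓞 K) (𝓞 L)) ≤ P :=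
    Ideal.map_comap_le
  have h2 : (P.comap (algebraMap (𝓞 K) (𝓞 L))).map (algebraMap (𝓞 K) (𝓞 L)) ≤ sI σ P := by
    rw [← sI_ext σ h.fix]
    exact Ideal.map_mono h1
  have hc := coprime_primes hP hP0 (sI_isPrime σ hP) (sI_ne_bot σ hP0) (Ne.symm hne)
  exact Ideal.le_of_dvd (hc.mul_dvd (Ideal.dvd_iff_le.2 h1) (Ideal.dvd_iff_le.2 h2))

lemma not_mem_sq_of_ne (h : IsQuad K L σ s) {P : Ideal (𝓞 L)} (hP : P.IsPrime) (hP0 : P ≠ ⊥)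
    (hne : sI σ P ≠ P) {c : 𝓞 K} (hc : c ∉ (P.comap (algebraMap (𝓞 K) (𝓞 L))) ^ 2) :
    algebraMap (𝓞 K) (𝓞 L) c ∉ P ^ 2 := by
  intro hm
  apply hc
  rw [← relNorm_of_ne h hP hP0 hne]
  apply mem_of_mem_ext (L := L)
  rw [Ideal.map_pow, relNorm_ext h, mul_pow]
  have h1 : Ideal.span {algebraMap (𝓞 K) (𝓞 L) c} ≤ P ^ 2 :=
    (Ideal.span_singleton_le_iff_mem _).2 hm
  have h2 : Ideal.span {algebraMap (𝓞 K) (𝓞 L) c} ≤ (sI σ P) ^ 2 := by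
    have h3 : sI σ (Ideal.span {algebraMap (𝓞 K) (𝓞 L) c}) = Ideal.span {algebraMap (𝓞 K) (𝓞 L) c} := by
      rw [sI_span]; congr 2; exact RingOfIntegers.ext (h.fix c)
    rw [← h3, ← map_pow]
    exact Ideal.map_mono h1
  have hcop := coprime_primes hP hP0 (sI_isPrime σ hP) (sI_ne_bot σ hP0) (Ne.symm hne)
  have := (hcop.pow (m := 2) (n := 2)).mul_dvd (Ideal.dvd_iff_le.2 h1) (Ideal.dvd_iff_le.2 h2)
  exact (Ideal.span_singleton_le_iff_mem _).1 (Ideal.le_of_dvd this)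

lemma sI_ne_of_resid (h : IsQuad K L σ s) {P : Ideal (𝓞 L)} {x : 𝓞 L} {a : 𝓞 K}
    (hx : sO σ x = -x) (ha : x - algebraMap (𝓞 K) (𝓞 L) a ∈ P) (h2 : 2 * x ∉ P) : sI σ P ≠ P := by
  intro e
  have h1 : sO σ (x - algebraMap (𝓞 K) (𝓞 L) a) ∈ sI σ P := (mem_sI σ).2 ⟨_, ha, rfl⟩
  have h3 : sO σ (algebraMap (𝓞 K) (𝓞 L) a) = algebraMap (𝓞 K) (𝓞 L) a :=
    RingOfIntegers.ext (h.fix a)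
  rw [e, map_sub, hx, h3] at h1
  apply h2
  have := P.sub_mem ha h1
  convert this using 1
  ring

lemma relNorm_of_absNorm {P : Ideal (𝓞 L)} (hP : P.IsPrime) (hP0 : P ≠ ⊥)
    (hn : Ideal.absNorm P = Ideal.absNorm (P.comap (algebraMap (𝓞 K) (𝓞 L)))) :
    Ideal.relNorm (𝓞 K) P = P.comap (algebraMap (𝓞 K) (𝓞 L)) := by
  apply ext_of_absNorm
  · exact fun h => hP0 (Ideal.relNorm_eq_bot_iff.1 h)
  · exact Ideal.relNorm_le_comap _ _
  · rw [Ideal.absNorm_relNorm, hn]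

end Split
end

section
section Two

variable {K : Type*} [Field K] [NumberField K]

lemma absNorm_nat (n : ℕ) : Ideal.absNorm (Ideal.span {(n : 𝓞 K)}) = n ^ Module.finrank ℚ K := by
  rw [Ideal.absNorm_span_singleton]
  have : (n : 𝓞 K) = algebraMap ℤ (𝓞 K) n := by simp
  rw [this, Algebra.norm_algebraMap, RingOfIntegers.rank, Int.natAbs_pow]
  simp

lemma two_primes {N : ℕ} (hN : 0 < N) (hdeg : Module.finrank ℚ K = 2 * N)
    (hram : ∀ P : Ideal (𝓞 K), P.IsPrime → (2 : 𝓞 K) ∈ P → (2 : 𝓞 K) ∈ P ^ N)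
    {θ m : 𝓞 K} (hθ : θ * (1 - θ) = 2 * m) {τ : K ≃+* K} (hτ : sO τ θ = 1 - θ)
    {P : Ideal (𝓞 K)} (hP : P.IsPrime) (h2 : (2 : 𝓞 K) ∈ P) :
    Ideal.absNorm P = 2 ∧ ∀ Q : Ideal (𝓞 K), Q.IsPrime → (2 : 𝓞 K) ∈ Q → (θ ∈ Q ↔ θ ∈ P) →
      Q = P := by
  have h20 : (2 : 𝓞 K) ≠ 0 := two_ne_zero
  have ne0 : ∀ P : Ideal (𝓞 K), (2 : 𝓞 K) ∈ P → P ≠ ⊥ := by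
    rintro P h rfl
    exact h20 (by simpa using h)
  have hdich : ∀ P : Ideal (𝓞 K), P.IsPrime → (2 : 𝓞 K) ∈ P → (θ ∈ P ↔ 1 - θ ∉ P) := by
    intro P hP h
    have h1 : θ * (1 - θ) ∈ P := by rw [hθ]; exact P.mul_mem_right _ h
    constructor
    · intro h3 h4
      apply hP.ne_top
      rw [Ideal.eq_top_iff_one]
      have := P.add_mem h3 h4
      simpa using this
    · intro h3
      exact (hP.mem_or_mem h1).resolve_right h3
  have hQ : (sI τ P).IsPrime := sI_isPrime τ hP
  have h2Q : (2 : 𝓞 K) ∈ sI τ P := (mem_sI τ).2 ⟨2, h2, map_ofNat _ 2⟩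
  have hP0 := ne0 P h2
  have hne : P ≠ sI τ P := by
    intro e
    have h1 : ∀ x, x ∈ P → sO τ x ∈ P := fun x hx => by rw [e]; exact (mem_sI τ).2 ⟨x, hx, rfl⟩
    by_cases hx : θ ∈ P
    · have h3 := h1 _ hx
      rw [hτ] at h3
      exact (hdich P hP h2).1 hx h3
    · have h3 : 1 - θ ∈ P := by
        by_contra h4
        exact hx ((hdich P hP h2).2 h4)
      have h4 := h1 _ h3
      rw [map_sub, map_one, hτ] at h4
      exact hx (by simpa using h4)
  have hcop := coprime_primes hP hP0 hQ (ne0 _ h2Q) hne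
  have hd : (P * sI τ P) ^ N ∣ Ideal.span {(2 : 𝓞 K)} := by
    rw [mul_pow]
    apply (hcop.pow (m := N) (n := N)).mul_dvd
    · rw [Ideal.dvd_iff_le, Ideal.span_singleton_le_iff_mem]; exact hram P hP h2
    · rw [Ideal.dvd_iff_le, Ideal.span_singleton_le_iff_mem]; exact hram _ hQ h2Q
  have hn2 : Ideal.absNorm (Ideal.span {(2 : 𝓞 K)}) = 2 ^ (2 * N) := by
    have := absNorm_nat (K := K) 2
    rw [hdeg] at this
    exact_mod_cast this
  have hnP : Ideal.absNorm ((P * sI τ P) ^ N) = Ideal.absNorm P ^ (2 * N) := by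
    rw [map_pow, map_mul, absNorm_sI, ← sq, pow_mul]
  have hdn := Ideal.absNorm_dvd_absNorm_of_le (Ideal.le_of_dvd hd)
  rw [hn2, hnP] at hdn
  have hP2 : Ideal.absNorm P = 2 := by
    have h1 : Ideal.absNorm P ≤ 2 := by
      have := Nat.le_of_dvd (by positivity) hdn
      exact (Nat.pow_le_pow_iff_left (by omega)).1 this
    have h3 : Ideal.absNorm P ≠ 1 := by rw [Ne, Ideal.absNorm_eq_one_iff]; exact hP.ne_top
    have h4 : Ideal.absNorm P ≠ 0 := by rw [Ne, Ideal.absNorm_eq_zero_iff]; exact hP0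
    omega
  refine ⟨hP2, ?_⟩
  intro R hR h2R hiff
  have heq : Ideal.span {(2 : 𝓞 K)} = (P * sI τ P) ^ N := by
    apply ext_of_absNorm _ (Ideal.le_of_dvd hd)
    · rw [hn2, hnP, hP2]
    · rwa [Ne, Ideal.span_singleton_eq_bot]
  have hle : (P * sI τ P) ^ N ≤ R := by
    rw [← heq, Ideal.span_singleton_le_iff_mem]; exact h2R
  have hle2 := hR.le_of_pow_le hle
  rcases hR.mul_le.1 hle2 with h | h
  · exact ((hP.isMaximal hP0).eq_of_le hR.ne_top h).symm
  · exfalso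
    have e := (hQ.isMaximal (ne0 _ h2Q)).eq_of_le hR.ne_top h
    rw [← e] at hiff
    by_cases hx : θ ∈ P
    · have h3 : sO τ θ ∈ sI τ P := (mem_sI τ).2 ⟨θ, hx, rfl⟩
      rw [hτ] at h3
      exact (hdich _ hQ h2Q).1 (hiff.2 hx) h3
    · have h3 : 1 - θ ∈ P := by
        by_contra h4
        exact hx ((hdich P hP h2).2 h4)
      have h4 : sO τ (1 - θ) ∈ sI τ P := (mem_sI τ).2 ⟨_, h3, rfl⟩
      rw [map_sub, map_one, hτ] at h4
      exact hx (hiff.1 (by simpa using h4))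

end Two

section B2

variable {G H : Type*} [CommGroup G] [CommGroup H]

/-- elements of odd order -/
def Od (G : Type*) [CommGroup G] : Subgroup G where
  carrier := {x | ∃ m : ℕ, Odd m ∧ x ^ m = 1}
  one_mem' := ⟨1, odd_one, by simp⟩
  mul_mem' := by
    rintro x y ⟨m, hm, hx⟩ ⟨n, hn, hy⟩
    refine ⟨m * n, hm.mul hn, ?_⟩
    rw [mul_pow, pow_mul, hx, mul_comm m n, pow_mul, hy, one_pow, one_pow, one_mul]
  inv_mem' := by
    rintro x ⟨m, hm, hx⟩
    exact ⟨m, hm, by rw [inv_pow, hx, inv_one]⟩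

/-- maximal 2-quotient (of a finite group) -/
abbrev B2 (G : Type*) [CommGroup G] := G ⧸ Od G

/-- class in the 2-quotient -/
def b2 (G : Type*) [CommGroup G] : G →* B2 G := QuotientGroup.mk' (Od G)

lemma b2_surj : Function.Surjective (b2 G) := QuotientGroup.mk'_surjective _

lemma b2_eq_one {x : G} : b2 G x = 1 ↔ ∃ m : ℕ, Odd m ∧ x ^ m = 1 :=
  (QuotientGroup.eq_one_iff x)

/-- functoriality -/
def mB (f : G →* H) : B2 G →* B2 H := QuotientGroup.map _ _ f (by
  rintro x ⟨m, hm, hx⟩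
  exact ⟨m, hm, by rw [← map_pow, hx, map_one]⟩)

@[simp] lemma mB_b2 (f : G →* H) (x : G) : mB f (b2 G x) = b2 H (f x) := rfl

/-- two-power torsion -/
def IsTwo (B : Type*) [CommGroup B] : Prop := ∀ x : B, ∃ k : ℕ, x ^ 2 ^ k = 1

lemma isTwo_B2 [Finite G] : IsTwo (B2 G) := by
  intro x
  obtain ⟨y, rfl⟩ := b2_surj x
  obtain ⟨k, m, hm, e⟩ := Nat.exists_eq_two_pow_mul_odd (Nat.card_pos (α := G)).ne'
  refine ⟨k, ?_⟩
  rw [← map_pow, b2_eq_one]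
  exact ⟨m, hm, by rw [← pow_mul, ← e, pow_card_eq_one']⟩

lemma card_Od_odd [Finite G] : Odd (Nat.card (Od G)) := by
  rw [← Nat.not_even_iff_odd, even_iff_two_dvd]
  intro h
  have : Fact (Nat.Prime 2) := ⟨Nat.prime_two⟩
  obtain ⟨⟨x, m, hm, hx⟩, ho⟩ := exists_prime_orderOf_dvd_card' 2 h
  have h1 : (⟨x, m, hm, hx⟩ : Od G) ^ m = 1 := Subtype.ext hx
  have h2 := orderOf_dvd_of_pow_eq_one h1
  rw [ho] at h2
  exact (Nat.not_even_iff_odd.2 hm) (even_iff_two_dvd.2 h2)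

lemma IsTwo.card {B : Type*} [CommGroup B] [Finite B] (h : IsTwo B) : ∃ k, Nat.card B = 2 ^ k := by
  have h1 : IsPGroup 2 B := fun x => h x
  have : Fact (Nat.Prime 2) := ⟨Nat.prime_two⟩
  exact IsPGroup.iff_card.1 h1

lemma two_part {a k m : ℕ} (h : a = 2 ^ k * m) (hm : Odd m) : 2 ^ (a.factorization 2) = 2 ^ k := by
  rw [h, Nat.factorization_mul (by positivity) (by rintro rfl; simp at hm)]
  rw [Finsupp.add_apply, Nat.prime_two.factorization_pow, Finsupp.single_eq_same,
    Nat.factorization_eq_zero_of_not_dvd, add_zero]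
  intro h2
  exact (Nat.not_even_iff_odd.2 hm) (even_iff_two_dvd.2 h2)

lemma card_B2 [Finite G] : Nat.card (B2 G) = 2 ^ ((Nat.card G).factorization 2) := by
  obtain ⟨k, hk⟩ := (isTwo_B2 (G := G)).card
  rw [hk]
  refine (two_part ?_ (card_Od_odd (G := G))).symm
  rw [← hk, Subgroup.card_eq_card_quotient_mul_card_subgroup (Od G)]

lemma odd_pow_gen {B : Type*} [CommGroup B] (h : IsTwo B) (x : B) {m : ℕ} (hm : Odd m) :
    ∃ n : ℕ, (x ^ m) ^ n = x := by
  obtain ⟨k, hk⟩ := h x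
  have hc : Nat.Coprime m (2 ^ k) := (Nat.coprime_two_right.2 hm).pow_right k
  have hu := (ZMod.unitOfCoprime m hc)
  have ho : orderOf x ∣ 2 ^ k := orderOf_dvd_of_pow_eq_one hk
  have hc' : Nat.Coprime m (orderOf x) := hc.coprime_dvd_right ho
  obtain ⟨n, hn⟩ := exists_pow_eq_self_of_coprime (x := x) (n := m) hc'
  exact ⟨n, hn⟩

lemma card_fix_B2 [Finite G] (σ : G →* G) :
    Nat.card (dmH (mB σ)).ker = 2 ^ ((Nat.card (dmH σ).ker).factorization 2) := by
  have himg : (dmH σ).ker.map (b2 G) = (dmH (mB σ)).ker := by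
    ext x
    constructor
    · rintro ⟨y, hy, rfl⟩
      have hy' : y ∈ (dmH σ).ker := hy
      rw [mem_ker_dmH] at hy' ⊢
      rw [mB_b2, hy']
    · intro hx
      obtain ⟨y, rfl⟩ := b2_surj x
      rw [mem_ker_dmH, mB_b2] at hx
      have h1 : b2 G (y / σ y) = 1 := by rw [map_div, hx, div_self']
      obtain ⟨m, hm, e⟩ := b2_eq_one.1 h1
      obtain ⟨n, hn⟩ := odd_pow_gen (isTwo_B2 (G := G)) (b2 G y) hm
      refine ⟨(y ^ m) ^ n, ?_, by rw [map_pow, map_pow, hn]⟩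
      change _ ∈ (dmH σ).ker
      apply Subgroup.pow_mem
      rw [mem_ker_dmH, map_pow]
      rw [div_pow, div_eq_one] at e
      exact e.symm
  have h1 := Subgroup.relIndex_ker (b2 G) (K := (dmH σ).ker)
  rw [himg] at h1
  have h2 : IsTwo (dmH (mB σ)).ker := by
    rintro ⟨x, hx⟩
    obtain ⟨k, hk⟩ := isTwo_B2 x
    exact ⟨k, Subtype.ext hk⟩
  obtain ⟨k, hk⟩ := h2.card
  have h3 : Nat.card (dmH σ).ker = Nat.card (dmH (mB σ)).ker *
      Nat.card ((b2 G).ker ⊓ (dmH σ).ker : Subgroup G) := by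
    rw [← h1, ← Subgroup.inf_relIndex_right]
    have := Subgroup.relIndex_mul_relIndex ⊥ ((b2 G).ker ⊓ (dmH σ).ker) (dmH σ).ker bot_le
      inf_le_right
    rw [Subgroup.relIndex_bot_left, Subgroup.relIndex_bot_left] at this
    rw [← this, mul_comm]
  rw [hk] at h3 ⊢
  refine (two_part h3 ?_).symm
  have h4 : Nat.card ((b2 G).ker ⊓ (dmH σ).ker : Subgroup G) ∣ Nat.card (Od G) := by
    apply Subgroup.card_dvd_of_le
    intro x hx
    exact (QuotientGroup.eq_one_iff x).1 hx.1
  exact Odd.of_dvd_nat card_Od_odd h4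

lemma b2_square {x : G} (h : IsSquare (b2 G x)) : IsSquare x := by
  obtain ⟨y, hy⟩ := h
  obtain ⟨z, rfl⟩ := b2_surj y
  have h1 : b2 G (x / (z * z)) = 1 := by rw [map_div, hy, map_mul, div_self']
  obtain ⟨m, ⟨k, rfl⟩, e⟩ := b2_eq_one.1 h1
  set w := x / (z * z) with hw
  have h2 : x = w * (z * z) := by rw [hw]; simp
  refine ⟨(w ^ k)⁻¹ * z, ?_⟩
  have h3 : w = (w ^ k)⁻¹ * (w ^ k)⁻¹ := by
    rw [pow_succ, two_mul, pow_add] at e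
    rw [← mul_inv]
    exact eq_inv_of_mul_eq_one_right e
  rw [h2]
  calc w * (z * z) = (w ^ k)⁻¹ * (w ^ k)⁻¹ * (z * z) := by rw [← h3]
    _ = _ := by rw [mul_mul_mul_comm]

end B2
end

section
section Groups

variable {A B : Type*} [CommGroup A] [Finite A] [CommGroup B] [Finite B]

lemma div_triv (hA : IsTwo A) (V : Subgroup A) (hV : ∀ v ∈ V, ∃ w ∈ V, v = w ^ 2) : V = ⊥ := by
  have key : ∀ k : ℕ, ∀ v ∈ V, ∃ w ∈ V, v = w ^ 2 ^ k := by
    intro k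
    induction k with
    | zero => intro v hv; exact ⟨v, hv, by simp⟩
    | succ k ih =>
      intro v hv
      obtain ⟨w, hw, rfl⟩ := ih v hv
      obtain ⟨u, hu, rfl⟩ := hV w hw
      exact ⟨u, hu, by rw [← pow_mul, pow_succ']⟩
  obtain ⟨k, hk⟩ := hA.card
  rw [Subgroup.eq_bot_iff_forall]
  intro v hv
  obtain ⟨w, _, rfl⟩ := key k v hv
  rw [← hk, pow_card_eq_one']

lemma nakayama (hA : IsTwo A) (H : Subgroup A) (h : H ⊔ (powMonoidHom 2 : A →* A).range = ⊤) :
    H = ⊤ := by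
  have hQ : IsTwo (A ⧸ H) := by
    intro x
    obtain ⟨y, rfl⟩ := QuotientGroup.mk_surjective x
    obtain ⟨k, hk⟩ := hA y
    exact ⟨k, by rw [← QuotientGroup.mk_pow, hk, QuotientGroup.mk_one]⟩
  have h1 : (⊤ : Subgroup (A ⧸ H)) = ⊥ := by
    apply div_triv hQ
    intro v _
    obtain ⟨y, rfl⟩ := QuotientGroup.mk_surjective v
    have hy : y ∈ H ⊔ (powMonoidHom 2 : A →* A).range := by rw [h]; trivial
    obtain ⟨a, ha, b, ⟨c, rfl⟩, rfl⟩ := Subgroup.mem_sup.1 hy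
    refine ⟨(c : A ⧸ H), trivial, ?_⟩
    rw [QuotientGroup.mk_mul, (QuotientGroup.eq_one_iff a).2 ha, one_mul]
    rfl
  rw [eq_top_iff]
  intro x _
  have : (x : A ⧸ H) ∈ (⊤ : Subgroup (A ⧸ H)) := trivial
  rw [h1] at this
  exact (QuotientGroup.eq_one_iff x).1 this

lemma index_sq : (powMonoidHom 2 : A →* A).range.index = Nat.card (powMonoidHom 2 : A →* A).ker := by
  have h1 := (powMonoidHom 2 : A →* A).range.card_mul_index
  have h2 := (powMonoidHom 2 : A →* A).ker.card_mul_index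
  rw [Subgroup.index_ker] at h2
  have h3 : 0 < Nat.card (powMonoidHom 2 : A →* A).range := Nat.card_pos
  rw [← h1] at h2
  have : Nat.card (powMonoidHom 2 : A →* A).range * (powMonoidHom 2 : A →* A).range.index =
    Nat.card (powMonoidHom 2 : A →* A).range * Nat.card (powMonoidHom 2 : A →* A).ker := by
    rw [← h2, mul_comm]
  exact Nat.eq_of_mul_eq_mul_left h3 this

lemma relIndex_ge_two {H K : Subgroup A} (hle : H ≤ K) {x : A} (hx : x ∈ K) (hn : x ∉ H) :
    2 ≤ H.relIndex K := by
  have h0 : H.relIndex K ≠ 0 := Subgroup.index_ne_zero_of_finite (H := H.subgroupOf K)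
  have h1 : H.relIndex K ≠ 1 := by
    intro h
    exact hn (Subgroup.relIndex_eq_one.1 h hx)
  omega

lemma gen_one (hA : IsTwo A) (h2 : Nat.card (powMonoidHom 2 : A →* A).ker ≤ 2) {x : A}
    (hx : ¬ IsSquare x) : Subgroup.zpowers x = ⊤ := by
  apply nakayama hA
  set S := (powMonoidHom 2 : A →* A).range with hS
  have h1 : 2 ≤ S.relIndex (Subgroup.zpowers x ⊔ S) := by
    refine relIndex_ge_two le_sup_right (x := x) (Subgroup.mem_sup_left (Subgroup.mem_zpowers x)) ?_
    rintro ⟨y, hy⟩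
    exact hx ⟨y, by rw [← hy]; exact pow_two y⟩
  have h3 := Subgroup.relIndex_mul_index (le_sup_right : S ≤ Subgroup.zpowers x ⊔ S)
  rw [index_sq] at h3
  have h4 : (Subgroup.zpowers x ⊔ S).index ≠ 0 := Subgroup.index_ne_zero_of_finite
  rw [← Subgroup.index_eq_one]
  by_contra h5
  have h6 : 2 ≤ (Subgroup.zpowers x ⊔ S).index := by omega
  have := Nat.mul_le_mul h1 h6
  omega

lemma gen_two (hA : IsTwo A) (h2 : Nat.card (powMonoidHom 2 : A →* A).ker ≤ 4) {x y : A}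
    (hx : ¬ IsSquare x) (hy : ¬ IsSquare y) (hxy : ¬ IsSquare (x * y)) :
    Subgroup.closure {x, y} = ⊤ := by
  apply nakayama hA
  set S := (powMonoidHom 2 : A →* A).range with hS
  have memS : ∀ z : A, z ∈ S → IsSquare z := by
    rintro _ ⟨y, rfl⟩
    exact ⟨y, pow_two y⟩
  have h1 : 2 ≤ S.relIndex (Subgroup.zpowers x ⊔ S) := by
    refine relIndex_ge_two le_sup_right (x := x) (Subgroup.mem_sup_left (Subgroup.mem_zpowers x)) ?_
    exact fun h => hx (memS _ h)
  have hle : Subgroup.zpowers x ⊔ S ≤ Subgroup.closure {x, y} ⊔ S := by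
    apply sup_le_sup_right
    rw [Subgroup.zpowers_le]
    exact Subgroup.subset_closure (by simp)
  have h1' : 2 ≤ (Subgroup.zpowers x ⊔ S).relIndex (Subgroup.closure {x, y} ⊔ S) := by
    refine relIndex_ge_two hle (x := y) (Subgroup.mem_sup_left (Subgroup.subset_closure (by simp))) ?_
    intro h
    obtain ⟨a, ⟨i, rfl⟩, b, ⟨c, rfl⟩, e⟩ := Subgroup.mem_sup.1 h
    dsimp only at e
    rcases Int.even_or_odd' i with ⟨k, rfl | rfl⟩
    · apply hy
      refine ⟨x ^ k * c, ?_⟩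
      rw [← e]
      simp only [powMonoidHom_apply, two_mul, zpow_add, pow_two]
      rw [mul_mul_mul_comm]
    · apply hxy
      refine ⟨x ^ (k + 1) * c, ?_⟩
      rw [← e]
      simp only [powMonoidHom_apply, two_mul, zpow_add, pow_two, zpow_one]
      rw [← mul_assoc, mul_mul_mul_comm (x ^ k * x)]
      congr 1
      rw [mul_comm x, mul_assoc, mul_assoc, mul_assoc]
      congr 1
      rw [mul_left_comm]
  have h3 := Subgroup.relIndex_mul_index (le_sup_right : S ≤ Subgroup.zpowers x ⊔ S)
  have h3' := Subgroup.relIndex_mul_index hle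
  rw [index_sq] at h3
  have h4 : (Subgroup.closure {x, y} ⊔ S).index ≠ 0 := Subgroup.index_ne_zero_of_finite
  rw [← Subgroup.index_eq_one]
  by_contra h5
  have h6 : 2 ≤ (Subgroup.closure {x, y} ⊔ S).index := by omega
  have := Nat.mul_le_mul h1 (Nat.mul_le_mul h1' h6)
  rw [h3', h3] at this
  omega

lemma card_dm (σ : A →* A) : Nat.card (dmH σ).range * Nat.card (dmH σ).ker = Nat.card A := by
  have h2 := (dmH σ).ker.card_mul_index
  rw [Subgroup.index_ker, mul_comm] at h2
  exact h2

lemma ker_N (N : A →* B) (σ : A →* A) (hN : Function.Surjective N) (hσ : ∀ x, N (σ x) = N x)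
    (hc : Nat.card (dmH σ).ker ≤ Nat.card B) : N.ker = (dmH σ).range := by
  symm
  have hle : (dmH σ).range ≤ N.ker := by
    rintro _ ⟨x, rfl⟩
    rw [MonoidHom.mem_ker, dmH_apply, map_div, hσ, div_self']
  apply Subgroup.eq_of_le_of_card_ge hle
  have h1 := card_dm σ
  have h2 := N.ker.card_mul_index
  rw [Subgroup.index_ker, MonoidHom.range_eq_top.2 hN, Subgroup.card_top] at h2
  have h3 : 0 < Nat.card B := Nat.card_pos
  have h4 : Nat.card N.ker * Nat.card B ≤ Nat.card (dmH σ).range * Nat.card B := by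
    rw [h2, ← h1]
    exact Nat.mul_le_mul_left _ hc
  exact Nat.le_of_mul_le_mul_right h4 h3

lemma step_zero (hA : IsTwo A) (N : A →* B) (σ : A →* A) (hσ : ∀ x, σ (σ x) = x)
    (hk : N.ker = (dmH σ).range) {x y : A} (hx : σ x = x) (hy : σ y = y)
    (hg : Subgroup.closure {N x, N y} = ⊤) : N.ker = ⊥ := by
  rw [hk]
  apply div_triv hA
  rintro _ ⟨a, rfl⟩
  have h1 : N a ∈ (Subgroup.closure {x, y}).map N := by
    rw [MonoidHom.map_closure, Set.image_pair, hg]; trivial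
  obtain ⟨b, hb, e⟩ := h1
  have hb' : σ b = b := by
    have : Subgroup.closure {x, y} ≤ (dmH σ).ker := by
      rw [Subgroup.closure_le]
      rintro z hz
      rcases hz with rfl | hz
      · exact mem_ker_dmH.2 hx
      · rw [Set.mem_singleton_iff] at hz; subst hz; exact mem_ker_dmH.2 hy
    exact mem_ker_dmH.1 (this hb)
  have h2 : a / b ∈ N.ker := by rw [MonoidHom.mem_ker, map_div, e, div_self']
  rw [hk] at h2
  obtain ⟨c, hc⟩ := h2
  have h3 : a = dmH σ c * b := by rw [hc]; simp
  refine ⟨dmH σ c, ⟨c, rfl⟩, ?_⟩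
  have h4 : dmH σ b = 1 := by rw [dmH_apply, hb', div_self']
  rw [h3, map_mul, h4, mul_one]
  simp only [dmH_apply, map_div, hσ, pow_two]
  rw [div_div_div_eq, div_mul_div_comm]
  

lemma step_succ (hA : IsTwo A) (N : A →* B) (g : A →* A) (hg : ∀ x, g (g (g (g x))) = x)
    (hN : ∀ x, N (g x) = N x) (hk : N.ker = (dmH (g.comp g)).range) : N.ker = ⊥ := by
  have hV : (dmH g).range = ⊥ := by
    apply div_triv hA
    have h1 : ∀ v ∈ (dmH g).range, ∃ w ∈ (dmH g).range, v = w * g w := by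
      rintro _ ⟨x, rfl⟩
      have h2 : dmH g x ∈ N.ker := by rw [MonoidHom.mem_ker, dmH_apply, map_div, hN, div_self']
      rw [hk] at h2
      obtain ⟨y, hy⟩ := h2
      refine ⟨dmH g y, ⟨y, rfl⟩, ?_⟩
      rw [← hy]
      simp only [dmH_apply, MonoidHom.comp_apply, map_div]
      simp
    have hst : ∀ v ∈ (dmH g).range, g v ∈ (dmH g).range := by
      rintro _ ⟨x, rfl⟩
      exact ⟨g x, by simp⟩
    intro v hv
    obtain ⟨w1, hw1, rfl⟩ := h1 v hv
    obtain ⟨w2, hw2, rfl⟩ := h1 w1 hw1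
    obtain ⟨w3, hw3, rfl⟩ := h1 w2 hw2
    obtain ⟨w, hw, rfl⟩ := h1 w3 hw3
    refine ⟨w * (g w) ^ 2 * (g (g w)) ^ 3 * (g (g (g w))) ^ 2, ?_, ?_⟩
    · exact mul_mem (mul_mem (mul_mem hw (pow_mem (hst _ hw) 2)) (pow_mem (hst _ (hst _ hw)) 3))
        (pow_mem (hst _ (hst _ (hst _ hw))) 2)
    · simp only [map_mul, hg]
      generalize g (g (g w)) = d
      generalize g (g w) = c
      generalize g w = b
      apply Additive.ofMul.injective
      simp only [ofMul_mul, ofMul_pow]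
      abel
  rw [hk, eq_bot_iff]
  rintro _ ⟨x, rfl⟩
  have h3 : ∀ x, g x = x := by
    intro x
    have : dmH g x ∈ (dmH g).range := ⟨x, rfl⟩
    rw [hV, Subgroup.mem_bot, dmH_apply, div_eq_one] at this
    exact this.symm
  rw [Subgroup.mem_bot, dmH_apply, MonoidHom.comp_apply, h3, h3, div_self']

end Groups
end

section
lemma four_cosets {X : Type*} [CommGroup X] {R N : Subgroup X} (h4 : R.relIndex N ≤ 4)
    (h0 : R.relIndex N ≠ 0) (hsq : ∀ e ∈ N, e * e ∈ R) {e₁ e₂ : X} (m₁ : e₁ ∈ N) (m₂ : e₂ ∈ N)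
    (n₁ : e₁ ∉ R) (n₂ : e₂ ∉ R) (n₃ : e₁ * e₂ ∉ R) {e : X} (he : e ∈ N) :
    e ∈ R ∨ e * e₁ ∈ R ∨ e * e₂ ∈ R ∨ e * (e₁ * e₂) ∈ R := by
  classical
  have hk : R.relIndex N = Nat.card (N.map (QuotientGroup.mk' R)) := by
    have := Subgroup.relIndex_ker (QuotientGroup.mk' R) (K := N)
    rwa [QuotientGroup.ker_mk'] at this
  have key : ∀ a b : X, a ∈ N → ((a : X ⧸ R) = b ↔ a * b ∈ R) := by
    intro a b ha
    rw [QuotientGroup.eq]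
    have h1 := hsq a ha
    constructor
    · intro h
      have := R.mul_mem h1 h
      rwa [show a * a * (a⁻¹ * b) = a * b by group] at this
    · intro h
      have := R.mul_mem (R.inv_mem h1) h
      rwa [show (a * a)⁻¹ * (a * b) = a⁻¹ * b by group] at this
  by_contra! hcon
  obtain ⟨c1, c2, c3, c4⟩ := hcon
  have hfin : Finite (N.map (QuotientGroup.mk' R)) := Nat.finite_of_card_ne_zero (by rw [← hk]; exact h0)
  let S : Finset (X ⧸ R) := {(1 : X ⧸ R), (e₁ : X ⧸ R), (e₂ : X ⧸ R), ((e₁ * e₂ : X) : X ⧸ R), (e : X ⧸ R)}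
  have hS : S.card = 5 := by
    have k1 : ∀ a : X, ((1 : X ⧸ R) = a ↔ a ∈ R) := by
      intro a
      have := key 1 a N.one_mem
      simpa using this
    have a1 := hsq _ m₁
    have a2 := hsq _ m₂
    simp only [S]
    rw [Finset.card_insert_of_notMem, Finset.card_insert_of_notMem, Finset.card_insert_of_notMem,
      Finset.card_insert_of_notMem, Finset.card_singleton]
    · rw [Finset.mem_singleton, key _ _ (N.mul_mem m₁ m₂), mul_comm]; exact c4
    · rw [Finset.mem_insert, Finset.mem_singleton, key _ _ m₂, key _ _ m₂]
      push Not
      refine ⟨fun h => n₁ ?_, by rwa [mul_comm]⟩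
      rw [mul_left_comm] at h
      exact (R.mul_mem_cancel_right a2).1 h
    · rw [Finset.mem_insert, Finset.mem_insert, Finset.mem_singleton, key _ _ m₁, key _ _ m₁, key _ _ m₁]
      push Not
      refine ⟨n₃, fun h => n₂ ?_, by rwa [mul_comm]⟩
      rw [← mul_assoc] at h
      exact (R.mul_mem_cancel_left a1).1 h
    · rw [Finset.mem_insert, Finset.mem_insert, Finset.mem_insert, Finset.mem_singleton, k1, k1, k1, k1]
      push Not
      exact ⟨n₁, n₂, n₃, c1⟩
  have hsub : (S : Set (X ⧸ R)) ⊆ (N.map (QuotientGroup.mk' R) : Set (X ⧸ R)) := by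
    intro x hx
    simp only [S, Finset.coe_insert, Finset.coe_singleton, Set.mem_insert_iff, Set.mem_singleton_iff] at hx
    rcases hx with rfl | rfl | rfl | rfl | rfl
    · exact one_mem _
    · exact ⟨e₁, m₁, rfl⟩
    · exact ⟨e₂, m₂, rfl⟩
    · exact ⟨_, N.mul_mem m₁ m₂, rfl⟩
    · exact ⟨_, he, rfl⟩
  have h5 := Set.ncard_le_ncard hsub (Set.toFinite _)
  rw [Set.ncard_coe_finset, hS] at h5
  have : (N.map (QuotientGroup.mk' R) : Set (X ⧸ R)).ncard = Nat.card (N.map (QuotientGroup.mk' R)) := rfl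
  omega

section
variable {K L : Type*} [Field K] [NumberField K] [Field L] [NumberField L] [Algebra K L]
  {σ : L ≃+* L} {s : L}

lemma mem_fixed_frac (h : IsQuad K L σ s) {y : 𝓞 L} {z : 𝓞 L} (hy : y ≠ 0) (hz : z ≠ 0)
    (e : y * sO σ z = sO σ y * z) : ∃ a b : 𝓞 K, a ≠ 0 ∧ b ≠ 0 ∧
      algebraMap (𝓞 K) (𝓞 L) b * y = algebraMap (𝓞 K) (𝓞 L) a * z := by
  have hz' : (z : L) ≠ 0 := by simpa using hz
  have hy' : (y : L) ≠ 0 := by simpa using hy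
  have hsz : σ (z : L) ≠ 0 := by simpa using hz
  have e' : (y : L) * σ z = σ y * z := by
    have := congrArg (algebraMap (𝓞 L) L) e
    simpa using this
  obtain ⟨c, hc⟩ := h.fixed (x := (y : L) / z) (by
    rw [map_div₀, div_eq_div_iff hsz hz']
    exact e'.symm)
  obtain ⟨a, b, hb, rfl⟩ := IsFractionRing.div_surjective (A := 𝓞 K) c
  have hb0 : b ≠ 0 := nonZeroDivisors.ne_zero hb
  have hb' : (algebraMap K L (algebraMap (𝓞 K) K b)) ≠ 0 := by simpa using hb0
  rw [map_div₀, div_eq_div_iff hz' hb'] at hc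
  have hE : algebraMap (𝓞 K) (𝓞 L) b * y = algebraMap (𝓞 K) (𝓞 L) a * z := by
    apply RingOfIntegers.ext
    change (algebraMap K L (algebraMap (𝓞 K) K b)) * (y : L) = (algebraMap K L (algebraMap (𝓞 K) K a)) * (z : L)
    rw [← hc, mul_comm]
  refine ⟨a, b, ?_, hb0, hE⟩
  rintro rfl
  rw [map_zero, zero_mul, mul_eq_zero] at hE
  rcases hE with h1 | h1
  · exact hb0 (by simpa using h1)
  · exact hy h1

lemma cap (h : IsQuad K L σ s) [IsTotallyReal K] [IsTotallyReal L] (φ : L →+* ℝ)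
    (hH : (nmH (sE σ)).range.relIndex (dmH (sE σ)).ker ≤ 2) {g₁ g₂ : 𝓞 L} (hg₁ : g₁ ≠ 0) (hg₂ : g₂ ≠ 0)
    {e₁ e₂ : (𝓞 L)ˣ} (he₁ : g₁ = e₁ * sO σ g₁) (he₂ : g₂ = e₂ * sO σ g₂)
    {m₁ m₂ : 𝓞 K} (hm₁ : g₁ * sO σ g₁ = algebraMap (𝓞 K) (𝓞 L) m₁)
    (hm₂ : g₂ * sO σ g₂ = algebraMap (𝓞 K) (𝓞 L) m₂)
    (n₁ : ∀ (I : Ideal (𝓞 K)) (a : 𝓞 K), a ≠ 0 → I * I ≠ Ideal.span {a * a * m₁})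
    (n₂ : ∀ (I : Ideal (𝓞 K)) (a : 𝓞 K), a ≠ 0 → I * I ≠ Ideal.span {a * a * m₂})
    (n₃ : ∀ (I : Ideal (𝓞 K)) (a : 𝓞 K), a ≠ 0 → I * I ≠ Ideal.span {a * a * (m₁ * m₂)}) :
    Function.Injective (jCl K L) := by
  obtain ⟨hb, hb0⟩ := herbrand h φ
  have s0 : ∀ x : 𝓞 L, x ≠ 0 → sO σ x ≠ 0 := by
    intro x hx
    simpa using hx
  have cancel : ∀ {g e : 𝓞 L}, g ≠ 0 → g = e * sO σ g → e * sO σ e = 1 := by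
    intro g e hg he
    have h1 : sO σ g = sO σ e * g := by
      conv_lhs => rw [he]
      rw [map_mul, h.involO]
    have : (e * sO σ e - 1) * g = 0 := by
      rw [h1] at he; linear_combination -he
    rcases mul_eq_zero.1 this with h2 | h2
    · exact sub_eq_zero.1 h2
    · exact absurd h2 hg
  have memN : ∀ {g : 𝓞 L} {e : (𝓞 L)ˣ}, g ≠ 0 → g = e * sO σ g → e ∈ (nmH (sE σ)).ker := by
    intro g e hg he
    exact mem_ker_nmH.2 (Units.ext (cancel hg he))
  -- if e ∈ R then g is ideal square type
  have nR : ∀ {g : 𝓞 L} {e : (𝓞 L)ˣ} {m : 𝓞 K}, g ≠ 0 → g = e * sO σ g →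
      g * sO σ g = algebraMap (𝓞 K) (𝓞 L) m → e ∈ (dmH (sE σ)).range → 
      ∃ (I : Ideal (𝓞 K)) (a : 𝓞 K), a ≠ 0 ∧ I * I = Ideal.span {a * a * m} := by
    rintro g e m hg he hm ⟨f, rfl⟩
    have he2 : g * sO σ f = sO σ g * f := by
      have hu : ((dmH (sE σ) f : (𝓞 L)ˣ) : 𝓞 L) * sO σ f = f := by
        have : dmH (sE σ) f * sE σ f = f := by simp
        exact congrArg Units.val this
      calc g * sO σ f = ((dmH (sE σ) f : (𝓞 L)ˣ) * sO σ g) * sO σ f := by rw [← he]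
        _ = sO σ g * (((dmH (sE σ) f : (𝓞 L)ˣ) : 𝓞 L) * sO σ f) := by ring
        _ = _ := by rw [hu]
    obtain ⟨a, b, ha, hb, e3⟩ := mem_fixed_frac h hg f.ne_zero he2
    have e4 := congrArg (sO σ) e3
    have fx : ∀ c : 𝓞 K, sO σ (algebraMap (𝓞 K) (𝓞 L) c) = algebraMap (𝓞 K) (𝓞 L) c :=
      fun c => RingOfIntegers.ext (h.fix _)
    rw [map_mul, map_mul, fx, fx] at e4
    refine ⟨Ideal.span {a}, b, hb, ?_⟩
    apply ext_inj (K := K) (L := L)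
    rw [Ideal.span_singleton_mul_span_singleton, Ideal.map_span, Ideal.map_span, Set.image_singleton,
      Set.image_singleton, Ideal.span_singleton_eq_span_singleton]
    refine ⟨f * sE σ f, ?_⟩
    rw [map_mul, map_mul, map_mul, ← hm, Units.val_mul, sE_coe]
    linear_combination (- algebraMap (𝓞 K) (𝓞 L) a * sO σ f) * e3 - algebraMap (𝓞 K) (𝓞 L) b * g * e4
  have hsq : ∀ e ∈ (nmH (sE σ)).ker, e * e ∈ (dmH (sE σ)).range := by
    intro e he
    refine ⟨e, ?_⟩
    rw [mem_ker_nmH] at he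
    rw [dmH_apply, div_eq_mul_inv, ← inv_eq_of_mul_eq_one_right he, inv_inv]
  have hg₃ : g₁ * g₂ ≠ 0 := mul_ne_zero hg₁ hg₂
  have he₃ : g₁ * g₂ = ((e₁ * e₂ : (𝓞 L)ˣ) : 𝓞 L) * sO σ (g₁ * g₂) := by
    rw [map_mul, Units.val_mul]
    calc g₁ * g₂ = (e₁ * sO σ g₁) * (e₂ * sO σ g₂) := by rw [← he₁, ← he₂]
      _ = _ := by ring
  have hm₃ : (g₁ * g₂) * sO σ (g₁ * g₂) = algebraMap (𝓞 K) (𝓞 L) (m₁ * m₂) := by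
    rw [map_mul, map_mul, ← hm₁, ← hm₂]; ring
  rw [injective_iff_map_eq_one]
  intro c hc
  obtain ⟨I, hI, rfl⟩ := cl_surj c
  rw [jCl_cl hI, cl_eq_one_iff (ext_ne_bot hI)] at hc
  obtain ⟨y, hy⟩ := hc
  change _ = Ideal.span {y} at hy
  have hy0 : y ≠ 0 := by
    rintro rfl
    exact ext_ne_bot (L := L) hI (by rw [hy]; simp)
  have hinv := sI_ext σ h.fix I
  rw [hy, sI_span, Ideal.span_singleton_eq_span_singleton] at hinv
  obtain ⟨e, he⟩ := hinv
  have he' : y = e * sO σ y := by rw [mul_comm]; exact he.symm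
  have cs := four_cosets (R := (dmH (sE σ)).range) (N := (nmH (sE σ)).ker) (by omega) (by omega) hsq
    (memN hg₁ he₁) (memN hg₂ he₂)
    (fun hR => by obtain ⟨I, a, ha, hh⟩ := nR hg₁ he₁ hm₁ hR; exact n₁ I a ha hh)
    (fun hR => by obtain ⟨I, a, ha, hh⟩ := nR hg₂ he₂ hm₂ hR; exact n₂ I a ha hh)
    (fun hR => by obtain ⟨I, a, ha, hh⟩ := nR hg₃ he₃ hm₃ hR; exact n₃ I a ha hh)
    (memN hy0 he')
  obtain ⟨ny, hny⟩ : ∃ ny : 𝓞 K, y * sO σ y = algebraMap (𝓞 K) (𝓞 L) ny :=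
    h.fixedO (by rw [map_mul, h.involO, mul_comm])
  have hII : I * I = Ideal.span {ny} := by
    apply ext_inj (K := K) (L := L)
    rw [Ideal.map_mul, hy, Ideal.map_span, Set.image_singleton, ← hny,
      Ideal.span_singleton_mul_span_singleton, Ideal.span_singleton_eq_span_singleton]
    refine ⟨e⁻¹, ?_⟩
    rw [Units.mul_inv_eq_iff_eq_mul]
    linear_combination y * he'
  -- case analysis
  have hcase : ∀ {g : 𝓞 L} {e' : (𝓞 L)ˣ} {m : 𝓞 K}, g ≠ 0 → g = e' * sO σ g →
      g * sO σ g = algebraMap (𝓞 K) (𝓞 L) m → e * e' ∈ (dmH (sE σ)).range → 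
      ∃ (J : Ideal (𝓞 K)) (a : 𝓞 K), a ≠ 0 ∧ J * J = Ideal.span {a * a * m} := by
    intro g e' m hg hge hgm hR
    have hyg : y * g = ((e * e' : (𝓞 L)ˣ) : 𝓞 L) * sO σ (y * g) := by
      rw [map_mul, Units.val_mul]
      calc y * g = (e * sO σ y) * (e' * sO σ g) := by rw [← he', ← hge]
        _ = _ := by ring
    obtain ⟨J, a, ha, hJ⟩ := nR (m := ny * m) (mul_ne_zero hy0 hg) hyg (by
      rw [map_mul, map_mul, ← hny, ← hgm]; ring) hR
    refine ⟨I * J, a * ny, mul_ne_zero ha ?_, ?_⟩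
    · rintro rfl
      rw [map_zero, mul_eq_zero] at hny
      rcases hny with h1 | h1
      · exact hy0 h1
      · exact s0 y hy0 h1
    · rw [mul_mul_mul_comm, hII, hJ, Ideal.span_singleton_mul_span_singleton]
      congr 2; ring
  rcases cs with hR | hR | hR | hR
  · obtain ⟨f, hf⟩ := hR
    have he2 : y * sO σ f = sO σ y * f := by
      have hu : (e : 𝓞 L) * sO σ f = f := by
        have : e * sE σ f = f := by rw [← hf]; simp
        exact congrArg Units.val this
      calc y * sO σ f = (e * sO σ y) * sO σ f := by rw [← he']
        _ = sO σ y * (e * sO σ f) := by ring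
        _ = _ := by rw [hu]
    obtain ⟨a, b, ha, hb, e3⟩ := mem_fixed_frac h hy0 f.ne_zero he2
    have : Ideal.span {b} * I = Ideal.span {a} * 1 := by
      apply ext_inj (K := K) (L := L)
      rw [mul_one, Ideal.map_mul, hy, Ideal.map_span, Ideal.map_span, Set.image_singleton,
        Set.image_singleton, Ideal.span_singleton_mul_span_singleton, e3,
        Ideal.span_singleton_eq_span_singleton]
      exact ⟨f⁻¹, by simp⟩
    have := (cl_eq_iff hI (J := 1) one_ne_zero).2 ⟨b, a, hb, ha, this⟩
    rw [this, cl_one]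
  · obtain ⟨J, a, ha, hh⟩ := hcase hg₁ he₁ hm₁ hR
    exact absurd hh (n₁ J a ha)
  · obtain ⟨J, a, ha, hh⟩ := hcase hg₂ he₂ hm₂ hR
    exact absurd hh (n₂ J a ha)
  · obtain ⟨J, a, ha, hh⟩ := hcase hg₃ he₃ hm₃ hR
    exact absurd hh (n₃ J a ha)

end
end

section
open Polynomial

section Phi
variable {R : Type*} [CommRing R] 

/-- even and odd parts -/
noncomputable def evP (f : R[X]) : R[X] := contract 2 f
noncomputable def odP (f : R[X]) : R[X] := contract 2 f.divX

lemma ev_od (f : R[X]) : f = expand R 2 (evP f) + X * expand R 2 (odP f) := by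
  ext n
  rcases n with _ | n
  · simp [evP, coeff_expand, coeff_contract]
  · rw [coeff_add, coeff_X_mul, coeff_expand two_pos, coeff_expand two_pos, evP, odP, coeff_contract two_ne_zero,
      coeff_contract two_ne_zero, coeff_divX]
    rcases Nat.even_or_odd' n with ⟨m, rfl | rfl⟩
    · rw [if_neg (by omega), if_pos (by omega), zero_add]
      congr 1; omega
    · rw [if_pos (by omega), if_neg (by omega), add_zero]
      congr 1; omega

/-- the norm polynomial -/
noncomputable def ph (f : R[X]) : R[X] := ((evP f)^2 - X * (odP f)^2).comp (X + 2)

/-- substitution `X ↦ X^2 - 2` -/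
noncomputable def cq (f : R[X]) : R[X] := f.comp (X^2 - 2)
/-- substitution `X ↦ -X` -/
noncomputable def ng (f : R[X]) : R[X] := f.comp (-X)

lemma cq_ph (f : R[X]) : cq (ph f) = f * ng f := by
  have h1 : ∀ g : R[X], g.comp (X^2) = expand R 2 g := fun g => by rw [expand_eq_comp_X_pow]
  have hn : ∀ g : R[X], (expand R 2 g).comp (-X) = expand R 2 g := by
    intro g
    rw [expand_eq_comp_X_pow, comp_assoc]; simp
  rw [cq, ph, comp_assoc]
  have : ((X : R[X]) + 2).comp (X^2-2) = X^2 := by simp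
  rw [this, sub_comp, mul_comp, pow_comp, pow_comp, X_comp, h1, h1]
  have e := ev_od f
  conv_rhs => rw [ng, e]
  rw [add_comp, mul_comp, X_comp, hn, hn]
  ring

lemma cq_inj : Function.Injective (cq : R[X] → R[X]) := by
  intro f g h
  have h1 : (cq f).comp X = (cq g).comp X := by rw [h]
  have h2 : ∀ f : R[X], cq f = expand R 2 (f.comp (X - 2)) := by
    intro f
    rw [expand_eq_comp_X_pow, comp_assoc, cq]; simp
  rw [h2, h2] at h
  have h3 := expand_injective two_pos h
  have h4 := congrArg (fun p => p.comp (X + 2)) h3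
  simpa [comp_assoc] using h4

@[simp] lemma cq_mul (f g : R[X]) : cq (f * g) = cq f * cq g := by simp [cq]
@[simp] lemma cq_add (f g : R[X]) : cq (f + g) = cq f + cq g := by simp [cq]
@[simp] lemma cq_sub (f g : R[X]) : cq (f - g) = cq f - cq g := by simp [cq]
@[simp] lemma ng_mul (f g : R[X]) : ng (f * g) = ng f * ng g := by simp [ng]
@[simp] lemma ng_add (f g : R[X]) : ng (f + g) = ng f + ng g := by simp [ng]
@[simp] lemma ng_sub (f g : R[X]) : ng (f - g) = ng f - ng g := by simp [ng]
@[simp] lemma ng_C (a : R) : ng (C a) = C a := by simp [ng]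
@[simp] lemma cq_C (a : R) : cq (C a) = C a := by simp [cq]
@[simp] lemma cq_ng (f : R[X]) : ng (cq f) = cq f := by
  rw [ng, cq, comp_assoc]; simp
@[simp] lemma ng_ng (f : R[X]) : ng (ng f) = f := by
  rw [ng, ng, comp_assoc]; simp

lemma ph_mul (f g : R[X]) : ph (f * g) = ph f * ph g := by
  apply cq_inj
  rw [cq_mul, cq_ph, cq_ph, cq_ph, ng_mul]; ring

lemma ph_C (a : R) : ph (C a) = C (a ^ 2) := by
  apply cq_inj
  rw [cq_ph, ng_C, cq_C, pow_two, C_mul]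

lemma ph_map {S : Type*} [CommRing S] (i : R →+* S) (f : R[X]) : ph (f.map i) = (ph f).map i := by
  apply cq_inj
  have h1 : ∀ g : R[X], cq (g.map i) = (cq g).map i := by
    intro g; simp [cq, map_comp]
  have h2 : ∀ g : R[X], ng (g.map i) = (ng g).map i := by
    intro g; simp [ng, map_comp]
  rw [cq_ph, h1, cq_ph, h2, Polynomial.map_mul]

lemma cq_eval (f : R[X]) (x : R) : (cq f).eval x = f.eval (x^2-2) := by
  simp [cq, eval_comp]
lemma ng_eval (f : R[X]) (x : R) : (ng f).eval x = f.eval (-x) := by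
  simp [ng, eval_comp]
lemma ph_eval (f : R[X]) (x : R) : (ph f).eval (x^2-2) = f.eval x * f.eval (-x) := by
  rw [← cq_eval, cq_ph, eval_mul, ng_eval]

/-- even polynomials are substitutions -/
lemma trace_cq (f : R[X]) : ∃ e : R[X], f + ng f = 2 * cq e ∧ e.eval (-2) = f.eval 0 := by
  refine ⟨(evP f).comp (X + 2), ?_, ?_⟩
  · have hn : ∀ g : R[X], (expand R 2 g).comp (-X) = expand R 2 g := by
      intro g
      rw [expand_eq_comp_X_pow, comp_assoc]; simp
    rw [cq, comp_assoc]
    have : ((X : R[X]) + 2).comp (X^2-2) = X^2 := by simp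
    rw [this, ← expand_eq_comp_X_pow]
    have e := ev_od f
    have e2 : ng f = expand R 2 (evP f) - X * expand R 2 (odP f) := by
      conv_lhs => rw [e, ng, add_comp, mul_comp, X_comp, hn, hn]
      ring
    rw [e2]
    linear_combination e
  · rw [eval_comp]
    simp [evP, ← coeff_zero_eq_eval_zero, coeff_contract]

lemma dvd_eval_sub (f : R[X]) (a b : R) : a - b ∣ f.eval a - f.eval b := sub_dvd_eval_sub a b f

/-- perturbation -/
lemma ph_pert (h k : R[X]) (c : R) : ∃ e : R[X], ph (h + C c * k) = ph h + C (2 * c) * e + C (c^2) * ph k ∧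
    e.eval (-2) = k.eval 0 * h.eval 0 := by
  obtain ⟨e, he, h0⟩ := trace_cq (k * ng h)
  refine ⟨e, ?_, ?_⟩
  · apply cq_inj
    rw [cq_ph, cq_add, cq_add, cq_mul, cq_mul, cq_ph, cq_ph, ng_add, ng_mul, cq_C, cq_C, ng_C]
    rw [ng_mul, ng_ng] at he
    simp only [C_mul, C_pow, map_ofNat]
    linear_combination (C c) * he
  · rw [h0, eval_mul, ng_eval, neg_zero]

/-- polynomials with constant term divisible by `2` -/
lemma even_at (f : R[X]) (h : 2 ∣ f.eval (-2)) : 2 ∣ f.eval 0 := by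
  have := dvd_eval_sub f 0 (-2)
  have h2 : (2 : R) ∣ f.eval 0 - f.eval (-2) := by simpa using this
  have := dvd_add h2 h
  simpa using this

lemma even_at2 (f : R[X]) (h : 2 ∣ f.eval 0) : 2 ∣ f.eval 2 := by
  have h2 : (2 : R) ∣ f.eval 2 - f.eval 0 := by simpa using dvd_eval_sub f 2 0
  simpa using dvd_add h2 h

lemma ph_step {g h : R[X]} {i : ℕ} (hi : 1 ≤ i) (hgh : ∃ k : R[X], g = h + C (2^i) * k ∧ 2 ∣ k.eval 0) :
    ∃ k : R[X], ph g = ph h + C (2^(i+1)) * k ∧ 2 ∣ k.eval 0 := by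
  obtain ⟨k, rfl, hk⟩ := hgh
  obtain ⟨e, he, h0⟩ := ph_pert h k (2^i)
  obtain ⟨j, rfl⟩ := Nat.exists_eq_add_of_le' hi
  refine ⟨e + C (2^j) * ph k, ?_, ?_⟩
  · rw [he, ← pow_mul]
    rw [show 2 * 2^(j+1) = (2:R)^(j+1+1) by ring, show (2:R)^((j+1)*2) = 2^(j+1+1) * 2^j by ring, C_mul]
    ring
  · apply even_at
    rw [eval_add, eval_mul, h0]
    have : (ph k).eval (-2) = k.eval 0 * k.eval 0 := by
      have := ph_eval k 0
      simpa using this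
    rw [this]
    exact dvd_add (hk.mul_right _) ((hk.mul_right _).mul_left _)

end Phi

abbrev Z2 := ℤ_[2]

lemma z2_dvd (x : Z2) : 2 ∣ x ↔ PadicInt.toZMod x = 0 := by
  rw [← RingHom.mem_ker, PadicInt.ker_toZMod, PadicInt.maximalIdeal_eq_span_p, Ideal.mem_span_singleton]
  norm_num

lemma z2_odd (x : Z2) (h : ¬ 2 ∣ x) : 2 ∣ x - 1 := by
  rw [z2_dvd] at h ⊢
  rw [map_sub, map_one]
  generalize PadicInt.toZMod x = y at *
  revert y; decide

lemma z2_prime : Prime (2 : Z2) := by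
  have := PadicInt.prime_p (p := 2)
  exact_mod_cast this

lemma poly_dvd {f g : Z2[X]} (h : f.map (PadicInt.toZMod) = g.map PadicInt.toZMod) :
    ∃ k : Z2[X], f = g + C 2 * k := by
  have : C 2 ∣ f - g := by
    rw [C_dvd_iff_dvd_coeff]
    intro i
    rw [z2_dvd, coeff_sub, map_sub, sub_eq_zero]
    have := congrArg (fun p => p.coeff i) h
    simpa using this
  obtain ⟨k, hk⟩ := this
  exact ⟨k, by rw [← hk]; ring⟩

lemma ph_mod2 (f : Z2[X]) : ∃ k : Z2[X], ph f = f + C 2 * k := by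
  apply poly_dvd
  rw [← ph_map]
  apply cq_inj
  rw [cq_ph]
  generalize f.map PadicInt.toZMod = g
  have h2 : (2 : (ZMod 2)[X]) = 0 := by
    rw [← map_ofNat (C : ZMod 2 →+* _) 2]
    rw [show (OfNat.ofNat 2 : ZMod 2) = 0 from rfl, C_0]
  have hng : ng g = g := by
    have : (-X : (ZMod 2)[X]) = X := by linear_combination (-X) * h2
    rw [ng, this, comp_X]
  rw [hng, cq, h2, sub_zero, ← expand_eq_comp_X_pow, ZMod.expand_card, pow_two]

/-- iterates -/
lemma ph_iter (f : Z2[X]) (h0 : ¬ 2 ∣ f.eval 0) (j : ℕ) :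
    ∃ k : Z2[X], ph^[j+2] f = ph^[j+1] f + C (2^(j+2)) * k ∧ 2 ∣ k.eval 0 := by
  induction j with
  | zero =>
    obtain ⟨k, hk⟩ := ph_mod2 f
    obtain ⟨e, he, h1⟩ := ph_pert f k 2
    refine ⟨e + ph k, ?_, ?_⟩
    · rw [zero_add, zero_add, Function.iterate_succ_apply, Function.iterate_one]
      conv_lhs => rw [hk, he]
      simp only [C_mul, C_pow, map_ofNat]; ring
    · apply even_at
      have h2 : (ph k).eval (-2) = k.eval 0 * k.eval 0 := by
        have := ph_eval k 0
        simpa using this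
      rw [eval_add, h1, h2]
      have h3 := z2_odd _ h0
      by_cases h4 : 2 ∣ k.eval 0
      · exact dvd_add (h4.mul_right _) (h4.mul_right _)
      · have h5 := z2_odd _ h4
        have : k.eval 0 * f.eval 0 + k.eval 0 * k.eval 0 =
          k.eval 0 * ((f.eval 0 - 1) + (k.eval 0 - 1)) + 2 * k.eval 0 := by ring
        rw [this]
        exact dvd_add ((dvd_add h3 h5).mul_left _) (dvd_mul_right _ _)
  | succ j ih =>
    have := ph_step (by omega) ih
    rw [← Function.iterate_succ_apply' ph, ← Function.iterate_succ_apply' ph] at this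
    exact this

lemma ph_odd (f : Z2[X]) (h0 : ¬ 2 ∣ f.eval 0) (j : ℕ) : ¬ 2 ∣ (ph^[j] f).eval 0 := by
  induction j with
  | zero => exact h0
  | succ j ih =>
    rw [Function.iterate_succ_apply']
    obtain ⟨k, hk⟩ := ph_mod2 (ph^[j] f)
    rw [hk, eval_add, eval_mul, eval_C]
    intro h
    exact ih ((dvd_add_left (dvd_mul_right 2 _)).1 h)

lemma ph_key (f : Z2[X]) (h0 : ¬ 2 ∣ f.eval 0) (j : ℕ) :
    2^(j+3) ∣ ((ph^[j] f).eval 0)^2 - 1 := by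
  obtain ⟨k, hk, hk0⟩ := ph_iter f h0 j
  have h2 := even_at2 k hk0
  have e1 := congrArg (eval 2) hk
  rw [eval_add, eval_mul, eval_C] at e1
  have e2 := ph_eval (ph^[j+1] f) 2
  rw [show (2:Z2)^2-2 = 2 by norm_num, ← Function.iterate_succ_apply' ph] at e2
  have e3 := ph_eval (ph^[j] f) 0
  rw [show (0:Z2)^2-2 = -2 by norm_num, ← Function.iterate_succ_apply' ph, neg_zero] at e3
  have hodd : ¬ 2 ∣ (ph^[j+1] f).eval 2 := by
    intro h
    apply ph_odd f h0 (j+1)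
    have h2 : (2 : Z2) ∣ (ph^[j+1] f).eval 0 - (ph^[j+1] f).eval 2 := by
      simpa using dvd_eval_sub (ph^[j+1] f) 0 2
    simpa using dvd_add h2 h
  have h5 : (2:Z2)^(j+3) ∣ (ph^[j+1] f).eval 2 * (((ph^[j] f).eval 0)^2 - 1) := by
    have : (ph^[j+1] f).eval 2 * (((ph^[j] f).eval 0)^2 - 1) = 2^(j+2) * k.eval 2 := by
      rw [pow_two, ← e3, mul_sub, ← e2]
      rw [e1]; ring
    rw [this, pow_succ]
    exact mul_dvd_mul_left _ h2
  have hcop : IsUnit ((ph^[j+1] f).eval 2) := by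
    by_contra hu
    apply hodd
    rw [PadicInt.not_isUnit_iff] at hu
    have := PadicInt.norm_lt_one_iff_dvd ((ph^[j+1] f).eval 2)
    have := this.1 hu
    exact_mod_cast this
  exact (hcop.dvd_mul_left).1 h5
end

section
open Polynomial

section
variable {R : Type*} [CommRing R] 

noncomputable def ckp (R : Type*) [CommRing R] : ℕ → R[X]
  | 0 => X
  | k+1 => cq (ckp R k)

lemma ckp_dvd {k : ℕ} {f g : R[X]} (h : ckp R (k+1) ∣ f - g) : ckp R k ∣ ph f - ph g := by
  obtain ⟨h, hh⟩ := h
  rw [ckp] at hh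
  obtain ⟨e, he, -⟩ := trace_cq (h * ng g)
  refine ⟨2 * e + ckp R k * ph h, ?_⟩
  apply cq_inj
  have hf : f = g + cq (ckp R k) * h := by rw [← hh]; ring
  have h2 : cq (2 : R[X]) = 2 := by simp [cq]
  rw [cq_sub, cq_ph, cq_ph, cq_mul, cq_add, cq_mul, cq_mul, cq_ph, hf, ng_add, ng_mul, cq_ng, h2]
  rw [ng_mul, ng_ng] at he
  linear_combination cq (ckp R k) * he

lemma iter_dvd {k : ℕ} {f g : R[X]} (h : ckp R k ∣ f - g) : (ph^[k] f).eval 0 = (ph^[k] g).eval 0 := by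
  induction k generalizing f g with
  | zero =>
    obtain ⟨e, he⟩ := h
    have := congrArg (eval 0) he
    simp [ckp] at this
    simpa [sub_eq_zero] using this
  | succ k ih =>
    rw [Function.iterate_succ_apply, Function.iterate_succ_apply]
    exact ih (ckp_dvd h)

lemma iter_mul (k : ℕ) (f g : R[X]) : ph^[k] (f * g) = ph^[k] f * ph^[k] g := by
  induction k generalizing f g with
  | zero => rfl
  | succ k ih => rw [Function.iterate_succ_apply, ph_mul, ih]; rfl

lemma iter_C (k : ℕ) (a : R) : ph^[k] (C a) = C (a ^ 2^k) := by
  induction k generalizing a with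
  | zero => simp
  | succ k ih => rw [Function.iterate_succ_apply, ph_C, ih, ← pow_mul, pow_succ' 2 k]

lemma iter_map {S : Type*} [CommRing S] (i : R →+* S) (k : ℕ) (f : R[X]) :
    ph^[k] (f.map i) = (ph^[k] f).map i := by
  induction k generalizing f with
  | zero => rfl
  | succ k ih => rw [Function.iterate_succ_apply, ph_map, ih]; rfl

lemma iter_X (k : ℕ) : ∃ u : R, u * u = 1 ∧ (ph^[k+1] (X : R[X])).eval 0 = u * 2 := by
  have h1 : ph (X : R[X]) = -X - 2 := by
    apply cq_inj; rw [cq_ph]; simp [cq, ng]; ring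
  have h2 : ph (-X - 2 : R[X]) = 2 - X := by
    apply cq_inj; rw [cq_ph]; simp [cq, ng]; ring
  have h3 : ph (2 - X : R[X]) = 2 - X := by
    apply cq_inj; rw [cq_ph]; simp [cq, ng]; ring
  rcases k with _ | k
  · refine ⟨-1, by ring, ?_⟩
    simp [h1]
  · refine ⟨1, by ring, ?_⟩
    have : ∀ k, ph^[k+2] (X : R[X]) = 2 - X := by
      intro k
      induction k with
      | zero => simp [h1, h2]
      | succ k ih => rw [Function.iterate_succ_apply', ih, h3]
    rw [this]; simp
end

lemma ckp_form (k : ℕ) : ∃ v : Z2[X], ckp Z2 (k+1) = X^(2^(k+1)) - C 2 * v ∧ ¬ 2 ∣ v.eval 0 := by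
  induction k with
  | zero =>
    refine ⟨1, by simp only [ckp, cq, X_comp, map_ofNat]; simp, ?_⟩
    rw [eval_one, z2_dvd]; simp
  | succ k ih =>
    obtain ⟨v, hv, h0⟩ := ih
    obtain ⟨e, he⟩ : ∃ e : Z2[X], (X^2-2)^(2^(k+1)) = X^(2^(k+2)) + C 2 * e := by
      apply poly_dvd
      have h2 : (2 : (ZMod 2)[X]) = 0 := by
        rw [← map_ofNat (C : ZMod 2 →+* _) 2]
        rw [show (OfNat.ofNat 2 : ZMod 2) = 0 from rfl, C_0]
      simp only [Polynomial.map_pow, Polynomial.map_sub, map_X, Polynomial.map_ofNat, h2, sub_zero]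
      rw [← pow_mul, ← pow_succ']
    have e0 := congrArg (eval 0) he
    have hp : 2^(k+1) = 2 * 2^k := pow_succ' 2 k
    have hpos : 0 < 2^k := by positivity
    obtain ⟨j, hj⟩ : ∃ j, 2^(k+1) = j + 2 := ⟨2^(k+1)-2, by omega⟩
    have e1 : 2 ∣ e.eval 0 := by
      simp only [eval_pow, eval_sub, eval_X, eval_ofNat, eval_add, eval_mul, eval_C, ne_eq, OfNat.ofNat_ne_zero,
        not_false_eq_true, zero_pow, zero_sub] at e0
      rw [zero_pow (by positivity), zero_add, hj, pow_succ] at e0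
      refine ⟨(-2)^j, ?_⟩
      have : (2:Z2) * (e.eval 0 - 2 * (-2)^j) = 0 := by
        rw [pow_succ] at e0; linear_combination -e0
      rcases mul_eq_zero.1 this with h | h
      · exact absurd h z2_prime.ne_zero
      · exact sub_eq_zero.1 h
    refine ⟨cq v - e, ?_, ?_⟩
    · rw [ckp, hv, cq_sub, cq_mul, cq_C]
      have : cq (X^(2^(k+1)) : Z2[X]) = (X^2-2)^(2^(k+1)) := by simp [cq]
      rw [this, he]; ring
    · rw [eval_sub, cq_eval]
      intro h
      have h1 := dvd_add h e1
      rw [sub_add_cancel] at h1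
      rw [show (0:Z2)^2-2 = -2 by norm_num] at h1
      exact h0 (even_at v h1)

lemma pow_two_unit {a b : ℕ} {x y : Z2} (hx : ¬ 2 ∣ x) (hy : ¬ 2 ∣ y) (h : 2^a * x = 2^b * y) : a = b := by
  have h2 := z2_prime
  rcases lt_trichotomy a b with hl | hl | hl
  · obtain ⟨c, rfl⟩ := Nat.exists_eq_add_of_lt hl
    exfalso
    rw [show a + c + 1 = a + (c + 1) by ring, pow_add, mul_assoc] at h
    have := mul_left_cancel₀ (pow_ne_zero _ h2.ne_zero) h
    exact hx ⟨2^c * y, by rw [this, pow_succ]; ring⟩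
  · exact hl
  · obtain ⟨c, rfl⟩ := Nat.exists_eq_add_of_lt hl
    exfalso
    rw [show b + c + 1 = b + (c + 1) by ring, pow_add, mul_assoc] at h
    have := mul_left_cancel₀ (pow_ne_zero _ h2.ne_zero) h
    exact hy ⟨2^c * x, by rw [← this, pow_succ]; ring⟩

lemma ph_norm {k : ℕ} {f : Z2[X]} (hdeg : f.natDegree < 2^(k+1)) (hf : ¬ C 2 ∣ f) {W : Z2} (hW : ¬ 2 ∣ W) {m l : ℕ}
    (h : 2^(m * 2^(k+1)) * W = 2^(l * 2^(k+1)) * (ph^[k+1] f).eval 0) :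
    2^(k+4) ∣ W^2 - 1 := by
  set p := f.map PadicInt.toZMod with hp
  have hp0 : p ≠ 0 := by
    intro h0
    apply hf
    obtain ⟨e, he⟩ := poly_dvd (f := f) (g := 0) (by rw [← hp, h0]; simp)
    exact ⟨e, by rw [he, zero_add]⟩
  obtain ⟨q, hq, hq0⟩ := exists_eq_pow_rootMultiplicity_mul_and_not_dvd p hp0 0
  set i := rootMultiplicity 0 p
  rw [C_0, sub_zero] at hq hq0
  have hi : i < 2^(k+1) := by
    have hqn : q ≠ 0 := by rintro rfl; simp at hq0
    have h1 : p.natDegree = i + q.natDegree := by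
      rw [hq, natDegree_X_pow_mul _ hqn, add_comm]
    have h2 : p.natDegree ≤ f.natDegree := natDegree_map_le
    omega
  obtain ⟨b, hb⟩ := Polynomial.map_surjective (PadicInt.toZMod (p := 2)) (ZMod.ringHom_surjective _) q
  obtain ⟨a, ha⟩ := poly_dvd (f := f) (g := X^i * b) (by rw [← hp, hq, Polynomial.map_mul, hb]; simp)
  have hb0 : ¬ 2 ∣ b.eval 0 := by
    rw [z2_dvd]
    intro h1
    apply hq0
    rw [X_dvd_iff, ← hb, coeff_map, coeff_zero_eq_eval_zero, h1]
  obtain ⟨v, hv, hv0⟩ := ckp_form k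
  set g := v * b + X^(2^(k+1) - i) * a with hg
  have hg0 : ¬ 2 ∣ g.eval 0 := by
    rw [hg, eval_add, eval_mul, eval_mul, eval_pow, eval_X, zero_pow (by omega), zero_mul, add_zero]
    intro h1
    rcases z2_prime.dvd_or_dvd h1 with h2 | h2
    · exact hv0 h2
    · exact hb0 h2
  have hN := iter_dvd (k := k+1) (f := v * f) (g := X^i * g) (by
    refine ⟨-a, ?_⟩
    rw [hv, ha, hg, mul_add (X^i), ← mul_assoc (X^i) (X^(2^(k+1)-i)) a, ← pow_add, Nat.add_sub_cancel' hi.le]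
    ring)
  rw [iter_mul, iter_mul, eval_mul, eval_mul] at hN
  have hXi : ∃ u : Z2, u * u = 1 ∧ (ph^[k+1] (X^i : Z2[X])).eval 0 = u * 2^i := by
    obtain ⟨u, hu, hu2⟩ := iter_X (R := Z2) k
    refine ⟨u^i, by rw [← mul_pow, hu, one_pow], ?_⟩
    have : ∀ i : ℕ, ph^[k+1] (X^i : Z2[X]) = (ph^[k+1] (X : Z2[X]))^i := by
      intro i
      induction i with
      | zero =>
        rw [pow_zero, pow_zero]
        have := iter_C (k+1) (1 : Z2)
        simpa using this
      | succ i ih => rw [pow_succ, iter_mul, ih, pow_succ]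
    rw [this, eval_pow, hu2, mul_pow]
  obtain ⟨u, hu, hu2⟩ := hXi
  rw [hu2] at hN
  have o1 := ph_odd v hv0 (k+1)
  have o2 := ph_odd g hg0 (k+1)
  have ou : ¬ 2 ∣ u := by
    intro h1
    have : (2:Z2) ∣ 1 := by rw [← hu]; exact h1.mul_right _
    exact z2_prime.not_dvd_one this
  have e1 := pow_two_unit (a := m * 2^(k+1)) (b := l * 2^(k+1) + i) (x := (ph^[k+1] v).eval 0 * W)
    (y := u * (ph^[k+1] g).eval 0) (fun h1 => (z2_prime.dvd_or_dvd h1).elim o1 hW)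
    (fun h1 => (z2_prime.dvd_or_dvd h1).elim ou o2) (by
      rw [pow_add]; linear_combination ((ph^[k+1] v).eval 0) * h + 2^(l * 2^(k+1)) * hN)
  have hi0 : i = 0 := by
    have h1 : 2^(k+1) ∣ i := by
      rw [← Nat.dvd_add_right (Dvd.intro_left l rfl : 2^(k+1) ∣ l * 2^(k+1)), ← e1]
      exact Dvd.intro_left m rfl
    exact Nat.eq_zero_of_dvd_of_lt h1 hi
  rw [hi0, add_zero] at e1
  rw [e1] at h
  have h' := mul_left_cancel₀ (pow_ne_zero _ z2_prime.ne_zero) h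
  rw [h']
  apply ph_key f ?_ (k+1)
  rw [ha, hi0, pow_zero, one_mul, eval_add, eval_mul, eval_C]
  intro h1
  exact hb0 ((dvd_add_left (dvd_mul_right _ _)).1 h1)

theorem ph_main {k : ℕ} {f : ℚ_[2][X]} (hdeg : f.natDegree < 2^(k+1)) {W : Z2} (hW : ¬ 2 ∣ W)
    (h : (ph^[k+1] f).eval 0 = (W : ℚ_[2])) : 2^(k+4) ∣ W^2 - 1 := by
  -- clear denominators
  have hW0 : W ≠ 0 := by rintro rfl; exact hW (dvd_zero _)
  have hden : ∃ (m : ℕ) (f₁ : Z2[X]), C ((2:ℚ_[2])^m) * f = f₁.map (algebraMap Z2 ℚ_[2]) := by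
    obtain ⟨b, hbm, hb⟩ := IsLocalization.integerNormalization_spec (nonZeroDivisors Z2) f
    have hb0 : b ≠ 0 := nonZeroDivisors.ne_zero hbm
    have h1 := PadicInt.unitCoeff_spec hb0
    refine ⟨(b : Z2).valuation, C (((PadicInt.unitCoeff hb0)⁻¹ : Z2ˣ) : Z2) *
      IsLocalization.integerNormalization (nonZeroDivisors Z2) f, ?_⟩
    rw [Polynomial.map_mul, hb, map_C, Algebra.smul_def, ← mul_assoc]
    congr 1
    change _ = C _ * C ((algebraMap Z2 ℚ_[2]) b)
    rw [← C_mul, ← map_mul]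
    congr 1
    have h2 : (((PadicInt.unitCoeff hb0)⁻¹ : Z2ˣ) : Z2) * b = 2^b.valuation := by
      rw [Units.inv_mul_eq_iff_eq_mul]
      exact_mod_cast h1
    rw [h2, map_pow, map_ofNat]
  obtain ⟨m, f₁, hf₁⟩ := hden
  have hf0 : f ≠ 0 := by
    rintro rfl
    have := iter_C (k+1) (0 : ℚ_[2])
    rw [C_0] at this
    rw [this] at h
    simp at h
    exact hW0 (Subtype.ext h.symm)
  have hf10 : f₁ ≠ 0 := by
    rintro rfl
    rw [Polynomial.map_zero] at hf₁
    simp [hf0] at hf₁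
  obtain ⟨l, f₂, hf₂, hnd⟩ : ∃ (l : ℕ) (f₂ : Z2[X]), f₁ = C (2^l) * f₂ ∧ ¬ C 2 ∣ f₂ := by
    have hfin : FiniteMultiplicity (C 2 : Z2[X]) f₁ := by
      apply FiniteMultiplicity.of_not_isUnit _ hf10
      rw [isUnit_C]
      exact z2_prime.not_isUnit
    obtain ⟨g, hg, hg2⟩ := hfin.exists_eq_pow_mul_and_not_dvd
    exact ⟨_, g, by rw [C_pow]; exact hg, hg2⟩
  refine ph_norm (m := m) (l := l) (f := f₂) ?_ hnd hW ?_
  · have e1 := congrArg natDegree hf₁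
    rw [natDegree_C_mul (by simp), natDegree_map_eq_of_injective (IsFractionRing.injective Z2 ℚ_[2]), hf₂,
      natDegree_C_mul (pow_ne_zero _ z2_prime.ne_zero)] at e1
    omega
  · have e1 := congrArg (fun p => (ph^[k+1] p).eval 0) hf₁
    simp only [iter_mul, iter_C, hf₂, iter_map, eval_mul, eval_C, Polynomial.map_mul, map_C, h] at e1
    apply IsFractionRing.injective Z2 ℚ_[2]
    rw [← coeff_zero_eq_eval_zero, coeff_map, coeff_zero_eq_eval_zero] at e1
    simp only [map_mul, map_pow, map_ofNat] at e1 ⊢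
    rw [pow_mul, pow_mul]
    exact e1
end

section
lemma odd_pow_two {o : Z2} (n : ℕ) : ∀ {y : Z2}, y - 1 = 8 * o → ¬ 2 ∣ o → ∃ o', y^(2^n) - 1 = 2^(n+3) * o' ∧ ¬ 2 ∣ o' := by
  induction n with
  | zero => intro y h1 h2; exact ⟨o, by rw [pow_zero, pow_one, h1]; ring, h2⟩
  | succ n ih =>
    intro y h1 h2
    obtain ⟨o', e, h3⟩ := ih h1 h2
    refine ⟨o' + 2 * (2^(n+1) * o'^2), ?_, ?_⟩
    · have : y^(2^n) = 1 + 2^(n+3) * o' := by rw [← e]; ring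
      rw [pow_succ, pow_mul, this]; ring
    · intro h
      exact h3 ((dvd_add_left (dvd_mul_right 2 _)).1 h)

lemma five_pow (n : ℕ) {w : Z2} (hw : 8 ∣ w - 5) : ¬ 2^(n+4) ∣ (w^(2^n))^2 - 1 := by
  obtain ⟨c, hc⟩ := hw
  have hw : w = 5 + 8 * c := by rw [← hc]; ring
  obtain ⟨o', e, h⟩ := odd_pow_two (o := 3 + 2 * (5 * c + 4 * c^2)) n (y := w^2) (by rw [hw]; ring) (by
    intro h
    have h1 : (2:Z2) ∣ 3 := (dvd_add_left (dvd_mul_right 2 _)).1 h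
    have : (2:Z2) ∣ 1 := by
      have := dvd_sub h1 (dvd_refl 2); rwa [show (3:Z2) - 2 = 1 by norm_num] at this
    exact z2_prime.not_dvd_one this)
  rw [← pow_mul, mul_comm, pow_mul, e]
  intro h1
  rw [show n + 4 = (n+3) + 1 by ring, pow_succ] at h1
  exact h ((mul_dvd_mul_iff_left (pow_ne_zero _ z2_prime.ne_zero)).1 h1)

lemma pell_split {m n D y : ℕ} (hc : Nat.Coprime m n) (hD : 0 < D) (h : m * n = D * y^2) :
    ∃ e f a b : ℕ, e * f = D ∧ m = e * a^2 ∧ n = f * b^2 := by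
  have h1 : D.gcd (m * n) = D := by rw [h]; exact Nat.gcd_eq_left (dvd_mul_right _ _)
  rw [Nat.Coprime.gcd_mul D hc] at h1
  obtain ⟨m', hm⟩ := Nat.gcd_dvd_right D m
  obtain ⟨n', hn⟩ := Nat.gcd_dvd_right D n
  set e := D.gcd m
  set f := D.gcd n
  have h2 : m' * n' = y^2 := by
    have : (e * f) * (m' * n') = (e * f) * y^2 := by
      rw [h1, ← h]; conv_rhs => rw [hm, hn]
      rw [← h1]; ring
    exact Nat.eq_of_mul_eq_mul_left (by rw [h1]; exact hD) this
  have hc' : Nat.Coprime m' n' := by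
    rw [hm, hn] at hc
    exact (Nat.Coprime.coprime_mul_left hc).coprime_mul_left_right
  have ha : ∃ a, m' = a^2 := by
    exact exists_eq_pow_of_mul_eq_pow (Nat.isUnit_iff.2 hc') h2
  have hb : ∃ b, n' = b^2 := by
    exact exists_eq_pow_of_mul_eq_pow (Nat.isUnit_iff.2 hc'.symm) ((mul_comm _ _).trans h2)
  obtain ⟨a, rfl⟩ := ha
  obtain ⟨b, rfl⟩ := hb
  exact ⟨e, f, a, b, h1, hm, hn⟩

lemma prime_split {p e f D : ℕ} (hp : p.Prime) (h : e * f = p * D) :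
    (∃ e', e = p * e' ∧ e' * f = D) ∨ (∃ f', f = p * f' ∧ e * f' = D) := by
  have : p ∣ e * f := ⟨D, h⟩
  rcases (hp.dvd_mul).1 this with ⟨e', rfl⟩ | ⟨f', rfl⟩
  · left; exact ⟨e', rfl, Nat.eq_of_mul_eq_mul_left hp.pos (by rw [← h]; ring)⟩
  · right; exact ⟨f', rfl, Nat.eq_of_mul_eq_mul_left hp.pos (by rw [← h]; ring)⟩

lemma leg_no {p : ℕ} [Fact p.Prime] {c x m : ℤ} (h : (p : ℤ) ∣ c * x^2 - m) : legendreSym p (c * m) ≠ -1 := by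
  intro h1
  rw [legendreSym.eq_neg_one_iff] at h1
  apply h1
  refine ⟨(c * x : ℤ), ?_⟩
  have h2 : ((c * x^2 - m : ℤ) : ZMod p) = 0 := (ZMod.intCast_zmod_eq_zero_iff_dvd _ p).2 h
  push_cast at h2 ⊢
  linear_combination (-(c : ZMod p)) * h2

/-- the case of `rs` -/
lemma pell_rs {r s : ℕ} (hr : r.Prime) (hs : s.Prime) (hr8 : r % 8 = 5) (hs8 : s % 8 = 5) (hne : r ≠ s)
    (hNeg : ¬ ∃ x y : ℤ, x ^ 2 - (r * s : ℕ) * y ^ 2 = -1) :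
    ∃ (a b : ℤ) (σ : ℤ), (σ = 1 ∨ σ = -1) ∧ r * a^2 - s * b^2 = σ := by
  have hrs8 : (r * s) % 8 = 1 := by rw [Nat.mul_mod, hr8, hs8]
  have hsq : ¬ IsSquare ((r * s : ℕ) : ℤ) := by
    rintro ⟨x, hx⟩
    have h1 : (r : ℤ) ∣ x * x := ⟨s, by rw [← hx]; push_cast; ring⟩
    have hrp : Prime (r : ℤ) := Nat.prime_iff_prime_int.1 hr
    have h2 : (r : ℤ) ∣ x := by rcases hrp.dvd_or_dvd h1 with h | h <;> exact h
    obtain ⟨y, rfl⟩ := h2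
    have h3 : (s : ℤ) = r * (y * y) := by
      have hr0 : (r : ℤ) ≠ 0 := hrp.ne_zero
      apply mul_left_cancel₀ hr0
      push_cast at hx; rw [hx]; ring
    have h4 : (r : ℤ) ∣ s := ⟨_, h3⟩
    have h5 : r ∣ s := by exact_mod_cast h4
    exact hne ((Nat.prime_dvd_prime_iff_eq hr hs).1 h5)
  have hpos : (0 : ℤ) < (r * s : ℕ) := by exact_mod_cast Nat.mul_pos hr.pos hs.pos
  obtain ⟨sol, hf⟩ := Pell.IsFundamental.exists_of_not_isSquare hpos hsq
  have hx1 := hf.1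
  have hmin : ∀ {b : Pell.Solution₁ ((r * s : ℕ) : ℤ)}, 1 < b.x → sol.x ≤ b.x := hf.2.2
  have heq := sol.prop
  set X := sol.x with hX
  set Y := sol.y with hY
  -- natural versions
  obtain ⟨x, hx⟩ : ∃ x : ℕ, (x : ℤ) = X := ⟨X.toNat, Int.toNat_of_nonneg (by omega)⟩
  obtain ⟨y, hy⟩ : ∃ y : ℕ, (y : ℤ) = Y := ⟨Y.toNat, Int.toNat_of_nonneg hf.2.1.le⟩
  rw [← hx, ← hy] at heq
  have heqN : x^2 = 1 + (r * s) * y^2 := by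
    have : (x:ℤ)^2 = 1 + (r * s : ℕ) * (y:ℤ)^2 := by linear_combination heq
    exact_mod_cast this
  have hx1' : 1 < x := by rw [← hx] at hx1; exact_mod_cast hx1
  have hmod : x % 2 = 1 ∧ y % 2 = 0 := by
    have h1 : x^2 % 8 = (1 + 1 * (y^2 % 8)) % 8 := by
      rw [heqN, Nat.add_mod, Nat.mul_mod, hrs8]; simp
    have hx8 : x % 8 < 8 := Nat.mod_lt _ (by norm_num)
    have hy8 : y % 8 < 8 := Nat.mod_lt _ (by norm_num)
    rw [Nat.pow_mod, Nat.pow_mod y] at h1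
    have e1 : x % 2 = (x % 8) % 2 := by omega
    have e2 : y % 2 = (y % 8) % 2 := by omega
    rw [e1, e2]
    generalize x % 8 = u at *
    generalize y % 8 = v at *
    interval_cases u <;> interval_cases v <;> revert h1 <;> decide
  obtain ⟨m, rfl⟩ : ∃ m, x = 2 * m + 1 := ⟨x / 2, by omega⟩
  obtain ⟨z, rfl⟩ : ∃ z, y = 2 * z := ⟨y / 2, by omega⟩
  have hmz : (m + 1) * m = (r * s) * z^2 := by
    have : 4 * ((m + 1) * m) = 4 * ((r * s) * z^2) := by linarith [heqN]
    omega
  obtain ⟨e, f, a, b, hef, hea, hfb⟩ := pell_split (by simp) (Nat.mul_pos hr.pos hs.pos) hmz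
  have hrel : (e : ℤ) * a^2 - f * b^2 = 1 := by
    have h1 : ((m : ℤ) + 1) = e * a^2 := by exact_mod_cast hea
    have h2 : (m : ℤ) = f * b^2 := by exact_mod_cast hfb
    rw [← h1, ← h2]; ring
  have hmpos : 0 < m := by omega
  rcases prime_split hr hef with ⟨e', rfl, h1⟩ | ⟨f', rfl, h1⟩
  · rcases prime_split hs (h1.trans (mul_one s).symm) with ⟨e'', rfl, h2⟩ | ⟨f'', rfl, h2⟩
    · exfalso
      obtain ⟨rfl, rfl⟩ := mul_eq_one.1 h2
      apply hNeg
      refine ⟨b, a, ?_⟩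
      push_cast at hrel ⊢; linear_combination -hrel
    · obtain ⟨rfl, rfl⟩ := mul_eq_one.1 h2
      refine ⟨a, b, 1, Or.inl rfl, ?_⟩
      push_cast at hrel ⊢; linear_combination hrel
  · rcases prime_split hs (h1.trans (mul_one s).symm) with ⟨e'', rfl, h2⟩ | ⟨f'', rfl, h2⟩
    · obtain ⟨rfl, rfl⟩ := mul_eq_one.1 h2
      refine ⟨b, a, -1, Or.inr rfl, ?_⟩
      push_cast at hrel ⊢; linear_combination -hrel
    · exfalso
      obtain ⟨rfl, rfl⟩ := mul_eq_one.1 h2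
      have ha1 : (1:ℤ) < a := by
        have : 1 < a := by
          by_contra h
          have : a ≤ 1 := by omega
          interval_cases a <;> omega
        exact_mod_cast this
      have hm2 := hmin (b := Pell.Solution₁.mk a b (by push_cast at hrel ⊢; linear_combination hrel)) (by simpa using ha1)
      have hm3 : X ≤ a := hm2
      rw [← hx] at hm3
      have hm4 : 2 * m + 1 ≤ a := by exact_mod_cast hm3
      nlinarith [hea]
end

section
lemma leg_neg_one_of_five {r : ℕ} [Fact r.Prime] (h : r % 8 = 5) : legendreSym r (-1) = 1 := by
  rw [legendreSym.at_neg_one (by omega), ZMod.χ₄_nat_one_mod_four (by omega)]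

lemma leg_two_of_five {r : ℕ} [Fact r.Prime] (h : r % 8 = 5) : legendreSym r 2 = -1 := by
  rw [legendreSym.at_two (by omega), ZMod.χ₈_nat_mod_eight, h]; rfl

lemma leg_neg_one_of_three {r : ℕ} [Fact r.Prime] (h : r % 4 = 3) : legendreSym r (-1) = -1 := by
  rw [legendreSym.at_neg_one (by omega), ZMod.χ₄_nat_three_mod_four (by omega)]

lemma leg_recip {r s : ℕ} [Fact r.Prime] [Fact s.Prime] (h : r % 8 = 5) (h2 : s % 2 = 1) : legendreSym s r = legendreSym r s :=
  legendreSym.quadratic_reciprocity_one_mod_four (by omega) (by omega)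

/-- `rs`-part selection -/
lemma pell_d_aux {q r s : ℕ} [Fact q.Prime] [Fact r.Prime] [Fact s.Prime] (η : ℕ)
    (hη : η = 1 ∨ η = 2)
    (hq4 : q % 4 = 3) (hr8 : r % 8 = 5) (hs8 : s % 8 = 5)
    (hqr : legendreSym r q = (-1) ^ (if η = 2 then 1 else 0))
    (hqs : legendreSym s q = (-1) ^ (if η = 2 then 1 else 0))
    (hrs : legendreSym s r = 1)
    (x y : ℕ) (hx : 1 < x)
    (hPell : x^2 = 1 + (η * q * r * s) * y ^ 2)
    (hfund : ∀ a b : ℤ, 0 < a → 0 < b → a ^ 2 - (η * q * r * s : ℕ) * b ^ 2 = 1 → (x:ℤ) ≤ a)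
    (hnsq : ¬ ∃ t : ℤ, 2 ^ (if η = 1 then 1 else 0) * (q : ℤ) * ((x:ℤ) - 1) = t ^ 2) :
    ∃ a b σ : ℤ, (σ = 1 ∨ σ = -1) ∧
      (r * a^2 - (η * q * s : ℕ) * b^2 = σ ∨ s * a^2 - (η * q * r : ℕ) * b^2 = σ) := by
  have hrp : r.Prime := Fact.out
  have hsp : s.Prime := Fact.out
  have hqp : q.Prime := Fact.out
  have hDpos : 0 < η * q * r * s := by
    have := hrp.pos; have := hsp.pos; have := hqp.pos
    have : 0 < η := by omega
    positivity
  have lr1 := leg_neg_one_of_five hr8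
  have lr2 := leg_two_of_five hr8
  have lrs : legendreSym r s = 1 := by rw [← leg_recip hr8 (by omega)]; exact hrs
  have lq1 := leg_neg_one_of_three hq4
  have lqr : legendreSym q r = legendreSym r q := leg_recip hr8 (by omega)
  have lqs : legendreSym q s = legendreSym s q := leg_recip hs8 (by omega)
  have lqrs : legendreSym q (r * s) = 1 := by
    rw [legendreSym.mul, lqr, lqs, hqr, hqs]; split_ifs <;> norm_num
  -- generic mod-r contradictions
  have nr : ∀ c x m : ℤ, (r : ℤ) ∣ c * x^2 - m → legendreSym r c * legendreSym r m = -1 → False := by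
    intro c x m h h1
    exact leg_no h (by rw [legendreSym.mul]; exact h1)
  have lneg : ∀ c : ℤ, legendreSym r (-c) = legendreSym r c := by
    intro c; rw [show -c = (-1) * c by ring, legendreSym.mul, lr1, one_mul]
  have lone : legendreSym r 1 = 1 := by simp
  by_cases hodd : x % 2 = 1
  · have hy2 : y % 2 = 0 := by
      by_contra hy
      obtain ⟨z, rfl⟩ : ∃ z, y = 2 * z + 1 := ⟨y / 2, by omega⟩
      obtain ⟨m, rfl⟩ : ∃ m, x = 2 * m + 1 := ⟨x / 2, by omega⟩
      have h0 : (2*m+1)^2 % 4 = 1 := by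
        rw [show (2*m+1)^2 = 1 + 4 * (m^2+m) by ring]; omega
      have h1 : (η * q * r * s) * (2*z+1)^2 % 4 = (η * q * r * s) % 4 := by
        rw [show (η * q * r * s) * (2*z+1)^2 = (η * q * r * s) + 4 * ((η * q * r * s) * (z^2+z)) by ring]; omega
      have h2 : (η * q * r * s) % 4 = ((η % 4) * 3 * 1 * 1) % 4 := by
        simp [Nat.mul_mod, hq4, show r % 4 = 1 by omega, show s % 4 = 1 by omega]
      rw [hPell] at h0
      rcases hη with rfl | rfl <;> omega
    obtain ⟨m, rfl⟩ : ∃ m, x = 2 * m + 1 := ⟨x / 2, by omega⟩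
    obtain ⟨z, rfl⟩ : ∃ z, y = 2 * z := ⟨y / 2, by omega⟩
    have hmz : (m + 1) * m = (η * q * r * s) * z^2 := by
      have : 4 * ((m + 1) * m) = 4 * ((η * q * r * s) * z^2) := by linarith [hPell]
      omega
    obtain ⟨e, f, a, b, hef, hea, hfb⟩ := pell_split (by simp) hDpos hmz
    have hrel : (e : ℤ) * a^2 - f * b^2 = 1 := by
      have h1 : ((m : ℤ) + 1) = e * a^2 := by exact_mod_cast hea
      have h2 : (m : ℤ) = f * b^2 := by exact_mod_cast hfb
      rw [← h1, ← h2]; ring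
    have hmpos : 0 < m := by omega
    -- split off r, s
    have hall : f ≠ η * q * r * s := by
      rintro rfl
      have he : e = 1 := by
        have := Nat.eq_of_mul_eq_mul_right hDpos (hef.trans (one_mul _).symm); exact this
      subst he
      have ha0 : 0 < a := by
        rcases Nat.eq_zero_or_pos a with h | h
        · subst h; omega
        · exact h
      have hb0 : 0 < b := by
        rcases Nat.eq_zero_or_pos b with h | h
        · subst h; omega
        · exact h
      have h3 := hfund a b (by exact_mod_cast ha0) (by exact_mod_cast hb0) (by linear_combination hrel)
      have hm4 : 2 * m + 1 ≤ a := by exact_mod_cast h3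
      nlinarith [hea]
    have hnf : f ≠ η * q := by
      rintro rfl
      apply hnsq
      refine ⟨2 * q * b, ?_⟩
      have h2 : (m : ℤ) = (η * q : ℕ) * b^2 := by exact_mod_cast hfb
      rcases hη with rfl | rfl
      · push_cast at h2 ⊢; rw [h2]; ring
      · push_cast at h2 ⊢; simp; rw [h2]; ring
    have hf1 : f ≠ 1 := by
      rintro rfl
      have he : e = η * q * r * s := by simpa using hef
      subst he
      refine leg_no (p := q) (c := -1) (x := b) (m := 1) ⟨-(η * r * s * a^2), ?_⟩ (by simpa using lq1)
      push_cast at hrel; linear_combination hrel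
    have hfrs : ¬ (e = η * q ∧ f = r * s) := by
      rintro ⟨rfl, rfl⟩
      refine leg_no (p := q) (c := -(r*s)) (x := b) (m := 1) ⟨-(η * a^2), ?_⟩ (by rw [show (-(r*s) * 1 : ℤ) = (-1) * (r * s) by ring, legendreSym.mul, lq1, lqrs]; rfl)
      push_cast at hrel; linear_combination hrel
    have key : ∀ e₁ f₁ : ℕ, e₁ * f₁ = η * q → (e₁ = 1 ∧ f₁ = η * q) ∨ (e₁ = η * q ∧ f₁ = 1) ∨
        (legendreSym r e₁ = -1 ∧ legendreSym r f₁ = -1) := by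
      intro e₁ f₁ h
      rcases hη with rfl | rfl
      · rw [one_mul] at h ⊢
        rcases prime_split hqp (h.trans (mul_one q).symm) with ⟨e9, rfl, h9⟩ | ⟨f9, rfl, h9⟩
        · obtain ⟨rfl, rfl⟩ := mul_eq_one.1 h9; right; left; simp
        · obtain ⟨rfl, rfl⟩ := mul_eq_one.1 h9; left; simp
      · have hq1 : legendreSym r q = -1 := by simpa using hqr
        rcases prime_split Nat.prime_two h with ⟨e', rfl, h1⟩ | ⟨f', rfl, h1⟩
        · rcases prime_split hqp (h1.trans (mul_one q).symm) with ⟨e9, rfl, h9⟩ | ⟨f9, rfl, h9⟩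
          · obtain ⟨rfl, rfl⟩ := mul_eq_one.1 h9; right; left; simp
          · obtain ⟨rfl, rfl⟩ := mul_eq_one.1 h9; right; right; simp [hq1, lr2]
        · rcases prime_split hqp (h1.trans (mul_one q).symm) with ⟨e9, rfl, h9⟩ | ⟨f9, rfl, h9⟩
          · obtain ⟨rfl, rfl⟩ := mul_eq_one.1 h9; right; right; simp [hq1, lr2]
          · obtain ⟨rfl, rfl⟩ := mul_eq_one.1 h9; left; simp
    have hef' : e * f = r * (s * (η * q)) := by rw [hef]; ring
    rcases prime_split hrp hef' with ⟨e', rfl, h1⟩ | ⟨f', rfl, h1⟩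
    · rcases prime_split hsp h1 with ⟨e'', rfl, h2⟩ | ⟨f'', rfl, h2⟩
      · -- e = r s e''
        rcases key _ _ h2 with ⟨rfl, rfl⟩ | ⟨rfl, rfl⟩ | ⟨h3, h4⟩
        · exact absurd rfl hnf
        · exact absurd rfl hf1
        · exfalso
          refine nr (-f) b 1 ⟨-(s * e'' * a^2), ?_⟩ (by rw [lneg, h4, lone]; rfl)
          push_cast at hrel; linear_combination hrel
      · rcases key _ _ h2 with ⟨rfl, rfl⟩ | ⟨rfl, rfl⟩ | ⟨h3, h4⟩
        · refine ⟨a, b, 1, Or.inl rfl, Or.inl ?_⟩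
          push_cast at hrel ⊢; linear_combination hrel
        · refine ⟨b, a, -1, Or.inr rfl, Or.inr ?_⟩
          push_cast at hrel ⊢; linear_combination -hrel
        · exfalso
          refine nr (-(s*f'')) b 1 ⟨-(e' * a^2), ?_⟩ (by rw [lneg, legendreSym.mul, lrs, h4, lone]; rfl)
          push_cast at hrel; linear_combination hrel
    · rcases prime_split hsp h1 with ⟨e'', rfl, h2⟩ | ⟨f'', rfl, h2⟩
      · rcases key _ _ h2 with ⟨rfl, rfl⟩ | ⟨rfl, rfl⟩ | ⟨h3, h4⟩
        · refine ⟨a, b, 1, Or.inl rfl, Or.inr ?_⟩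
          push_cast at hrel ⊢; linear_combination hrel
        · refine ⟨b, a, -1, Or.inr rfl, Or.inl ?_⟩
          push_cast at hrel ⊢; linear_combination -hrel
        · exfalso
          refine nr (s*e'') a 1 ⟨(f' * b^2), ?_⟩ (by rw [legendreSym.mul, lrs, h3, lone]; rfl)
          push_cast at hrel; linear_combination hrel
      · rcases key _ _ h2 with ⟨rfl, rfl⟩ | ⟨rfl, rfl⟩ | ⟨h3, h4⟩
        · exact absurd (by ring) hall
        · exact absurd ⟨rfl, by ring⟩ hfrs
        · exfalso
          refine nr e a 1 ⟨(s * f'' * b^2), ?_⟩ (by rw [h3, lone]; rfl)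
          push_cast at hrel; linear_combination hrel
  · exfalso
    rcases hη with rfl | rfl
    · obtain ⟨m, rfl⟩ : ∃ m, x = m + 1 := ⟨x - 1, by omega⟩
      have hmz : (m + 2) * m = (1 * q * r * s) * y^2 := by linarith [hPell]
      obtain ⟨e, f, a, b, hef, hea, hfb⟩ := pell_split (by
        rw [add_comm, Nat.coprime_add_self_left, Nat.coprime_two_left, Nat.odd_iff]; omega) hDpos hmz
      have hrel : (e : ℤ) * a^2 - f * b^2 = 2 := by
        have h1 : ((m : ℤ) + 2) = e * a^2 := by exact_mod_cast hea
        have h2 : (m : ℤ) = f * b^2 := by exact_mod_cast hfb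
        rw [← h1, ← h2]; ring
      have lrq : legendreSym r q = 1 := by simpa using hqr
      have key : ∀ e₁ f₁ : ℕ, e₁ * f₁ = s * q → legendreSym r e₁ = 1 ∧ legendreSym r f₁ = 1 := by
        intro e₁ f₁ h
        rcases prime_split hsp h with ⟨e', rfl, h1⟩ | ⟨f', rfl, h1⟩ <;>
        rcases prime_split hqp (h1.trans (mul_one q).symm) with ⟨e9, rfl, h9⟩ | ⟨f9, rfl, h9⟩ <;>
        obtain ⟨rfl, rfl⟩ := mul_eq_one.1 h9 <;> push_cast <;> simp [legendreSym.mul, lrs, lrq]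
      have hef' : e * f = r * (s * q) := by rw [hef]; ring
      rcases prime_split hrp hef' with ⟨e', rfl, h1⟩ | ⟨f', rfl, h1⟩
      · refine nr (-f) b 2 ⟨-(e' * a^2), ?_⟩ (by rw [lneg, (key _ _ h1).2, lr2]; rfl)
        push_cast at hrel; linear_combination hrel
      · refine nr e a 2 ⟨(f' * b^2), ?_⟩ (by rw [(key _ _ h1).1, lr2]; rfl)
        push_cast at hrel; linear_combination hrel
    · have : x^2 % 2 = 1 := by rw [hPell, show 1 + 2 * q * r * s * y^2 = 1 + 2 * (q * r * s * y^2) by ring]; omega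
      have h3 : x % 2 = 0 := by omega
      rw [Nat.pow_mod, h3] at this; norm_num at this
end

section
lemma rat_dvd {a b : ℤ} (h : (a : 𝓞 ℚ) ∣ (b : 𝓞 ℚ)) : a ∣ b := by
  have := map_dvd (Rat.ringOfIntegersEquiv : 𝓞 ℚ →+* ℤ) h
  simpa using this

lemma TN_rat {l : ℕ} [Fact l.Prime] {c z : ℤ} (hc : (l:ℤ) ∣ c) (hc2 : ¬ (l:ℤ)^2 ∣ c) (a b : ℚ)
    (e : (z:ℚ) = a^2 - c*b^2) : IsSquare (z : ZMod l) := by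
  let f : 𝓞 ℚ →+* ZMod l := (Int.castRingHom _).comp (Rat.ringOfIntegersEquiv : 𝓞 ℚ →+* ℤ)
  have hf : ∀ n : ℤ, f (n : 𝓞 ℚ) = n := fun n => map_intCast f n
  have hk : RingHom.ker f ≤ Ideal.span {((l : ℤ) : 𝓞 ℚ)} := by
    intro x hx
    have h1 : ((Rat.ringOfIntegersEquiv x : ℤ) : ZMod l) = 0 := hx
    obtain ⟨y, hy⟩ := (ZMod.intCast_zmod_eq_zero_iff_dvd _ l).1 h1
    rw [Ideal.mem_span_singleton]
    refine ⟨(y : 𝓞 ℚ), ?_⟩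
    apply Rat.ringOfIntegersEquiv.injective
    rw [hy]; simp
  have := TN f (c := (c : 𝓞 ℚ)) (z := (z : 𝓞 ℚ)) (by rw [hf]; exact (ZMod.intCast_zmod_eq_zero_iff_dvd _ l).2 hc)
    (by
      intro hm
      have h1 := Ideal.pow_right_mono hk 2 hm
      rw [Ideal.span_singleton_pow, Ideal.mem_span_singleton] at h1
      apply hc2
      apply rat_dvd
      push_cast at h1 ⊢; exact h1) a b (by push_cast; exact e)
  rwa [hf] at this

lemma rat_card : Nat.card (ClassGroup (𝓞 ℚ)) = 1 := by
  have := Rat.classNumber_eq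
  rw [NumberField.classNumber, ← Nat.card_eq_fintype_card] at this
  exact this

variable {L : Type*} [Field L] [NumberField L] {σ : L ≃+* L} {s : L}

lemma rat_norm (h : IsQuad ℚ L σ s) {c : ℤ} (hs : s * s = c) {l : ℕ} [Fact l.Prime]
    (hc : (l:ℤ) ∣ c) (hc2 : ¬ (l:ℤ)^2 ∣ c) {z : ℤ} (x : L) (hx : x * σ x = z) : IsSquare (z : ZMod l) := by
  obtain ⟨a, b, rfl⟩ := h.gen x
  refine TN_rat hc hc2 a b ?_
  apply (algebraMap ℚ L).injective
  rw [map_add, map_mul, h.fix, h.fix, h.σs] at hx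
  simp only [map_sub, map_mul, map_pow, map_intCast]
  rw [← hx, ← hs]; ring

lemma rat_span {l : ℕ} (hl : l.Prime) {p : Ideal (𝓞 ℚ)} (hp : p.IsPrime) (hm : (l : 𝓞 ℚ) ∈ p) :
    p = Ideal.span {(l : 𝓞 ℚ)} := by
  have hP : Prime (l : 𝓞 ℚ) := by
    have h1 : Prime (l : ℤ) := Nat.prime_iff_prime_int.1 hl
    have := (MulEquiv.prime_iff (Rat.ringOfIntegersEquiv.symm : ℤ ≃* 𝓞 ℚ) (p := (l:ℤ))).2 h1
    simpa using this
  have h0 : Ideal.span {(l : 𝓞 ℚ)} ≠ ⊥ := by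
    rw [Ne, Ideal.span_singleton_eq_bot]; exact hP.ne_zero
  have h1 : (Ideal.span {(l : 𝓞 ℚ)}).IsPrime := (Ideal.span_singleton_prime hP.ne_zero).2 hP
  have h2 := h1.isMaximal h0
  exact (h2.eq_of_le hp.ne_top ((Ideal.span_singleton_le_iff_mem _).2 hm)).symm

lemma rat_iIdx (h : IsQuad ℚ L σ s) (S : Finset ℕ) (hp : ∀ l ∈ S, l.Prime)
    (hS : ∀ P ∈ RP ℚ σ, ∃ l ∈ S, (l : 𝓞 L) ∈ P) : iIdx ℚ σ ∣ 2 ^ S.card := by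
  classical
  refine (iIdx_dvd h (S.image (fun l : ℕ => Ideal.span {(l : 𝓞 ℚ)})) ?_).trans (pow_dvd_pow 2 Finset.card_image_le)
  intro P hP
  obtain ⟨l, hl, hm⟩ := hS P hP
  rw [Finset.mem_image]
  refine ⟨l, hl, ?_⟩
  have := hP.1
  exact (rat_span (hp l hl) (Ideal.IsPrime.comap _) (by simpa using hm)).symm

/-- `σ = -1` on classes over a field with trivial class group -/
lemma rat_aCl (h : IsQuad ℚ L σ s) (c : ClassGroup (𝓞 L)) : c * aCl σ c = 1 := by
  rw [← jCl_nCl h]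
  have : Subsingleton (ClassGroup (𝓞 ℚ)) := (Nat.card_eq_one_iff_unique.1 rat_card).1
  rw [Subsingleton.elim (nCl ℚ L c) 1, map_one]

lemma rat_tors (h : IsQuad ℚ L σ s) [IsTotallyReal L] (φ : L →+* ℝ) (S : Finset ℕ) (hp : ∀ l ∈ S, l.Prime)
    (hS : ∀ P ∈ RP ℚ σ, ∃ l ∈ S, (l : 𝓞 L) ∈ P) :
    Nat.card (powMonoidHom 2 : ClassGroup (𝓞 L) →* _).ker * 2 * (nU ℚ σ).index ∣ 2 ^ S.card := by
  have h1 := AF h φ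
  rw [rat_card, one_mul] at h1
  have h2 : (dmH (aCl σ)).ker = (powMonoidHom 2 : ClassGroup (𝓞 L) →* _).ker := by
    ext c
    rw [mem_ker_dmH, MonoidHom.mem_ker, powMonoidHom_apply, sq]
    have := rat_aCl h c
    constructor
    · intro e; rwa [e] at this
    · intro e; exact mul_left_cancel (this.trans e.symm)
  rw [← h2, h1]
  exact rat_iIdx h S hp hS

/-- ideals of square norm up to... : a class is a nonsquare if the norm is a nonresidue -/
lemma odd_card_of_tors {G : Type*} [CommGroup G] [Finite G] (h : Nat.card (powMonoidHom 2 : G →* G).ker = 1) :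
    Odd (Nat.card G) := by
  rw [← Nat.not_even_iff_odd, even_iff_two_dvd]
  intro h2
  haveI : Fact (Nat.Prime 2) := ⟨Nat.prime_two⟩
  obtain ⟨x, hx⟩ := exists_prime_orderOf_dvd_card' 2 h2
  have h3 : x ∈ (powMonoidHom 2 : G →* G).ker := by
    rw [MonoidHom.mem_ker, powMonoidHom_apply, ← hx, pow_orderOf_eq_one]
  rw [Subgroup.card_eq_one.1 h, Subgroup.mem_bot] at h3
  rw [h3, orderOf_one] at hx; omega

/-- primes dividing in terms of `4m` -/
lemma mem_of_four {K : Type*} [Field K] [NumberField K] {P : Ideal (𝓞 K)} (hP : P.IsPrime) {x : 𝓞 K} {m : ℕ}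
    (hx : x * x = m) (h : 2 * x ∈ P) : ((2 : ℕ) : 𝓞 K) ∈ P ∨ (m : 𝓞 K) ∈ P := by
  rcases hP.mem_or_mem h with h | h
  · left; exact_mod_cast h
  · right; rw [← hx]; exact P.mul_mem_left _ h

lemma neg_one_nU (h : IsQuad ℚ L σ s) {c : ℤ} (hs : s * s = c) {q : ℕ} [Fact q.Prime] (hq : q % 4 = 3)
    (hc : (q:ℤ) ∣ c) (hc2 : ¬ (q:ℤ)^2 ∣ c) : (nU ℚ σ).index ≠ 1 := by
  intro e
  have h1 : (-1 : (𝓞 ℚ)ˣ) ∈ nU ℚ σ := by rw [Subgroup.index_eq_one.1 e]; trivial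
  obtain ⟨z, hz⟩ := mem_nU.1 h1
  have := rat_norm h hs hc hc2 (z := -1) z (by rw [← hz]; simp)
  have h2 := ZMod.exists_sq_eq_neg_one_iff (p := q)
  have h3 : IsSquare (-1 : ZMod q) := by simpa using this
  exact h2.1 h3 hq

lemma pow_two_bound {a b t : ℕ} (h : a * 2 * b ∣ 2 ^ (t + 2)) (hb : b ≠ 1) : a ≤ 2 ^ t := by
  have hb0 : b ≠ 0 := by
    rintro rfl; simp at h
  have h1 : a * 2 * b ≤ 2 ^ (t+2) := Nat.le_of_dvd (by positivity) h
  have h2 : 2 ≤ b := by omega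
  have : a * 2 * 2 ≤ a * 2 * b := Nat.mul_le_mul_left _ h2
  have : 2^(t+2) = 2^t * 4 := by ring
  omega
end

section
section
variable {K : Type*} [Field K] [NumberField K]

lemma exists_prime_over {l : ℕ} (hl : l.Prime) : ∃ P : Ideal (𝓞 K), P.IsPrime ∧ P ≠ ⊥ ∧ (l : 𝓞 K) ∈ P := by
  have h1 : Ideal.span {(l : 𝓞 K)} ≠ ⊤ := by
    intro e
    have := absNorm_nat (K := K) l
    rw [e, Ideal.absNorm_top] at this
    have h2 : 1 < l ^ Module.finrank ℚ K := Nat.one_lt_pow Module.finrank_pos.ne' hl.one_lt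
    omega
  obtain ⟨P, hP, hle⟩ := Ideal.exists_le_maximal _ h1
  have hm : (l : 𝓞 K) ∈ P := hle (Ideal.mem_span_singleton_self _)
  refine ⟨P, hP.isPrime, ?_, hm⟩
  rintro rfl
  rw [Ideal.mem_bot] at hm
  exact hl.ne_zero (by exact_mod_cast hm)

lemma prime_ne_bot {l : ℕ} (hl : l ≠ 0) {P : Ideal (𝓞 K)} (hm : (l : 𝓞 K) ∈ P) : P ≠ ⊥ := by
  rintro rfl
  rw [Ideal.mem_bot] at hm
  exact hl (by exact_mod_cast hm)

lemma coprime_mem {m n : ℕ} (h : Nat.Coprime m n) {P : Ideal (𝓞 K)} (hP : P.IsPrime) (hm : (m : 𝓞 K) ∈ P)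
    (hn : (n : 𝓞 K) ∈ P) : False := by
  have h1 : IsCoprime (m : ℤ) (n : ℤ) := Nat.isCoprime_iff_coprime.2 h
  obtain ⟨a, b, e⟩ := h1
  apply hP.ne_top
  rw [Ideal.eq_top_iff_one]
  have : (1 : 𝓞 K) = a * m + b * n := by exact_mod_cast (congrArg (Int.cast : ℤ → 𝓞 K) e).symm
  rw [this]
  exact P.add_mem (P.mul_mem_left _ hm) (P.mul_mem_left _ hn)

/-- parity obstruction -/
lemma odd_nsq {P J : Ideal (𝓞 K)} (hP : P.IsPrime) (hP0 : P ≠ ⊥) {m : 𝓞 K} {k : ℕ} (hk : Odd k)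
    (hm : Ideal.span {m} = P ^ k * J) (hJ : ¬ J ≤ P) (I : Ideal (𝓞 K)) (a : 𝓞 K) (ha : a ≠ 0) :
    I * I ≠ Ideal.span {a * a * m} := by
  intro e
  have hPp : Prime P := (Ideal.prime_iff_isPrime hP0).2 hP
  have hJ0 : J ≠ ⊥ := by rintro rfl; exact hJ bot_le
  have e2 : I * I = Ideal.span {a} * Ideal.span {a} * (P ^ k * J) := by
    rw [e, ← hm, Ideal.span_singleton_mul_span_singleton, Ideal.span_singleton_mul_span_singleton]
  have ha0 : Ideal.span {a} ≠ ⊥ := by rwa [Ne, Ideal.span_singleton_eq_bot]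
  have hI0 : I ≠ ⊥ := by
    rintro rfl
    rw [Ideal.bot_mul] at e2
    exact mul_ne_zero (mul_ne_zero ha0 ha0) (mul_ne_zero (pow_ne_zero k hP0) hJ0) e2.symm
  have h1 := congrArg (emultiplicity P) e2
  have fI : FiniteMultiplicity P I := FiniteMultiplicity.of_prime_left hPp hI0
  have fa : FiniteMultiplicity P (Ideal.span {a}) := FiniteMultiplicity.of_prime_left hPp ha0
  have hJm : emultiplicity P J = 0 := emultiplicity_eq_zero.2 (by rwa [Ideal.dvd_iff_le])
  rw [emultiplicity_mul hPp, emultiplicity_mul hPp, emultiplicity_mul hPp, emultiplicity_mul hPp,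
    emultiplicity_pow_self_of_prime hPp, hJm, fI.emultiplicity_eq_multiplicity, fa.emultiplicity_eq_multiplicity] at h1
  norm_cast at h1
  obtain ⟨j, rfl⟩ := hk
  omega

/-- `P^h` principal -/
lemma sq_two_gen (hodd : Odd (Nat.card (ClassGroup (𝓞 K)))) (hdeg : Module.finrank ℚ K = 2)
    {P : Ideal (𝓞 K)} (hP : P.IsPrime) (h2 : (2 : 𝓞 K) ∈ P ^ 2) :
    ∃ (h : ℕ) (π : 𝓞 K) (v : (𝓞 K)ˣ), Odd h ∧ π ^ 2 = 2 ^ h * v := by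
  have h2' : (2 : 𝓞 K) ∈ P := Ideal.pow_le_self (by norm_num) h2
  have hP0 : P ≠ ⊥ := prime_ne_bot (l := 2) (by norm_num) (by exact_mod_cast h2')
  have hN : Ideal.absNorm (Ideal.span {(2 : 𝓞 K)}) = 4 := by
    have := absNorm_nat (K := K) 2
    rw [hdeg] at this; exact_mod_cast this
  have h4 : Ideal.span {(2 : 𝓞 K)} = P ^ 2 := by
    apply ext_of_absNorm
    · rw [Ne, Ideal.span_singleton_eq_bot]; exact two_ne_zero
    · rwa [Ideal.span_singleton_le_iff_mem]
    · have hle : Ideal.span {(2 : 𝓞 K)} ≤ P ^ 2 := by rwa [Ideal.span_singleton_le_iff_mem]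
      have hd := Ideal.absNorm_dvd_absNorm_of_le hle
      rw [hN, map_pow] at hd
      have h1 : Ideal.absNorm P ≠ 1 := by rw [Ne, Ideal.absNorm_eq_one_iff]; exact hP.ne_top
      have h0 : Ideal.absNorm P ≠ 0 := by rw [Ne, Ideal.absNorm_eq_zero_iff]; exact hP0
      rw [hN, map_pow]
      have := Nat.le_of_dvd (by norm_num) hd
      have : 2 ≤ Ideal.absNorm P := by omega
      nlinarith
  set h := Nat.card (ClassGroup (𝓞 K))
  have h5 : cl (P ^ h) = 1 := by rw [cl_pow hP0]; exact pow_card_eq_one'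
  rw [cl_eq_one_iff (pow_ne_zero h hP0)] at h5
  obtain ⟨π, hπ⟩ : ∃ π, P ^ h = Ideal.span {π} := by
    first
    | exact h5
    | (obtain ⟨x, hx⟩ := h5; exact ⟨x, hx⟩)
    | (obtain ⟨x, _, hx⟩ := h5; exact ⟨x, hx⟩)
  have h6 : Ideal.span {(2 : 𝓞 K) ^ h} = Ideal.span {π ^ 2} := by
    rw [← Ideal.span_singleton_pow, h4, ← Ideal.span_singleton_pow, ← hπ, ← pow_mul, ← pow_mul, mul_comm]
  rw [Ideal.span_singleton_eq_span_singleton] at h6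
  obtain ⟨v, hv⟩ := h6
  exact ⟨h, π, v, hodd, hv.symm⟩

/-- units in degree two -/
lemma units_gen2 [IsTotallyReal K] (φ : K →+* ℝ) (hdeg : Module.finrank ℚ K = 2) {w : (𝓞 K)ˣ}
    (h1 : ¬ ∃ y : K, y * y = (w : K)) (h2 : ¬ ∃ y : K, y * y = -(w : K)) (u : (𝓞 K)ˣ) :
    ∃ v : (𝓞 K)ˣ, u = v ^ 2 ∨ u = -v^2 ∨ u = w * v^2 ∨ u = - (w * v^2) := by
  have hi := unit_index K φ
  rw [hdeg] at hi
  have hmem : ∀ {x : (𝓞 K)ˣ}, x ∈ (powMonoidHom 2 : (𝓞 K)ˣ →* (𝓞 K)ˣ).range ↔ ∃ v, v ^ 2 = x := by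
    intro x; exact Iff.rfl
  have cs := four_cosets (R := (powMonoidHom 2 : (𝓞 K)ˣ →* (𝓞 K)ˣ).range) (N := ⊤)
    (by rw [Subgroup.relIndex_top_right, hi]; norm_num) (by rw [Subgroup.relIndex_top_right, hi]; norm_num)
    (fun e _ => hmem.2 ⟨e, sq e⟩) (e₁ := -1) (e₂ := w) trivial trivial
    (by
      intro h
      obtain ⟨v, hv⟩ := hmem.1 h
      have : ((v : 𝓞 K) : K) ^ 2 = -1 := by
        have := congrArg (fun x : (𝓞 K)ˣ => ((x : 𝓞 K) : K)) hv
        simpa using this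
      have h3 := congrArg φ this
      rw [map_pow, map_neg, map_one] at h3
      nlinarith [sq_nonneg (φ ((v : 𝓞 K) : K))])
    (by
      intro h
      obtain ⟨v, hv⟩ := hmem.1 h
      exact h1 ⟨((v : 𝓞 K) : K), by rw [← hv]; push_cast; ring⟩)
    (by
      intro h
      obtain ⟨v, hv⟩ := hmem.1 h
      exact h2 ⟨((v : 𝓞 K) : K), by
        have := congrArg (fun x : (𝓞 K)ˣ => ((x : 𝓞 K) : K)) hv
        simp at this
        rw [← sq, this]⟩)
    (e := u) trivial
  have inv : ∀ {x y v : (𝓞 K)ˣ}, v ^ 2 = x * y → x = y * (v * y⁻¹) ^ 2 := by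
    intro x y v h
    rw [mul_pow, h]
    rw [inv_pow, sq, mul_inv]
    calc x = x * (y * y⁻¹) * (y * y⁻¹) := by simp
      _ = _ := by ac_rfl
  rcases cs with h | h | h | h
  · obtain ⟨v, hv⟩ := hmem.1 h; exact ⟨v, Or.inl hv.symm⟩
  · obtain ⟨v, hv⟩ := hmem.1 h
    exact ⟨v, Or.inr (Or.inl ((inv hv).trans (by simp)))⟩
  · obtain ⟨v, hv⟩ := hmem.1 h
    exact ⟨_, Or.inr (Or.inr (Or.inl (inv hv)))⟩
  · obtain ⟨v, hv⟩ := hmem.1 h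
    exact ⟨v * w⁻¹, Or.inr (Or.inr (Or.inr ((inv hv).trans (by simp))))⟩

end

section
variable {K L : Type*} [Field K] [NumberField K] [Field L] [NumberField L] [Algebra K L]
variable {σ : L ≃+* L} {s : L}

lemma unram (h : IsQuad K L σ s) {P : Ideal (𝓞 L)} (hP : P.IsPrime) (hP0 : P ≠ ⊥) (hR : P ∉ RP K σ)
    {c : 𝓞 K} (hc : c ∉ (P.comap (algebraMap (𝓞 K) (𝓞 L))) ^ 2) : algebraMap (𝓞 K) (𝓞 L) c ∉ P ^ 2 := by
  by_cases hs : sI σ P = P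
  · have h1 : ∃ a : Ideal (𝓞 K), P = a.map (algebraMap (𝓞 K) (𝓞 L)) := by
      by_contra hn
      push Not at hn
      exact hR ⟨hP, hP0, hs, hn⟩
    obtain ⟨a, rfl⟩ := h1
    intro hm
    rw [← Ideal.map_pow] at hm
    exact hc (Ideal.pow_right_mono Ideal.le_comap_map 2 (mem_of_mem_ext hm))
  · exact not_mem_sq_of_ne h hP hP0 hs hc

lemma rat_not_sq {l : ℕ} (hl : l.Prime) {p : Ideal (𝓞 ℚ)} (hp : p.IsPrime) (hm : (l : 𝓞 ℚ) ∈ p) {c : ℤ}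
    (hc : ¬ (l:ℤ)^2 ∣ c) : (c : 𝓞 ℚ) ∉ p ^ 2 := by
  rw [rat_span hl hp hm, Ideal.span_singleton_pow, Ideal.mem_span_singleton]
  intro h
  apply hc
  apply rat_dvd
  push_cast; exact h

lemma rat_unram (h : IsQuad ℚ L σ s) {P : Ideal (𝓞 L)} (hP : P.IsPrime) (hR : P ∉ RP ℚ σ)
    {l : ℕ} (hl : l.Prime) (hm : (l : 𝓞 L) ∈ P) {c : ℤ}
    (hc : ¬ (l:ℤ)^2 ∣ c) : (c : 𝓞 L) ∉ P ^ 2 := by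
  have := unram h hP (prime_ne_bot hl.ne_zero hm) hR
    (rat_not_sq hl (Ideal.IsPrime.comap (algebraMap (𝓞 ℚ) (𝓞 L)) (K := P)) (by simpa using hm) hc)
  simpa using this

lemma SQ (h : IsQuad K L σ s) {c x : K} (hc : s * s = algebraMap K L c) {y : L} (hy : y * y = algebraMap K L x) :
    IsSquare x ∨ IsSquare (x * c) := by
  have inj := (algebraMap K L).injective
  have h1 : (σ y - y) * (σ y + y) = 0 := by
    have : σ y * σ y = y * y := by rw [← map_mul, hy, h.fix]
    linear_combination this
  rcases mul_eq_zero.1 h1 with e | e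
  · obtain ⟨a, ha⟩ := h.fixed (sub_eq_zero.1 e)
    left
    exact ⟨a, inj (by rw [map_mul, ← ha, hy])⟩
  · obtain ⟨a, ha⟩ := h.fixed (x := y * s) (by rw [map_mul, h.σs, eq_neg_of_add_eq_zero_left e]; ring)
    right
    exact ⟨a, inj (by rw [map_mul, map_mul, ← ha, ← hy, ← hc]; ring)⟩
end
end

section
section
variable {L : Type*} [Field L] [NumberField L]

@[simp] lemma v_mul (x y : 𝓞 L) : ((x * y : 𝓞 L) : L) = x * y := rfl
@[simp] lemma v_add (x y : 𝓞 L) : ((x + y : 𝓞 L) : L) = x + y := rfl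
@[simp] lemma v_sub (x y : 𝓞 L) : ((x - y : 𝓞 L) : L) = x - y := rfl
@[simp] lemma v_neg (x : 𝓞 L) : ((-x : 𝓞 L) : L) = -x := rfl
@[simp] lemma v_one : ((1 : 𝓞 L) : L) = 1 := rfl
@[simp] lemma v_zero : ((0 : 𝓞 L) : L) = 0 := rfl
@[simp] lemma v_pow (x : 𝓞 L) (n : ℕ) : ((x ^ n : 𝓞 L) : L) = x ^ n := map_pow (algebraMap (𝓞 L) L) x n
@[simp] lemma v_nat (n : ℕ) : ((n : 𝓞 L) : L) = n := map_natCast (algebraMap (𝓞 L) L) n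
@[simp] lemma v_int (n : ℤ) : ((n : 𝓞 L) : L) = n := map_intCast (algebraMap (𝓞 L) L) n
@[simp] lemma v_two : ((2 : 𝓞 L) : L) = 2 := map_ofNat (algebraMap (𝓞 L) L) 2
@[simp] lemma v_mk {x : L} (hx) : ((⟨x, hx⟩ : 𝓞 L) : L) = x := rfl
@[simp] lemma v_alg (x : 𝓞 L) : algebraMap (𝓞 L) L x = (x : L) := rfl

lemma intSqrt {d : L} {m : ℕ} (hd : d * d = m) : ∃ D : 𝓞 L, (D : L) = d ∧ D * D = m := by
  have h1 : IsIntegral ℤ d := by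
    apply IsIntegral.of_pow (n := 2) (by norm_num)
    rw [sq, hd]; exact isIntegral_algebraMap (R := ℤ) (x := (m : ℤ)) |> fun h => by simpa using h
  obtain ⟨D, hD⟩ : ∃ D : 𝓞 L, (D : L) = d := ⟨⟨d, h1⟩, rfl⟩
  refine ⟨D, hD, ?_⟩
  apply RingOfIntegers.ext
  rw [v_mul, v_nat, hD]; exact hd

lemma intHalf {d : L} {m : ℕ} (hd : d * d = (1 + 4 * m : ℕ)) : ∃ θ : 𝓞 L, 2 * (θ : L) = 1 + d ∧ θ * θ = θ + m := by
  have e : ((1 + d) / 2) * ((1 + d) / 2) = (1 + d)/2 + m := by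
    push_cast at hd
    linear_combination hd / 4
  have h1 : IsIntegral ℤ ((1 + d) / 2) := by
    refine ⟨Polynomial.X ^ 2 - Polynomial.X - Polynomial.C (m : ℤ), ?_, ?_⟩
    · monicity!
    · simp only [Polynomial.eval₂_sub, Polynomial.eval₂_pow, Polynomial.eval₂_X, Polynomial.eval₂_C]
      rw [sq, e]; simp
  obtain ⟨D, hD⟩ : ∃ D : 𝓞 L, (D : L) = (1 + d) / 2 := ⟨⟨_, h1⟩, rfl⟩
  refine ⟨D, ?_, ?_⟩
  · rw [hD]; ring
  · apply RingOfIntegers.ext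
    rw [v_mul, v_add, v_nat, hD]; exact e

/-- ramification of two -/
lemma two_ram {η q : ℕ} (hη : η = 1 ∨ η = 2) (hq : q % 4 = 3) {a : 𝓞 L} (ha : a * a = (η * q : ℕ))
    {P : Ideal (𝓞 L)} (hP : P.IsPrime) (h2 : (2 : 𝓞 L) ∈ P) : (2 : 𝓞 L) ∈ P ^ 2 := by
  have hodd : ∀ m : ℕ, m % 2 = 1 → (m : 𝓞 L) ∉ P := by
    intro m hm h
    exact coprime_mem (m := 2) (n := m) (by rw [Nat.coprime_two_left, Nat.odd_iff]; exact hm) hP (by exact_mod_cast h2) h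
  rcases hη with rfl | rfl
  · obtain ⟨k, rfl⟩ : ∃ k, q = 4 * k + 3 := ⟨q / 4, by omega⟩
    have haP : a ∉ P := by
      intro h
      apply hodd (1 * (4 * k + 3)) (by omega)
      rw [← ha]; exact P.mul_mem_left _ h
    have e : (1 + a) * (1 + a) = 2 * (a + 2 * (k + 1 : ℕ)) := by
      have : (1 + a) * (1 + a) = 1 + 2 * a + a * a := by ring
      rw [this, ha]; push_cast; ring
    have h3 : 1 + a ∈ P := by
      have : (1 + a) * (1 + a) ∈ P := by rw [e]; exact P.mul_mem_right _ h2
      rcases hP.mem_or_mem this with h | h <;> exact h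
    have h4 : (a + 2 * (k + 1 : ℕ)) * 2 ∈ P ^ 2 := by
      rw [mul_comm, ← e, sq]; exact Ideal.mul_mem_mul h3 h3
    rcases Ideal.IsPrime.mul_mem_pow P h4 with h | h
    · exact absurd ((P.add_mem_iff_left (P.mul_mem_right _ h2)).1 h) haP
    · exact h
  · have e : a * a = 2 * (q : 𝓞 L) := by rw [ha]; push_cast; ring
    have h3 : a ∈ P := by
      have : a * a ∈ P := by rw [e]; exact P.mul_mem_right _ h2
      rcases hP.mem_or_mem this with h | h <;> exact h
    have h4 : (q : 𝓞 L) * 2 ∈ P ^ 2 := by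
      rw [mul_comm, ← e, sq]; exact Ideal.mul_mem_mul h3 h3
    rcases Ideal.IsPrime.mul_mem_pow P h4 with h | h
    · exact absurd h (hodd q (by omega))
    · exact h

lemma absNorm_span_norm (x : 𝓞 L) : ((Ideal.absNorm (Ideal.span {x}) : ℕ) : ℚ) = |Algebra.norm ℚ (x : L)| := by
  rw [Ideal.absNorm_span_singleton]
  have h := Algebra.coe_norm_int x
  rw [← h, Nat.cast_natAbs]
  push_cast; rfl

variable {σ : L ≃+* L} {s : L}

lemma rat_nsq (h : IsQuad ℚ L σ s) {c : ℤ} (hs : s * s = c) {l : ℕ} [Fact l.Prime]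
    (hc : (l:ℤ) ∣ c) (hc2 : ¬ (l:ℤ)^2 ∣ c) {I : Ideal (𝓞 L)} (hI : I ≠ ⊥) {n : ℕ} (hn : Ideal.absNorm I = n)
    (n1 : ¬ IsSquare ((n : ℤ) : ZMod l)) (n2 : ¬ IsSquare ((-n : ℤ) : ZMod l)) : ¬ IsSquare (cl I) := by
  rintro ⟨c', hc'⟩
  obtain ⟨J, hJ, rfl⟩ := cl_surj c'
  rw [← cl_mul hJ hJ, cl_eq_iff hI (mul_ne_zero hJ hJ)] at hc'
  obtain ⟨x, y, hx, hy, e⟩ := hc'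
  have e1 := congrArg (fun I => ((Ideal.absNorm I : ℕ) : ℚ)) e
  simp only [map_mul, Nat.cast_mul, absNorm_span_norm, hn] at e1
  obtain ⟨m, hm⟩ : ∃ m : ℚ, m = ((Ideal.absNorm J : ℕ) : ℚ) := ⟨_, rfl⟩
  rw [← hm] at e1
  have hx0 : ((x : 𝓞 L) : L) ≠ 0 := by simpa using hx
  have hN : Algebra.norm ℚ ((y : L) / x * algebraMap ℚ L m) = n ∨ Algebra.norm ℚ ((y : L) / x * algebraMap ℚ L m) = -n := by
    have hnx : Algebra.norm ℚ (x : L) ≠ 0 := by rwa [Ne, Algebra.norm_eq_zero_iff]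
    have hd : Algebra.norm ℚ ((y : L) / x) = Algebra.norm ℚ (y : L) / Algebra.norm ℚ (x : L) := by
      rw [eq_div_iff hnx, ← map_mul, div_mul_cancel₀ _ hx0]
    rw [map_mul, hd, Algebra.norm_algebraMap, h.finrank]
    rw [div_mul_eq_mul_div, div_eq_iff hnx, div_eq_iff hnx]
    rcases abs_choice (Algebra.norm ℚ (x : L)) with h1 | h1 <;>
    rcases abs_choice (Algebra.norm ℚ (y : L)) with h2 | h2 <;> rw [h1, h2] at e1
    · left; linear_combination -e1
    · right; linear_combination e1
    · right; linear_combination -e1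
    · left; linear_combination e1
  have key := h.norm_eq ((y : L) / x * algebraMap ℚ L m)
  rcases hN with e2 | e2
  · rw [e2] at key
    exact n1 (rat_norm h hs hc hc2 (z := n) _ (key.symm.trans (by simp)))
  · rw [e2] at key
    exact n2 (rat_norm h hs hc hc2 (z := -n) _ (key.symm.trans (by simp)))

end

lemma leg_nonsq {r : ℕ} [Fact r.Prime] {n : ℤ} (h : legendreSym r n = -1) : ¬ IsSquare (n : ZMod r) :=
  (legendreSym.eq_neg_one_iff r).1 h

section k1
variable {k : Type*} [Field k] [NumberField k] {σ : k ≃+* k} {d : k}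
variable {r s : ℕ} [Fact r.Prime] [Fact s.Prime]

lemma rs_mod (hr8 : r % 8 = 5) (hs8 : s % 8 = 5) : ∃ m, r * s = 1 + 4 * (2 * m) := by
  refine ⟨(r * s) / 8, ?_⟩
  have : (r * s) % 8 = 1 := by rw [Nat.mul_mod, hr8, hs8]
  omega

/-- general: any automorphism negating `√rs` ramifies only over `rs` -/
lemma rs_ram {K L : Type*} [Field K] [NumberField K] [Field L] [NumberField L] [Algebra K L]
    {σ : L ≃+* L} {x d : L} (h : IsQuad K L σ x) (hr8 : r % 8 = 5) (hs8 : s % 8 = 5)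
    (hd : d * d = (r * s : ℕ)) (hσ : σ d = - d) {P : Ideal (𝓞 L)} (hP : P ∈ RP K σ) :
    ((r * s : ℕ) : 𝓞 L) ∈ P := by
  obtain ⟨m, hm⟩ := rs_mod hr8 hs8
  obtain ⟨θ, h1, h2⟩ := intHalf (d := d) (m := 2 * m) (by rw [hd, hm])
  obtain ⟨D, h3, h4⟩ := intSqrt hd
  have h5 := RP_diff h hP θ
  have h6 : sO σ θ - θ = - D := by
    apply RingOfIntegers.ext
    have : σ (2 * (θ : L)) = 1 - d := by rw [h1, map_add, map_one, hσ]; ring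
    rw [map_mul, map_ofNat] at this
    simp only [v_sub, sO_coe, v_neg, h3]
    have h2' : (2 : L) ≠ 0 := two_ne_zero
    apply mul_left_cancel₀ h2'
    linear_combination this - h1
  rw [h6, P.neg_mem_iff] at h5
  rw [← h4]; exact P.mul_mem_left _ h5

lemma rs_prime {L : Type*} [Field L] [NumberField L] {P : Ideal (𝓞 L)} (hP : P.IsPrime) (h : ((r * s : ℕ) : 𝓞 L) ∈ P) :
    (r : 𝓞 L) ∈ P ∨ (s : 𝓞 L) ∈ P := by
  rw [Nat.cast_mul] at h; exact hP.mem_or_mem h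

lemma k1_tors (h : IsQuad ℚ k σ d) [IsTotallyReal k] (φ : k →+* ℝ) (hr8 : r % 8 = 5) (hs8 : s % 8 = 5)
    (hd : d * d = (r * s : ℕ)) : Nat.card (powMonoidHom 2 : ClassGroup (𝓞 k) →* _).ker ≤ 2 := by
  have hr : r.Prime := Fact.out
  have hs : s.Prime := Fact.out
  have h1 := rat_tors h φ {r, s} (by
    intro l hl; simp only [Finset.mem_insert, Finset.mem_singleton] at hl
    rcases hl with rfl | rfl <;> assumption) (by
    intro P hP
    rcases rs_prime hP.1 (rs_ram h hr8 hs8 hd h.σs hP) with h | h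
    · exact ⟨r, by simp, h⟩
    · exact ⟨s, by simp, h⟩)
  have h2 : (2:ℕ) ^ ({r, s} : Finset ℕ).card ≤ 2 ^ 2 := Nat.pow_le_pow_right (by norm_num) Finset.card_le_two
  have h3 := Nat.le_of_dvd (by positivity) h1
  have h4 : (nU ℚ σ).index ≠ 0 := by
    intro e; rw [e, mul_zero, zero_dvd_iff] at h1; simp at h1
  have h5 : 1 ≤ (nU ℚ σ).index := by omega
  nlinarith

/-- the two primes above `2` -/
lemma k1_two (h : IsQuad ℚ k σ d) (hr8 : r % 8 = 5) (hs8 : s % 8 = 5)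
    (hd : d * d = (r * s : ℕ)) {P : Ideal (𝓞 k)} (hP : P.IsPrime) (h2 : (2 : 𝓞 k) ∈ P) : Ideal.absNorm P = 2 := by
  obtain ⟨m, hm⟩ := rs_mod hr8 hs8
  obtain ⟨θ, h3, h4⟩ := intHalf (d := d) (m := 2 * m) (by rw [hd, hm])
  refine (two_primes (N := 1) (by norm_num) (by rw [h.finrank]) (fun P _ h => by simpa using h)
    (θ := θ) (m := -m) (τ := σ) ?_ ?_ hP h2).1
  · push_cast at h4 ⊢; linear_combination -h4
  · apply RingOfIntegers.ext
    have : σ (2 * (θ : k)) = 1 - d := by rw [h3, map_add, map_one, h.σs]; ring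
    rw [map_mul, map_ofNat] at this
    simp only [v_sub, sO_coe, v_one]
    apply mul_left_cancel₀ (two_ne_zero (α := k))
    linear_combination this + h3

lemma not_sq_dvd {r s : ℕ} (hr : r.Prime) (hs : s.Prime) (hne : r ≠ s) : ¬ (r : ℤ)^2 ∣ ((r * s : ℕ) : ℤ) := by
  rw [show (r : ℤ)^2 = ((r^2 : ℕ) : ℤ) by push_cast; rfl, Int.natCast_dvd_natCast, sq]
  intro h
  have := (mul_dvd_mul_iff_left hr.ne_zero).1 h
  exact hne ((Nat.prime_dvd_prime_iff_eq hr hs).1 this)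

lemma k1_nsq (h : IsQuad ℚ k σ d) (hr8 : r % 8 = 5) (hs8 : s % 8 = 5) (hne : r ≠ s)
    (hd : d * d = (r * s : ℕ)) {P : Ideal (𝓞 k)} (hP : P.IsPrime) (h2 : (2 : 𝓞 k) ∈ P) : ¬ IsSquare (cl P) := by
  have hr : r.Prime := Fact.out
  have hs : s.Prime := Fact.out
  refine rat_nsq h (c := (r * s : ℕ)) (by rw [hd]; push_cast; rfl) (l := r) ⟨s, by push_cast; rfl⟩
    (not_sq_dvd hr hs hne) (prime_ne_bot (l := 2) (by norm_num) (by exact_mod_cast h2)) (k1_two h hr8 hs8 hd hP h2) ?_ ?_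
  · exact leg_nonsq (by simpa using leg_two_of_five hr8)
  · apply leg_nonsq
    rw [show (-(2:ℕ) : ℤ) = (-1) * 2 by norm_num, legendreSym.mul, leg_two_of_five hr8, leg_neg_one_of_five hr8]; rfl
end k1

section F
variable {F : Type*} [Field F] [NumberField F] {σ : F ≃+* F} {a : F} {η q : ℕ} [Fact q.Prime]

lemma etaq_not_sq (hη : η = 1 ∨ η = 2) (hq : q % 4 = 3) : ¬ (q : ℤ)^2 ∣ ((η * q : ℕ) : ℤ) := by
  have hqp : q.Prime := Fact.out
  rw [show (q : ℤ)^2 = ((q^2 : ℕ) : ℤ) by push_cast; rfl, Int.natCast_dvd_natCast, sq]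
  intro h
  have := (mul_dvd_mul_iff_right hqp.ne_zero).1 h
  have h3 := Nat.le_of_dvd (by omega) this
  have := hqp.two_le
  rcases hη with rfl | rfl <;> omega

lemma F_odd (h : IsQuad ℚ F σ a) [IsTotallyReal F] (φ : F →+* ℝ) (hη : η = 1 ∨ η = 2) (hq : q % 4 = 3)
    (ha : a * a = (η * q : ℕ)) : Odd (Nat.card (ClassGroup (𝓞 F))) := by
  have hqp : q.Prime := Fact.out
  obtain ⟨A, hA, hA2⟩ := intSqrt ha
  have h1 := rat_tors h φ {2, q} (by
    intro l hl; simp only [Finset.mem_insert, Finset.mem_singleton] at hl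
    rcases hl with rfl | rfl
    · exact Nat.prime_two
    · assumption) (by
    intro P hP
    have h5 := RP_diff h hP A
    have h6 : sO σ A - A = - (2 * A) := by
      apply RingOfIntegers.ext
      simp only [v_sub, sO_coe, v_neg, v_mul, hA, h.σs, v_two]; ring
    rw [h6, P.neg_mem_iff] at h5
    rcases mem_of_four hP.1 hA2 h5 with h | h
    · exact ⟨2, by simp, h⟩
    · rw [Nat.cast_mul] at h
      rcases hP.1.mem_or_mem h with h | h
      · rcases hη with rfl | rfl
        · exact absurd ((Ideal.eq_top_iff_one _).2 (by simpa using h)) hP.1.ne_top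
        · exact ⟨2, by simp, h⟩
      · exact ⟨q, by simp, h⟩)
  have h2 : (nU ℚ σ).index ≠ 1 := neg_one_nU h (c := (η * q : ℕ)) (by rw [ha]; push_cast; rfl) hq
    ⟨η, by push_cast; ring⟩ (etaq_not_sq hη hq)
  have h3 := pow_two_bound (t := 0) (h1.trans (pow_dvd_pow 2 Finset.card_le_two)) h2
  apply odd_card_of_tors
  have : Nat.card (powMonoidHom 2 : ClassGroup (𝓞 F) →* _).ker ≠ 0 := Nat.card_pos.ne'
  omega

lemma F_pi (h : IsQuad ℚ F σ a) [IsTotallyReal F] (φ : F →+* ℝ) (hη : η = 1 ∨ η = 2) (hq : q % 4 = 3)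
    (ha : a * a = (η * q : ℕ)) : ∃ (m : ℕ) (π : 𝓞 F) (v : (𝓞 F)ˣ), Odd m ∧ π ^ 2 = 2 ^ m * v ∧
      ∀ u : (𝓞 F)ˣ, ∃ w : (𝓞 F)ˣ, u = w ^ 2 ∨ u = -w^2 ∨ u = v * w^2 ∨ u = - (v * w^2) := by
  have hqp : q.Prime := Fact.out
  obtain ⟨A, hA, hA2⟩ := intSqrt ha
  obtain ⟨P, hP, hP0, h2⟩ := exists_prime_over (K := F) Nat.prime_two
  obtain ⟨m, π, v, hm, hv⟩ := sq_two_gen (F_odd h φ hη hq ha) h.finrank hP (two_ram hη hq hA2 hP (by exact_mod_cast h2))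
  have hv' : (π : F) ^ 2 = 2 ^ m * ((v : 𝓞 F) : F) := by
    have := congrArg (fun x : 𝓞 F => (x : F)) hv
    simpa using this
  refine ⟨m, π, v, hm, hv, units_gen2 φ h.finrank ?_ ?_⟩
  · rintro ⟨y, hy⟩
    obtain ⟨k, rfl⟩ := hm
    change y * y = ((v : 𝓞 F) : F) at hy
    have hy0 : y ≠ 0 := by
      rintro rfl
      rw [mul_zero] at hy
      exact v.ne_zero (RingOfIntegers.ext (by simpa using hy.symm))
    have h4 : ((π : F) / (2 ^ k * y)) * ((π : F) / (2 ^ k * y)) = algebraMap ℚ F 2 := by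
      field_simp
      rw [hv', ← hy, map_ofNat]; ring
    have h5 := SQ h (c := (η * q : ℕ)) (by rw [ha]; simp) h4
    rcases h5 with h5 | h5
    · have : IsSquare ((2 : ℕ) : ℚ) := by exact_mod_cast h5
      rw [Rat.isSquare_natCast_iff] at this
      exact Nat.prime_two.not_isSquare this
    · have : IsSquare ((2 * (η * q) : ℕ) : ℚ) := by exact_mod_cast h5
      rw [Rat.isSquare_natCast_iff] at this
      rcases hη with rfl | rfl
      · obtain ⟨t, ht⟩ := this
        have h6 : t * t % 4 = (t % 4) * (t % 4) % 4 := Nat.mul_mod _ _ _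
        have h7 : t % 4 < 4 := Nat.mod_lt _ (by norm_num)
        generalize t % 4 = u at *
        interval_cases u <;> omega
      · obtain ⟨t, ht⟩ := this
        have h8 : 2 ∣ t * t := ⟨2 * q, by rw [← ht]⟩
        have h9 : 2 ∣ t := by rcases (Nat.prime_two.dvd_mul).1 h8 with h | h <;> exact h
        obtain ⟨t', rfl⟩ := h9
        have h10 : q = t' * t' := by nlinarith
        exact hqp.not_isSquare ⟨t', h10⟩
  · rintro ⟨y, hy⟩
    have h3 := congrArg φ hv'
    have h4 := congrArg φ hy
    simp only [map_mul, map_pow, map_neg, map_ofNat] at h3 h4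
    have h5 : 0 ≤ φ (π : F) ^ 2 := sq_nonneg _
    have h6 : 0 ≤ φ y * φ y := mul_self_nonneg _
    have h7 : φ ((v : 𝓞 F) : F) ≠ 0 := by
      rw [Ne, map_eq_zero]
      intro e
      exact v.ne_zero (RingOfIntegers.ext (by simpa using e))
    have h8 : φ ((v : 𝓞 F) : F) < 0 := lt_of_le_of_ne (by linarith) h7
    have : (0:ℝ) < 2 ^ m := by positivity
    nlinarith

end F
end

section
/-- numerical data -/
structure Nm (η q r s : ℕ) (a0 b0 A B ε0 ε1 : ℤ) [Fact q.Prime] [Fact r.Prime] [Fact s.Prime] : Prop where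
  hη : η = 1 ∨ η = 2
  hq4 : q % 4 = 3
  hr8 : r % 8 = 5
  hs8 : s % 8 = 5
  hne : r ≠ s
  lr : legendreSym r (η * q : ℕ) = 1
  ls : legendreSym s (η * q : ℕ) = 1
  lrs : legendreSym r s = 1
  lsr : legendreSym s r = 1
  hε0 : ε0 = 1 ∨ ε0 = -1
  hε1 : ε1 = 1 ∨ ε1 = -1
  e1 : r * a0 ^ 2 - s * b0 ^ 2 = ε0
  e2 : r * A ^ 2 - (η * q * s : ℕ) * B ^ 2 = ε1

lemma Nm.nqr {η q r s : ℕ} {a0 b0 A B ε0 ε1 : ℤ} [Fact q.Prime] [Fact r.Prime] [Fact s.Prime] (M : Nm η q r s a0 b0 A B ε0 ε1) : q ≠ r := by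
  rintro rfl; have := M.hr8; have := M.hq4; omega

lemma Nm.nqs {η q r s : ℕ} {a0 b0 A B ε0 ε1 : ℤ} [Fact q.Prime] [Fact r.Prime] [Fact s.Prime] (M : Nm η q r s a0 b0 A B ε0 ε1) : q ≠ s := by
  rintro rfl; have := M.hs8; have := M.hq4; omega

/-- biquadratic field data -/
structure Bq (η q r s : ℕ) {k1 k2 F K : Type*} [Field k1] [Field k2] [Field F] [Field K]
    [NumberField k1] [NumberField k2] [NumberField F] [NumberField K]
    [Algebra k1 K] [Algebra k2 K] [Algebra F K]
    (ρ1 : k1 ≃+* k1) (ρ2 : k2 ≃+* k2) (ρF : F ≃+* F) (σ1 σ2 τ : K ≃+* K) (d1 : k1) (d2 : k2) (aF : F)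
    (a d : K) : Prop where
  q1 : IsQuad ℚ k1 ρ1 d1
  q2 : IsQuad ℚ k2 ρ2 d2
  qF : IsQuad ℚ F ρF aF
  Q1 : IsQuad k1 K σ1 a
  Q2 : IsQuad k2 K σ2 d
  QF : IsQuad F K τ d
  c1 : algebraMap k1 K d1 = d
  c2 : algebraMap k2 K d2 = a * d
  cF : algebraMap F K aF = a
  ha : a * a = (η * q : ℕ)
  hd : d * d = (r * s : ℕ)

lemma unit_of_sq {L : Type*} [Field L] [NumberField L] {y : L} {v : (𝓞 L)ˣ} (h : y * y = ((v : 𝓞 L) : L)) :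
    ∃ u : (𝓞 L)ˣ, ((u : 𝓞 L) : L) = y := by
  have h1 : IsIntegral ℤ y := by
    apply IsIntegral.of_pow (n := 2) (by norm_num)
    rw [sq, h]; exact (v : 𝓞 L).2
  obtain ⟨Y, hY⟩ : ∃ Y : 𝓞 L, (Y : L) = y := ⟨⟨y, h1⟩, rfl⟩
  have h2 : Y * Y = v := by
    apply RingOfIntegers.ext; rw [v_mul, hY, h]
  have h3 : IsUnit Y := by
    apply isUnit_of_mul_isUnit_left (y := Y); rw [h2]; exact v.isUnit
  exact ⟨h3.unit, by simpa using hY⟩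

lemma unit_val_ne {L : Type*} [Field L] [NumberField L] (v : (𝓞 L)ˣ) : ((v : 𝓞 L) : L) ≠ 0 := by
  intro h
  exact v.ne_zero (RingOfIntegers.ext h)

lemma unit_val_inv {L : Type*} [Field L] [NumberField L] (v : (𝓞 L)ˣ) :
    (((v⁻¹ : (𝓞 L)ˣ) : 𝓞 L) : L) = (((v : 𝓞 L) : L))⁻¹ := by
  apply eq_inv_of_mul_eq_one_left
  rw [← v_mul, Units.inv_mul, v_one]

lemma unit_val_mul {L : Type*} [Field L] [NumberField L] (v w : (𝓞 L)ˣ) :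
    (((v * w : (𝓞 L)ˣ) : 𝓞 L) : L) = ((v : 𝓞 L) : L) * ((w : 𝓞 L) : L) := by
  rw [Units.val_mul, v_mul]

/-- Pell-type units: `X = ρ a + b √D`, `X² = ρ w`. -/
lemma pell_unit {k : Type*} [Field k] [NumberField k] {σ : k ≃+* k} {e : k} (h : IsQuad ℚ k σ e) {m n : ℕ}
    (he : e * e = (m * n : ℕ)) {a b ε : ℤ} (hε : ε = 1 ∨ ε = -1) (hp : m * a ^ 2 - n * b ^ 2 = ε) :
    ∃ (X : 𝓞 k) (w : (𝓞 k)ˣ), (X : k) = m * a + b * e ∧ X * X = m * w ∧ X * sO σ X = m * (ε : 𝓞 k) ∧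
      ((w : 𝓞 k) : k) = (m * a ^ 2 + n * b^2) + 2 * a * b * e ∧ w * sO σ w = 1 := by
  obtain ⟨D, hD, hDD⟩ := intSqrt he
  have hDD' : D * D = m * n := by rw [hDD]; push_cast; rfl
  have hp' : (m : 𝓞 k) * a ^ 2 - n * b ^ 2 = ε := by exact_mod_cast hp
  have hε' : (ε : 𝓞 k) * ε = 1 := by rcases hε with rfl | rfl <;> simp
  have hσD : sO σ D = - D := by
    apply RingOfIntegers.ext; rw [sO_coe, v_neg, hD, h.σs]
  set w : 𝓞 k := (m * a ^ 2 + n * b^2) + 2 * a * b * D with hw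
  have hσw : sO σ w = (m * a ^ 2 + n * b^2) - 2 * a * b * D := by
    simp only [hw, map_add, map_mul, map_pow, map_natCast, map_intCast, map_ofNat, hσD]; ring
  have hww : w * sO σ w = 1 := by
    rw [hσw, hw, ← hε', ← hp']
    linear_combination (-4 * a^2 * b^2) * hDD'
  have hww' : sO σ w * w = 1 := by rw [mul_comm]; exact hww
  refine ⟨m * a + b * D, ⟨w, sO σ w, hww, hww'⟩, ?_, ?_, ?_, ?_, hww⟩
  · simp only [v_add, v_mul, v_nat, v_int, hD]
  · change _ = m * w
    rw [hw]; linear_combination b^2 * hDD'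
  · simp only [map_add, map_mul, map_natCast, map_intCast, hσD]
    rw [← hp']; linear_combination (-b^2) * hDD'
  · change (w : k) = _
    rw [hw]; simp only [v_add, v_mul, v_nat, v_int, v_pow, v_two, hD]

/-- all units are generated by `-1, w` up to squares -/
lemma pell_gen {k : Type*} [Field k] [NumberField k] [IsTotallyReal k] (φ : k →+* ℝ) {σ : k ≃+* k} {e : k} (h : IsQuad ℚ k σ e)
    {r n : ℕ} (hr : r.Prime) (hrn : ¬ r ∣ n) (hns : ¬ IsSquare n)
    (he : e * e = (r * n : ℕ)) {X : 𝓞 k} {w : (𝓞 k)ˣ} (hX : X * X = r * w) (u : (𝓞 k)ˣ) :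
    ∃ v : (𝓞 k)ˣ, u = v ^ 2 ∨ u = -v^2 ∨ u = w * v^2 ∨ u = - (w * v^2) := by
  have hX' : (X : k) * X = r * ((w : 𝓞 k) : k) := by
    have := congrArg (fun x : 𝓞 k => (x : k)) hX
    simpa using this
  have hr0 : (r : k) ≠ 0 := by exact_mod_cast hr.ne_zero
  refine units_gen2 φ h.finrank ?_ ?_ u
  · rintro ⟨y, hy⟩
    change y * y = ((w : 𝓞 k) : k) at hy
    have hy0 : y ≠ 0 := by
      rintro rfl
      exact unit_val_ne w (by rw [← hy]; ring)
    have h4 : ((X : k) / y) * ((X : k) / y) = algebraMap ℚ k r := by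
      rw [div_mul_div_comm, hX', ← hy, mul_div_assoc, div_self (mul_ne_zero hy0 hy0)]; simp
    have h5 := SQ h (c := (r * n : ℕ)) (by rw [he]; simp) h4
    rcases h5 with h5 | h5
    · rw [Rat.isSquare_natCast_iff] at h5
      exact hr.not_isSquare h5
    · have : IsSquare ((r * (r * n) : ℕ) : ℚ) := by exact_mod_cast h5
      rw [Rat.isSquare_natCast_iff] at this
      obtain ⟨t, ht⟩ := this
      have h8 : r ∣ t := by
        have : r ∣ t * t := ⟨r * n, by rw [← ht]⟩
        rcases (hr.dvd_mul).1 this with h | h <;> exact h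
      obtain ⟨t', rfl⟩ := h8
      apply hns
      refine ⟨t', ?_⟩
      have : r * (r * n) = r * (r * (t' * t')) := by rw [ht]; ring
      exact Nat.eq_of_mul_eq_mul_left hr.pos (Nat.eq_of_mul_eq_mul_left hr.pos this)
  · rintro ⟨y, hy⟩
    change y * y = -((w : 𝓞 k) : k) at hy
    have h3 := congrArg φ hX'
    have h4 := congrArg φ hy
    simp only [map_mul, map_neg, map_natCast] at h3 h4
    have h5 : 0 ≤ φ (X : k) * φ (X : k) := mul_self_nonneg _
    have h6 : 0 ≤ φ y * φ y := mul_self_nonneg _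
    have h7 : φ ((w : 𝓞 k) : k) ≠ 0 := by
      rw [Ne, map_eq_zero]; exact unit_val_ne w
    have h8 : φ ((w : 𝓞 k) : k) < 0 := lt_of_le_of_ne (by linarith) h7
    have : (0:ℝ) < r := by exact_mod_cast hr.pos
    nlinarith

section
variable {η q r s : ℕ} {a0 b0 A B ε0 ε1 : ℤ} [Fact q.Prime] [Fact r.Prime] [Fact s.Prime]
variable {k1 k2 F K : Type*} [Field k1] [Field k2] [Field F] [Field K]
    [NumberField k1] [NumberField k2] [NumberField F] [NumberField K]
    [Algebra k1 K] [Algebra k2 K] [Algebra F K]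
    {ρ1 : k1 ≃+* k1} {ρ2 : k2 ≃+* k2} {ρF : F ≃+* F} {σ1 σ2 τ : K ≃+* K} {d1 : k1} {d2 : k2} {aF : F}
    {a d : K}

namespace Bq
variable (H : Bq η q r s ρ1 ρ2 ρF σ1 σ2 τ d1 d2 aF a d)
include H

lemma d0 : d ≠ 0 := H.Q2.s0
lemma an0 : a ≠ 0 := H.Q1.s0
lemma σ1d : σ1 d = d := by rw [← H.c1, H.Q1.fix]
lemma σ1a : σ1 a = -a := H.Q1.σs
lemma σ2d : σ2 d = -d := H.Q2.σs
lemma τd : τ d = -d := H.QF.σs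
lemma τa : τ a = a := by rw [← H.cF, H.QF.fix]
lemma σ2a : σ2 a = -a := by
  have := H.Q2.fix d2
  rw [H.c2, map_mul, H.σ2d] at this
  apply mul_right_cancel₀ H.d0
  linear_combination -this

lemma gen1 (x : k1) : ∃ m n : ℚ, x = m + n * d1 := by
  obtain ⟨m, n, e⟩ := H.q1.gen x
  exact ⟨m, n, by simpa using e⟩
lemma gen (x : K) : ∃ m n m' n' : ℚ, x = m + n * d + (m' + n' * d) * a := by
  obtain ⟨u, v, e⟩ := H.Q1.gen x
  obtain ⟨m, n, hu⟩ := H.gen1 u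
  obtain ⟨m', n', hv⟩ := H.gen1 v
  refine ⟨m, n, m', n', ?_⟩
  rw [e, hu, hv]
  simp [H.c1]

lemma σ2_eq (x : K) : σ2 x = τ (σ1 x) := by
  obtain ⟨m, n, m', n', rfl⟩ := H.gen x
  simp [H.σ1d, H.σ1a, H.σ2d, H.σ2a, H.τd, H.τa]
lemma hd1 : d1 * d1 = (r * s : ℕ) := (algebraMap k1 K).injective (by rw [map_mul, H.c1, H.hd]; simp)
lemma haF : aF * aF = (η * q : ℕ) := (algebraMap F K).injective (by rw [map_mul, H.cF, H.ha]; simp)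
lemma hd2 : d2 * d2 = (r * (η * q * s) : ℕ) := (algebraMap k2 K).injective (by
  rw [map_mul, H.c2, map_natCast]
  have := H.ha; have h2 := H.hd
  push_cast at *
  linear_combination d * d * this + η * q * h2)
lemma σ1_k2 (x : k2) : σ1 (algebraMap k2 K x) = algebraMap k2 K (ρ2 x) := by
  obtain ⟨m, n, rfl⟩ := H.q2.gen x
  simp [H.c2, H.σ1d, H.σ1a, H.q2.σs]
lemma σ2_k1 (x : k1) : σ2 (algebraMap k1 K x) = algebraMap k1 K (ρ1 x) := by
  obtain ⟨m, n, rfl⟩ := H.q1.gen x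
  simp [H.c1, H.σ2d, H.σ2a, H.q1.σs]
lemma σ1_F (x : F) : σ1 (algebraMap F K x) = algebraMap F K (ρF x) := by
  obtain ⟨m, n, rfl⟩ := H.qF.gen x
  simp [H.cF, H.σ1a, H.qF.σs]
lemma deg : Module.finrank ℚ K = 4 := by
  have h1 := H.q1.finrank
  have h2 := H.Q1.finrank
  have := Module.finrank_mul_finrank ℚ k1 K
  rw [← this, h1, h2]
end Bq
end
end

section
lemma theta_ex {L : Type*} [Field L] [NumberField L] {r s : ℕ} [Fact r.Prime] [Fact s.Prime] (hr8 : r % 8 = 5) (hs8 : s % 8 = 5) {d : L}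
    (hd : d * d = (r * s : ℕ)) {τ : L ≃+* L} (hτ : τ d = -d) :
    ∃ θ m : 𝓞 L, θ * (1 - θ) = 2 * m ∧ sO τ θ = 1 - θ ∧ 2 * (θ : L) = 1 + d := by
  obtain ⟨m, hm⟩ := rs_mod hr8 hs8
  obtain ⟨θ, h3, h4⟩ := intHalf (d := d) (m := 2 * m) (by rw [hd, hm])
  refine ⟨θ, -m, ?_, ?_, h3⟩
  · push_cast at h4 ⊢; linear_combination -h4
  · apply RingOfIntegers.ext
    have : τ (2 * (θ : L)) = 1 - d := by rw [h3, map_add, map_one, hτ]; ring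
    rw [map_mul, map_ofNat] at this
    simp only [v_sub, sO_coe, v_one]
    apply mul_left_cancel₀ (two_ne_zero (α := L))
    linear_combination this + h3

lemma one_fac {K : Type*} [Field K] [NumberField K] {P : Ideal (𝓞 K)} {x : 𝓞 K} (h1 : x ∈ P) (h2 : x ∉ P ^ 2) :
    ∃ J : Ideal (𝓞 K), Ideal.span {x} = P * J ∧ ¬ J ≤ P := by
  obtain ⟨J, hJ⟩ := Ideal.dvd_iff_le.2 ((Ideal.span_singleton_le_iff_mem P).2 h1)
  refine ⟨J, hJ, fun h => h2 ?_⟩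
  rw [sq]
  apply Ideal.mul_mono_right h
  rw [← hJ]; exact Ideal.mem_span_singleton_self x

lemma two_comap {k K : Type*} [Field k] [NumberField k] [Field K] [NumberField K] [Algebra k K] {P : Ideal (𝓞 K)}
    (h : (2 : 𝓞 K) ∈ P) : (2 : 𝓞 k) ∈ P.comap (algebraMap (𝓞 k) (𝓞 K)) := by
  rw [Ideal.mem_comap]
  have : algebraMap (𝓞 k) (𝓞 K) 2 = 2 := map_ofNat _ 2
  rw [this]; exact h

lemma inv_of_odd {F K : Type*} [Field F] [NumberField F] [Field K] [NumberField K] [Algebra F K] {τ : K ≃+* K} {d : K}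
    (h : IsQuad F K τ d) (hodd : Odd (Nat.card (ClassGroup (𝓞 F)))) (x : B2 (ClassGroup (𝓞 K))) :
    mB (aCl τ) x = x⁻¹ := by
  obtain ⟨c, rfl⟩ := b2_surj x
  rw [mB_b2, eq_comm, inv_eq_iff_mul_eq_one, ← map_mul, ← jCl_nCl h, b2_eq_one]
  exact ⟨_, hodd, by rw [← map_pow, pow_card_eq_one', map_one]⟩

lemma relIndex_le_two {G : Type*} [CommGroup G] {H K : Subgroup G} {c : G} (hc : c ∈ K)
    (h : ∀ x ∈ K, x ∈ H ∨ c * x ∈ H) : H.relIndex K ≤ 2 := by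
  have := Nat.card_le_card_of_surjective
    (fun b : Bool => ((if b then (1 : K) else ⟨c, hc⟩⁻¹ : K) : K ⧸ H.subgroupOf K)) (by
    intro x
    obtain ⟨y, rfl⟩ := QuotientGroup.mk_surjective x
    rcases h y y.2 with h1 | h1
    · refine ⟨true, ?_⟩
      rw [QuotientGroup.eq]
      simpa [Subgroup.mem_subgroupOf] using h1
    · refine ⟨false, ?_⟩
      rw [QuotientGroup.eq]
      simpa [Subgroup.mem_subgroupOf] using h1)
  simpa [Subgroup.relIndex, Subgroup.index] using this

section
variable {η q r s : ℕ} {a0 b0 A B ε0 ε1 : ℤ} [Fact q.Prime] [Fact r.Prime] [Fact s.Prime]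
variable {k1 k2 F K : Type*} [Field k1] [Field k2] [Field F] [Field K]
    [NumberField k1] [NumberField k2] [NumberField F] [NumberField K]
    [Algebra k1 K] [Algebra k2 K] [Algebra F K]
    {ρ1 : k1 ≃+* k1} {ρ2 : k2 ≃+* k2} {ρF : F ≃+* F} {σ1 σ2 τ : K ≃+* K} {d1 : k1} {d2 : k2} {aF : F}
    {a d : K}

lemma F_norm (h : IsQuad ℚ F ρF aF) {m : ℕ} {π : 𝓞 F} {v : (𝓞 F)ˣ} (hv : π ^ 2 = 2 ^ m * v) :
    ∃ δ : ℤ, (δ = 1 ∨ δ = -1) ∧ π * sO ρF π = ((δ * 2 ^ m : ℤ) : 𝓞 F) := by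
  have h1 : Ideal.span {π} ^ 2 = Ideal.span {(2 : 𝓞 F)} ^ m := by
    rw [Ideal.span_singleton_pow, Ideal.span_singleton_pow, hv, Ideal.span_singleton_mul_right_unit v.isUnit]
  have h2 := congrArg Ideal.absNorm h1
  have h3 : Ideal.absNorm (Ideal.span {(2 : 𝓞 F)}) = 2 ^ 2 := by
    have := absNorm_nat (K := F) 2
    rw [h.finrank] at this
    exact_mod_cast this
  rw [map_pow, map_pow, h3, ← pow_mul, mul_comm, pow_mul] at h2
  have h4 : Ideal.absNorm (Ideal.span {π}) = 2 ^ m := Nat.pow_left_injective (n := 2) (by norm_num) h2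
  have h5 := absNorm_span_norm π
  rw [h4] at h5
  have key := h.norm_eq (π : F)
  rcases abs_choice (Algebra.norm ℚ (π : F)) with h6 | h6 <;> rw [h6] at h5
  · refine ⟨1, by simp, RingOfIntegers.ext ?_⟩
    rw [v_mul, sO_coe, ← key, ← h5, v_int]; simp
  · refine ⟨-1, by simp, RingOfIntegers.ext ?_⟩
    rw [v_mul, sO_coe, ← key, show Algebra.norm ℚ (π : F) = - ((2 ^ m : ℕ) : ℚ) by rw [h5]; ring, v_int]; simp

namespace Bq
variable (H : Bq η q r s ρ1 ρ2 ρF σ1 σ2 τ d1 d2 aF a d)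
include H

lemma units (M : Nm η q r s a0 b0 A B ε0 ε1) : ∃ (x1 : 𝓞 k1) (w1 : (𝓞 k1)ˣ) (X : 𝓞 k2) (w2 : (𝓞 k2)ˣ) (u : (𝓞 K)ˣ),
    x1 * x1 = r * w1 ∧ x1 * sO ρ1 x1 = r * (ε0 : 𝓞 k1) ∧
    ((w1 : 𝓞 k1) : k1) = (r * a0 ^ 2 + s * b0^2) + 2 * a0 * b0 * d1 ∧
    X * X = r * w2 ∧ X * sO ρ2 X = r * (ε1 : 𝓞 k2) ∧
    ((u : 𝓞 K) : K) * algebraMap k1 K x1 = algebraMap k2 K X ∧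
    ((u : 𝓞 K) : K) * σ1 ((u : 𝓞 K) : K) * algebraMap k1 K ((w1 : 𝓞 k1) : k1) = (ε1 : K) ∧
    ((u : 𝓞 K) : K) * σ2 ((u : 𝓞 K) : K) * (ε0 : K) = algebraMap k2 K ((w2 : 𝓞 k2) : k2) := by
  have hr : r.Prime := Fact.out
  obtain ⟨x1, w1, h1, h2, h3, h4, h5⟩ := pell_unit H.q1 (m := r) (n := s) H.hd1 M.hε0 M.e1
  obtain ⟨X, w2, g1, g2, g3, g4, g5⟩ := pell_unit H.q2 (m := r) (n := η * q * s) H.hd2 M.hε1 M.e2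
  have hr0 : (r : K) ≠ 0 := by exact_mod_cast hr.ne_zero
  have h2' : algebraMap k1 K x1 * algebraMap k1 K x1 = r * algebraMap k1 K ((w1 : 𝓞 k1) : k1) := by
    have := congrArg (fun x : 𝓞 k1 => algebraMap k1 K (x : k1)) h2
    simpa using this
  have g2' : algebraMap k2 K X * algebraMap k2 K X = r * algebraMap k2 K ((w2 : 𝓞 k2) : k2) := by
    have := congrArg (fun x : 𝓞 k2 => algebraMap k2 K (x : k2)) g2
    simpa using this
  have h3' : algebraMap k1 K x1 * algebraMap k1 K (ρ1 x1) = r * (ε0 : K) := by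
    have := congrArg (fun x : 𝓞 k1 => algebraMap k1 K (x : k1)) h3
    simpa using this
  have g3' : algebraMap k2 K X * algebraMap k2 K (ρ2 X) = r * (ε1 : K) := by
    have := congrArg (fun x : 𝓞 k2 => algebraMap k2 K (x : k2)) g3
    simpa using this
  have hw0 : algebraMap k1 K ((w1 : 𝓞 k1) : k1) ≠ 0 := by simpa using unit_val_ne w1
  have hx0 : algebraMap k1 K x1 ≠ 0 := by
    intro e
    rw [e, mul_zero] at h2'
    exact mul_ne_zero hr0 hw0 h2'.symm
  have hε0 : (ε0 : K) * ε0 = 1 := by rcases M.hε0 with e | e <;> simp [e]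
  have hρx0 : algebraMap k1 K (ρ1 x1) ≠ 0 := by
    intro e
    rw [e, mul_zero] at h3'
    have : (r : K) = 0 := by linear_combination (-ε0 : K) * h3' - r * hε0
    exact hr0 this
  obtain ⟨u, hu⟩ := unit_of_sq (L := K) (y := algebraMap k2 K X / algebraMap k1 K x1)
    (v := jE k2 K w2 * (jE k1 K w1)⁻¹) (by
      rw [unit_val_mul, unit_val_inv, div_mul_div_comm, h2', g2', mul_div_mul_left _ _ hr0, div_eq_mul_inv]; rfl)
  refine ⟨x1, w1, X, w2, u, h2, h3, h4, g2, g3, ?_, ?_, ?_⟩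
  · rw [hu, div_mul_cancel₀ _ hx0]
  · rw [hu, map_div₀, H.σ1_k2, H.Q1.fix, div_mul_div_comm, h2', g3', mul_div_mul_left _ _ hr0, div_mul_cancel₀ _ hw0]
  · rw [hu, map_div₀, H.σ2_k1, H.Q2.fix, div_mul_div_comm, h3', g2', mul_div_mul_left _ _ hr0]
    have hε00 : (ε0 : K) ≠ 0 := left_ne_zero_of_mul_eq_one hε0
    rw [div_mul_cancel₀ _ hε00]

lemma twoK (M : Nm η q r s a0 b0 A B ε0 ε1) {P : Ideal (𝓞 K)} (hP : P.IsPrime) (h2 : (2 : 𝓞 K) ∈ P) :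
    Ideal.absNorm P = 2 := by
  obtain ⟨θ, m, h3, h4, -⟩ := theta_ex M.hr8 M.hs8 H.hd H.τd
  obtain ⟨A', -, hA'⟩ := intSqrt H.ha
  exact (two_primes (N := 2) (by norm_num) H.deg (fun P hP h => two_ram M.hη M.hq4 hA' hP h) h3 h4 hP h2).1

lemma relNorm_two (M : Nm η q r s a0 b0 A B ε0 ε1) {P : Ideal (𝓞 K)} (hP : P.IsPrime) (h2 : (2 : 𝓞 K) ∈ P) :
    Ideal.relNorm (𝓞 k1) P = P.comap (algebraMap (𝓞 k1) (𝓞 K)) := by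
  apply relNorm_of_absNorm hP (prime_ne_bot (l := 2) (by norm_num) (by exact_mod_cast h2))
  rw [H.twoK M hP h2, k1_two H.q1 M.hr8 M.hs8 H.hd1 (Ideal.IsPrime.comap _) (two_comap h2)]

/-- `N : A(K) → A(k₁)` is onto -/
lemma N1_surj [IsTotallyReal k1] (φ : k1 →+* ℝ) (M : Nm η q r s a0 b0 A B ε0 ε1) :
    Function.Surjective (mB (nCl k1 K)) := by
  obtain ⟨P, hP, hP0, h2⟩ := exists_prime_over (K := K) Nat.prime_two
  have h2' : (2 : 𝓞 K) ∈ P := by exact_mod_cast h2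
  have h1 := k1_tors H.q1 φ M.hr8 M.hs8 H.hd1
  set G := ClassGroup (𝓞 k1)
  have hC : Nat.card (powMonoidHom 2 : B2 G →* B2 G).ker ≤ 2 := by
    have e1 : (powMonoidHom 2 : B2 G →* B2 G).ker = (dmH (mB (invMonoidHom : G →* G))).ker := by
      ext x
      obtain ⟨y, rfl⟩ := b2_surj x
      rw [mem_ker_dmH, mB_b2, MonoidHom.mem_ker]
      simp only [powMonoidHom_apply, invMonoidHom_apply, map_inv]
      rw [inv_eq_iff_mul_eq_one, sq]
    have e2 : (powMonoidHom 2 : G →* G).ker = (dmH (invMonoidHom : G →* G)).ker := by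
      ext y
      rw [mem_ker_dmH, MonoidHom.mem_ker]
      simp only [powMonoidHom_apply, invMonoidHom_apply]
      rw [inv_eq_iff_mul_eq_one, sq]
    rw [e1, card_fix_B2, ← e2]
    exact (Nat.ordProj_le 2 Nat.card_pos.ne').trans h1
  have h3 := gen_one isTwo_B2 hC (x := b2 G (cl (P.comap (algebraMap (𝓞 k1) (𝓞 K))))) (fun h =>
    k1_nsq H.q1 M.hr8 M.hs8 M.hne H.hd1 (Ideal.IsPrime.comap _) (two_comap h2') (b2_square h))
  rw [← MonoidHom.range_eq_top, eq_top_iff, ← h3, Subgroup.zpowers_le]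
  exact ⟨b2 _ (cl P), by rw [mB_b2, nCl_cl hP0, H.relNorm_two M hP h2']⟩

lemma j1_inj [IsTotallyReal k1] [IsTotallyReal F] [IsTotallyReal K] (φ : K →+* ℝ) (M : Nm η q r s a0 b0 A B ε0 ε1) :
    Function.Injective (jCl k1 K) := by
  have hr : r.Prime := Fact.out
  have hs : s.Prime := Fact.out
  have hqp : q.Prime := Fact.out
  obtain ⟨x1, w1, X, w2, u, u1, -, -, -, -, -, u3, -⟩ := H.units M
  obtain ⟨A', hA', hAA⟩ := intSqrt H.ha
  obtain ⟨m, π, v, hm, hv, -⟩ := F_pi H.qF (φ.comp (algebraMap F K)) M.hη M.hq4 H.haF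
  obtain ⟨δ, hδ, hN⟩ := F_norm H.qF hv
  have hπ0 : π ≠ 0 := by
    rintro rfl
    have : (2 ^ m * (v : 𝓞 F)) = 0 := by rw [← hv]; ring
    simp at this
  have hσA : sO σ1 A' = -A' := by apply RingOfIntegers.ext; rw [sO_coe, v_neg, hA', H.σ1a]
  have hA0 : A' ≠ 0 := by rintro rfl; exact H.an0 (by rw [← hA']; rfl)
  obtain ⟨e2, he2⟩ := unit_of_sq (L := F) (y := (π : F) / ρF π) (v := v * (sE ρF v)⁻¹) (by
    have : (π : F) * π = 2 ^ m * ((v : 𝓞 F) : F) := by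
      have := congrArg (fun x : 𝓞 F => (x : F)) hv
      simp only [v_pow, v_mul, v_two] at this
      rw [← this, sq]
    have h2 : ρF (π : F) * ρF π = 2 ^ m * ρF ((v : 𝓞 F) : F) := by rw [← map_mul, this, map_mul, map_pow, map_ofNat]
    rw [unit_val_mul, unit_val_inv, div_mul_div_comm, this, h2, mul_div_mul_left _ _ (pow_ne_zero _ two_ne_zero), div_eq_mul_inv]; rfl)
  have hπF : (π : F) ≠ 0 := fun h => hπ0 (RingOfIntegers.ext h)
  have hσπ : ∀ x : 𝓞 F, sO σ1 (algebraMap (𝓞 F) (𝓞 K) x) = algebraMap (𝓞 F) (𝓞 K) (sO ρF x) := by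
    intro x; apply RingOfIntegers.ext; exact H.σ1_F x
  -- the ideals
  obtain ⟨Pq, hPq, hPq0, hqm⟩ := exists_prime_over (K := k1) hqp
  obtain ⟨Pt, hPt, hPt0, htm⟩ := exists_prime_over (K := k1) Nat.prime_two
  have cop : ∀ {l : ℕ} {P : Ideal (𝓞 k1)}, l.Prime → l ≠ r → l ≠ s → P.IsPrime → (l : 𝓞 k1) ∈ P → P ∉ RP ℚ ρ1 := by
    intro l P hl h1 h2 hP hm hR
    rcases rs_prime hP (rs_ram H.q1 M.hr8 M.hs8 H.hd1 H.q1.σs hR) with h | h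
    · exact coprime_mem ((Nat.coprime_primes hl hr).2 h1) hP hm h
    · exact coprime_mem ((Nat.coprime_primes hl hs).2 h2) hP hm h
  have hqr := M.nqr
  have hqs := M.nqs
  have hq2 : q ≠ 2 := by rintro rfl; have := M.hq4; omega
  have h2r : 2 ≠ r := by rintro rfl; have := M.hr8; omega
  have h2s : 2 ≠ s := by rintro rfl; have := M.hs8; omega
  have facq : ∀ c : ℤ, (q : ℤ) ∣ c → ¬ (q : ℤ) ^ 2 ∣ c → ∀ (I : Ideal (𝓞 k1)) (a : 𝓞 k1), a ≠ 0 →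
      I * I ≠ Ideal.span {a * a * (c : 𝓞 k1)} := by
    intro c hc hc2
    have h1 := rat_unram H.q1 hPq (cop hqp hqr hqs hPq hqm) hqp hqm hc2
    have h0 : (c : 𝓞 k1) ∈ Pq := by
      obtain ⟨c', rfl⟩ := hc
      push_cast; exact Pq.mul_mem_right _ hqm
    obtain ⟨J, hJ, hJ2⟩ := one_fac h0 h1
    exact odd_nsq hPq hPq0 (k := 1) (by decide) (by rw [pow_one, hJ]) hJ2
  have hqη := etaq_not_sq (q := q) M.hη M.hq4
  refine cap H.Q1 φ ?_ (g₁ := A') (g₂ := algebraMap (𝓞 F) (𝓞 K) π) hA0 (by simpa using hπ0) (e₁ := -1)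
    (e₂ := jE F K e2) (by rw [hσA]; simp) ?_ (m₁ := ((-(η * q : ℕ) : ℤ) : 𝓞 k1))
    (m₂ := ((δ * 2 ^ m : ℤ) : 𝓞 k1)) ?_ ?_ (facq _ ?_ ?_) ?_ ?_
  · rw [← jE_range H.Q1]
    have key : ∀ x : (𝓞 k1)ˣ, jE k1 K x ∈ (nmH (sE σ1)).range ∨ -jE k1 K x ∈ (nmH (sE σ1)).range := by
      have hsq : ∀ v : (𝓞 k1)ˣ, jE k1 K (v ^ 2) ∈ (nmH (sE σ1)).range := by
        intro v
        refine ⟨jE k1 K v, ?_⟩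
        have : jE k1 K v ∈ (dmH (sE σ1)).ker := by rw [← jE_range H.Q1]; exact ⟨v, rfl⟩
        rw [mem_ker_dmH] at this
        rw [nmH_apply, this, map_pow, sq]
      have hw : jE k1 K w1 ∈ (nmH (sE σ1)).range ∨ -jE k1 K w1 ∈ (nmH (sE σ1)).range := by
        have h1 : ((u * sE σ1 u : (𝓞 K)ˣ) : 𝓞 K) * (jE k1 K w1 : (𝓞 K)ˣ) = (ε1 : 𝓞 K) := by
          apply RingOfIntegers.ext
          rw [v_mul, v_int, ← u3]; rfl
        rcases M.hε1 with e | e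
        · left
          refine ⟨u⁻¹, ?_⟩
          rw [nmH_apply, map_inv, ← mul_inv, inv_eq_iff_mul_eq_one]
          apply Units.ext
          rw [Units.val_mul, h1, e]; simp
        · right
          refine ⟨u⁻¹, ?_⟩
          rw [nmH_apply, map_inv, ← mul_inv, inv_eq_iff_mul_eq_one]
          apply Units.ext
          rw [Units.val_mul, Units.val_neg, mul_neg, h1, e]; simp
      intro x
      have hne2 : ¬ r ∣ s := fun h => M.hne ((Nat.prime_dvd_prime_iff_eq hr hs).1 h)
      have jneg : ∀ y : (𝓞 k1)ˣ, jE k1 K (-y) = - jE k1 K y := by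
        intro y; apply Units.ext; exact map_neg (algebraMap (𝓞 k1) (𝓞 K)) _
      obtain ⟨v, e | e | e | e⟩ := pell_gen (φ.comp (algebraMap k1 K)) H.q1 hr hne2 hs.not_isSquare H.hd1 u1 x
      · left; rw [e]; exact hsq v
      · right; rw [e, jneg, neg_neg]; exact hsq v
      · rw [e, map_mul]
        rcases hw with h | h
        · left; exact mul_mem h (hsq v)
        · right; rw [← neg_mul]; exact mul_mem h (hsq v)
      · rw [e, jneg, neg_neg, map_mul]
        rcases hw with h | h
        · right; exact mul_mem h (hsq v)
        · left; rw [← neg_mul]; exact mul_mem h (hsq v)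
    apply relIndex_le_two (c := -1)
    · exact ⟨-1, by apply Units.ext; simp [jE]⟩
    · rintro _ ⟨x, rfl⟩
      rw [neg_one_mul]; exact key x
  · rw [hσπ]
    apply RingOfIntegers.ext
    have : ((e2 : 𝓞 F) : F) * ρF π = π := by rw [he2, div_mul_cancel₀ _ (by simpa using hπF)]
    have := congrArg (algebraMap F K) this
    rw [map_mul] at this
    exact this.symm
  · rw [hσA, map_intCast, mul_neg, hAA]; push_cast; ring
  · rw [hσπ, ← map_mul, hN, map_intCast, map_intCast]
  · exact ⟨-η, by push_cast; ring⟩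
  · rw [dvd_neg]; exact hqη
  · have h1 := rat_unram H.q1 hPt (cop Nat.prime_two h2r h2s hPt htm) Nat.prime_two htm (c := 2) (by norm_num)
    obtain ⟨J, hJ, hJ2⟩ := one_fac (x := ((2 : ℤ) : 𝓞 k1)) (by exact_mod_cast htm) h1
    refine odd_nsq hPt hPt0 hm (J := J ^ m) ?_ ?_
    · rw [← mul_pow, ← hJ, Ideal.span_singleton_pow]
      rcases hδ with e | e <;> rw [e] <;> push_cast
      · rw [one_mul]
      · rw [neg_one_mul, Ideal.span_singleton_neg]
    · intro h
      exact hJ2 (hPt.le_of_pow_le h)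
  · have := facq (-(η * q : ℕ) * (δ * 2 ^ m)) ⟨-η * (δ * 2 ^ m), by push_cast; ring⟩ ?_
    · intro I x hx; rw [← Int.cast_mul]; exact this I x hx
    · intro h
      have hc : IsCoprime ((q : ℤ)^2) (δ * 2 ^ m) := by
        apply IsCoprime.pow_left
        apply IsCoprime.mul_right
        · rcases hδ with e | e <;> rw [e]
          · exact isCoprime_one_right
          · exact isCoprime_one_right.neg_right
        · apply IsCoprime.pow_right
          exact Nat.isCoprime_iff_coprime.2 ((Nat.coprime_primes hqp Nat.prime_two).2 hq2)
      have := hc.dvd_of_dvd_mul_right h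
      rw [dvd_neg] at this
      exact hqη this

end Bq
end
end

section
section
variable {K L : Type*} [Field K] [NumberField K] [Field L] [NumberField L] [Algebra K L] {σ : L ≃+* L} {s : L}

lemma nU_dvd (h : IsQuad K L σ s) [IsTotallyReal K] (φ : K →+* ℝ) : (nU K σ).index ∣ 2 ^ Module.finrank ℚ K := by
  rw [← unit_index K φ]
  apply Subgroup.index_dvd_of_le
  rintro _ ⟨v, rfl⟩
  rw [mem_nU]
  refine ⟨algebraMap K L ((v : 𝓞 K) : K), ?_⟩
  rw [h.fix, ← map_mul]
  congr 1
  change (((v ^ 2 : (𝓞 K)ˣ) : 𝓞 K) : K) = _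
  rw [sq, unit_val_mul]

/-- the 2-part version of the ambiguous class number formula -/
lemma AF2 (h : IsQuad K L σ s) [IsTotallyReal K] [IsTotallyReal L] (φ : L →+* ℝ) :
    ∃ i u : ℕ, iIdx K σ = i * u ∧ Odd u ∧ Nat.card (dmH (mB (aCl σ))).ker * 2 * (nU K σ).index =
      Nat.card (B2 (ClassGroup (𝓞 K))) * i := by
  obtain ⟨k, hk⟩ := (Nat.dvd_prime_pow Nat.prime_two).1 (nU_dvd h (φ.comp (algebraMap K L)))
  have h1 := AF h φ
  have hi : iIdx K σ ≠ 0 := by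
    intro e
    rw [e, mul_zero, hk.2] at h1
    have : 0 < Nat.card (dmH (aCl σ)).ker := Nat.card_pos
    have : 0 < 2 ^ k := by positivity
    simp_all
  obtain ⟨a, m, hm, e1⟩ := Nat.exists_eq_two_pow_mul_odd (Nat.card_pos (α := (dmH (aCl σ)).ker)).ne'
  obtain ⟨b, n, hn, e2⟩ := Nat.exists_eq_two_pow_mul_odd (Nat.card_pos (α := ClassGroup (𝓞 K))).ne'
  obtain ⟨c, o, ho, e3⟩ := Nat.exists_eq_two_pow_mul_odd hi
  refine ⟨2 ^ c, o, e3, ho, ?_⟩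
  rw [card_fix_B2, card_B2, two_part e1 hm, two_part e2 hn, hk.2]
  rw [e1, e2, e3, hk.2] at h1
  have h2 : 2 ^ (a + 1 + k) * m = 2 ^ (b + c) * (n * o) := by
    rw [pow_add, pow_add, pow_add]; linarith
  have h3 := two_part h2 (hn.mul ho)
  rw [two_part rfl hm] at h3
  rw [← pow_succ, ← pow_add, h3, pow_add]

lemma AF_le (h : IsQuad K L σ s) [IsTotallyReal K] [IsTotallyReal L] (φ : L →+* ℝ) {C : Finset (Ideal (𝓞 K))}
    {t : ℕ} (ht : C.card ≤ t) (hC : ∀ P ∈ RP K σ, P.comap (algebraMap (𝓞 K) (𝓞 L)) ∈ C)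
    {u : (𝓞 K)ˣ} (hu : u ∉ nU K σ) :
    Nat.card (dmH (mB (aCl σ))).ker * 4 ≤ Nat.card (B2 (ClassGroup (𝓞 K))) * 2 ^ t := by
  obtain ⟨i, o, h1, h2, h3⟩ := AF2 h φ
  have h4 : i ≤ 2 ^ t := by
    have : i ∣ 2 ^ C.card := (Dvd.intro _ h1.symm).trans (iIdx_dvd h C hC)
    exact (Nat.le_of_dvd (by positivity) this).trans (Nat.pow_le_pow_right (by norm_num) ht)
  have h5 : 2 ≤ (nU K σ).index := by
    have h6 : (nU K σ).index ≠ 1 := by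
      intro e; rw [Subgroup.index_eq_one] at e; exact hu (by rw [e]; trivial)
    have h7 : (nU K σ).index ≠ 0 := by
      intro e
      have := nU_dvd h (φ.comp (algebraMap K L))
      rw [e, zero_dvd_iff] at this
      simp at this
    omega
  calc _ ≤ Nat.card (dmH (mB (aCl σ))).ker * 2 * (nU K σ).index := by nlinarith [Nat.zero_le (Nat.card (dmH (mB (aCl σ))).ker)]
    _ = _ := h3
    _ ≤ _ := Nat.mul_le_mul_left _ h4

lemma two_over {F : Type*} [Field F] [NumberField F] {ρ : F ≃+* F} {x : F} (h : IsQuad ℚ F ρ x) {l : ℕ} (hl : l.Prime)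
    {P Q : Ideal (𝓞 F)} (hP : P.IsPrime) (hQ : Q.IsPrime) (h1 : (l : 𝓞 F) ∈ P) (h2 : (l : 𝓞 F) ∈ Q) :
    Q = P ∨ Q = sI ρ P := by
  have e : P.comap (algebraMap (𝓞 ℚ) (𝓞 F)) = Q.comap (algebraMap (𝓞 ℚ) (𝓞 F)) := by
    rw [rat_span hl (Ideal.IsPrime.comap _) (by simpa using h1), rat_span hl (Ideal.IsPrime.comap (K := Q) _) (by simpa using h2)]
  have h3 : P * sI ρ P ≤ Q := by
    rw [← relNorm_ext h, Ideal.map_le_iff_le_comap, ← e]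
    exact Ideal.relNorm_le_comap _ _
  have hP0 := prime_ne_bot hl.ne_zero h1
  have hPm : P.IsMaximal := hP.isMaximal hP0
  have hsm : (sI ρ P).IsMaximal := (sI_isPrime ρ hP).isMaximal (sI_ne_bot ρ hP0)
  rcases hQ.mul_le.1 h3 with h | h
  · left; exact (hPm.eq_of_le hQ.ne_top h).symm
  · right; exact (hsm.eq_of_le hQ.ne_top h).symm

end

section
variable {η q r s : ℕ} {a0 b0 A B ε0 ε1 : ℤ} [Fact q.Prime] [Fact r.Prime] [Fact s.Prime]
variable {k1 k2 F K : Type*} [Field k1] [Field k2] [Field F] [Field K]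
    [NumberField k1] [NumberField k2] [NumberField F] [NumberField K]
    [Algebra k1 K] [Algebra k2 K] [Algebra F K]
    {ρ1 : k1 ≃+* k1} {ρ2 : k2 ≃+* k2} {ρF : F ≃+* F} {σ1 σ2 τ : K ≃+* K} {d1 : k1} {d2 : k2} {aF : F}
    {a d : K}

/-- split residue map at a prime `l` -/
lemma split_resid (h : IsQuad ℚ F ρF aF) {m : ℕ} (ha : aF * aF = m) {l : ℕ} [Fact l.Prime] (hl : l ≠ 2)
    (hlm : legendreSym l m = 1) {c : ℤ} (hc : (l : ℤ) ∣ c) (hc2 : ¬ (l : ℤ) ^ 2 ∣ c) :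
    ∃ f : 𝓞 F →+* ZMod l, f c = 0 ∧ (c : 𝓞 F) ∉ RingHom.ker f ^ 2 := by
  have hlp : l.Prime := Fact.out
  obtain ⟨A', hA, hAA⟩ := intSqrt ha
  obtain ⟨P, hP, hP0, hm⟩ := exists_prime_over (K := F) hlp
  have hm0 : ((m : ℤ) : ZMod l) ≠ 0 := by
    intro e
    rw [(legendreSym.eq_zero_iff l m).2 e] at hlm
    norm_num at hlm
  obtain ⟨t, ht⟩ := (legendreSym.eq_one_iff l hm0).1 hlm
  obtain ⟨t, rfl⟩ := ZMod.intCast_surjective t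
  have h1 : (l : ℤ) ∣ m - t * t := by
    rw [← ZMod.intCast_zmod_eq_zero_iff_dvd]
    · push_cast at ht ⊢; rw [ht, sub_self]
  have h2 : (A' - (t : 𝓞 F)) * (A' - ((-t : ℤ) : 𝓞 F)) ∈ P := by
    have : (A' - (t : 𝓞 F)) * (A' - ((-t : ℤ) : 𝓞 F)) = ((m - t * t : ℤ) : 𝓞 F) := by
      push_cast; rw [← hAA]; ring
    rw [this]
    obtain ⟨z, hz⟩ := h1
    rw [hz]; push_cast; exact P.mul_mem_right _ hm
  have h3 : ∃ t : ℤ, A' - (t : 𝓞 F) ∈ P := by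
    rcases hP.mem_or_mem h2 with h | h
    exacts [⟨_, h⟩, ⟨_, h⟩]
  obtain ⟨t', h3⟩ := h3
  have h4 : 2 * A' ∉ P := by
    intro h4
    rcases mem_of_four hP hAA h4 with h | h
    · exact coprime_mem ((Nat.coprime_primes hlp Nat.prime_two).2 hl) hP hm h
    · refine coprime_mem ((Nat.Prime.coprime_iff_not_dvd hlp).2 ?_) hP hm h
      intro h5
      apply hm0
      rw [ZMod.intCast_zmod_eq_zero_iff_dvd]
      exact_mod_cast h5
  have hne : sI ρF P ≠ P := sI_ne_of_resid h (x := A') (a := (t' : 𝓞 ℚ))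
    (by apply RingOfIntegers.ext; rw [sO_coe, v_neg, hA, h.σs]) (by rw [map_intCast]; exact h3) h4
  have hN : Ideal.absNorm P = l := by
    have e1 := Ideal.absNorm_relNorm (𝓞 ℚ) (𝓞 F) P
    rw [relNorm_of_ne h hP hP0 hne, rat_span hlp (Ideal.IsPrime.comap _) (by simpa using hm), absNorm_nat] at e1
    rw [← e1]; simp
  obtain ⟨f, hf⟩ := residHom hN
  refine ⟨f, ?_, ?_⟩
  · obtain ⟨z, rfl⟩ := hc
    simp
  · rw [hf]
    exact rat_unram h hP (fun hR => hne hR.2.2.1) hlp hm hc2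

namespace Bq
variable (H : Bq η q r s ρ1 ρ2 ρF σ1 σ2 τ d1 d2 aF a d)
include H

lemma tau_norm (z : K) : ∃ α β : F, z * τ z = algebraMap F K (α ^ 2 - (((r * s : ℕ) : ℤ) : 𝓞 F) * β ^ 2) := by
  obtain ⟨α, β, rfl⟩ := H.QF.gen z
  refine ⟨α, β, ?_⟩
  have := H.hd
  simp only [map_add, map_mul, map_sub, map_pow, H.QF.fix, H.τd, v_int, map_intCast]
  push_cast at this ⊢
  linear_combination (- (algebraMap F K β)^2) * this

/-- test map at `r` or `s` -/
lemma test {l : ℕ} [Fact l.Prime] (hl8 : l % 8 = 5) (hlm : legendreSym l (η * q : ℕ) = 1)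
    (hc : (l : ℤ) ∣ ((r * s : ℕ) : ℤ)) (hc2 : ¬ (l : ℤ) ^ 2 ∣ ((r * s : ℕ) : ℤ))
    {m : ℕ} (hm : Odd m) {π : 𝓞 F} {v : (𝓞 F)ˣ} (hv : π ^ 2 = 2 ^ m * v) :
    ∃ f : 𝓞 F →+* ZMod l, ¬ IsSquare (f v) ∧
      ∀ (x : 𝓞 F) (z : K), algebraMap F K x = z * τ z → IsSquare (f x) := by
  have hl2 : l ≠ 2 := by rintro rfl; omega
  have hlp : l.Prime := Fact.out
  obtain ⟨f, h1, h2⟩ := split_resid H.qF H.haF hl2 hlm hc hc2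
  refine ⟨f, ?_, ?_⟩
  · rintro ⟨t, ht⟩
    have h3 : f π ^ 2 = 2 ^ m * (t * t) := by rw [← map_pow, hv, map_mul, ht, map_pow, map_ofNat]
    have ht0 : t ≠ 0 := by
      rintro rfl
      rw [mul_zero] at ht
      exact (v.isUnit.map f).ne_zero ht
    obtain ⟨k, rfl⟩ := hm
    have h20 : (2 : ZMod l) ≠ 0 := by
      have := (ZMod.natCast_eq_zero_iff 2 l).not.2 (fun h => hl2 ((Nat.prime_dvd_prime_iff_eq hlp Nat.prime_two).1 h))
      exact_mod_cast this
    apply leg_nonsq (r := l) (n := 2) (leg_two_of_five hl8)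
    refine ⟨f π / (2 ^ k * t), ?_⟩
    push_cast
    rw [div_mul_div_comm, eq_div_iff (mul_ne_zero (mul_ne_zero (pow_ne_zero _ h20) ht0) (mul_ne_zero (pow_ne_zero _ h20) ht0))]
    linear_combination -h3
  · intro x z hz
    obtain ⟨α, β, e⟩ := H.tau_norm z
    rw [e] at hz
    exact TN f h1 h2 α β ((algebraMap F K).injective hz)

lemma tests (M : Nm η q r s a0 b0 A B ε0 ε1) {m : ℕ} (hm : Odd m) {π : 𝓞 F} {v : (𝓞 F)ˣ} (hv : π ^ 2 = 2 ^ m * v) :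
    (∃ f : 𝓞 F →+* ZMod r, ¬ IsSquare (f v) ∧
      ∀ (x : 𝓞 F) (z : K), algebraMap F K x = z * τ z → IsSquare (f x)) ∧
    (∃ f : 𝓞 F →+* ZMod s, ¬ IsSquare (f v) ∧
      ∀ (x : 𝓞 F) (z : K), algebraMap F K x = z * τ z → IsSquare (f x)) := by
  have hr : r.Prime := Fact.out
  have hs : s.Prime := Fact.out
  refine ⟨H.test M.hr8 M.lr ⟨s, by push_cast; ring⟩ (not_sq_dvd hr hs M.hne) hm hv,
    H.test M.hs8 M.ls ⟨r, by push_cast; ring⟩ ?_ hm hv⟩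
  rw [mul_comm]; exact not_sq_dvd hs hr M.hne.symm

lemma tors_le [IsTotallyReal F] [IsTotallyReal K] (φ : K →+* ℝ) (M : Nm η q r s a0 b0 A B ε0 ε1) :
    Nat.card (powMonoidHom 2 : B2 (ClassGroup (𝓞 K)) →* _).ker ≤ 4 := by
  classical
  have hr : r.Prime := Fact.out
  have hs : s.Prime := Fact.out
  have hodd := F_odd H.qF (φ.comp (algebraMap F K)) M.hη M.hq4 H.haF
  obtain ⟨m, π, v, hm, hv, -⟩ := F_pi H.qF (φ.comp (algebraMap F K)) M.hη M.hq4 H.haF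
  obtain ⟨⟨f, f1, f2⟩, -⟩ := H.tests M hm hv
  obtain ⟨P, hP, -, hPm⟩ := exists_prime_over (K := F) hr
  obtain ⟨Q, hQ, -, hQm⟩ := exists_prime_over (K := F) hs
  have h1 := AF_le H.QF φ (C := {P, sI ρF P, Q, sI ρF Q}) (t := 4) Finset.card_le_four (by
    intro R hR
    have hp : (R.comap (algebraMap (𝓞 F) (𝓞 K))).IsPrime := hR.1.comap _
    rcases rs_prime hR.1 (rs_ram H.QF M.hr8 M.hs8 H.hd H.τd hR) with h | h
    · rcases two_over H.qF hr hP hp hPm (by simpa using h) with e | e <;> rw [e] <;> simp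
    · rcases two_over H.qF hs hQ hp hQm (by simpa using h) with e | e <;> rw [e] <;> simp) (u := v) (by
    rw [mem_nU]
    rintro ⟨z, hz⟩
    exact f1 (f2 _ z hz))
  have h2 : Nat.card (B2 (ClassGroup (𝓞 F))) = 1 := by
    rw [card_B2, Nat.factorization_eq_zero_of_not_dvd, pow_zero]
    rw [← even_iff_two_dvd, Nat.not_even_iff_odd]; exact hodd
  rw [h2] at h1
  have h3 : (powMonoidHom 2 : B2 (ClassGroup (𝓞 K)) →* _).ker = (dmH (mB (aCl τ))).ker := by
    ext x
    rw [mem_ker_dmH, inv_of_odd H.QF hodd, MonoidHom.mem_ker, powMonoidHom_apply, inv_eq_iff_mul_eq_one, sq]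
  rw [h3]; omega

end Bq
end
end

section
lemma mB_inj {G H : Type*} [CommGroup G] [CommGroup H] {f : G →* H} (hf : Function.Injective f) :
    Function.Injective (mB f) := by
  rw [injective_iff_map_eq_one]
  intro x hx
  obtain ⟨y, rfl⟩ := b2_surj x
  rw [mB_b2, b2_eq_one] at hx
  obtain ⟨m, hm, e⟩ := hx
  rw [b2_eq_one]
  refine ⟨m, hm, hf ?_⟩
  rw [map_pow, e, map_one]

section
variable {η q r s : ℕ} {a0 b0 A B ε0 ε1 : ℤ} [Fact q.Prime] [Fact r.Prime] [Fact s.Prime]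
variable {k1 k2 F K : Type*} [Field k1] [Field k2] [Field F] [Field K]
    [NumberField k1] [NumberField k2] [NumberField F] [NumberField K]
    [Algebra k1 K] [Algebra k2 K] [Algebra F K]
    {ρ1 : k1 ≃+* k1} {ρ2 : k2 ≃+* k2} {ρF : F ≃+* F} {σ1 σ2 τ : K ≃+* K} {d1 : k1} {d2 : k2} {aF : F}
    {a d : K}

namespace Bq
variable (H : Bq η q r s ρ1 ρ2 ρF σ1 σ2 τ d1 d2 aF a d)
include H

lemma RP_empty (M : Nm η q r s a0 b0 A B ε0 ε1) (P : Ideal (𝓞 K)) : P ∉ RP k2 σ2 := by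
  intro hP
  have hr : r.Prime := Fact.out
  have hs : s.Prime := Fact.out
  have hqp : q.Prime := Fact.out
  have h1 := rs_ram H.Q2 M.hr8 M.hs8 H.hd H.σ2d hP
  obtain ⟨A', hA, hAA⟩ := intSqrt H.ha
  have h5 := RP_diff H.Q2 hP A'
  have h6 : sO σ2 A' - A' = - (2 * A') := by
    apply RingOfIntegers.ext
    simp only [v_sub, sO_coe, v_neg, v_mul, hA, H.σ2a, v_two]; ring
  rw [h6, P.neg_mem_iff] at h5
  have hqr := M.nqr
  have hqs := M.nqs
  have h2r : 2 ≠ r := by rintro rfl; have := M.hr8; omega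
  have h2s : 2 ≠ s := by rintro rfl; have := M.hs8; omega
  have c2 : Nat.Coprime 2 (r * s) := Nat.Coprime.mul_right ((Nat.coprime_primes Nat.prime_two hr).2 h2r) ((Nat.coprime_primes Nat.prime_two hs).2 h2s)
  have cq : Nat.Coprime q (r * s) := Nat.Coprime.mul_right ((Nat.coprime_primes hqp hr).2 hqr) ((Nat.coprime_primes hqp hs).2 hqs)
  rcases mem_of_four hP.1 hAA h5 with h | h
  · exact coprime_mem c2 hP.1 h h1
  · refine coprime_mem (Nat.Coprime.mul_left ?_ cq) hP.1 h h1
    rcases M.hη with e | e <;> rw [e]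
    · simp
    · exact c2

lemma nU_top [IsTotallyReal k2] (φ : k2 →+* ℝ) (M : Nm η q r s a0 b0 A B ε0 ε1) : nU k2 σ2 = ⊤ := by
  have hr : r.Prime := Fact.out
  have hs : s.Prime := Fact.out
  have hqp : q.Prime := Fact.out
  obtain ⟨x1, w1, X, w2, u, -, -, -, u1, -, -, -, u3⟩ := H.units M
  have hsq : ∀ v : (𝓞 k2)ˣ, v ^ 2 ∈ nU k2 σ2 := by
    intro v
    rw [mem_nU]
    refine ⟨algebraMap k2 K ((v : 𝓞 k2) : k2), ?_⟩
    rw [H.Q2.fix, ← map_mul]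
    congr 1
    change (((v ^ 2 : (𝓞 k2)ˣ) : 𝓞 k2) : k2) = _
    rw [sq, unit_val_mul]
  have hneg : (-1 : (𝓞 k2)ˣ) ∈ nU k2 σ2 := by
    rw [mem_nU]
    obtain ⟨x, y, hxy⟩ := Nat.Prime.sq_add_sq (p := r) (by have := M.hr8; omega)
    obtain ⟨x', y', hxy'⟩ := Nat.Prime.sq_add_sq (p := s) (by have := M.hs8; omega)
    obtain ⟨X', Y', hXY⟩ := Nat.sq_add_sq_mul hxy.symm hxy'.symm
    have hY : Y' ≠ 0 := by
      rintro rfl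
      have h1 : r ∣ X' := by
        have : r ∣ X' ^ 2 := ⟨s, by rw [hXY]; ring⟩
        exact hr.dvd_of_dvd_pow this
      obtain ⟨t, rfl⟩ := h1
      apply not_sq_dvd hr hs M.hne
      exact ⟨t ^ 2, by rw [hXY]; push_cast; ring⟩
    refine ⟨(X' + d) / Y', ?_⟩
    have hY' : (Y' : K) ≠ 0 := by exact_mod_cast hY
    have hd := H.hd
    rw [hXY] at hd
    simp only [map_div₀, map_add, map_natCast, H.σ2d]
    rw [div_mul_div_comm, eq_div_iff (mul_ne_zero hY' hY')]
    push_cast at hd ⊢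
    linear_combination hd
  have hw : w2 ∈ nU k2 σ2 := by
    rcases M.hε0 with e | e
    · rw [mem_nU]
      exact ⟨u, by rw [e] at u3; simpa using u3.symm⟩
    · have : -1 * w2 ∈ nU k2 σ2 := by
        rw [mem_nU]
        refine ⟨u, ?_⟩
        rw [e] at u3
        rw [neg_one_mul, Units.val_neg]
        change algebraMap k2 K (-((w2 : 𝓞 k2) : k2)) = _
        rw [map_neg, ← u3]; simp
      have h2 := mul_mem hneg this
      simpa using h2
  have hqr := M.nqr
  have hqs := M.nqs
  have h2r : 2 ≠ r := by rintro rfl; have := M.hr8; omega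
  have h2q : 2 ≠ q := by rintro rfl; have := M.hq4; omega
  have hnd : ¬ r ∣ η * q * s := by
    intro h
    rcases hr.dvd_mul.1 h with h | h
    · rcases hr.dvd_mul.1 h with h | h
      · rcases M.hη with e | e <;> rw [e] at h
        · exact hr.one_lt.ne' (Nat.dvd_one.1 h)
        · exact h2r ((Nat.prime_dvd_prime_iff_eq hr Nat.prime_two).1 h).symm
      · exact hqr ((Nat.prime_dvd_prime_iff_eq hr hqp).1 h).symm
    · exact M.hne ((Nat.prime_dvd_prime_iff_eq hr hs).1 h)
  have hns : ¬ IsSquare (η * q * s) := by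
    rintro ⟨t, ht⟩
    have h1 : q ∣ t := by
      have : q ∣ t * t := ⟨η * s, by rw [← ht]; ring⟩
      rcases hqp.dvd_mul.1 this with h | h <;> exact h
    obtain ⟨t', rfl⟩ := h1
    have h2 : η * s = q * (t' * t') := Nat.eq_of_mul_eq_mul_left hqp.pos (by linarith)
    have h3 : q ∣ η * s := ⟨_, h2⟩
    rcases hqp.dvd_mul.1 h3 with h | h
    · rcases M.hη with e | e <;> rw [e] at h
      · exact hqp.one_lt.ne' (Nat.dvd_one.1 h)
      · exact h2q ((Nat.prime_dvd_prime_iff_eq hqp Nat.prime_two).1 h).symm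
    · exact hqs ((Nat.prime_dvd_prime_iff_eq hqp hs).1 h)
  rw [eq_top_iff]
  intro x _
  obtain ⟨v, e | e | e | e⟩ := pell_gen φ H.q2 hr hnd hns H.hd2 u1 x
  · rw [e]; exact hsq v
  · rw [e, ← neg_one_mul]; exact mul_mem hneg (hsq v)
  · rw [e]; exact mul_mem hw (hsq v)
  · rw [e, ← neg_one_mul]; exact mul_mem hneg (mul_mem hw (hsq v))

theorem h0 [IsTotallyReal k1] [IsTotallyReal k2] [IsTotallyReal F] [IsTotallyReal K] (φ : K →+* ℝ)
    (M : Nm η q r s a0 b0 A B ε0 ε1) :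
    2 * Nat.card (B2 (ClassGroup (𝓞 K))) = Nat.card (B2 (ClassGroup (𝓞 k1))) * Nat.card (B2 (ClassGroup (𝓞 k2))) := by
  have hodd := F_odd H.qF (φ.comp (algebraMap F K)) M.hη M.hq4 H.haF
  obtain ⟨i, o, h1, h2, h3⟩ := AF2 H.Q2 φ
  have hi : i = 1 := by
    have := iIdx_dvd H.Q2 ∅ (fun P hP => absurd hP (H.RP_empty M P))
    rw [h1] at this
    simpa using (Dvd.intro _ rfl).trans this
  rw [H.nU_top (φ.comp (algebraMap k2 K)) M, hi, Subgroup.index_top, mul_one, mul_one] at h3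
  have h4 := card_dm (mB (aCl σ2))
  have h5 : dmH (mB (aCl σ2)) = (mB (jCl k1 K)).comp (mB (nCl k1 K)) := by
    refine MonoidHom.ext fun x => ?_
    obtain ⟨c, rfl⟩ := b2_surj x
    have e1 : mB (jCl k1 K) (mB (nCl k1 K) (b2 _ c)) = b2 _ c * b2 _ (aCl σ1 c) := by
      rw [mB_b2, mB_b2, jCl_nCl H.Q1, map_mul]
    have e2 : mB (aCl σ2) (b2 _ c) = (b2 _ (aCl σ1 c))⁻¹ := by
      rw [mB_b2, aCl_comp (σ := σ1) (τ := τ) H.σ2_eq, ← mB_b2]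
      exact inv_of_odd H.QF hodd _
    rw [dmH_apply, e2, div_inv_eq_mul]
    exact e1.symm
  have h6 : Nat.card (dmH (mB (aCl σ2))).range = Nat.card (B2 (ClassGroup (𝓞 k1))) := by
    rw [h5, MonoidHom.range_comp, MonoidHom.range_eq_top.2 (H.N1_surj (φ.comp (algebraMap k1 K)) M)]
    rw [Subgroup.card_map_of_injective (mB_inj (H.j1_inj φ M)), Subgroup.card_top]
  rw [h6] at h4
  rw [← h4, ← h3]; ring

/-- generators of `A(K)` -/
lemma gens [IsTotallyReal k1] [IsTotallyReal F] [IsTotallyReal K] (φ : K →+* ℝ)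
    (M : Nm η q r s a0 b0 A B ε0 ε1) {p : ℕ} (hp : p ≠ 0) (pr : legendreSym r p = -1) (ps : legendreSym s p = 1)
    {P b : Ideal (𝓞 K)} (hP : P.IsPrime) (h2 : (2 : 𝓞 K) ∈ P) (hb0 : b ≠ ⊥)
    (hb : Ideal.relNorm (𝓞 F) b = Ideal.span {(p : 𝓞 F)}) :
    Subgroup.closure {b2 _ (cl P), b2 _ (cl b)} = ⊤ := by
  have hr : r.Prime := Fact.out
  have hs : s.Prime := Fact.out
  have hP0 : P ≠ ⊥ := prime_ne_bot (l := 2) (by norm_num) (by exact_mod_cast h2)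
  have hbN : Ideal.absNorm b = p ^ 2 := by
    have := Ideal.absNorm_relNorm (𝓞 F) (𝓞 K) b
    rw [hb, absNorm_nat, H.qF.finrank] at this
    exact this.symm
  have hp0 : ((p : ℤ) : ZMod r) ≠ 0 := by
    intro e
    rw [(legendreSym.eq_zero_iff r p).2 e] at pr; norm_num at pr
  -- step 1
  have step1 : ∀ (I : Ideal (𝓞 K)) (n : ℤ), I ≠ ⊥ → (n : ZMod r) ≠ 0 → (Ideal.absNorm I : ℤ) = 2 * n ^ 2 → ¬ IsSquare (b2 _ (cl I)) := by
    intro I n hI hn hN hsq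
    obtain ⟨c, hc⟩ := b2_square hsq
    have h3 : IsSquare (cl (Ideal.relNorm (𝓞 k1) I)) := by
      rw [← nCl_cl hI, hc, map_mul]; exact ⟨_, rfl⟩
    have hn2 : legendreSym r (2 * n ^ 2) = -1 := by
      rw [legendreSym.mul, legendreSym.sq_one' r hn, leg_two_of_five M.hr8, mul_one]
    refine rat_nsq H.q1 (c := (r * s : ℕ)) (by rw [H.hd1]; push_cast; rfl) (l := r) ⟨s, by push_cast; rfl⟩
      (not_sq_dvd hr hs M.hne) (fun h => hI (Ideal.relNorm_eq_bot_iff.1 h)) (n := Ideal.absNorm I) (Ideal.absNorm_relNorm (𝓞 k1) (𝓞 K) I) ?_ ?_ h3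
    · rw [hN]; exact leg_nonsq hn2
    · rw [hN]; apply leg_nonsq
      rw [← neg_one_mul, legendreSym.mul, hn2, leg_neg_one_of_five M.hr8]; rfl
  -- step 2
  have step2 : ¬ IsSquare (b2 _ (cl b)) := by
    intro hsq
    obtain ⟨c, hc⟩ := b2_square hsq
    obtain ⟨J, hJ, rfl⟩ := cl_surj c
    rw [← cl_mul hJ hJ, cl_eq_iff hb0 (mul_ne_zero hJ hJ)] at hc
    obtain ⟨x, y, hx, hy, e⟩ := hc
    have e1 := congrArg (Ideal.relNorm (𝓞 F)) e
    simp only [map_mul, Ideal.relNorm_singleton, hb] at e1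
    set nx := Algebra.intNorm (𝓞 F) (𝓞 K) x with hnx
    set ny := Algebra.intNorm (𝓞 F) (𝓞 K) y with hny
    have hnx0 : nx ≠ 0 := by rwa [Ne, Algebra.intNorm_eq_zero]
    have hny0 : ny ≠ 0 := by rwa [Ne, Algebra.intNorm_eq_zero]
    set I := Ideal.relNorm (𝓞 F) J with hI
    have hI0 : I ≠ ⊥ := fun h => hJ (Ideal.relNorm_eq_bot_iff.1 h)
    have hodd := F_odd H.qF (φ.comp (algebraMap F K)) M.hη M.hq4 H.haF
    have hp0' : (p : 𝓞 F) ≠ 0 := by exact_mod_cast hp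
    have hcl : cl I * cl I = 1 := by
      rw [← cl_mul hI0 hI0, ← cl_span hp0', cl_eq_iff (mul_ne_zero hI0 hI0) (by simpa using hp0')]
      exact ⟨ny, nx, hny0, hnx0, e1.symm⟩
    have hcl1 : cl I = 1 := by
      obtain ⟨k, hk⟩ := hodd
      have h6 : cl I ^ Nat.card (ClassGroup (𝓞 F)) = 1 := pow_card_eq_one'
      rw [hk, pow_succ, pow_mul, sq, hcl, one_pow, one_mul] at h6
      exact h6
    obtain ⟨g, hg⟩ := ((cl_eq_one_iff hI0).1 hcl1).principal
    have hg' : I = Ideal.span {g} := hg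
    have hg0 : g ≠ 0 := by rintro rfl; exact hI0 (by rw [hg']; simp)
    rw [hg', Ideal.span_singleton_mul_span_singleton, Ideal.span_singleton_mul_span_singleton,
      Ideal.span_singleton_mul_span_singleton, Ideal.span_singleton_eq_span_singleton] at e1
    obtain ⟨ω, hω⟩ := e1
    obtain ⟨m, π, v, hm, hv, hgen⟩ := F_pi H.qF (φ.comp (algebraMap F K)) M.hη M.hq4 H.haF
    obtain ⟨⟨f, f1, f2⟩, ⟨f', f1', f2'⟩⟩ := H.tests M hm hv
    -- p * ω is a norm
    have hxK : (x : K) ≠ 0 := fun h => hx (RingOfIntegers.ext h)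
    have nmx : algebraMap F K nx = x * τ x := congrArg (fun x : 𝓞 K => (x : K)) (intNorm_ext H.QF x)
    have nmy : algebraMap F K ny = y * τ y := congrArg (fun x : 𝓞 K => (x : K)) (intNorm_ext H.QF y)
    have hτx : τ (x : K) ≠ 0 := by simpa using hxK
    have key : algebraMap F K ((p * (ω : 𝓞 F) : 𝓞 F) : F) = (y * algebraMap F K g / x) * τ (y * algebraMap F K g / x) := by
      have h7 := congrArg (fun x : 𝓞 F => algebraMap F K (x : F)) hω
      simp only [v_mul, v_nat, map_mul, map_natCast, nmx, nmy] at h7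
      simp only [v_mul, v_nat, map_div₀, map_mul, map_natCast, H.QF.fix]
      rw [div_mul_div_comm, eq_div_iff (mul_ne_zero hxK hτx)]
      linear_combination h7
    have r1 := f2 _ _ key
    have s1 := f2' _ _ key
    have hp0s : ((p : ℤ) : ZMod s) ≠ 0 := by
      intro e
      rw [(legendreSym.eq_zero_iff s p).2 e] at ps; norm_num at ps
    have sqp : IsSquare ((p : ℤ) : ZMod s) := (legendreSym.eq_one_iff s hp0s).1 ps
    have nsqp : ¬ IsSquare ((p : ℤ) : ZMod r) := leg_nonsq pr
    have cancel : ∀ {k : Type _} [Field k] {a b : k}, b ≠ 0 → IsSquare b → IsSquare (a * b) → IsSquare a := by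
      intro k _ a b hb h1 h2
      have := h2.mul h1.inv
      rwa [mul_assoc, mul_inv_cancel₀ hb, mul_one] at this
    have neg1 : ∀ {l : ℕ} [Fact l.Prime], l % 8 = 5 → IsSquare (-1 : ZMod l) := by
      intro l _ hl
      exact ZMod.exists_sq_eq_neg_one_iff.2 (by omega)
    have neg1r := neg1 M.hr8
    have neg1s := neg1 M.hs8
    have fu : ∀ {l : ℕ} [Fact l.Prime] (f : 𝓞 F →+* ZMod l) (u : (𝓞 F)ˣ), f u ≠ 0 :=
      fun f u => (u.isUnit.map f).ne_zero
    have fsq : ∀ {l : ℕ} [Fact l.Prime] (f : 𝓞 F →+* ZMod l) (u : (𝓞 F)ˣ), IsSquare (f u ^ 2) :=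
      fun f u => ⟨_, sq _⟩
    rw [map_mul, map_natCast] at r1 s1
    obtain ⟨w, e | e | e | e⟩ := hgen ω
    · rw [e, Units.val_pow_eq_pow_val, map_pow] at r1
      exact nsqp (by push_cast; exact cancel (pow_ne_zero _ (fu f w)) (fsq f w) r1)
    · rw [e, Units.val_neg, Units.val_pow_eq_pow_val, map_neg, map_pow, ← neg_one_mul] at r1
      exact nsqp (by push_cast; exact cancel (mul_ne_zero (by simp) (pow_ne_zero _ (fu f w))) (neg1r.mul (fsq f w)) r1)
    · rw [e, Units.val_mul, Units.val_pow_eq_pow_val, map_mul, map_pow, ← mul_assoc] at s1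
      have := cancel (pow_ne_zero _ (fu f' w)) (fsq f' w) s1
      rw [mul_comm] at this
      push_cast at sqp hp0s
      exact f1' (cancel hp0s sqp this)
    · rw [e, Units.val_neg, Units.val_mul, Units.val_pow_eq_pow_val, map_neg, map_mul, map_pow] at s1
      have s1' : IsSquare ((p : ZMod s) * f' v * ((-1) * f' w ^ 2)) := by convert s1 using 1; ring
      have := cancel (mul_ne_zero (by simp) (pow_ne_zero _ (fu f' w))) (neg1s.mul (fsq f' w)) s1'
      rw [mul_comm] at this
      push_cast at sqp hp0s
      exact f1' (cancel hp0s sqp this)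
  apply gen_two isTwo_B2 (H.tors_le φ M)
  · exact step1 P 1 hP0 (by simp) (by rw [H.twoK M hP h2]; norm_num)
  · exact step2
  · rw [← map_mul, ← cl_mul hP0 hb0]
    exact step1 _ p (mul_ne_zero hP0 hb0) hp0 (by rw [map_mul, H.twoK M hP h2, hbN]; push_cast; ring)

end Bq
end
end

section
/-- iterates of `x ↦ x² - 2` -/
def TT {R : Type*} [CommRing R] (x : R) (i : ℕ) : R := (fun y => y ^ 2 - 2)^[i] x

lemma TT_zero {R : Type*} [CommRing R] (x : R) : TT x 0 = x := rfl

lemma TT_succ {R : Type*} [CommRing R] (x : R) (i : ℕ) : TT x (i + 1) = TT x i ^ 2 - 2 := by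
  unfold TT; rw [Function.iterate_succ_apply']

lemma TT_succ' {R : Type*} [CommRing R] (x : R) (i : ℕ) : TT x (i + 1) = TT (x ^ 2 - 2) i := by
  unfold TT; rw [Function.iterate_succ_apply]

lemma TT_map {R S : Type*} [CommRing R] [CommRing S] (f : R →+* S) (x : R) (i : ℕ) : f (TT x i) = TT (f x) i := by
  induction i with
  | zero => rfl
  | succ i ih => rw [TT_succ, TT_succ, map_sub, map_pow, ih, map_ofNat]

lemma TT_prod {R : Type*} [CommRing R] (x : R) (m : ℕ) :
    (∏ k ∈ Finset.range m, TT x k) ^ 2 * (4 - x ^ 2) = 4 - TT x m ^ 2 := by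
  induction m with
  | zero => simp [TT_zero]
  | succ m ih => rw [Finset.prod_range_succ, TT_succ]; linear_combination TT x m ^ 2 * ih

section
variable {L : Type*} [Field L] [NumberField L]

lemma TT_data {x : L} {m : ℕ} (hx : TT x m = 0) : ∃ X Y : 𝓞 L, (X : L) = x ∧ TT X m = 0 ∧
    Y * ∏ k ∈ Finset.range m, TT X k = 2 ∧ Y ^ 2 = 4 - X ^ 2 := by
  have hint : ∀ i ≤ m, IsIntegral ℤ (TT x (m - i)) := by
    intro i
    induction i with
    | zero => intro _; rw [Nat.sub_zero, hx]; exact isIntegral_zero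
    | succ i ih =>
      intro h
      have h1 := ih (by omega)
      apply IsIntegral.of_pow (n := 2) (by norm_num)
      have h2 : m - i = (m - (i + 1)) + 1 := by omega
      rw [h2, TT_succ] at h1
      have := h1.add (isIntegral_algebraMap (R := ℤ) (A := L) (x := 2))
      simpa using this
  have hxi := hint m le_rfl
  rw [Nat.sub_self, TT_zero] at hxi
  obtain ⟨X, hX⟩ : ∃ X : 𝓞 L, (X : L) = x := ⟨⟨x, hxi⟩, rfl⟩
  have hXm : TT X m = 0 := by
    apply RingOfIntegers.ext
    have := TT_map (algebraMap (𝓞 L) L) X m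
    rw [v_zero, ← hx, ← hX]; exact this
  have hp := TT_prod X m
  rw [hXm] at hp
  set Pr := ∏ k ∈ Finset.range m, TT X k with hPr
  have hPr0 : (Pr : L) ≠ 0 := by
    intro h
    have h' : Pr = 0 := RingOfIntegers.ext h
    rw [h'] at hp
    norm_num at hp
  have e1 : (2 / (Pr : L)) ^ 2 = 4 - (X : L) ^ 2 := by
    rw [div_pow, div_eq_iff (pow_ne_zero 2 hPr0)]
    have := congrArg (fun x : 𝓞 L => (x : L)) hp
    simp only [v_mul, v_pow, v_sub, v_zero] at this
    have h4 : ((4 : 𝓞 L) : L) = 4 := map_ofNat _ _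
    rw [h4] at this
    linear_combination -this
  have hYi : IsIntegral ℤ (2 / (Pr : L)) := by
    apply IsIntegral.of_pow (n := 2) (by norm_num)
    rw [e1]
    have h5 : IsIntegral ℤ ((4 - X ^ 2 : 𝓞 L) : L) := RingOfIntegers.isIntegral_coe _
    have h4 : ((4 : 𝓞 L) : L) = 4 := map_ofNat _ _
    rwa [v_sub, v_pow, h4] at h5
  obtain ⟨Y, hY⟩ : ∃ Y : 𝓞 L, (Y : L) = 2 / (Pr : L) := ⟨⟨_, hYi⟩, rfl⟩
  refine ⟨X, Y, hX, hXm, ?_, ?_⟩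
  · apply RingOfIntegers.ext
    rw [v_mul, hY, div_mul_cancel₀ _ hPr0, v_two]
  · apply RingOfIntegers.ext
    have h4 : ((4 : 𝓞 L) : L) = 4 := map_ofNat _ _
    rw [v_pow, hY, e1, v_sub, v_pow, h4]

lemma TT_div {X Y : 𝓞 L} {m : ℕ} (h2 : Y * ∏ k ∈ Finset.range m, TT X k = 2) {P : Ideal (𝓞 L)} (hY : Y ∈ P) {i : ℕ}
    (hi : i < m) : ∃ y ∈ P, TT X i * y = 2 := by
  rw [← Finset.mul_prod_erase _ _ (Finset.mem_range.2 hi)] at h2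
  exact ⟨Y * ∏ x ∈ (Finset.range m).erase i, TT X x, P.mul_mem_right _ hY, by rw [← h2]; ring⟩

lemma two_ram' {x a : L} {m q : ℕ} (hm : 0 < m) (hx : TT x m = 0) (hq : q % 4 = 3) (ha : a * a = q) {P : Ideal (𝓞 L)}
    (hP : P.IsPrime) (h2P : (2 : 𝓞 L) ∈ P) : (2 : 𝓞 L) ∈ P ^ (2 ^ (m + 1)) := by
  obtain ⟨X, Y, hX, hXm, h2, hY⟩ := TT_data hx
  obtain ⟨Q, hQ, hQQ⟩ := intSqrt (d := a) (m := q) (by exact_mod_cast ha)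
  obtain ⟨c, hc⟩ : ∃ c : ℕ, q + 1 = 4 * c := ⟨(q + 1) / 4, by omega⟩
  have hc' : Q * Q = 4 * (c : 𝓞 L) - 1 := by
    rw [hQQ, eq_sub_iff_add_eq]; exact_mod_cast hc
  -- all TT in P
  have hmem : ∀ i ≤ m, TT X (m - i) ∈ P := by
    intro i
    induction i with
    | zero => intro _; rw [Nat.sub_zero, hXm]; exact P.zero_mem
    | succ i ih =>
      intro h
      have h1 := ih (by omega)
      have h3 : m - i = (m - (i + 1)) + 1 := by omega
      rw [h3, TT_succ] at h1
      have := P.add_mem h1 h2P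
      rw [sub_add_cancel] at this
      exact hP.mem_of_pow_mem _ this
  have hXP : X ∈ P := by have := hmem m le_rfl; rwa [Nat.sub_self, TT_zero] at this
  have h4P : (4 : 𝓞 L) ∈ P := by
    have := P.mul_mem_left 2 h2P; norm_num at this; exact this
  have hYP : Y ∈ P := by
    apply hP.mem_of_pow_mem 2
    rw [hY]; exact P.sub_mem h4P (P.pow_mem_of_mem hXP 2 (by norm_num))
  have h1P : (1 : 𝓞 L) ∉ P := fun h => hP.ne_top ((Ideal.eq_top_iff_one P).2 h)
  -- lambda
  obtain ⟨lam, hlam⟩ : ∃ l : 𝓞 L, 2 * (l : L) = 4 * c + ((2 * c - 1) * X + Y * Q) := by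
    have hi : IsIntegral ℤ ((4 * c + ((2 * c - 1) * X + Y * Q)) / 2 : L) := by
      have hY' : (Y : L) ^ 2 = 4 - (X : L) ^ 2 := by
        have h4 : ((4 : 𝓞 L) : L) = 4 := map_ofNat _ _
        rw [← v_pow, hY, v_sub, v_pow, h4]
      have hQ' : (Q : L) * Q = 4 * c - 1 := by
        rw [← v_mul, hQQ, v_nat, eq_sub_iff_add_eq]; exact_mod_cast hc
      refine isIntegral_trans (R := ℤ) (A := 𝓞 L) _ ?_
      refine ⟨Polynomial.X ^ 2 - Polynomial.C (4 * c + (2 * c - 1) * X) * Polynomial.X + Polynomial.C ((2 * c - 1 + c * X) ^ 2), ?_, ?_⟩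
      · monicity!
      · have e4 : algebraMap (𝓞 L) L (4 * c + (2 * c - 1) * X) = 4 * c + (2 * c - 1) * X := by
          simp only [map_add, map_mul, map_sub, map_natCast, map_one, map_ofNat]
        have e5 : algebraMap (𝓞 L) L ((2 * c - 1 + c * X) ^ 2) = (2 * c - 1 + c * X) ^ 2 := by
          simp only [map_add, map_mul, map_sub, map_natCast, map_one, map_pow, map_ofNat]
        simp only [Polynomial.eval₂_add, Polynomial.eval₂_sub, Polynomial.eval₂_mul, Polynomial.eval₂_pow, Polynomial.eval₂_X, Polynomial.eval₂_C]
        rw [e4, e5]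
        linear_combination (1 / 4 * (Q : L) * Q) * hY' + (1 / 4 * (4 - (X : L) ^ 2)) * hQ'
    exact ⟨⟨_, hi⟩, by show 2 * ((4 * c + ((2 * c - 1) * X + Y * Q)) / 2 : L) = _; ring⟩
  have toO : ∀ z w : 𝓞 L, (2 : L) * z = 2 * w → z = w := by
    intro z w h; exact RingOfIntegers.ext (mul_left_cancel₀ two_ne_zero h)
  have hlam' : 2 * lam = 4 * c + ((2 * c - 1) * X + Y * Q) := by
    apply RingOfIntegers.ext
    simp only [v_mul, v_add, v_sub, v_nat, v_two, v_one]
    rw [hlam]; congr 2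
  have two_c : ∀ z w : 𝓞 L, 4 * z = 4 * w → z = w := fun z w h => mul_left_cancel₀ (by norm_num) h
  have hnorm : lam * (4 * c + (2 * c - 1) * X - lam) = (2 * c - 1 + c * X) ^ 2 := by
    apply two_c
    linear_combination (8 * (c : 𝓞 L) + 2 * (2 * c - 1) * X - 2 * lam - (4 * c + (2 * c - 1) * X + Y * Q)) * hlam' - Y ^ 2 * hc' - (4 * c - 1) * hY
  have hlamP : lam ∉ P := by
    intro h
    have h3 := P.mul_mem_right (4 * c + (2 * c - 1) * X - lam) h
    rw [hnorm] at h3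
    have h4 := hP.mem_of_pow_mem _ h3
    apply h1P
    have h5 := P.sub_mem (P.add_mem (P.mul_mem_right (c : 𝓞 L) h2P) (P.mul_mem_left (c : 𝓞 L) hXP)) h4
    convert h5 using 1; ring
  -- omega
  obtain ⟨ω, hω⟩ : ∃ ω : 𝓞 L, ω ^ 2 = (2 - X) * lam := by
    have e : ((2 - X + Y * Q) / 2 : L) ^ 2 = ((2 - X) * lam : 𝓞 L) := by
      have hY' : (Y : L) ^ 2 = 4 - (X : L) ^ 2 := by
        have h4 : ((4 : 𝓞 L) : L) = 4 := map_ofNat _ _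
        rw [← v_pow, hY, v_sub, v_pow, h4]
      have hQ' : (Q : L) * Q = 4 * c - 1 := by
        rw [← v_mul, hQQ, v_nat, eq_sub_iff_add_eq]; exact_mod_cast hc
      rw [v_mul, v_sub, v_two]
      linear_combination (1 / 4 * (Q : L) * Q) * hY' + (1 / 4 * (4 - (X : L) ^ 2)) * hQ' - 1 / 2 * (2 - (X : L)) * hlam
    have hi : IsIntegral ℤ ((2 - X + Y * Q) / 2 : L) := by
      apply IsIntegral.of_pow (n := 2) (by norm_num)
      rw [e]; exact RingOfIntegers.isIntegral_coe _
    obtain ⟨ω, hω⟩ : ∃ ω : 𝓞 L, (ω : L) = (2 - X + Y * Q) / 2 := ⟨⟨_, hi⟩, rfl⟩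
    exact ⟨ω, RingOfIntegers.ext (by rw [v_pow, hω]; exact e)⟩
  have hωP : ω ∈ P := by
    apply hP.mem_of_pow_mem 2
    rw [hω]; exact P.mul_mem_right _ (P.sub_mem h2P hXP)
  have hX2 : X ∈ P ^ 2 := by
    obtain ⟨y, hy, e⟩ := TT_div h2 hYP hm
    rw [TT_zero] at e
    have h3 : ω ^ 2 ∈ P ^ 2 := Ideal.pow_mem_pow hωP 2
    have h4 : ((y - 1) * lam) * X ∈ P ^ 2 := by
      convert h3 using 1; rw [hω, ← e]; ring
    rcases hP.mul_mem_pow _ h4 with h5 | h5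
    · rcases hP.mem_or_mem h5 with h6 | h6
      · exact absurd (by simpa using P.sub_mem hy h6) h1P
      · exact absurd h6 hlamP
    · exact h5
  have hpow : ∀ i < m, TT X i ∈ P ^ (2 ^ (i + 1)) := by
    intro i
    induction i with
    | zero => intro _; simpa [TT_zero] using hX2
    | succ i ih =>
      intro h
      have h3 := Ideal.pow_mem_pow (ih (by omega)) 2
      rw [← pow_mul, ← pow_succ] at h3
      obtain ⟨y, hy, e⟩ := TT_div h2 hYP h
      have h4 : (1 + y) * TT X (i + 1) ∈ P ^ (2 ^ (i + 1 + 1)) := by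
        convert h3 using 1
        have := TT_succ X i
        linear_combination e + this
      rcases hP.mul_mem_pow _ h4 with h5 | h5
      · exact absurd (by simpa using P.sub_mem h5 hy) h1P
      · exact h5
  have h3 := Ideal.pow_mem_pow (hpow (m - 1) (by omega)) 2
  rw [← pow_mul, ← pow_succ, show m - 1 + 1 = m by omega] at h3
  convert h3 using 1
  have := TT_succ X (m - 1)
  rw [show m - 1 + 1 = m by omega, hXm] at this
  linear_combination this
end
end

section
/-- a layer `ℚ(√(ηq), √(rs), t_n)` -/
structure Lay (η q r s n : ℕ) {L : Type*} [Field L] [NumberField L] (τ : L ≃+* L) (a d x : L) : Prop where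
  hη : η = 1 ∨ η = 2
  hq4 : q % 4 = 3
  hr8 : r % 8 = 5
  hs8 : s % 8 = 5
  deg : Module.finrank ℚ L = 2 * 2 ^ (n + 1)
  ha : a * a = (η * q : ℕ)
  hd : d * d = (r * s : ℕ)
  hx : TT x n = 0
  τd : τ d = -d

section
variable {η q r s n : ℕ} [Fact r.Prime] [Fact s.Prime]
variable {K L : Type*} [Field K] [NumberField K] [Field L] [NumberField L] [Algebra K L] {σ τ : L ≃+* L} {τK : K ≃+* K}
  {a d x : L} {aK dK xK : K}

lemma TT_two_mem {x : L} {X Y : 𝓞 L} {m : ℕ} (hm : 0 < m) (h2 : Y * ∏ k ∈ Finset.range m, TT X k = 2) {P : Ideal (𝓞 L)}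
    (h : X ∈ P) : (2 : 𝓞 L) ∈ P := by
  rw [← h2, ← Finset.mul_prod_erase _ _ (Finset.mem_range.2 hm), TT_zero, mul_left_comm]
  exact P.mul_mem_right _ h

namespace Lay

lemma ram (H : Lay η q r s n τ a d x) {P : Ideal (𝓞 L)} (hP : P.IsPrime) (h2 : (2 : 𝓞 L) ∈ P) : (2 : 𝓞 L) ∈ P ^ (2 ^ (n + 1)) := by
  rcases Nat.eq_zero_or_pos n with h0 | h0
  · obtain ⟨A', -, hA'⟩ := intSqrt H.ha
    rw [h0]; exact two_ram H.hη H.hq4 hA' hP h2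
  · rcases H.hη with e | e
    · exact two_ram' h0 H.hx H.hq4 (by rw [H.ha, e, one_mul]) hP h2
    · have h3 := TT_succ x (n - 1)
      rw [show n - 1 + 1 = n by omega, H.hx] at h3
      have h4 : TT x (n - 1) ^ 2 = 2 := by linear_combination -h3
      refine two_ram' (a := a / TT x (n - 1)) h0 H.hx H.hq4 ?_ hP h2
      rw [div_mul_div_comm, ← sq (TT x _), h4, H.ha, e]; push_cast; ring

lemma two (H : Lay η q r s n τ a d x) : ∃ θ : 𝓞 L, 2 * (θ : L) = 1 + d ∧ ∀ P : Ideal (𝓞 L), P.IsPrime → (2 : 𝓞 L) ∈ P →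
    Ideal.absNorm P = 2 ∧ ∀ Q : Ideal (𝓞 L), Q.IsPrime → (2 : 𝓞 L) ∈ Q → (θ ∈ Q ↔ θ ∈ P) → Q = P := by
  obtain ⟨θ, m, h3, h4, h5⟩ := theta_ex H.hr8 H.hs8 H.hd H.τd
  exact ⟨θ, h5, fun P hP h2 => two_primes (by positivity) H.deg (fun P hP h => H.ram hP h) h3 h4 hP h2⟩

lemma card2 (H : Lay η q r s n τ a d x) : ∃ C : Finset (Ideal (𝓞 L)), C.card ≤ 2 ∧ ∀ P : Ideal (𝓞 L), P.IsPrime → (2 : 𝓞 L) ∈ P → P ∈ C := by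
  classical
  obtain ⟨θ, -, h⟩ := H.two
  have key : ∀ p : Prop, ∃ P : Ideal (𝓞 L), ∀ Q : Ideal (𝓞 L), Q.IsPrime → (2 : 𝓞 L) ∈ Q → (θ ∈ Q ↔ p) → Q = P := by
    intro p
    by_cases hp : ∃ P : Ideal (𝓞 L), P.IsPrime ∧ (2 : 𝓞 L) ∈ P ∧ (θ ∈ P ↔ p)
    · obtain ⟨P, hP, h2, e⟩ := hp
      exact ⟨P, fun Q hQ hQ2 e' => (h P hP h2).2 Q hQ hQ2 (e'.trans e.symm)⟩
    · exact ⟨⊥, fun Q hQ hQ2 e' => absurd ⟨Q, hQ, hQ2, e'⟩ hp⟩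
  obtain ⟨P1, h1⟩ := key True
  obtain ⟨P2, h2⟩ := key False
  refine ⟨{P1, P2}, Finset.card_le_two, fun P hP hP2 => ?_⟩
  rw [Finset.mem_insert, Finset.mem_singleton]
  by_cases hθ : θ ∈ P
  · exact Or.inl (h1 P hP hP2 (by simpa using hθ))
  · exact Or.inr (h2 P hP hP2 (by simpa using hθ))

lemma fix2 (H : Lay η q r s n τ a d x) (hσ : σ d = d) {P : Ideal (𝓞 L)} (hP : P.IsPrime) (h2 : (2 : 𝓞 L) ∈ P) : sI σ P = P := by
  obtain ⟨θ, e, h⟩ := H.two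
  have hθ : sO σ θ = θ := by
    apply RingOfIntegers.ext
    have h3 := congrArg σ e
    rw [map_mul, map_ofNat, map_add, map_one, hσ, ← e] at h3
    exact mul_left_cancel₀ two_ne_zero h3
  have hinj : Function.Injective (sO σ) := (sO σ).injective
  refine (h P hP h2).2 _ (sI_isPrime σ hP) ((mem_sI σ).2 ⟨2, h2, map_ofNat _ _⟩) ⟨fun h => ?_, fun h => (mem_sI σ).2 ⟨θ, h, hθ⟩⟩
  obtain ⟨y, hy, e'⟩ := (mem_sI σ).1 h
  rwa [hinj (e'.trans hθ.symm)] at hy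

variable (HK : Lay η q r s n τK aK dK xK) (HL : Lay η q r s (n + 1) τ a d x) (h : IsQuad K L σ x)
  (hdK : algebraMap K L dK = d)

include HK HL in
lemma relNorm2 {P : Ideal (𝓞 L)} (hP : P.IsPrime) (h2 : (2 : 𝓞 L) ∈ P) :
    Ideal.relNorm (𝓞 K) P = P.comap (algebraMap (𝓞 K) (𝓞 L)) := by
  apply relNorm_of_absNorm hP (prime_ne_bot (l := 2) (by norm_num) (by exact_mod_cast h2))
  obtain ⟨_, -, h3⟩ := HK.two
  obtain ⟨_, -, h4⟩ := HL.two
  rw [(h4 P hP h2).1, (h3 _ (Ideal.IsPrime.comap _) (two_comap h2)).1]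

include HK HL h in
lemma fix_le [IsTotallyReal K] [IsTotallyReal L] (φ : L →+* ℝ) {u : (𝓞 K)ˣ} (hu : u ∉ nU K σ) :
    Nat.card (dmH (mB (aCl σ))).ker ≤ Nat.card (B2 (ClassGroup (𝓞 K))) := by
  obtain ⟨C, hC, hC2⟩ := HK.card2
  have := AF_le h φ hC (fun P hP => ?_) hu
  · linarith
  · obtain ⟨X, Y, hX, -, e, -⟩ := TT_data HL.hx
    have h5 := RP_diff h hP X
    have h6 : sO σ X - X = - (2 * X) := by
      apply RingOfIntegers.ext
      simp only [v_sub, sO_coe, v_neg, v_mul, hX, h.σs, v_two]; ring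
    rw [h6, P.neg_mem_iff] at h5
    have hP' := hP.1
    have h7 : (2 : 𝓞 L) ∈ P := by
      rcases hP'.mem_or_mem h5 with h | h
      · exact h
      · exact TT_two_mem (x := x) (by omega) e h
    exact hC2 _ (Ideal.IsPrime.comap _) (two_comap h7)
end Lay

lemma sI_ext' {g : L ≃+* L} {gK : K ≃+* K} (hg : ∀ y, g (algebraMap K L y) = algebraMap K L (gK y)) (I : Ideal (𝓞 K)) :
    sI g (I.map (algebraMap (𝓞 K) (𝓞 L))) = (sI gK I).map (algebraMap (𝓞 K) (𝓞 L)) := by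
  change (I.map (algebraMap (𝓞 K) (𝓞 L))).map _ = (I.map _).map _
  rw [Ideal.map_map, Ideal.map_map]
  congr 1
  ext x
  exact hg _

lemma aCl_jCl' {g : L ≃+* L} {gK : K ≃+* K} (hg : ∀ y, g (algebraMap K L y) = algebraMap K L (gK y)) (c : ClassGroup (𝓞 K)) :
    aCl g (jCl K L c) = jCl K L (aCl gK c) := by
  obtain ⟨I, hI, rfl⟩ := cl_surj c
  rw [jCl_cl hI, aCl_cl g (ext_ne_bot hI), sI_ext' hg, aCl_cl gK hI, jCl_cl (sI_ne_bot gK hI)]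

/-- norm and automorphisms -/
lemma relNorm_g {x : L} (h : IsQuad K L σ x) {g : L ≃+* L} {gK : K ≃+* K} (hg : ∀ y, g (algebraMap K L y) = algebraMap K L (gK y))
    (hc : ∀ y, g (σ y) = σ (g y)) (I : Ideal (𝓞 L)) : Ideal.relNorm (𝓞 K) (sI g I) = sI gK (Ideal.relNorm (𝓞 K) I) := by
  apply ext_inj (L := L)
  have e1 : ∀ J : Ideal (𝓞 L), sI g (sI σ J) = sI σ (sI g J) := by
    intro J
    ext y
    simp only [mem_sI]
    constructor
    · rintro ⟨_, ⟨z, hz, rfl⟩, rfl⟩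
      exact ⟨_, ⟨z, hz, rfl⟩, RingOfIntegers.ext (hc z).symm⟩
    · rintro ⟨_, ⟨z, hz, rfl⟩, rfl⟩
      exact ⟨_, ⟨z, hz, rfl⟩, RingOfIntegers.ext (hc z)⟩
  rw [relNorm_ext h, ← e1, ← map_mul, ← relNorm_ext h]
  exact sI_ext' hg _

lemma nCl_g {x : L} (h : IsQuad K L σ x) {g : L ≃+* L} {gK : K ≃+* K} (hg : ∀ y, g (algebraMap K L y) = algebraMap K L (gK y))
    (hc : ∀ y, g (σ y) = σ (g y)) (c : ClassGroup (𝓞 L)) : nCl K L (aCl g c) = aCl gK (nCl K L c) := by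
  obtain ⟨I, hI, rfl⟩ := cl_surj c
  rw [aCl_cl g hI, nCl_cl (sI_ne_bot g hI), relNorm_g h hg hc, nCl_cl hI,
    aCl_cl gK (fun e => hI (Ideal.relNorm_eq_bot_iff.1 e))]

lemma step_n {x : L} (h : IsQuad K L σ x) {g : L ≃+* L} {gK : K ≃+* K} (hg : ∀ y, g (algebraMap K L y) = algebraMap K L (gK y))
    (hgg : ∀ y, g (g y) = σ y) (ht : ∀ c : B2 (ClassGroup (𝓞 K)), mB (aCl gK) c = c)
    (hk : (mB (nCl K L)).ker = (dmH (mB (aCl σ))).range) : (mB (nCl K L)).ker = ⊥ := by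
  have hcomp : ∀ c : B2 (ClassGroup (𝓞 L)), mB (aCl g) (mB (aCl g) c) = mB (aCl σ) c := by
    intro c
    obtain ⟨c, rfl⟩ := b2_surj c
    rw [mB_b2, mB_b2, mB_b2, aCl_comp (ρ := σ) (σ := g) (τ := g) (fun y => (hgg y).symm)]
  refine step_succ isTwo_B2 (mB (nCl K L)) (mB (aCl g)) ?_ ?_ ?_
  · intro c
    rw [hcomp, hcomp]
    obtain ⟨c, rfl⟩ := b2_surj c
    rw [mB_b2, mB_b2, ← aCl_comp (ρ := RingEquiv.refl L) (σ := σ) (τ := σ) (fun y => (h.invol y).symm), aCl_id (fun _ => rfl)]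
  · intro c
    rw [← ht (mB (nCl K L) c)]
    obtain ⟨c, rfl⟩ := b2_surj c
    rw [mB_b2, mB_b2, mB_b2, mB_b2, nCl_g h hg (fun y => by rw [← hgg, ← hgg])]
  · rw [hk]
    congr 2
    exact MonoidHom.ext fun c => (hcomp c).symm

lemma triv_of_ker {x : L} (h : IsQuad K L σ x) (hk : (mB (nCl K L)).ker = ⊥) (c : B2 (ClassGroup (𝓞 L))) : mB (aCl σ) c = c := by
  apply (MonoidHom.ker_eq_bot_iff _).1 hk
  obtain ⟨c, rfl⟩ := b2_surj c
  rw [mB_b2, mB_b2, mB_b2, nCl_aCl h]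

/-- the automorphism `σ` acts trivially on the classes coming from `D` -/
lemma sigma_D {k3 Q2 D : Type*} [Field k3] [NumberField k3] [Field Q2] [NumberField Q2] [Field D] [NumberField D]
    [Algebra k3 D] [Algebra Q2 D] [Algebra D L] [Algebra k3 L] [IsScalarTower k3 D L] {α β κ : D ≃+* D} {e w : D}
    (hα : IsQuad Q2 D α e) (hκ : IsQuad k3 D κ w) (hβ : ∀ y, β y = κ (α y))
    (hσ : ∀ y, σ (algebraMap D L y) = algebraMap D L (β y)) (hodd : Odd (Nat.card (ClassGroup (𝓞 Q2))))
    (h3 : ∀ c, mB (jCl k3 L) c = 1) (c : B2 (ClassGroup (𝓞 D))) :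
    mB (aCl σ) (mB (jCl D L) c) = mB (jCl D L) c := by
  have hjj : ∀ c : ClassGroup (𝓞 k3), jCl D L (jCl k3 D c) = jCl k3 L c := by
    intro c
    obtain ⟨I, hI, rfl⟩ := cl_surj c
    rw [jCl_cl hI, jCl_cl (ext_ne_bot hI), jCl_cl hI, Ideal.map_map]
    congr 2
    ext y
    exact (IsScalarTower.algebraMap_apply k3 D L y).symm
  obtain ⟨c, rfl⟩ := b2_surj c
  have e1 : mB (aCl σ) (mB (jCl D L) (b2 _ c)) = mB (jCl D L) (mB (aCl β) (b2 _ c)) := by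
    rw [mB_b2, mB_b2, mB_b2, mB_b2, aCl_jCl' hσ]
  have e2 : mB (aCl β) (b2 _ c) = (mB (aCl κ) (b2 _ c))⁻¹ := by
    rw [mB_b2, aCl_comp (σ := α) (τ := κ) hβ, ← mB_b2, ← mB_b2, inv_of_odd hα hodd, map_inv]
  have e3 : mB (jCl D L) (b2 _ c) * mB (jCl D L) (mB (aCl κ) (b2 _ c)) = 1 := by
    rw [← map_mul, mB_b2, ← map_mul, ← jCl_nCl hκ, mB_b2, hjj, ← mB_b2, h3]
  rw [e1, e2, map_inv, inv_eq_iff_mul_eq_one, mul_comm]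
  exact e3
end
end

section
lemma B2_tors {G : Type*} [CommGroup G] [Finite G] :
    Nat.card (powMonoidHom 2 : B2 G →* B2 G).ker ≤ Nat.card (powMonoidHom 2 : G →* G).ker := by
  rw [← index_sq, ← index_sq]
  have h1 : (powMonoidHom 2 : B2 G →* B2 G).range = (powMonoidHom 2 : G →* G).range.map (b2 G) := by
    ext x
    simp only [MonoidHom.mem_range, Subgroup.mem_map, powMonoidHom_apply]
    constructor
    · rintro ⟨y, rfl⟩
      obtain ⟨z, rfl⟩ := b2_surj y
      exact ⟨z ^ 2, ⟨z, rfl⟩, map_pow _ _ _⟩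
    · rintro ⟨_, ⟨z, rfl⟩, rfl⟩
      exact ⟨b2 G z, (map_pow _ _ _).symm⟩
  rw [h1]
  exact Nat.le_of_dvd (Nat.pos_of_ne_zero Subgroup.FiniteIndex.index_ne_zero) (Subgroup.index_map_dvd _ b2_surj)

section
variable {L : Type*} [Field L] [NumberField L]

lemma ideal_sq_inj {I J : Ideal (𝓞 L)} (h : I * I = J * J) : I = J := by
  rw [← sq, ← sq] at h
  have h1 : I ∣ J := (UniqueFactorizationMonoid.pow_dvd_pow_iff_dvd two_ne_zero).1 h.dvd
  have h2 : J ∣ I := (UniqueFactorizationMonoid.pow_dvd_pow_iff_dvd two_ne_zero).1 h.symm.dvd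
  exact dvd_antisymm h1 h2

/-- `e² = m n` with `m, n` coprime -/
lemma split_sq {e : 𝓞 L} {m n : ℕ} (hc : Nat.Coprime m n) (he : e * e = (m * n : ℕ)) :
    Ideal.span {(m : 𝓞 L), e} * Ideal.span {(m : 𝓞 L), e} = Ideal.span {(m : 𝓞 L)} ∧
    Ideal.span {(m : 𝓞 L), e} * Ideal.span {(n : 𝓞 L), e} = Ideal.span {e} := by
  obtain ⟨u, v, huv⟩ := Nat.isCoprime_iff_coprime.2 hc
  have huv' : (u : 𝓞 L) * m + v * n = 1 := by exact_mod_cast huv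
  rw [Nat.cast_mul] at he
  rw [Ideal.span_pair_mul_span_pair, Ideal.span_pair_mul_span_pair]
  constructor
  · apply le_antisymm
    · rw [Ideal.span_le]
      rintro _ (rfl | rfl | rfl | rfl)
      · exact Ideal.mem_span_singleton.2 ⟨m, rfl⟩
      · exact Ideal.mem_span_singleton.2 ⟨e, rfl⟩
      · exact Ideal.mem_span_singleton.2 ⟨e, mul_comm _ _⟩
      · exact Ideal.mem_span_singleton.2 ⟨n, he⟩
    · rw [Ideal.span_singleton_le_iff_mem]
      have e1 : (m : 𝓞 L) = u * (m * m) + v * (e * e) := by linear_combination -v * he - m * huv'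
      have e2 : ∀ J : Ideal (𝓞 L), (m : 𝓞 L) * m ∈ J → e * e ∈ J → (m : 𝓞 L) ∈ J := fun J h1 h2 => by
        rw [e1]; exact J.add_mem (J.mul_mem_left _ h1) (J.mul_mem_left _ h2)
      exact e2 _ (Ideal.subset_span (by simp)) (Ideal.subset_span (by simp))
  · apply le_antisymm
    · rw [Ideal.span_le]
      rintro _ (rfl | rfl | rfl | rfl)
      · exact Ideal.mem_span_singleton.2 ⟨e, he.symm⟩
      · exact Ideal.mem_span_singleton.2 ⟨m, mul_comm _ _⟩
      · exact Ideal.mem_span_singleton.2 ⟨n, rfl⟩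
      · exact Ideal.mem_span_singleton.2 ⟨e, rfl⟩
    · rw [Ideal.span_singleton_le_iff_mem]
      have e1 : e = u * (m * e) + v * (e * n) := by linear_combination -e * huv'
      have e2 : ∀ J : Ideal (𝓞 L), (m : 𝓞 L) * e ∈ J → e * n ∈ J → e ∈ J := fun J h1 h2 => by
        rw [e1]; exact J.add_mem (J.mul_mem_left _ h1) (J.mul_mem_left _ h2)
      exact e2 _ (Ideal.subset_span (by simp)) (Ideal.subset_span (by simp))

lemma split_norm (hdeg : Module.finrank ℚ L = 2) {e : 𝓞 L} {m n : ℕ} (hc : Nat.Coprime m n) (he : e * e = (m * n : ℕ)) :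
    Ideal.absNorm (Ideal.span {(m : 𝓞 L), e}) = m := by
  have h1 := congrArg Ideal.absNorm (split_sq hc he).1
  rw [map_mul, absNorm_nat, hdeg, ← sq] at h1
  exact Nat.pow_left_injective (n := 2) (by norm_num) h1

lemma Q2_odd {σ : L ≃+* L} {s : L} (h : IsQuad ℚ L σ s) [IsTotallyReal L] (φ : L →+* ℝ) (hs : s * s = 2) :
    Odd (Nat.card (ClassGroup (𝓞 L))) := by
  obtain ⟨A, hA, hA2⟩ := intSqrt (d := s) (m := 2) (by rw [hs]; norm_num)
  have h1 := rat_tors h φ {2} (by simp [Nat.prime_two]) (by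
    intro P hP
    refine ⟨2, by simp, ?_⟩
    have h5 := RP_diff h hP A
    have h6 : sO σ A - A = - (2 * A) := by
      apply RingOfIntegers.ext
      simp only [v_sub, sO_coe, v_neg, v_mul, hA, h.σs, v_two]; ring
    rw [h6, P.neg_mem_iff] at h5
    rcases mem_of_four hP.1 hA2 h5 with h | h <;> exact h)
  apply odd_card_of_tors
  simp only [Finset.card_singleton, pow_one] at h1
  have h2 := (Nat.dvd_prime Nat.prime_two).1 ((dvd_mul_right _ _).trans h1)
  omega

variable {η q r s : ℕ} {a0 b0 A B ε0 ε1 : ℤ} [Fact q.Prime] [Fact r.Prime] [Fact s.Prime]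
variable {k : Type*} [Field k] [NumberField k] {ρ : k ≃+* k} {e : k}

lemma k3_tors (h : IsQuad ℚ k ρ e) [IsTotallyReal k] (φ : k →+* ℝ) (M : Nm η q r s a0 b0 A B ε0 ε1)
    (he : e * e = (2 * η * q * r * s : ℕ)) : Nat.card (powMonoidHom 2 : ClassGroup (𝓞 k) →* _).ker ≤ 4 := by
  have hr : r.Prime := Fact.out
  have hs : s.Prime := Fact.out
  have hqp : q.Prime := Fact.out
  obtain ⟨E, hE, hE2⟩ := intSqrt he
  have h1 := rat_tors h φ {2, q, r, s} (by
    intro l hl; simp only [Finset.mem_insert, Finset.mem_singleton] at hl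
    rcases hl with rfl | rfl | rfl | rfl
    · exact Nat.prime_two
    all_goals assumption) (by
    intro P hP
    have h5 := RP_diff h hP E
    have h6 : sO ρ E - E = - (2 * E) := by
      apply RingOfIntegers.ext
      simp only [v_sub, sO_coe, v_neg, v_mul, hE, h.σs, v_two]; ring
    rw [h6, P.neg_mem_iff] at h5
    rcases mem_of_four hP.1 hE2 h5 with h | h
    · exact ⟨2, by simp, h⟩
    · simp only [Nat.cast_mul] at h
      rcases hP.1.mem_or_mem h with h | h
      · rcases hP.1.mem_or_mem h with h | h
        · rcases hP.1.mem_or_mem h with h | h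
          · rcases hP.1.mem_or_mem h with h | h
            · exact ⟨2, by simp, h⟩
            · rcases M.hη with rfl | rfl
              · exact absurd ((Ideal.eq_top_iff_one _).2 (by simpa using h)) hP.1.ne_top
              · exact ⟨2, by simp, h⟩
          · exact ⟨q, by simp, h⟩
        · exact ⟨r, by simp, h⟩
      · exact ⟨s, by simp, h⟩)
  have hqr := M.nqr
  have hqs := M.nqs
  have h2q : q ≠ 2 := by rintro rfl; have := M.hq4; omega
  have hnd : ¬ (q : ℤ) ^ 2 ∣ (2 * η * q * r * s : ℕ) := by
    intro h
    have h' : q ^ 2 ∣ 2 * η * q * r * s := by exact_mod_cast h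
    have h2 : q * q ∣ q * (2 * η * r * s) := by rw [← sq]; convert h' using 1; ring
    have h3 := Nat.dvd_of_mul_dvd_mul_left hqp.pos h2
    rcases hqp.dvd_mul.1 h3 with h4 | h4
    · rcases hqp.dvd_mul.1 h4 with h4 | h4
      · rcases hqp.dvd_mul.1 h4 with h4 | h4
        · exact h2q ((Nat.prime_dvd_prime_iff_eq hqp Nat.prime_two).1 h4)
        · rcases M.hη with e | e <;> rw [e] at h4
          · exact hqp.one_lt.ne' (Nat.dvd_one.1 h4)
          · exact h2q ((Nat.prime_dvd_prime_iff_eq hqp Nat.prime_two).1 h4)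
      · exact hqr ((Nat.prime_dvd_prime_iff_eq hqp hr).1 h4)
    · exact hqs ((Nat.prime_dvd_prime_iff_eq hqp hs).1 h4)
  have h2 : (nU ℚ ρ).index ≠ 1 := neg_one_nU h (c := (2 * η * q * r * s : ℕ)) (by rw [he]; push_cast; rfl) M.hq4
    ⟨2 * η * r * s, by push_cast; ring⟩ hnd
  exact pow_two_bound (t := 2) (h1.trans (pow_dvd_pow 2 Finset.card_le_four)) h2

lemma k3_nsq (h : IsQuad ℚ k ρ e) {l m n : ℕ} [Fact l.Prime] (he : e * e = (m * n : ℕ)) (hc : Nat.Coprime m n)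
    (hl8 : l % 8 = 5) (hl : l ∣ m) (hl2 : ¬ l ^ 2 ∣ m) (hn : legendreSym l n = -1) {E : 𝓞 k} (hE : (E : k) = e) :
    ¬ IsSquare (cl (Ideal.span {(m : 𝓞 k), E})) := by
  have hE2 : E * E = (m * n : ℕ) := by
    apply RingOfIntegers.ext; rw [v_mul, hE, he, v_nat]
  have hn0 : n ≠ 0 := by rintro rfl; simp at hn
  have hE0 : E ≠ 0 := by rintro rfl; apply h.s0; rw [← hE]; rfl
  have hI : Ideal.span {(m : 𝓞 k), E} ≠ ⊥ := fun e => hE0 (by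
    have : E ∈ Ideal.span {(m : 𝓞 k), E} := Ideal.subset_span (by simp)
    rw [e] at this; simpa using this)
  have hJ : Ideal.span {(n : 𝓞 k), E} ≠ ⊥ := fun e => hE0 (by
    have : E ∈ Ideal.span {(n : 𝓞 k), E} := Ideal.subset_span (by simp)
    rw [e] at this; simpa using this)
  have h1 := (split_sq hc hE2).2
  have h2 : cl (Ideal.span {(m : 𝓞 k), E}) = (cl (Ideal.span {(n : 𝓞 k), E}))⁻¹ := by
    apply eq_inv_of_mul_eq_one_left
    rw [← cl_mul hI hJ, h1, cl_span hE0]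
  rw [h2, isSquare_inv]
  refine rat_nsq h (c := (m * n : ℕ)) (by rw [he]; push_cast; rfl) (l := l) (by exact_mod_cast hl.mul_right n) ?_ hJ (split_norm h.finrank hc.symm
    (by rw [hE2, mul_comm])) (leg_nonsq hn) (leg_nonsq ?_)
  · intro h3
    have h4 : l ^ 2 ∣ m * n := by exact_mod_cast h3
    have h5 : Nat.Coprime (l ^ 2) n := Nat.Coprime.pow_left 2 (hc.coprime_dvd_left hl)
    exact hl2 (h5.dvd_of_dvd_mul_right h4)
  · rw [← neg_one_mul, legendreSym.mul, hn, leg_neg_one_of_five hl8]; rfl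
end

lemma span_pair_ext {K L : Type*} [Field K] [NumberField K] [Field L] [NumberField L] [Algebra K L] {m n : ℕ} {E : 𝓞 K}
    (hc : Nat.Coprime m n) (hE : E * E = (m * n : ℕ)) {x w : 𝓞 L} (hw : IsUnit w) (hx : x * x = m * w) :
    (Ideal.span {(m : 𝓞 K), E}).map (algebraMap (𝓞 K) (𝓞 L)) = Ideal.span {x} := by
  apply ideal_sq_inj
  rw [← Ideal.map_mul, (split_sq hc hE).1, Ideal.map_span, Set.image_singleton, map_natCast,
    Ideal.span_singleton_mul_span_singleton, hx]
  exact (Ideal.span_singleton_mul_right_unit hw _).symm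

section
variable {η q r s : ℕ} {a0 b0 A B ε0 ε1 : ℤ} [Fact q.Prime] [Fact r.Prime] [Fact s.Prime]
variable {k : Type*} [Field k] [NumberField k] {ρ : k ≃+* k} {e : k}
variable {L : Type*} [Field L] [NumberField L] [Algebra k L]

lemma k3_kill (h : IsQuad ℚ k ρ e) [IsTotallyReal k] (φ : k →+* ℝ) (M : Nm η q r s a0 b0 A B ε0 ε1)
    (he : e * e = (2 * η * q * r * s : ℕ)) {x1 w x2 w' : 𝓞 L} (hw : IsUnit w) (hw' : IsUnit w')
    (hx1 : x1 * x1 = r * w) (hx2 : x2 * x2 = s * w') (c : B2 (ClassGroup (𝓞 k))) :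
    mB (jCl k L) c = 1 := by
  have hr : r.Prime := Fact.out
  have hs : s.Prime := Fact.out
  have hqp : q.Prime := Fact.out
  have hne := M.hne
  have hqr := M.nqr
  have hqs := M.nqs
  have hr2 : r ≠ 2 := by rintro rfl; have := M.hr8; omega
  have hs2 : s ≠ 2 := by rintro rfl; have := M.hs8; omega
  obtain ⟨E, hE, hE2⟩ := intSqrt he
  have crη : ∀ l : ℕ, l.Prime → l ≠ 2 → Nat.Coprime l η := by
    intro l hl h2
    rcases M.hη with e | e <;> rw [e]
    · exact Nat.coprime_one_right l
    · exact (Nat.coprime_primes hl Nat.prime_two).2 h2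
  have c2 : ∀ l : ℕ, l.Prime → l ≠ 2 → l ≠ q → Nat.Coprime l (2 * (η * q)) := fun l hl h2 hq =>
    Nat.Coprime.mul_right ((Nat.coprime_primes hl Nat.prime_two).2 h2) (Nat.Coprime.mul_right (crη l hl h2)
      ((Nat.coprime_primes hl hqp).2 hq))
  have crs : Nat.Coprime r s := (Nat.coprime_primes hr hs).2 hne
  have c_r : Nat.Coprime r (2 * (η * q) * s) := Nat.Coprime.mul_right (c2 r hr hr2 hqr.symm) crs
  have c_s : Nat.Coprime s (2 * (η * q) * r) := Nat.Coprime.mul_right (c2 s hs hs2 hqs.symm) crs.symm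
  have c_rs : Nat.Coprime (r * s) (2 * (η * q)) := Nat.Coprime.mul_left (c2 r hr hr2 hqr.symm) (c2 s hs hs2 hqs.symm)
  have e_r : 2 * η * q * r * s = r * (2 * (η * q) * s) := by ring
  have e_s : 2 * η * q * r * s = s * (2 * (η * q) * r) := by ring
  have e_rs : 2 * η * q * r * s = (r * s) * (2 * (η * q)) := by ring
  have l2r : legendreSym r (2 * (η * q) : ℕ) = -1 := by
    rw [Nat.cast_mul, legendreSym.mul, M.lr]
    have := leg_two_of_five M.hr8
    simpa using this
  have l2s : legendreSym s (2 * (η * q) : ℕ) = -1 := by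
    rw [Nat.cast_mul, legendreSym.mul, M.ls]
    have := leg_two_of_five M.hs8
    simpa using this
  have lr : legendreSym r (2 * (η * q) * s : ℕ) = -1 := by
    rw [Nat.cast_mul, legendreSym.mul, l2r, M.lrs]; rfl
  have ls : legendreSym s (2 * (η * q) * r : ℕ) = -1 := by
    rw [Nat.cast_mul, legendreSym.mul, l2s, M.lsr]; rfl
  have np : ∀ l : ℕ, l.Prime → ¬ l ^ 2 ∣ l := fun l hl h => by
    have := Nat.le_of_dvd hl.pos h
    nlinarith [hl.two_le]
  have n1 := k3_nsq h (e_r ▸ he) c_r M.hr8 dvd_rfl (np r hr) lr hE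
  have n2 := k3_nsq h (e_s ▸ he) c_s M.hs8 dvd_rfl (np s hs) ls hE
  have n3 := k3_nsq h (e_rs ▸ he) c_rs M.hr8 (dvd_mul_right r s) (by
    intro h
    rw [sq] at h
    have := Nat.dvd_of_mul_dvd_mul_left hr.pos h
    exact hne ((Nat.prime_dvd_prime_iff_eq hr hs).1 this)) l2r hE
  have hE0 : E ≠ 0 := by rintro rfl; apply h.s0; rw [← hE]; rfl
  have hI : ∀ m : ℕ, Ideal.span {(m : 𝓞 k), E} ≠ ⊥ := fun m e => hE0 (by
    have : E ∈ Ideal.span {(m : 𝓞 k), E} := Ideal.subset_span (by simp)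
    rw [e] at this; simpa using this)
  have e3 : Ideal.span {((r * s : ℕ) : 𝓞 k), E} = Ideal.span {(r : 𝓞 k), E} * Ideal.span {(s : 𝓞 k), E} := by
    apply ideal_sq_inj
    rw [(split_sq c_rs (e_rs ▸ hE2)).1, mul_mul_mul_comm, (split_sq c_r (e_r ▸ hE2)).1, (split_sq c_s (e_s ▸ hE2)).1,
      Ideal.span_singleton_mul_span_singleton, Nat.cast_mul]
  rw [e3, cl_mul (hI _) (hI _)] at n3
  have hg := gen_two (A := B2 (ClassGroup (𝓞 k))) isTwo_B2 (B2_tors.trans (k3_tors h φ M he))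
    (fun h => n1 (b2_square h)) (fun h => n2 (b2_square h)) (fun h => n3 (b2_square (by rw [map_mul]; exact h)))
  have hc : c ∈ Subgroup.closure {b2 _ (cl (Ideal.span {(r : 𝓞 k), E})), b2 _ (cl (Ideal.span {(s : 𝓞 k), E}))} := by
    rw [hg]; trivial
  have hle : Subgroup.closure {b2 _ (cl (Ideal.span {(r : 𝓞 k), E})), b2 _ (cl (Ideal.span {(s : 𝓞 k), E}))} ≤ (mB (jCl k L)).ker := by
    rw [Subgroup.closure_le]
    have nz : ∀ (l : ℕ) (x w : 𝓞 L), l.Prime → IsUnit w → x * x = l * w → x ≠ 0 := by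
      rintro l x w hl hw hx rfl
      rw [zero_mul] at hx
      rcases mul_eq_zero.1 hx.symm with h | h
      · exact hl.ne_zero (by exact_mod_cast h)
      · exact hw.ne_zero h
    rintro _ (rfl | rfl)
    · show mB (jCl k L) _ = 1
      rw [mB_b2, jCl_cl (hI _), span_pair_ext c_r (e_r ▸ hE2) hw hx1, cl_span (nz r x1 w hr hw hx1), map_one]
    · show mB (jCl k L) _ = 1
      rw [mB_b2, jCl_cl (hI _), span_pair_ext c_s (e_s ▸ hE2) hw' hx2, cl_span (nz s x2 w' hs hw' hx2), map_one]
  exact hle hc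
end
end

section
lemma resid_TT {p : ℕ} [Fact p.Prime] {A : Type*} [CommRing A] [IsDomain A] (f : ZMod p →+* A) (n : ℕ) :
    ∀ y : A, TT y n = 0 → 2 ^ (n + 2) ∣ p - 1 → ∃ w : ZMod p, w ^ 2 ^ (n + 1) = -1 ∧ y = f (w + w⁻¹) := by
  have hp : p.Prime := Fact.out
  induction n with
  | zero =>
    intro y hy hd
    rw [TT_zero] at hy
    have h1 : p % 4 = 1 := by have := hp.two_le; omega
    obtain ⟨w, hw⟩ := (ZMod.exists_sq_eq_neg_one_iff (p := p)).2 (by omega)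
    have hw0 : w ≠ 0 := by
      rintro rfl; simp at hw
    refine ⟨w, by rw [zero_add, pow_one, sq, ← hw], ?_⟩
    have h3 : w + w⁻¹ = 0 := by
      field_simp
      rw [sq, ← hw]; ring
    rw [hy, h3, map_zero]
  | succ n ih =>
    intro y hy hd
    rw [TT_succ'] at hy
    obtain ⟨w, hw, hw2⟩ := ih _ hy ((pow_dvd_pow 2 (by omega)).trans hd)
    have hw0 : w ≠ 0 := by
      rintro rfl
      rw [zero_pow (by positivity)] at hw
      simp at hw
    obtain ⟨c, hc⟩ := hd
    have h2 : p / 2 = 2 ^ (n + 1) * (2 * c) := by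
      have h3 : 2 ^ (n + 1 + 2) * c = 2 * (2 ^ (n + 1) * (2 * c)) := by ring
      have := hp.two_le
      omega
    have h4 : IsSquare w := by
      rw [ZMod.euler_criterion p hw0, h2, pow_mul, hw, pow_mul]; simp
    obtain ⟨v, rfl⟩ := h4
    have hv : v ≠ 0 := fun h => hw0 (by rw [h]; simp)
    have h5 : v ^ 2 ^ (n + 1 + 1) = -1 := by
      rw [← hw, pow_succ' 2 (n + 1), pow_mul, sq]
    have h6 : y ^ 2 = (f (v + v⁻¹)) ^ 2 := by
      have e1 : (v + v⁻¹) ^ 2 = v * v + (v * v)⁻¹ + 2 := by field_simp; ring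
      rw [← map_pow, e1, map_add, ← hw2, map_ofNat]; ring
    rcases sq_eq_sq_iff_eq_or_eq_neg.1 h6 with h | h
    · exact ⟨v, h5, h⟩
    · refine ⟨-v, ?_, ?_⟩
      · rw [Even.neg_pow (by simp [parity_simps]), h5]
      · rw [h, ← map_neg]; congr 1; rw [inv_neg]; ring

section
variable {K L : Type*} [Field K] [NumberField K] [Field L] [NumberField L] [Algebra K L] {σ : L ≃+* L} {s : L}

lemma TT_int {x : L} {n p : ℕ} [Fact p.Prime] {X : 𝓞 L} (hX : (X : L) = x) (hXn : TT X n = 0) (hp : 2 ^ (n + 2) ∣ p - 1) {P : Ideal (𝓞 L)}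
    (hP : P.IsPrime) (hpP : (p : 𝓞 L) ∈ P) : ∃ z : ℕ, X - z ∈ P := by
  have hpp : p.Prime := Fact.out
  have : CharP (𝓞 L ⧸ P) p := by
    rw [CharP.charP_iff_prime_eq_zero hpp]
    have := Ideal.Quotient.eq_zero_iff_mem.2 hpP
    simpa using this
  obtain ⟨w, -, hw⟩ := resid_TT (ZMod.castHom (dvd_refl p) (𝓞 L ⧸ P)) n (Ideal.Quotient.mk P X)
    (by rw [← TT_map, hXn, map_zero]) hp
  refine ⟨(w + w⁻¹).val, ?_⟩
  rw [← Ideal.Quotient.eq_zero_iff_mem, map_sub, hw, sub_eq_zero, map_natCast]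
  conv_lhs => rw [← ZMod.natCast_zmod_val (w + w⁻¹)]
  rw [map_natCast]

lemma relNorm_p {x : L} (h : IsQuad K L σ x) {m p : ℕ} [Fact p.Prime] (hx : TT x (m + 1) = 0) (hp : 2 ^ (m + 1 + 2) ∣ p - 1)
    {P : Ideal (𝓞 L)} (hP : P.IsPrime) (hpP : (p : 𝓞 L) ∈ P) :
    Ideal.relNorm (𝓞 K) P = P.comap (algebraMap (𝓞 K) (𝓞 L)) := by
  have hpp : p.Prime := Fact.out
  obtain ⟨X, Y, hX, hXm, hXY, -⟩ := TT_data hx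
  obtain ⟨z, hz⟩ := TT_int hX hXm hp hP hpP
  apply relNorm_of_ne h hP (prime_ne_bot hpp.ne_zero hpP)
  have h2 : (2 : 𝓞 L) ∉ P := by
    intro h2
    have hc : Nat.Coprime p 2 := by
      rw [Nat.coprime_primes hpp Nat.prime_two]
      rintro rfl
      have : 2 ∣ 2 - 1 := (dvd_pow_self 2 (by omega)).trans hp
      omega
    exact coprime_mem hc hP hpP h2
  refine sI_ne_of_resid h (x := X) (a := (z : 𝓞 K)) ?_ (by rwa [map_natCast]) ?_
  · apply RingOfIntegers.ext; rw [sO_coe, hX, h.σs, v_neg, hX]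
  · intro h3
    rcases hP.mem_or_mem h3 with h3 | h3
    · exact h2 h3
    · exact h2 (TT_two_mem (x := x) (Nat.succ_pos m) hXY h3)

lemma relNorm_split (h : IsQuad K L σ s) {n p : ℕ} [Fact p.Prime] {x : 𝓞 L} (hx : sO σ x = -x) (hxx : x * x = (n : ℕ))
    (hn : IsSquare (n : ZMod p)) (hn0 : (n : ZMod p) ≠ 0) (hp2 : p ≠ 2)
    {P : Ideal (𝓞 L)} (hP : P.IsPrime) (hpP : (p : 𝓞 L) ∈ P) :
    Ideal.relNorm (𝓞 K) P = P.comap (algebraMap (𝓞 K) (𝓞 L)) := by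
  have hpp : p.Prime := Fact.out
  apply relNorm_of_ne h hP (prime_ne_bot hpp.ne_zero hpP)
  have h2 : 2 * x ∉ P := by
    intro h3
    rcases hP.mem_or_mem h3 with h3 | h3
    · exact coprime_mem ((Nat.coprime_primes hpp Nat.prime_two).2 hp2) hP hpP h3
    · have h4 : (n : 𝓞 L) ∈ P := by rw [← hxx]; exact P.mul_mem_left _ h3
      refine coprime_mem (m := p) (n := n) ?_ hP hpP h4
      rw [Nat.Prime.coprime_iff_not_dvd hpp]
      rwa [← ZMod.natCast_eq_zero_iff]
  obtain ⟨z, hz⟩ := hn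
  have h3 : (p : ℤ) ∣ n - (z.val : ℤ) * z.val := by
    rw [← ZMod.intCast_zmod_eq_zero_iff_dvd] <;> try infer_instance
    push_cast
    rw [hz, ZMod.natCast_zmod_val, sub_self]
  obtain ⟨c, hc⟩ := h3
  have h4 : (x - z.val) * (x + z.val) ∈ P := by
    have h5 : ((n : ℤ) - (z.val : ℤ) * z.val : 𝓞 L) = p * (c : ℤ) := by exact_mod_cast hc
    have e : (x - z.val) * (x + z.val) = p * (c : ℤ) := by
      rw [← h5]; push_cast; linear_combination hxx
    rw [e]; exact P.mul_mem_right _ hpP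
  rcases hP.mem_or_mem h4 with h4 | h4
  · exact sI_ne_of_resid h (a := (z.val : 𝓞 K)) hx (by rwa [map_natCast]) h2
  · exact sI_ne_of_resid h (a := -(z.val : 𝓞 K)) hx (by rwa [map_neg, map_natCast, sub_neg_eq_add]) h2

variable {F : Type*} [Field F] [NumberField F] {ρ : F ≃+* F} {aF : F}

lemma rat_absNorm_span (p : ℕ) : Ideal.absNorm (Ideal.span {(p : 𝓞 ℚ)}) = p := by
  rw [absNorm_nat, Module.finrank_self, pow_one]

lemma inert_span (h : IsQuad ℚ F ρ aF) {n p : ℕ} [Fact p.Prime] (ha : aF * aF = (n : ℕ)) (hn : ¬ IsSquare (n : ZMod p)) (hp2 : p ≠ 2)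
    {P : Ideal (𝓞 F)} (hP : P.IsPrime) (hpP : (p : 𝓞 F) ∈ P) : P = Ideal.span {(p : 𝓞 F)} := by
  have hpp : p.Prime := Fact.out
  obtain ⟨A, hA, hAA⟩ := intSqrt ha
  have hP0 : P ≠ ⊥ := prime_ne_bot hpp.ne_zero hpP
  have hm : P.comap (algebraMap (𝓞 ℚ) (𝓞 F)) = Ideal.span {(p : 𝓞 ℚ)} := by
    apply rat_span hpp (hP.comap _)
    rw [Ideal.mem_comap, map_natCast]; exact hpP
  by_cases hs : sI ρ P = P
  · by_cases hex : ∃ a : Ideal (𝓞 ℚ), P = a.map (algebraMap (𝓞 ℚ) (𝓞 F))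
    · obtain ⟨a, ha⟩ := hex
      have h1 : a ≤ Ideal.span {(p : 𝓞 ℚ)} := by
        rw [← hm]; exact Ideal.map_le_iff_le_comap.1 ha.ge
      apply le_antisymm
      · have := Ideal.map_mono (f := algebraMap (𝓞 ℚ) (𝓞 F)) h1
        rw [← ha, Ideal.map_span, Set.image_singleton, map_natCast] at this
        exact this
      · rwa [Ideal.span_singleton_le_iff_mem]
    · exfalso
      have hRP : RP ℚ ρ P := ⟨hP, hP0, hs, fun a ha => hex ⟨a, ha⟩⟩
      have h5 := RP_diff h hRP A
      have h6 : sO ρ A - A = - (2 * A) := by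
        apply RingOfIntegers.ext
        simp only [v_sub, sO_coe, v_neg, v_mul, hA, h.σs, v_two]; ring
      rw [h6, P.neg_mem_iff] at h5
      rcases mem_of_four hP hAA h5 with h | h
      · exact coprime_mem ((Nat.coprime_primes hpp Nat.prime_two).2 hp2) hP hpP h
      · refine coprime_mem (m := p) (n := n) ?_ hP hpP h
        rw [Nat.Prime.coprime_iff_not_dvd hpp, ← ZMod.natCast_eq_zero_iff]
        intro h; rw [h] at hn; exact hn (IsSquare.zero)
  · exfalso
    have h1 := relNorm_of_ne h hP hP0 hs
    have h2 : Ideal.absNorm P = p := by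
      rw [← Ideal.absNorm_relNorm (𝓞 ℚ) (𝓞 F) P, h1, hm, rat_absNorm_span]
    obtain ⟨f, -⟩ := residHom h2
    exact hn ⟨f A, by rw [← map_mul, hAA, map_natCast]⟩

lemma rat_ideal_of_absNorm {p : ℕ} (hp : p.Prime) {I : Ideal (𝓞 ℚ)} (h : Ideal.absNorm I = p) : I = Ideal.span {(p : 𝓞 ℚ)} :=
  rat_span hp (isPrime_of_absNorm hp h) (by rw [← h]; exact Ideal.absNorm_mem I)
end

section
variable {η q r s : ℕ} {a0 b0 A B ε0 ε1 : ℤ} [Fact q.Prime] [Fact r.Prime] [Fact s.Prime]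

/-- the auxiliary prime -/
structure Px (η q r s N p : ℕ) [Fact p.Prime] [Fact r.Prime] [Fact s.Prime] : Prop where
  hN : 2 ^ N ∣ p - 1
  h8 : p % 8 = 1
  lr : legendreSym r p = -1
  ls : legendreSym s p = 1
  nq : ¬ IsSquare ((η * q : ℕ) : ZMod p)
  sq2 : IsSquare ((2 : ℕ) : ZMod p)
  sqd : IsSquare ((η * q * (r * s) : ℕ) : ZMod p)
  nd : ((η * q * (r * s) : ℕ) : ZMod p) ≠ 0

lemma Px.ex (M : Nm η q r s a0 b0 A B ε0 ε1) (N : ℕ) : ∃ (p : ℕ) (_ : Fact p.Prime), Px η q r s N p := by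
  have hr : r.Prime := Fact.out
  have hs : s.Prime := Fact.out
  have hqp : q.Prime := Fact.out
  have hne := M.hne
  have hqr := M.nqr
  have hqs := M.nqs
  have hr2 : r ≠ 2 := by rintro rfl; have := M.hr8; omega
  have hs2 : s ≠ 2 := by rintro rfl; have := M.hs8; omega
  have hq2 : q ≠ 2 := by rintro rfl; have := M.hq4; omega
  have c1 : Nat.Coprime q r := (Nat.coprime_primes hqp hr).2 hqr
  have c2 : Nat.Coprime (2 ^ (N + 3) * s) (q * r) := by
    apply Nat.Coprime.mul_left
    · apply Nat.Coprime.pow_left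
      exact Nat.Coprime.mul_right ((Nat.coprime_primes Nat.prime_two hqp).2 hq2.symm) ((Nat.coprime_primes Nat.prime_two hr).2 hr2.symm)
    · exact Nat.Coprime.mul_right ((Nat.coprime_primes hs hqp).2 hqs.symm) ((Nat.coprime_primes hs hr).2 hne.symm)
  obtain ⟨x, hx1, hx2⟩ := Nat.chineseRemainder c1 (q - 1) 2
  obtain ⟨y, hy1, hy2⟩ := Nat.chineseRemainder c2 1 x
  have hyq : y ≡ q - 1 [MOD q] := (hy2.of_mul_right r).trans hx1
  have hyr : y ≡ 2 [MOD r] := (hy2.of_mul_left q).trans hx2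
  have hcop : Nat.Coprime y ((2 ^ (N + 3) * s) * (q * r)) := by
    apply Nat.Coprime.mul_right
    · rw [Nat.Coprime, hy1.gcd_eq]; exact Nat.gcd_one_left _
    · apply Nat.Coprime.mul_right
      · rw [Nat.Coprime, hyq.gcd_eq]
        exact (Nat.coprime_self_sub_left hqp.one_lt.le).2 (Nat.coprime_one_left q)
      · rw [Nat.Coprime, hyr.gcd_eq]
        exact (Nat.coprime_primes Nat.prime_two hr).2 hr2.symm
  obtain ⟨p, hgt, hp, hpy⟩ := Nat.forall_exists_prime_gt_and_modEq (η * q * (r * s)) (q := (2 ^ (N + 3) * s) * (q * r)) (by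
    have := hqp.ne_zero; have := hr.ne_zero; have := hs.ne_zero; positivity) hcop
  have fp : Fact p.Prime := ⟨hp⟩
  have h1 : p ≡ 1 [MOD 2 ^ (N + 3) * s] := (hpy.of_mul_right _).trans hy1
  have h2 : p ≡ 1 [MOD 2 ^ (N + 3)] := h1.of_mul_right _
  have h8 : p % 8 = 1 := by
    have : p ≡ 1 [MOD 8] := h2.of_dvd ⟨2 ^ N, by ring⟩
    exact this
  have hps : p ≡ 1 [MOD s] := h1.of_mul_left _
  have hpq : p ≡ q - 1 [MOD q] := ((hpy.of_mul_left _).of_mul_right _).trans hyq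
  have hpr : p ≡ 2 [MOD r] := ((hpy.of_mul_left _).of_mul_left _).trans hyr
  have lr : legendreSym r p = -1 := by
    rw [← leg_two_of_five M.hr8]
    unfold legendreSym; congr 1
    have := (ZMod.natCast_eq_natCast_iff _ _ _).2 hpr
    simpa using this
  have ls : legendreSym s p = 1 := by
    rw [← legendreSym.at_one (p := s)]
    unfold legendreSym; congr 1
    have := (ZMod.natCast_eq_natCast_iff _ _ _).2 hps
    simpa using this
  have lq : legendreSym q p = -1 := by
    rw [← leg_neg_one_of_three M.hq4]
    unfold legendreSym; congr 1
    have := (ZMod.natCast_eq_natCast_iff _ _ _).2 hpq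
    rw [Nat.cast_sub hqp.one_lt.le] at this
    simpa using this
  have hrec : ∀ (l : ℕ) [Fact l.Prime], l ≠ 2 → legendreSym p l = legendreSym l p := fun l _ hl =>
    (legendreSym.quadratic_reciprocity_one_mod_four (by omega) hl).symm
  have l2 : legendreSym p (2 : ℕ) = 1 := by
    have := legendreSym.at_two (p := p) (by omega)
    rw [ZMod.χ₈_nat_mod_eight, h8] at this
    simpa using this
  have lη : legendreSym p η = 1 := by
    rcases M.hη with rfl | rfl
    · simp
    · exact l2
  have lηq : legendreSym p (η * q : ℕ) = -1 := by
    rw [Nat.cast_mul, legendreSym.mul, lη, hrec q hq2, lq]; rfl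
  have ld : legendreSym p (η * q * (r * s) : ℕ) = 1 := by
    rw [Nat.cast_mul, legendreSym.mul, lηq, Nat.cast_mul, legendreSym.mul, hrec r hr2, hrec s hs2, lr, ls]; rfl
  have nd : ((η * q * (r * s) : ℕ) : ZMod p) ≠ 0 := by
    intro h
    rw [ZMod.natCast_eq_zero_iff] at h
    have hη0 : η ≠ 0 := by rcases M.hη with h | h <;> omega
    have := Nat.le_of_dvd (by have := hqp.ne_zero; have := hr.ne_zero; have := hs.ne_zero; positivity) h
    omega
  have n2 : ((2 : ℕ) : ZMod p) ≠ 0 := by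
    intro h
    rw [ZMod.natCast_eq_zero_iff] at h
    have := Nat.le_of_dvd (by norm_num) h
    have := hp.two_le
    omega
  refine ⟨p, fp, ?_, h8, lr, ls, ?_, ?_, ?_, nd⟩
  · have := (Nat.modEq_iff_dvd' hp.one_lt.le).1 h2.symm
    exact (pow_dvd_pow 2 (by omega)).trans this
  · have := (legendreSym.eq_neg_one_iff (p := p) (a := (η * q : ℕ))).1 lηq
    simpa using this
  · have := (legendreSym.eq_one_iff p (a := (2 : ℕ)) (by exact_mod_cast n2)).1 l2
    exact_mod_cast this
  · have := (legendreSym.eq_one_iff p (a := (η * q * (r * s) : ℕ)) (by exact_mod_cast nd)).1 ld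
    exact_mod_cast this
end
end

section
open Polynomial

/-- extension of a ring homomorphism to a quadratic extension -/
lemma lift_quad {K L R : Type*} [Field K] [Field L] [Algebra K L] [CommRing R] {s : L} {c : K}
    (hgen : ∀ x : L, ∃ a b : K, x = algebraMap K L a + algebraMap K L b * s) (hs : ∀ a : K, s ≠ algebraMap K L a)
    (hc : s * s = algebraMap K L c) (f : K →+* R) {s' : R} (hs' : s' * s' = f c) :
    ∃ g : L →+* R, (∀ a, g (algebraMap K L a) = f a) ∧ g s = s' := by
  have uniq : ∀ a b a' b' : K, algebraMap K L a + algebraMap K L b * s = algebraMap K L a' + algebraMap K L b' * s →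
      a = a' ∧ b = b' := by
    intro a b a' b' h
    have hb : b = b' := by
      by_contra hb
      have h1 : algebraMap K L (b - b') ≠ 0 := by
        rw [Ne, map_eq_zero]; exact sub_ne_zero.2 hb
      apply hs ((a' - a) / (b - b'))
      rw [map_div₀, eq_div_iff h1, map_sub, map_sub]
      linear_combination h
    subst hb
    exact ⟨(algebraMap K L).injective (by linear_combination h), rfl⟩
  choose A B hAB using hgen
  have key : ∀ a b : K, f (A (algebraMap K L a + algebraMap K L b * s)) + f (B (algebraMap K L a + algebraMap K L b * s)) * s' = f a + f b * s' := by
    intro a b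
    obtain ⟨h1, h2⟩ := uniq _ _ _ _ (hAB (algebraMap K L a + algebraMap K L b * s)).symm
    rw [h1, h2]
  have key' : ∀ (x : L) (a b : K), x = algebraMap K L a + algebraMap K L b * s → f (A x) + f (B x) * s' = f a + f b * s' := by
    rintro x a b rfl; exact key a b
  refine ⟨{ toFun := fun x => f (A x) + f (B x) * s', map_one' := ?_, map_mul' := ?_, map_zero' := ?_, map_add' := ?_ }, ?_, ?_⟩
  · show f (A 1) + f (B 1) * s' = 1
    rw [key' 1 1 0 (by simp)]; simp
  · intro x y
    show f (A (x * y)) + f (B (x * y)) * s' = (f (A x) + f (B x) * s') * (f (A y) + f (B y) * s')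
    rw [key' (x * y) (A x * A y + B x * B y * c) (A x * B y + B x * A y) (by
      simp only [map_add, map_mul]
      linear_combination (hAB x) * y + (algebraMap K L (A x) + algebraMap K L (B x) * s) * (hAB y) + algebraMap K L (B x) * algebraMap K L (B y) * hc)]
    simp only [map_add, map_mul]
    linear_combination - f (B x) * f (B y) * hs'
  · show f (A 0) + f (B 0) * s' = 0
    rw [key' 0 0 0 (by simp)]; simp
  · intro x y
    show f (A (x + y)) + f (B (x + y)) * s' = (f (A x) + f (B x) * s') + (f (A y) + f (B y) * s')
    rw [key' (x + y) (A x + A y) (B x + B y) (by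
      simp only [map_add]
      linear_combination (hAB x) + (hAB y))]
    simp only [map_add]; ring
  · intro a
    show f (A (algebraMap K L a)) + f (B (algebraMap K L a)) * s' = f a
    rw [key' (algebraMap K L a) a 0 (by simp)]; simp
  · show f (A s) + f (B s) * s' = s'
    rw [key' s 0 1 (by simp)]; simp

lemma z2_sqrt {n : ℕ} (h : n % 8 = 1) : ∃ z : Z2, z * z = n := by
  have hd : (2 : ℤ) ^ 3 ∣ 1 - (n : ℤ) := by omega
  have h1 : ‖((1 - (n : ℤ) : ℤ) : Z2)‖ ≤ ((2 : ℕ) : ℝ) ^ (-(3 : ℕ) : ℤ) := PadicInt.norm_int_le_pow_iff_dvd.2 (by exact_mod_cast hd)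
  have h2 : ‖(2 : Z2)‖ = 1 / 2 := by
    have := PadicInt.norm_p (p := 2)
    simpa using this
  obtain ⟨z, hz, -⟩ := hensels_lemma (p := 2) (R := Z2) (F := X ^ 2 - C (n : Z2)) (a := 1) (by
    have e1 : (aeval (1 : Z2)) (X ^ 2 - C (n : Z2) : Z2[X]) = ((1 - (n : ℤ) : ℤ) : Z2) := by simp
    have e2 : (aeval (1 : Z2)) (derivative (X ^ 2 - C (n : Z2) : Z2[X])) = 2 := by simp; norm_num
    rw [e1, e2, h2]
    refine lt_of_le_of_lt h1 ?_
    norm_num)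
  refine ⟨z, ?_⟩
  simp at hz
  rw [← sq]; linear_combination hz

lemma z2_odd_sq {y : Z2} (h : ¬ 2 ∣ y) : 8 ∣ y * y - 1 := by
  have h1 : ∀ x : Z2, 2 ∣ x ∨ 2 ∣ x - 1 := by
    intro x
    rw [z2_dvd, z2_dvd, map_sub, map_one]
    generalize PadicInt.toZMod x = c
    revert c; decide
  obtain ⟨c, hc⟩ := (h1 y).resolve_left h
  have hy : y = 1 + 2 * c := by rw [← hc]; ring
  rcases h1 c with ⟨b, hb⟩ | ⟨b, hb⟩
  · exact ⟨b * (2 * b + 1), by rw [hy, hb]; ring⟩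
  · have : c = 1 + 2 * b := by rw [← hb]; ring
    exact ⟨(1 + 2 * b) * (b + 1), by rw [hy, this]; ring⟩

lemma z2_int_dvd {m : ℤ} : (2 : Z2) ∣ (m : Z2) ↔ 2 ∣ m := by
  rw [z2_dvd, map_intCast, ZMod.intCast_zmod_eq_zero_iff_dvd]; rfl

section
variable {η q r s : ℕ} {a0 b0 A B ε0 ε1 : ℤ} [Fact q.Prime] [Fact r.Prime] [Fact s.Prime]

lemma w_five (M : Nm η q r s a0 b0 A B ε0 ε1) {z : Z2} (hz : z * z = (r * s : ℕ)) :
    8 ∣ ((r * a0 ^ 2 + s * b0 ^ 2 : ℤ) + 2 * a0 * b0 * z) - 5 := by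
  have hr8 := M.hr8
  have hs8 := M.hs8
  set W : Z2 := ((r * a0 ^ 2 + s * b0 ^ 2 : ℤ) + 2 * a0 * b0 * z) with hW
  have hrW : (r * a0 + b0 * z) * (r * a0 + b0 * z) = r * W := by
    rw [hW]; push_cast at hz ⊢; linear_combination (b0 : Z2) ^ 2 * hz
  have h2 : Prime (2 : Z2) := by exact_mod_cast PadicInt.prime_p (p := 2)
  have hz2 : ¬ 2 ∣ z := by
    intro h
    have h3 : (2 : Z2) ∣ ((r * s : ℕ) : ℤ) := by
      have : (2 : Z2) ∣ ((r * s : ℕ) : Z2) := by rw [← hz]; exact h.mul_right z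
      exact_mod_cast this
    rw [z2_int_dvd] at h3
    have h4 : 2 ∣ r * s := by exact_mod_cast h3
    rcases Nat.prime_two.dvd_mul.1 h4 with h | h <;> omega
  have hodd : ¬ 2 ∣ (r * a0 + b0 * z : Z2) := by
    intro h
    have hab : (a0 + b0) % 2 = 1 := by
      have e := congrArg (· % 2) M.e1
      have hr2 : (r : ℤ) % 2 = 1 := by omega
      have hs2 : (s : ℤ) % 2 = 1 := by omega
      rcases M.hε0 with hε | hε <;> rw [hε] at e <;>
      rcases Int.emod_two_eq_zero_or_one a0 with h0 | h0 <;> rcases Int.emod_two_eq_zero_or_one b0 with h1 | h1 <;>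
        simp [Int.sub_emod, Int.mul_emod, pow_two, h0, h1, hr2, hs2] at e ⊢ <;> omega
    have hr2 : ¬ 2 ∣ (r : ℤ) := by omega
    by_cases hb : 2 ∣ b0
    · have ha : ¬ 2 ∣ a0 := by omega
      have h5 : (2 : Z2) ∣ ((r * a0 : ℤ) : Z2) := by
        have h6 : (2 : Z2) ∣ b0 * z := (z2_int_dvd.2 hb).mul_right z
        push_cast
        exact (dvd_add_left h6).1 h
      rw [z2_int_dvd] at h5
      rcases Int.prime_two.dvd_or_dvd h5 with h | h
      · exact hr2 h
      · exact ha h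
    · have ha : 2 ∣ a0 := by omega
      have h6 : (2 : Z2) ∣ r * a0 := (z2_int_dvd.2 ha).mul_left _
      have h7 := (dvd_add_right h6).1 h
      rcases h2.dvd_or_dvd h7 with h | h
      · exact hb (z2_int_dvd.1 h)
      · exact hz2 h
  have h8 := z2_odd_sq hodd
  rw [hrW] at h8
  obtain ⟨c, hc⟩ := h8
  obtain ⟨k, hk⟩ : ∃ k, r = 8 * k + 5 := ⟨r / 8, by omega⟩
  refine ⟨5 * c - 3 * W - 5 * k * W, ?_⟩
  rw [hk] at hc
  push_cast at hc
  linear_combination 5 * hc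

variable {k : Type*} [Field k] [NumberField k] {ρ : k ≃+* k} {d1 : k}

lemma S11core (M : Nm η q r s a0 b0 A B ε0 ε1) (h : IsQuad ℚ k ρ d1) (hd : d1 * d1 = (r * s : ℕ)) {w1 c : k}
    (hw : w1 = (r * a0 ^ 2 + s * b0 ^ 2) + 2 * a0 * b0 * d1) (hc : c * w1 = ε1)
    {R : Type*} [Field R] (ι : k →+* R) {t : ℕ → R} (ht0 : t 0 = 0) (hts : ∀ j, t (j + 1) ^ 2 = 2 + t j) {n : ℕ}
    (hconj : ∀ j, j < n → ∀ P : k[X], P.eval₂ ι (t (j + 1)) = 0 → P.eval₂ ι (-t (j + 1)) = 0)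
    {f : k[X]} (hf : f.natDegree < 2 ^ (n + 1)) (he : (ph f).eval₂ ι (t n) = ι c) : False := by
  have hit : ∀ i ≤ n, (ph^[i + 1] f).eval₂ ι (t (n - i)) = ι (c ^ 2 ^ i) := by
    intro i
    induction i with
    | zero => intro _; simpa using he
    | succ i ih =>
      intro hi
      have ih := ih (by omega)
      obtain ⟨j, hj⟩ : ∃ j, n - i = j + 1 := ⟨n - i - 1, by omega⟩
      have hj' : n - (i + 1) = j := by omega
      rw [hj] at ih
      have h1 := hconj j (by omega) (ph^[i + 1] f - C (c ^ 2 ^ i)) (by rw [eval₂_sub, ih, eval₂_C, sub_self])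
      rw [eval₂_sub, eval₂_C, sub_eq_zero] at h1
      rw [hj', Function.iterate_succ_apply', ← eval_map, ← ph_map]
      have h2 : t j = t (j + 1) ^ 2 - 2 := by rw [hts]; ring
      rw [h2, ph_eval, eval_map, eval_map, ih, h1, ← map_mul, pow_succ, pow_mul]
      ring_nf
  have h1 := hit n le_rfl
  rw [Nat.sub_self, ht0, eval₂_at_zero] at h1
  have h2 := ι.injective h1
  have hrs8 : (r * s) % 8 = 1 := by rw [Nat.mul_mod, M.hr8, M.hs8]
  obtain ⟨z, hz⟩ := z2_sqrt hrs8
  obtain ⟨ψ, -, hψ⟩ := lift_quad (c := ((r * s : ℕ) : ℚ)) h.gen h.s_nmem (by rw [hd]; simp) (algebraMap ℚ ℚ_[2]) (s' := (z : ℚ_[2])) (by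
    rw [map_natCast]; exact_mod_cast congrArg (fun x : Z2 => (x : ℚ_[2])) hz)
  have h8 := w_five M hz
  set W1 : Z2 := ((r * a0 ^ 2 + s * b0 ^ 2 : ℤ) + 2 * a0 * b0 * z) with hW1
  have hψw : ψ w1 = (W1 : ℚ_[2]) := by
    rw [hw, hW1]
    simp only [map_add, map_mul, map_pow, map_natCast, map_intCast, map_ofNat, hψ]
    push_cast; rfl
  have hW1u : IsUnit W1 := by
    rw [PadicInt.isUnit_iff]
    by_contra hne1
    have hlt : ‖W1‖ < 1 := lt_of_le_of_ne (PadicInt.norm_le_one W1) hne1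
    have h3 : (2 : Z2) ∣ W1 := by
      have := (PadicInt.norm_lt_one_iff_dvd W1).1 hlt
      exact_mod_cast this
    have h4 : (2 : Z2) ∣ W1 - 5 := dvd_trans ⟨4, by norm_num⟩ h8
    have h5 : (2 : Z2) ∣ ((5 : ℤ) : Z2) := by
      have := (dvd_sub_right h3).1 h4
      exact_mod_cast this
    rw [z2_int_dvd] at h5
    omega
  obtain ⟨V, hV⟩ := hW1u.exists_right_inv
  have hψc : ψ c = ((ε1 * V : Z2) : ℚ_[2]) := by
    have e1 := congrArg ψ hc
    rw [map_mul, hψw, map_intCast] at e1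
    have e2 : (W1 : ℚ_[2]) * (V : ℚ_[2]) = 1 := by exact_mod_cast congrArg (fun x : Z2 => (x : ℚ_[2])) hV
    push_cast
    linear_combination (V : ℚ_[2]) * e1 - ψ c * e2
  have hε : (ε1 : Z2) * ε1 = 1 := by
    rcases M.hε1 with h | h <;> rw [h] <;> norm_num
  have hWV : (ε1 * V : Z2) ^ 2 ^ n * (ε1 * W1) ^ 2 ^ n = 1 := by
    rw [← mul_pow]
    have : (ε1 * V : Z2) * (ε1 * W1) = 1 := by linear_combination hε * V * W1 + hV
    rw [this, one_pow]
  have h3 := ph_main (k := n) (f := f.map ψ) (W := (ε1 * V : Z2) ^ 2 ^ n) (by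
      exact lt_of_le_of_lt natDegree_map_le hf) (by
      intro h
      have h4 : (2 : Z2) ∣ 1 := by rw [← hWV]; exact h.mul_right _
      have h5 : (2 : Z2) ∣ ((1 : ℤ) : Z2) := by exact_mod_cast h4
      rw [z2_int_dvd] at h5; omega) (by
      rw [iter_map, ← coeff_zero_eq_eval_zero, coeff_map, h2, map_pow, hψc]; push_cast; rfl)
  apply five_pow n h8
  have e3 : (ε1 * V : Z2) ^ 2 ^ n * W1 ^ 2 ^ n * ((ε1 * V : Z2) ^ 2 ^ n * W1 ^ 2 ^ n) = 1 := by
    rw [← mul_pow, ← mul_pow]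
    have : (ε1 * V * W1 : Z2) * (ε1 * V * W1) = 1 := by
      linear_combination hε * (V * W1) ^ 2 + (W1 * V + 1) * hV
    rw [this, one_pow]
  obtain ⟨y, hy⟩ := h3
  refine ⟨- y * (W1 ^ 2 ^ n) ^ 2, ?_⟩
  generalize (ε1 * V : Z2) ^ 2 ^ n = v at e3 hy
  linear_combination e3 - (W1 ^ 2 ^ n) ^ 2 * hy
end
end

section
open Polynomial IntermediateField

lemma lift_aut {K L : Type*} [Field K] [Field L] [NumberField L] [Algebra K L] {s : L} {c : K}
    (hgen : ∀ x : L, ∃ a b : K, x = algebraMap K L a + algebraMap K L b * s) (hs : ∀ a : K, s ≠ algebraMap K L a)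
    (hc : s * s = algebraMap K L c) (ρ : K ≃+* K) {s' : L} (hs' : s' * s' = algebraMap K L (ρ c)) :
    ∃ g : L ≃+* L, (∀ a, g (algebraMap K L a) = algebraMap K L (ρ a)) ∧ g s = s' := by
  obtain ⟨g, h1, h2⟩ := lift_quad hgen hs hc ((algebraMap K L).comp (ρ : K →+* K)) hs'
  have hb : Function.Bijective g := by
    have := AlgHom.bijective (RingHom.toRatAlgHom g)
    exact this
  exact ⟨RingEquiv.ofBijective g hb, h1, h2⟩

lemma mk_quad {K L : Type*} [Field K] [Field L] [NumberField L] [Algebra K L] {s : L} {c : K}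
    (hgen : ∀ x : L, ∃ a b : K, x = algebraMap K L a + algebraMap K L b * s) (hs : ∀ a : K, s ≠ algebraMap K L a)
    (hc : s * s = algebraMap K L c) : ∃ σ : L ≃+* L, IsQuad K L σ s := by
  obtain ⟨σ, h1, h2⟩ := lift_aut hgen hs hc (RingEquiv.refl K) (s' := -s) (by rw [neg_mul_neg, hc]; rfl)
  exact ⟨σ, fun h => hs 0 (by rw [h, map_zero]), h2, h1, hgen⟩

/-- the subfield `E + E s` -/
lemma gen_of_adjoin {E : IntermediateField ℚ ℝ} {s : ℝ} (hs : s ∉ E) (hc : s * s ∈ E) (S : Set ℝ)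
    (hS : ∀ x ∈ S, ∃ a ∈ E, ∃ b ∈ E, x = a + b * s) : ∀ x ∈ adjoin ℚ S, ∃ a ∈ E, ∃ b ∈ E, x = a + b * s := by
  intro x hx
  induction hx using IntermediateField.adjoin_induction with
  | mem x hx => exact hS x hx
  | algebraMap x => exact ⟨_, E.algebraMap_mem x, 0, E.zero_mem, by simp⟩
  | add x y _ _ h1 h2 =>
    obtain ⟨a, ha, b, hb, rfl⟩ := h1
    obtain ⟨a', ha', b', hb', rfl⟩ := h2
    exact ⟨_, E.add_mem ha ha', _, E.add_mem hb hb', by ring⟩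
  | mul x y _ _ h1 h2 =>
    obtain ⟨a, ha, b, hb, rfl⟩ := h1
    obtain ⟨a', ha', b', hb', rfl⟩ := h2
    exact ⟨a * a' + b * b' * (s * s), E.add_mem (E.mul_mem ha ha') (E.mul_mem (E.mul_mem hb hb') hc), a * b' + a' * b,
      E.add_mem (E.mul_mem ha hb') (E.mul_mem ha' hb), by ring⟩
  | inv x _ h1 =>
    obtain ⟨a, ha, b, hb, rfl⟩ := h1
    by_cases h0 : a + b * s = 0
    · exact ⟨0, E.zero_mem, 0, E.zero_mem, by rw [h0]; simp⟩
    · have h2 : a - b * s ≠ 0 := by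
        intro h2
        by_cases hb0 : b = 0
        · apply h0; rw [hb0] at h2 ⊢; linear_combination h2
        · apply hs
          have : s = a / b := by field_simp; linear_combination -h2
          rw [this]; exact E.div_mem ha hb
      have hm : a * a - b * b * (s * s) ∈ E := E.sub_mem (E.mul_mem ha ha) (E.mul_mem (E.mul_mem hb hb) hc)
      have e1 : a * a - b * b * (s * s) = (a + b * s) * (a - b * s) := by ring
      refine ⟨a / (a * a - b * b * (s * s)), E.div_mem ha hm, - b / (a * a - b * b * (s * s)), E.div_mem (E.neg_mem hb) hm, ?_⟩
      rw [e1]; field_simp; ring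

class IsI (x : ℝ) : Prop where
  int : IsIntegral ℚ x

instance (x y : ℝ) [IsI x] [IsI y] : IsI (x * y) := ⟨IsI.int.mul IsI.int⟩

noncomputable def tR (n : ℕ) : ℝ := 2 * Real.cos (2 * Real.pi / 2 ^ (n + 2))
noncomputable def TR (n : ℕ) : ℝ := 2 * Real.sin (2 * Real.pi / 2 ^ (n + 2))

lemma tR_zero : tR 0 = 0 := by
  have : 2 * Real.pi / 2 ^ (0 + 2) = Real.pi / 2 := by norm_num; ring
  rw [tR, this, Real.cos_pi_div_two, mul_zero]

lemma TR_zero : TR 0 = 2 := by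
  have : 2 * Real.pi / 2 ^ (0 + 2) = Real.pi / 2 := by norm_num; ring
  rw [TR, this, Real.sin_pi_div_two, mul_one]

lemma tR_arg (n : ℕ) : 2 * Real.pi / 2 ^ (n + 2) = 2 * (2 * Real.pi / 2 ^ (n + 1 + 2)) := by
  rw [pow_succ 2 (n + 1 + 1)]; field_simp

lemma tR_succ (n : ℕ) : tR (n + 1) ^ 2 = 2 + tR n := by
  rw [tR, tR, tR_arg n, Real.cos_two_mul]; ring

lemma TR_succ (n : ℕ) : TR (n + 1) * tR (n + 1) = TR n := by
  rw [tR, TR, TR, tR_arg n, Real.sin_two_mul]; ring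

lemma TR_sq (n : ℕ) : TR n ^ 2 = 4 - tR n ^ 2 := by
  rw [tR, TR]; linear_combination 4 * Real.sin_sq_add_cos_sq (2 * Real.pi / 2 ^ (n + 2))

lemma TR_ne (n : ℕ) : TR n ≠ 0 := by
  induction n with
  | zero => rw [TR_zero]; norm_num
  | succ n ih => intro h; apply ih; rw [← TR_succ, h, zero_mul]

lemma tR_ne (n : ℕ) : tR (n + 1) ≠ 0 := by
  intro h; apply TR_ne n; rw [← TR_succ, h, mul_zero]

instance (n : ℕ) : IsI (tR n) := ⟨by
  induction n with
  | zero => rw [tR_zero]; exact isIntegral_zero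
  | succ n ih =>
    apply IsIntegral.of_pow (n := 2) (by norm_num)
    rw [tR_succ]
    exact IsIntegral.add (by exact_mod_cast isIntegral_algebraMap (R := ℚ) (A := ℝ) (x := 2)) ih⟩

noncomputable def QQ (x : ℝ) : IntermediateField ℚ ℝ := adjoin ℚ {x}
noncomputable def DD (x y : ℝ) : IntermediateField ℚ ℝ := adjoin ℚ {x, y}
noncomputable def KK (a d : ℝ) (n : ℕ) : IntermediateField ℚ ℝ := adjoin ℚ {a, d, tR n}

lemma nf_adjoin {S : Set ℝ} (hf : S.Finite) (h : ∀ x ∈ S, IsIntegral ℚ x) : NumberField (adjoin ℚ S) := by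
  have : FiniteDimensional ℚ (adjoin ℚ S) := by
    have := hf.to_subtype
    exact IntermediateField.finiteDimensional_adjoin h
  exact { to_charZero := inferInstance, to_finiteDimensional := this }

instance (x : ℝ) [IsI x] : NumberField (QQ x) := nf_adjoin (by simp) (by simp [IsI.int])
instance (x y : ℝ) [IsI x] [IsI y] : NumberField (DD x y) := nf_adjoin (by simp) (by simp [IsI.int])
instance (a d : ℝ) (n : ℕ) [IsI a] [IsI d] : NumberField (KK a d n) := nf_adjoin (by simp) (by simp [IsI.int])

noncomputable instance (E E' : IntermediateField ℚ ℝ) [h : Fact (E ≤ E')] : Algebra E E' := (inclusion h.out).toRingHom.toAlgebra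

lemma alg_coe {E E' : IntermediateField ℚ ℝ} [h : Fact (E ≤ E')] (x : E) : ((algebraMap E E' x : E') : ℝ) = x := rfl

instance (E E' E'' : IntermediateField ℚ ℝ) [h : Fact (E ≤ E')] [h' : Fact (E' ≤ E'')] [h'' : Fact (E ≤ E'')] :
    IsScalarTower E E' E'' := IsScalarTower.of_algebraMap_eq (fun _ => rfl)

lemma mem_QQ (x : ℝ) : x ∈ QQ x := subset_adjoin _ _ (by simp)
lemma mem_DD1 (x y : ℝ) : x ∈ DD x y := subset_adjoin _ _ (by simp)
lemma mem_DD2 (x y : ℝ) : y ∈ DD x y := subset_adjoin _ _ (by simp)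
lemma mem_KKa (a d : ℝ) (n : ℕ) : a ∈ KK a d n := subset_adjoin _ _ (by simp)
lemma mem_KKd (a d : ℝ) (n : ℕ) : d ∈ KK a d n := subset_adjoin _ _ (by simp)
lemma mem_KKt (a d : ℝ) (n : ℕ) : tR n ∈ KK a d n := subset_adjoin _ _ (by simp)
lemma QQ_le {x : ℝ} {E : IntermediateField ℚ ℝ} (h : x ∈ E) : QQ x ≤ E := by
  rw [QQ, adjoin_le_iff]; simpa using h
lemma DD_le {x y : ℝ} {E : IntermediateField ℚ ℝ} (h : x ∈ E) (h' : y ∈ E) : DD x y ≤ E := by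
  rw [DD, adjoin_le_iff]; rintro _ (rfl | rfl) <;> assumption
lemma KK_le {a d : ℝ} {n : ℕ} {E : IntermediateField ℚ ℝ} (ha : a ∈ E) (hd : d ∈ E) (ht : tR n ∈ E) : KK a d n ≤ E := by
  rw [KK, adjoin_le_iff]; rintro _ (rfl | rfl | rfl) <;> assumption

lemma mem_KKt' (a d : ℝ) (n : ℕ) : tR n ∈ KK a d (n + 1) := by
  have : tR n = tR (n + 1) * tR (n + 1) - 2 := by linear_combination -tR_succ n
  rw [this]
  exact sub_mem (mul_mem (mem_KKt a d _) (mem_KKt a d _)) (by exact_mod_cast _root_.natCast_mem (KK a d (n + 1)) 2)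

lemma mem_KKT (a d : ℝ) (n : ℕ) : TR n ∈ KK a d n := by
  induction n with
  | zero => rw [TR_zero]; exact_mod_cast _root_.natCast_mem (KK a d 0) 2
  | succ n ih =>
    rw [eq_div_of_mul_eq (tR_ne n) (TR_succ n)]
    exact div_mem (KK_le (mem_KKa a d _) (mem_KKd a d _) (mem_KKt' a d n) ih) (mem_KKt a d _)

instance (a d : ℝ) (n : ℕ) : Fact (KK a d n ≤ KK a d (n + 1)) := ⟨KK_le (mem_KKa a d _) (mem_KKd a d _) (mem_KKt' a d n)⟩
instance (a d : ℝ) : Fact (KK a d 0 ≤ KK a d 1) := ⟨KK_le (mem_KKa a d _) (mem_KKd a d _) (mem_KKt' a d 0)⟩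
instance (a d : ℝ) (n : ℕ) : Fact (QQ d ≤ KK a d n) := ⟨QQ_le (mem_KKd a d n)⟩
instance (a d : ℝ) (n : ℕ) : Fact (QQ a ≤ KK a d n) := ⟨QQ_le (mem_KKa a d n)⟩
instance (a d : ℝ) (n : ℕ) : Fact (QQ (a * d) ≤ KK a d n) := ⟨QQ_le (mul_mem (mem_KKa a d n) (mem_KKd a d n))⟩
instance (x y : ℝ) : Fact (QQ x ≤ DD x y) := ⟨QQ_le (mem_DD1 x y)⟩
instance (x y : ℝ) : Fact (QQ y ≤ DD x y) := ⟨QQ_le (mem_DD2 x y)⟩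
instance (x y : ℝ) : Fact (QQ (x * y) ≤ DD x y) := ⟨QQ_le (mul_mem (mem_DD1 x y) (mem_DD2 x y))⟩
instance (a d : ℝ) : Fact (DD (tR 1) (a * d) ≤ KK a d 1) :=
  ⟨DD_le (mem_KKt a d 1) (mul_mem (mem_KKa a d 1) (mem_KKd a d 1))⟩
instance (a d : ℝ) : Fact (QQ (tR 1 * (a * d)) ≤ KK a d 1) :=
  ⟨QQ_le (mul_mem (mem_KKt a d 1) (mul_mem (mem_KKa a d 1) (mem_KKd a d 1)))⟩
lemma KK_zero_le (a d : ℝ) (n : ℕ) : KK a d 0 ≤ KK a d n :=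
  KK_le (mem_KKa a d _) (mem_KKd a d _) (by rw [tR_zero]; exact zero_mem _)

/-- quadratic extension of intermediate fields -/
lemma quad_IF {E E' : IntermediateField ℚ ℝ} [NumberField E'] [h : Fact (E ≤ E')] {s : ℝ} (hs' : s ∈ E') (hs : s ∉ E) (hc : s * s ∈ E) (S : Set ℝ)
    (hS : ∀ x ∈ S, ∃ a ∈ E, ∃ b ∈ E, x = a + b * s) (hE' : E' = adjoin ℚ S) :
    ∃ σ : E' ≃+* E', IsQuad E E' σ ⟨s, hs'⟩ := by
  apply mk_quad (c := ⟨s * s, hc⟩)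
  · rintro ⟨x, hx⟩
    rw [hE'] at hx
    obtain ⟨a, ha, b, hb, rfl⟩ := gen_of_adjoin hs hc S hS x hx
    exact ⟨⟨a, ha⟩, ⟨b, hb⟩, rfl⟩
  · rintro ⟨x, hx⟩ e
    have : s = x := congrArg Subtype.val e
    exact hs (this ▸ hx)
  · rfl

lemma quad_Q {x : ℝ} [IsI x] {m : ℕ} (hx : x * x = m) (hm : ¬ IsSquare m) :
    ∃ σ : QQ x ≃+* QQ x, IsQuad ℚ (QQ x) σ ⟨x, mem_QQ x⟩ := by
  have hns : ∀ y : ℚ, x ≠ y := by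
    rintro y rfl
    have h1 : y * y = (m : ℚ) := by exact_mod_cast hx
    exact hm (Rat.isSquare_natCast_iff.1 ⟨y, h1.symm⟩)
  have hnb : x ∉ (⊥ : IntermediateField ℚ ℝ) := by
    rw [mem_bot]; rintro ⟨y, hy⟩; exact hns y hy.symm
  apply mk_quad (c := (m : ℚ))
  · rintro ⟨y, hy⟩
    obtain ⟨a, ha, b, hb, e⟩ := gen_of_adjoin (E := ⊥) hnb (by rw [hx]; exact _root_.natCast_mem _ m) {x} (by
      rintro _ rfl; exact ⟨0, zero_mem _, 1, one_mem _, by simp⟩) y hy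
    rw [mem_bot] at ha hb
    obtain ⟨a, rfl⟩ := ha
    obtain ⟨b, rfl⟩ := hb
    exact ⟨a, b, Subtype.ext e⟩
  · intro y e
    have e' : x = ((algebraMap ℚ (QQ x) y : QQ x) : ℝ) := congrArg Subtype.val e
    exact hns y e'
  · apply Subtype.ext
    show x * x = _
    rw [hx, map_natCast]; rfl
end

section
open Polynomial IntermediateField

lemma tR_TT (n : ℕ) : TT (tR n) n = 0 := by
  induction n with
  | zero => rw [TT_zero, tR_zero]
  | succ n ih => rw [TT_succ', tR_succ]; simpa using ih

lemma real_sqrt_c {z : ℂ} {c : ℝ} (hc : 0 ≤ c) (h : z * z = c) : ∃ x : ℝ, z = x ∧ x * x = c := by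
  have h1 : z ^ 2 = ((Real.sqrt c : ℝ) : ℂ) ^ 2 := by
    rw [sq, h, ← Complex.ofReal_pow, Real.sq_sqrt hc]
  rcases sq_eq_sq_iff_eq_or_eq_neg.1 h1 with h | h
  · exact ⟨Real.sqrt c, h, Real.mul_self_sqrt hc⟩
  · exact ⟨-Real.sqrt c, by rw [h]; push_cast; rfl, by rw [neg_mul_neg]; exact Real.mul_self_sqrt hc⟩

lemma TT_real (n : ℕ) : ∀ z : ℂ, TT z n = 0 → ∃ x : ℝ, z = x ∧ -2 ≤ x ∧ x ≤ 2 := by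
  induction n with
  | zero => intro z hz; exact ⟨0, by rw [TT_zero] at hz; simpa using hz, by norm_num, by norm_num⟩
  | succ n ih =>
    intro z hz
    rw [TT_succ'] at hz
    obtain ⟨x, hx, h1, h2⟩ := ih _ hz
    obtain ⟨y, hy, hyy⟩ := real_sqrt_c (z := z) (c := x + 2) (by linarith) (by push_cast; rw [← hx]; ring)
    exact ⟨y, hy, by nlinarith, by nlinarith⟩

lemma tr_adjoin {S : Set ℝ} (h : ∀ (φ : adjoin ℚ S →+* ℂ) (x : ℝ) (hx : x ∈ S), ∃ y : ℝ, φ ⟨x, subset_adjoin _ _ hx⟩ = y) :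
    IsTotallyReal (adjoin ℚ S) := by
  refine ⟨fun v => ?_⟩
  rw [← InfinitePlace.mk_embedding v, InfinitePlace.isReal_mk_iff]
  apply ComplexEmbedding.isReal_iff.2
  set φ := v.embedding
  have key : ∀ (x : ℝ) (hx : x ∈ adjoin ℚ S), ∃ y : ℝ, φ ⟨x, hx⟩ = y := by
    intro x hx
    induction hx using IntermediateField.adjoin_induction with
    | mem x hx => exact h φ x hx
    | algebraMap x =>
      refine ⟨x, ?_⟩
      have : (⟨algebraMap ℚ ℝ x, _root_.algebraMap_mem _ x⟩ : adjoin ℚ S) = (x : adjoin ℚ S) := rfl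
      rw [this, map_ratCast]; simp
    | add x y hx hy h1 h2 =>
      obtain ⟨u, hu⟩ := h1
      obtain ⟨v, hv⟩ := h2
      refine ⟨u + v, ?_⟩
      have : (⟨x + y, add_mem hx hy⟩ : adjoin ℚ S) = ⟨x, hx⟩ + ⟨y, hy⟩ := rfl
      rw [this, map_add, hu, hv]; simp
    | mul x y hx hy h1 h2 =>
      obtain ⟨u, hu⟩ := h1
      obtain ⟨v, hv⟩ := h2
      refine ⟨u * v, ?_⟩
      have : (⟨x * y, mul_mem hx hy⟩ : adjoin ℚ S) = ⟨x, hx⟩ * ⟨y, hy⟩ := rfl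
      rw [this, map_mul, hu, hv]; simp
    | inv x hx h1 =>
      obtain ⟨u, hu⟩ := h1
      refine ⟨u⁻¹, ?_⟩
      have : (⟨x⁻¹, inv_mem hx⟩ : adjoin ℚ S) = ⟨x, hx⟩⁻¹ := rfl
      rw [this, map_inv₀, hu]; simp
  apply RingHom.ext
  rintro ⟨x, hx⟩
  obtain ⟨y, hy⟩ := key x hx
  rw [ComplexEmbedding.conjugate_coe_eq, hy, Complex.conj_ofReal]

lemma nsq_mul {l m : ℕ} (hl : l.Prime) (hm : ¬ l ∣ m) : ¬ IsSquare (l * m) := by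
  rintro ⟨x, hx⟩
  have h1 : l ∣ x * x := ⟨m, hx.symm⟩
  have h2 : l ∣ x := by rcases hl.dvd_mul.1 h1 with h | h <;> exact h
  obtain ⟨y, rfl⟩ := h2
  apply hm
  refine ⟨y * y, ?_⟩
  apply Nat.eq_of_mul_eq_mul_left hl.pos
  rw [hx]; ring

/-- the real square roots -/
structure AD (η q r s : ℕ) (a d : ℝ) : Prop where
  ha : a * a = (η * q : ℕ)
  hd : d * d = (r * s : ℕ)

section
variable {η q r s : ℕ} {a0 b0 A B ε0 ε1 : ℤ} [Fact q.Prime] [Fact r.Prime] [Fact s.Prime] {a d : ℝ}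

/-- nonsquares -/
structure NS (η q r s : ℕ) : Prop where
  nrs : ¬ IsSquare (r * s)
  nd : ¬ IsSquare (η * q * (r * s))
  nq : ¬ IsSquare (η * q)
  n2 : ¬ IsSquare 2
  nd2 : ¬ IsSquare (2 * (η * q * (r * s)))
  nq2 : ¬ IsSquare (2 * (η * q))
  nrs2 : ¬ IsSquare (2 * (r * s))

lemma Nm.ns (M : Nm η q r s a0 b0 A B ε0 ε1) : NS η q r s := by
  have hr : r.Prime := Fact.out
  have hs : s.Prime := Fact.out
  have hqp : q.Prime := Fact.out
  have hne := M.hne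
  have hqr := M.nqr
  have hr2 : r ≠ 2 := by rintro rfl; have := M.hr8; omega
  have hq2 : q ≠ 2 := by rintro rfl; have := M.hq4; omega
  have pd : ∀ l m : ℕ, l.Prime → m.Prime → l ≠ m → ¬ l ∣ m := fun l m hl hm h => by
    rwa [Nat.prime_dvd_prime_iff_eq hl hm]
  have η2 : ∀ l : ℕ, l.Prime → l ≠ 2 → ¬ l ∣ η := by
    intro l hl h2
    rcases M.hη with h | h <;> rw [h]
    · exact hl.not_dvd_one
    · exact pd l 2 hl Nat.prime_two h2
  have dm : ∀ l m n : ℕ, l.Prime → ¬ l ∣ m → ¬ l ∣ n → ¬ l ∣ m * n := fun l m n hl h1 h2 h => by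
    rcases hl.dvd_mul.1 h with h | h
    · exact h1 h
    · exact h2 h
  have r1 : ¬ r ∣ η := η2 r hr hr2
  have r2 : ¬ r ∣ q := pd r q hr hqp hqr.symm
  have r3 : ¬ r ∣ s := pd r s hr hs hne
  have r4 : ¬ r ∣ 2 := pd r 2 hr Nat.prime_two hr2
  have q1 : ¬ q ∣ η := η2 q hqp hq2
  have q3 : ¬ q ∣ 2 := pd q 2 hqp Nat.prime_two hq2
  refine ⟨nsq_mul hr r3, ?_, ?_, ?_, ?_, ?_, ?_⟩
  · have := nsq_mul hr (dm r _ _ hr (dm r _ _ hr r1 r2) r3)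
    convert this using 2 <;> ring
  · have := nsq_mul hqp q1
    convert this using 2 <;> ring
  · simpa using nsq_mul (l := 2) (m := 1) Nat.prime_two (by norm_num)
  · have := nsq_mul hr (dm r _ _ hr r4 (dm r _ _ hr (dm r _ _ hr r1 r2) r3))
    convert this using 2 <;> ring
  · have := nsq_mul hqp (dm q _ _ hqp q3 q1)
    convert this using 2 <;> ring
  · have := nsq_mul hr (dm r _ _ hr r4 r3)
    convert this using 2 <;> ring

lemma AD.IsIa (H : AD η q r s a d) : IsI a := ⟨by
  apply IsIntegral.of_pow (n := 2) (by norm_num)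
  rw [sq, H.ha]; exact_mod_cast isIntegral_algebraMap (R := ℚ) (A := ℝ) (x := ((η * q : ℕ) : ℚ))⟩

lemma AD.IsId (H : AD η q r s a d) : IsI d := ⟨by
  apply IsIntegral.of_pow (n := 2) (by norm_num)
  rw [sq, H.hd]; exact_mod_cast isIntegral_algebraMap (R := ℚ) (A := ℝ) (x := ((r * s : ℕ) : ℚ))⟩

variable [IsI a] [IsI d]

lemma AD.tr (H : AD η q r s a d) (n : ℕ) : IsTotallyReal (KK a d n) := by
  apply tr_adjoin
  intro φ x hx
  have aux : ∀ (x : ℝ) (hx : x ∈ adjoin ℚ {a, d, tR n}) (m : ℕ), x * x = m → ∃ y : ℝ, φ ⟨x, hx⟩ = y := by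
    intro x hx m hm
    have e : φ ⟨x, hx⟩ * φ ⟨x, hx⟩ = ((m : ℝ) : ℂ) := by
      rw [← map_mul]
      have : (⟨x, hx⟩ * ⟨x, hx⟩ : adjoin ℚ {a, d, tR n}) = (m : adjoin ℚ {a, d, tR n}) := Subtype.ext hm
      rw [this, map_natCast]; simp
    obtain ⟨y, hy, -⟩ := real_sqrt_c (by positivity) e
    exact ⟨y, hy⟩
  rcases hx with h | h | h
  · subst h; exact aux _ _ _ H.ha
  · subst h; exact aux _ _ _ H.hd
  · have h' : x = tR n := h
    subst h'
    obtain ⟨y, hy, -⟩ := TT_real n (φ ⟨tR n, mem_KKt a d n⟩) (by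
      rw [← TT_map]
      have : TT (⟨tR n, mem_KKt a d n⟩ : adjoin ℚ {a, d, tR n}) n = 0 := by
        apply Subtype.ext
        have := TT_map (algebraMap (adjoin ℚ {a, d, tR n}) ℝ) ⟨tR n, mem_KKt a d n⟩ n
        exact this.trans (tR_TT n)
      erw [this]; rw [map_zero])
    exact ⟨y, hy⟩

lemma tr_of_le {E E' : IntermediateField ℚ ℝ} [NumberField E] [NumberField E'] [Fact (E ≤ E')] (h : IsTotallyReal E') : IsTotallyReal E :=
  IsTotallyReal.of_algebra E E'

lemma not_mem_of_nsq_Q {x : ℝ} [IsI x] {m n : ℕ} (hx : x * x = m) (hm : ¬ IsSquare m) {y : ℝ} (hy : y * y = n)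
    (hn : ¬ IsSquare n) (hmn : ¬ IsSquare (n * m)) : y ∉ QQ x := by
  intro h
  obtain ⟨σ, h1⟩ := quad_Q hx hm
  rcases SQ h1 (c := m) (x := n) (y := ⟨y, h⟩) (by apply Subtype.ext; show x * x = _; rw [hx, map_natCast]; rfl)
    (by apply Subtype.ext; show y * y = _; rw [hy, map_natCast]; rfl) with h | h
  · exact hn (Rat.isSquare_natCast_iff.1 h)
  · exact hmn (Rat.isSquare_natCast_iff.1 (by exact_mod_cast h))
end
end

section
open Polynomial IntermediateField

lemma tR1 : tR 1 * tR 1 = (2 : ℕ) := by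
  have := tR_succ 0
  rw [tR_zero] at this
  push_cast; linear_combination this

section
variable {η q r s : ℕ} {a d : ℝ}

lemma AD.had (H : AD η q r s a d) : (a * d) * (a * d) = (η * q * (r * s) : ℕ) := by
  have h1 := H.ha
  have h2 := H.hd
  push_cast at *
  linear_combination d * d * h1 + η * q * h2

lemma AD.d0 (H : AD η q r s a d) (N : NS η q r s) : d ≠ 0 := by
  rintro rfl
  have := H.hd
  rw [mul_zero] at this
  exact N.nrs ⟨0, by exact_mod_cast this.symm⟩

lemma nat_mem (E : IntermediateField ℚ ℝ) (m : ℕ) {x : ℝ} (h : x = m) : x ∈ E := h ▸ _root_.natCast_mem E m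

variable [IsI a] [IsI d]

lemma AD.bq (H : AD η q r s a d) (N : NS η q r s) : ∃ ρ1 ρ2 ρF σ1 σ2 τ, Bq η q r s (k1 := QQ d) (k2 := QQ (a * d)) (F := QQ a)
    (K := KK a d 0) ρ1 ρ2 ρF σ1 σ2 τ ⟨d, mem_QQ d⟩ ⟨a * d, mem_QQ _⟩ ⟨a, mem_QQ a⟩ ⟨a, mem_KKa a d 0⟩ ⟨d, mem_KKd a d 0⟩ := by
  obtain ⟨ρ1, q1⟩ := quad_Q H.hd N.nrs
  obtain ⟨ρ2, q2⟩ := quad_Q H.had N.nd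
  obtain ⟨ρF, qF⟩ := quad_Q H.ha N.nq
  have a1 : a ∉ QQ d := not_mem_of_nsq_Q H.hd N.nrs H.ha N.nq N.nd
  have d1 : d ∉ QQ a := not_mem_of_nsq_Q H.ha N.nq H.hd N.nrs (by rw [mul_comm]; exact N.nd)
  have d2 : d ∉ QQ (a * d) := by
    intro h
    have h2 : a ∈ QQ (a * d) := by
      have := div_mem (mem_QQ (a * d)) h
      rwa [mul_div_cancel_right₀ _ (H.d0 N)] at this
    obtain ⟨σ, h1⟩ := quad_Q H.had N.nd
    have e : ∀ (x : ℝ) (hx : x ∈ QQ (a * d)) (n : ℕ), x * x = n → ¬ IsSquare n → IsSquare (n * (η * q * (r * s))) := by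
      intro x hx n hn h
      by_contra h'
      exact not_mem_of_nsq_Q H.had N.nd hn h h' hx
    have h3 := e d h _ H.hd N.nrs
    obtain ⟨y, hy⟩ := h3
    have hd : r * s ∣ y := by
      rw [← Nat.pow_dvd_pow_iff (n := 2) (by norm_num), sq y, ← hy]
      exact ⟨η * q, by ring⟩
    obtain ⟨z, rfl⟩ := hd
    apply N.nq
    have h0 : 0 < r * s := Nat.pos_of_ne_zero fun h => N.nrs (h ▸ ⟨0, rfl⟩)
    refine ⟨z, Nat.eq_of_mul_eq_mul_left h0 (Nat.eq_of_mul_eq_mul_left h0 ?_)⟩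
    linarith
  have hS : ∀ E : IntermediateField ℚ ℝ, (0 : ℝ) ∈ E ∧ (1 : ℝ) ∈ E := fun E => ⟨zero_mem E, one_mem E⟩
  obtain ⟨σ1, Q1⟩ := quad_IF (E := QQ d) (E' := KK a d 0) (mem_KKa a d 0) a1 (nat_mem _ _ H.ha) {a, d, tR 0} (by
    rintro x (rfl | rfl | h)
    · exact ⟨0, zero_mem _, 1, one_mem _, by ring⟩
    · exact ⟨_, mem_QQ _, 0, zero_mem _, by ring⟩
    · exact ⟨0, zero_mem _, 0, zero_mem _, by rw [show x = tR 0 from h, tR_zero]; ring⟩) rfl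
  obtain ⟨τ, QF⟩ := quad_IF (E := QQ a) (E' := KK a d 0) (mem_KKd a d 0) d1 (nat_mem _ _ H.hd) {a, d, tR 0} (by
    rintro x (rfl | rfl | h)
    · exact ⟨_, mem_QQ _, 0, zero_mem _, by ring⟩
    · exact ⟨0, zero_mem _, 1, one_mem _, by ring⟩
    · exact ⟨0, zero_mem _, 0, zero_mem _, by rw [show x = tR 0 from h, tR_zero]; ring⟩) rfl
  obtain ⟨σ2, Q2⟩ := quad_IF (E := QQ (a * d)) (E' := KK a d 0) (mem_KKd a d 0) d2 (nat_mem _ _ H.hd) {a, d, tR 0} (by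
    rintro x (rfl | rfl | h)
    · refine ⟨0, zero_mem _, x * d / (r * s : ℕ), div_mem (mem_QQ _) (nat_mem _ _ rfl), ?_⟩
      have h0 := H.d0 N
      rw [← H.hd]; field_simp; ring
    · exact ⟨0, zero_mem _, 1, one_mem _, by ring⟩
    · exact ⟨0, zero_mem _, 0, zero_mem _, by rw [show x = tR 0 from h, tR_zero]; ring⟩) rfl
  exact ⟨ρ1, ρ2, ρF, σ1, σ2, τ, q1, q2, qF, Q1, Q2, QF, rfl, rfl, rfl, Subtype.ext (by simpa using H.ha), Subtype.ext (by simpa using H.hd)⟩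

lemma quad_D {x y : ℝ} [IsI x] [IsI y] {m n : ℕ} (hx : x * x = m) (hm : ¬ IsSquare m) (hy : y * y = n) (hn : ¬ IsSquare n)
    (hmn : ¬ IsSquare (m * n)) : (∃ α, IsQuad (QQ x) (DD x y) α ⟨y, mem_DD2 x y⟩) ∧ (∃ α, IsQuad (QQ y) (DD x y) α ⟨x, mem_DD1 x y⟩) := by
  refine ⟨?_, ?_⟩
  · refine quad_IF (E := QQ x) (E' := DD x y) (mem_DD2 x y) (not_mem_of_nsq_Q hx hm hy hn (by rwa [mul_comm])) (nat_mem _ _ hy) {x, y} ?_ rfl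
    rintro z (rfl | h)
    · exact ⟨_, mem_QQ _, 0, zero_mem _, by ring⟩
    · exact ⟨0, zero_mem _, 1, one_mem _, by rw [show z = y from h]; ring⟩
  · refine quad_IF (E := QQ y) (E' := DD x y) (mem_DD1 x y) (not_mem_of_nsq_Q hy hn hx hm hmn) (nat_mem _ _ hx) {x, y} ?_ rfl
    rintro z (rfl | h)
    · exact ⟨0, zero_mem _, 1, one_mem _, by ring⟩
    · exact ⟨_, mem_QQ _, 0, zero_mem _, by rw [show z = y from h]; ring⟩

/-- `ℚ(xy) → ℚ(x,y)` generated by `x` -/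
lemma quad_D' {x y : ℝ} [IsI x] [IsI y] {m n : ℕ} (hx : x * x = m) (hm : ¬ IsSquare m) (hy : y * y = n)
    (hmn : ¬ IsSquare (m * n)) (hmn' : ¬ IsSquare (m * (m * n))) : ∃ α, IsQuad (QQ (x * y)) (DD x y) α ⟨x, mem_DD1 x y⟩ := by
  have h0 : x ≠ 0 := by rintro rfl; exact hm ⟨0, by rw [mul_zero] at hx; exact_mod_cast hx.symm⟩
  refine quad_IF (E := QQ (x * y)) (E' := DD x y) (mem_DD1 x y)
    (not_mem_of_nsq_Q (m := m * n) (by push_cast; rw [← hx, ← hy]; ring) hmn hx hm hmn') (nat_mem _ _ hx) {x, y} ?_ rfl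
  rintro z (rfl | h)
  · exact ⟨0, zero_mem _, 1, one_mem _, by ring⟩
  · refine ⟨0, zero_mem _, x * y / m, div_mem (mem_QQ _) (nat_mem _ _ rfl), ?_⟩
    rw [show z = y from h, ← hx]; field_simp; ring
end
end

section
open Polynomial IntermediateField

lemma IsQuad.deg {K L : Type*} [Field K] [NumberField K] [Field L] [NumberField L] [Algebra K L] {σ : L ≃+* L} {x : L} (h : IsQuad K L σ x) :
    Module.finrank ℚ L = Module.finrank ℚ K * 2 := by
  rw [← Module.finrank_mul_finrank ℚ K L, h.finrank]

section
variable {η q r s : ℕ} {a d : ℝ} [IsI a] [IsI d]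

/-- the generator `t_n` of the layer -/
noncomputable def tK (a d : ℝ) (n : ℕ) : KK a d n := ⟨tR n, mem_KKt a d n⟩
noncomputable def tT (a d : ℝ) (n : ℕ) : KK a d n := ⟨TR n, mem_KKT a d n⟩
noncomputable def aK (a d : ℝ) (n : ℕ) : KK a d n := ⟨a, mem_KKa a d n⟩
noncomputable def dK (a d : ℝ) (n : ℕ) : KK a d n := ⟨d, mem_KKd a d n⟩

lemma tK_sq (n : ℕ) : tK a d (n + 1) * tK a d (n + 1) = algebraMap (KK a d n) (KK a d (n + 1)) (2 + tK a d n) := by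
  apply Subtype.ext
  show tR (n + 1) * tR (n + 1) = 2 + tR n
  rw [← tR_succ]; ring

lemma alg_a (n : ℕ) : algebraMap (KK a d n) (KK a d (n + 1)) (aK a d n) = aK a d (n + 1) := rfl
lemma alg_d (n : ℕ) : algebraMap (KK a d n) (KK a d (n + 1)) (dK a d n) = dK a d (n + 1) := rfl

lemma tT_mul (n : ℕ) : tT a d (n + 1) * tK a d (n + 1) = algebraMap (KK a d n) (KK a d (n + 1)) (tT a d n) :=
  Subtype.ext (TR_succ n)

lemma tT_ne (n : ℕ) : tT a d n ≠ 0 := fun h => TR_ne n (congrArg Subtype.val h)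

lemma tT_sq (n : ℕ) : tT a d n * tT a d n = 4 - tK a d n * tK a d n := by
  apply Subtype.ext
  show TR n * TR n = 4 - tR n * tR n
  linear_combination TR_sq n

lemma quad_T {n : ℕ} {σ : KK a d (n + 1) ≃+* KK a d (n + 1)} (h : IsQuad (KK a d n) (KK a d (n + 1)) σ (tK a d (n + 1))) :
    σ (tT a d (n + 1)) = - tT a d (n + 1) := by
  have h1 := congrArg σ (tT_mul (a := a) (d := d) n)
  rw [map_mul, h.fix, h.σs, ← tT_mul] at h1
  apply mul_right_cancel₀ h.s0
  linear_combination -h1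

lemma tower_of {n : ℕ} (hn : tR (n + 1) ∉ KK a d n) : ∃ σ, IsQuad (KK a d n) (KK a d (n + 1)) σ (tK a d (n + 1)) := by
  refine quad_IF (E := KK a d n) (E' := KK a d (n + 1)) (mem_KKt a d _) hn ?_ {a, d, tR (n + 1)} ?_ rfl
  · have : tR (n + 1) * tR (n + 1) = (2 : ℕ) + tR n := by push_cast; rw [← tR_succ]; ring
    rw [this]; exact add_mem (nat_mem _ _ rfl) (mem_KKt a d n)
  · rintro x (h | h | h)
    · exact ⟨a, mem_KKa a d n, 0, zero_mem _, by rw [h]; ring⟩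
    · exact ⟨d, mem_KKd a d n, 0, zero_mem _, by rw [h]; ring⟩
    · exact ⟨0, zero_mem _, 1, one_mem _, by rw [show x = _ from h]; ring⟩

lemma AD.tower_nm (H : AD η q r s a d) (N : NS η q r s) (n : ℕ) : tR (n + 1) ∉ KK a d n := by
  induction n with
  | zero =>
    intro h
    obtain ⟨ρ1, ρ2, ρF, σ1, σ2, τ, HB⟩ := H.bq N
    have key : ∀ m : ℕ, ¬ IsSquare m → ¬ IsSquare (m * (r * s)) → ¬ IsSquare (m : QQ d) := by
      rintro m h1 h2 ⟨y, hy⟩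
      exact not_mem_of_nsq_Q H.hd N.nrs (y := y) (n := m) (by have := congrArg Subtype.val hy; simpa using this.symm) h1 h2 y.2
    rcases SQ HB.Q1 (c := ((η * q : ℕ) : QQ d)) (x := ((2 : ℕ) : QQ d)) (y := ⟨tR 1, h⟩) (by rw [HB.ha, map_natCast])
      (by rw [map_natCast]; exact Subtype.ext tR1) with h1 | h1
    · exact key 2 N.n2 N.nrs2 h1
    · exact key (2 * (η * q)) N.nq2 (by rw [mul_assoc]; exact N.nd2) (by rw [Nat.cast_mul]; exact h1)
  | succ n ih =>
    intro h
    obtain ⟨σ, h1⟩ := tower_of ih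
    set x : KK a d (n + 1) := ⟨tR (n + 1 + 1), h⟩
    have hx : x * x = 2 + tK a d (n + 1) := by
      apply Subtype.ext
      show tR (n + 1 + 1) * tR (n + 1 + 1) = 2 + tR (n + 1)
      rw [← tR_succ]; ring
    have hy : (x * σ x) * (x * σ x) = tT a d (n + 1) * tT a d (n + 1) := by
      have : σ x * σ x = 2 - tK a d (n + 1) := by
        rw [← map_mul, hx, map_add, map_ofNat, h1.σs]; ring
      rw [tT_sq]; linear_combination (σ x * σ x) * hx + (2 + tK a d (n + 1)) * this
    have hf : σ (x * σ x) = x * σ x := by rw [map_mul, h1.invol, mul_comm]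
    have hT := quad_T h1
    have hT0 := tT_ne (a := a) (d := d) (n + 1)
    have : (2 : KK a d (n + 1)) * tT a d (n + 1) = 0 := by
      rcases mul_self_eq_mul_self_iff.1 hy with h2 | h2
      · rw [h2] at hf; rw [hT] at hf; linear_combination -hf
      · rw [h2, map_neg, hT] at hf; linear_combination hf
    rcases mul_eq_zero.1 this with h2 | h2
    · exact two_ne_zero h2
    · exact hT0 h2

lemma AD.tower (H : AD η q r s a d) (N : NS η q r s) (n : ℕ) :
    ∃ σ, IsQuad (KK a d n) (KK a d (n + 1)) σ (tK a d (n + 1)) := tower_of (H.tower_nm N n)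

lemma AD.aut (H : AD η q r s a d) (N : NS η q r s) {a' d' : ℝ} (h0 : ∃ g : KK a d 0 ≃+* KK a d 0, (g (aK a d 0) : ℝ) = a' ∧ (g (dK a d 0) : ℝ) = d') (n : ℕ) :
    ∃ g : KK a d n ≃+* KK a d n, (g (aK a d n) : ℝ) = a' ∧ (g (dK a d n) : ℝ) = d' ∧ g (tK a d n) = tK a d n := by
  induction n with
  | zero =>
    obtain ⟨g, h1, h2⟩ := h0
    refine ⟨g, h1, h2, ?_⟩
    have : tK a d 0 = 0 := Subtype.ext tR_zero
    rw [this, map_zero]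
  | succ n ih =>
    obtain ⟨g, h1, h2, h3⟩ := ih
    obtain ⟨σ, h⟩ := H.tower N n
    obtain ⟨g', h4, h5⟩ := lift_aut h.gen h.s_nmem (tK_sq n) g (s' := tK a d (n + 1)) (by
      rw [map_add, map_ofNat, h3]; exact tK_sq n)
    exact ⟨g', by rw [← alg_a, h4, alg_coe, h1], by rw [← alg_d, h4, alg_coe, h2], h5⟩

lemma four {n : ℕ} {σ : KK a d (n + 1) ≃+* KK a d (n + 1)}
    (hσ : IsQuad (KK a d n) (KK a d (n + 1)) σ (tK a d (n + 1)))
    {σ' : KK a d (n + 1 + 1) ≃+* KK a d (n + 1 + 1)} (hσ' : IsQuad (KK a d (n + 1)) (KK a d (n + 1 + 1)) σ' (tK a d (n + 1 + 1))) :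
    ∃ g : KK a d (n + 1 + 1) ≃+* KK a d (n + 1 + 1), (∀ y, g (algebraMap _ _ y) = algebraMap _ _ (σ y)) ∧ ∀ y, g (g y) = σ' y := by
  obtain ⟨g, h1, h2⟩ := lift_aut hσ'.gen hσ'.s_nmem (tK_sq (n + 1)) σ (s' := tT a d (n + 1 + 1)) (by
    rw [map_add, map_ofNat, hσ.σs, tT_sq, tK_sq, map_add, map_add, map_neg, map_ofNat]; ring)
  refine ⟨g, h1, fun y => ?_⟩
  obtain ⟨u, v, rfl⟩ := hσ'.gen y
  have h3 : g (tT a d (n + 1 + 1)) = - tK a d (n + 1 + 1) := by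
    have h4 := congrArg g (tT_mul (a := a) (d := d) (n + 1))
    rw [map_mul, h1, h2, quad_T hσ, map_neg, ← tT_mul] at h4
    apply mul_right_cancel₀ (tT_ne (a := a) (d := d) (n + 1 + 1))
    rw [h4]; ring
  rw [map_add, map_mul, map_add, map_mul, map_add, map_mul, h1, h1, h1, h1, h2, h3, hσ'.fix, hσ'.fix, hσ'.σs, hσ.invol, hσ.invol]

variable [Fact q.Prime] [Fact r.Prime] [Fact s.Prime]

lemma AD.tau (H : AD η q r s a d) (N : NS η q r s) (n : ℕ) : ∃ τ : KK a d n ≃+* KK a d n, τ (dK a d n) = - dK a d n := by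
  obtain ⟨ρ1, ρ2, ρF, σ1, σ2, τ, HB⟩ := H.bq N
  obtain ⟨g, h1, h2, h3⟩ := H.aut N (a' := a) (d' := -d) ⟨τ, congrArg Subtype.val HB.τa, congrArg Subtype.val HB.τd⟩ n
  exact ⟨g, Subtype.ext h2⟩

lemma AD.tau1 (H : AD η q r s a d) (N : NS η q r s) (n : ℕ) : ∃ τ : KK a d n ≃+* KK a d n, τ (aK a d n) = - aK a d n ∧ τ (dK a d n) = dK a d n ∧
    τ (tK a d n) = tK a d n := by
  obtain ⟨ρ1, ρ2, ρF, σ1, σ2, τ, HB⟩ := H.bq N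
  obtain ⟨g, h1, h2, h3⟩ := H.aut N (a' := -a) (d' := d) ⟨σ1, congrArg Subtype.val HB.σ1a, congrArg Subtype.val HB.σ1d⟩ n
  exact ⟨g, Subtype.ext h1, Subtype.ext h2, h3⟩

lemma AD.lay {a0 b0 A B ε0 ε1 : ℤ} (M : Nm η q r s a0 b0 A B ε0 ε1) (H : AD η q r s a d) (n : ℕ) :
    ∃ τ, Lay η q r s n τ (aK a d n) (dK a d n) (tK a d n) := by
  have N := M.ns
  obtain ⟨τ, hτ⟩ := H.tau N n
  refine ⟨τ, M.hη, M.hq4, M.hr8, M.hs8, ?_, Subtype.ext H.ha, Subtype.ext H.hd, ?_, hτ⟩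
  · induction n with
    | zero =>
      obtain ⟨ρ1, ρ2, ρF, σ1, σ2, τ, HB⟩ := H.bq N
      rw [HB.deg]; norm_num
    | succ n ih =>
      obtain ⟨τ', hτ'⟩ := H.tau N n
      obtain ⟨σ, h⟩ := H.tower N n
      rw [h.deg, ih τ' hτ', pow_succ 2 (n + 1), mul_assoc]
  · apply Subtype.ext
    exact (TT_map (algebraMap (KK a d n) ℝ) (tK a d n) n).trans (tR_TT n)
end
end

section
open Polynomial IntermediateField

lemma ev_conj {k L : Type*} [Field k] [Field L] (j : k →+* L) {σ : L ≃+* L} (σj : ∀ x, σ (j x) = j x) (f : k[X]) (x : L) :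
    σ (f.eval₂ j x) = f.eval₂ j (σ x) := by
  have := hom_eval₂ f j (σ : L →+* L) x
  rwa [show (σ : L →+* L).comp j = j from RingHom.ext σj] at this

lemma ev_coe {E E' : IntermediateField ℚ ℝ} [Fact (E ≤ E')] (f : E[X]) (x : E') :
    f.eval₂ (algebraMap E ℝ) (x : ℝ) = ((f.eval₂ (algebraMap E E') x : E') : ℝ) :=
  (hom_eval₂ f (algebraMap E E') (algebraMap E' ℝ) x).symm

lemma ev_two {E E' : IntermediateField ℚ ℝ} [Fact (E ≤ E')] {f : E[X]} {x : E'} {c : E}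
    (h : f.eval₂ (algebraMap E E') x * f.eval₂ (algebraMap E E') (-x) = algebraMap E E' c) :
    f.eval₂ (algebraMap E ℝ) (x : ℝ) * f.eval₂ (algebraMap E ℝ) (-(x : ℝ)) = algebraMap E ℝ c := by
  have h1 := ev_coe f x
  have h2 := ev_coe f (-x)
  have h3 := congrArg (algebraMap E' ℝ) h
  rw [map_mul] at h3
  exact (congrArg₂ (· * ·) h1 h2).trans h3

lemma ev_zero {E E' : IntermediateField ℚ ℝ} [Fact (E ≤ E')] (f : E[X]) {σ : E' ≃+* E'} (hσ : ∀ x, σ (algebraMap E E' x) = algebraMap E E' x) {x : E'}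
    (hx : σ x = - x) (h : f.eval₂ (algebraMap E ℝ) (x : ℝ) = 0) : f.eval₂ (algebraMap E ℝ) (-(x : ℝ)) = 0 := by
  have e2 : f.eval₂ (algebraMap E E') x = 0 := Subtype.ext ((ev_coe f _).symm.trans h)
  have e3 := ev_conj _ (σ := σ) hσ f x
  rw [e2, map_zero, hx] at e3
  refine (ev_coe f (- x)).trans ?_
  rw [← e3]; rfl

lemma lin_coe {E E' E'' : IntermediateField ℚ ℝ} [Fact (E ≤ E'')] [Fact (E' ≤ E'')] {u : E'} {α β : E} {x : E''}
    (h : (u : ℝ) = α + β * x) : algebraMap E E'' α + algebraMap E E'' β * x = algebraMap E' E'' u := Subtype.ext h.symm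

lemma unit_up {E E' : IntermediateField ℚ ℝ} [NumberField E] [NumberField E'] [Fact (E ≤ E')] (u0 : (𝓞 E)ˣ) :
    ∃ u : (𝓞 E')ˣ, ((u : 𝓞 E') : E') = algebraMap E E' ((u0 : 𝓞 E) : E) :=
  ⟨Units.map (algebraMap (𝓞 E) (𝓞 E')).toMonoidHom u0, rfl⟩

lemma S11abs {k L : Type*} [Field k] [Field L] (j : k →+* L) {σ τ : L ≃+* L} {t a : L} {N : ℕ} {α β e : k}
    (rep : ∀ y : L, ∃ f g : k[X], f.natDegree < N ∧ y = f.eval₂ j t + g.eval₂ j t * a) (h2 : (2 : L) ≠ 0) (ha : a * a = j e)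
    (σj : ∀ x, σ (j x) = j x) (σt : σ t = -t) (σa : σ a = a) (τj : ∀ x, τ (j x) = j x) (τt : τ t = t) (τa : τ a = -a)
    {z : L} (hz : j α + j β * a = z * σ z) :
    ∃ f : k[X], f.natDegree < N ∧ f.eval₂ j t * f.eval₂ j (-t) = j (α * α - β * β * e) := by
  have σf := ev_conj j σj
  have τf := ev_conj j τj
  have hττ : τ (τ z) = z := by
    obtain ⟨f, g, -, rfl⟩ := rep z
    simp only [map_add, map_mul, τf, τt, τa, map_neg, neg_neg]
  have hστ : σ (τ z) = τ (σ z) := by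
    obtain ⟨f, g, -, rfl⟩ := rep z
    simp only [map_add, map_mul, τf, τt, τa, map_neg, σf, σt, σa]
  obtain ⟨f, g, hf, e1⟩ := rep (z * τ z)
  have e2 : z * τ z = f.eval₂ j t := by
    have h : τ (z * τ z) = z * τ z := by rw [map_mul, hττ, mul_comm]
    have h' := h
    nth_rewrite 1 [e1] at h'
    rw [map_add, map_mul, τf, τf, τt, τa] at h'
    apply mul_left_cancel₀ h2
    linear_combination e1 - h'
  refine ⟨f, hf, ?_⟩
  have e3 : f.eval₂ j (-t) = σ (z * τ z) := by rw [e2, σf, σt]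
  have e4 : τ z * τ (σ z) = j α - j β * a := by
    rw [← map_mul, ← hz, map_add, map_mul, τj, τj, τa]; ring
  rw [e3, ← e2, map_mul, hστ, map_sub, map_mul, map_mul, map_mul, ← ha]
  linear_combination (τ z * τ (σ z)) * (-hz) + (j α + j β * a) * e4

lemma cq_deg {k : Type*} [Field k] {f : k[X]} {m : ℕ} (hf : f.natDegree < 2 ^ m) {g : k[X]} (hg : g.natDegree < 2 ^ m) :
    (cq f + X * cq g).natDegree < 2 ^ (m + 1) := by
  have h1 : (X ^ 2 - 2 : k[X]).natDegree ≤ 2 := by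
    have : (2 : k[X]) = C 2 := rfl
    rw [this, natDegree_X_pow_sub_C]
  have h2 : ∀ f : k[X], (cq f).natDegree ≤ f.natDegree * 2 := fun f =>
    natDegree_comp_le.trans (Nat.mul_le_mul_left _ h1)
  have h3 : (X * cq g).natDegree ≤ 1 + g.natDegree * 2 := by
    refine natDegree_mul_le.trans ?_
    have := h2 g
    rw [natDegree_X]; omega
  have h4 := natDegree_add_le (cq f) (X * cq g)
  have h5 := h2 f
  rw [pow_succ]
  rcases le_max_iff.1 h4 with h | h <;> omega

section
variable {η q r s : ℕ} {a d : ℝ} [IsI a] [IsI d]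

lemma cq_eval₂ {k R : Type*} [Field k] [CommRing R] (j : k →+* R) (f : k[X]) (x : R) : (cq f).eval₂ j x = f.eval₂ j (x ^ 2 - 2) := by
  rw [cq, eval₂_comp]; simp

lemma AD.rep (H : AD η q r s a d) (N : NS η q r s) (m : ℕ) : ∀ y : KK a d m, ∃ f g : (QQ d)[X], f.natDegree < 2 ^ m ∧ g.natDegree < 2 ^ m ∧
    y = f.eval₂ (algebraMap (QQ d) (KK a d m)) (tK a d m) + g.eval₂ (algebraMap (QQ d) (KK a d m)) (tK a d m) * aK a d m := by
  induction m with
  | zero =>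
    intro y
    obtain ⟨ρ1, ρ2, ρF, σ1, σ2, τ, HB⟩ := H.bq N
    obtain ⟨u, v, h⟩ := HB.Q1.gen y
    exact ⟨C u, C v, by simp, by simp, by rw [eval₂_C, eval₂_C]; exact h⟩
  | succ m ih =>
    intro y
    obtain ⟨σ, h⟩ := H.tower N m
    obtain ⟨u, v, rfl⟩ := h.gen y
    obtain ⟨f, g, hf, hg, rfl⟩ := ih u
    obtain ⟨f', g', hf', hg', rfl⟩ := ih v
    have ht : algebraMap (KK a d m) (KK a d (m + 1)) (tK a d m) = tK a d (m + 1) ^ 2 - 2 := by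
      rw [sq, tK_sq, map_add, map_ofNat]; ring
    have he : ∀ f : (QQ d)[X], algebraMap (KK a d m) (KK a d (m + 1)) (f.eval₂ (algebraMap (QQ d) (KK a d m)) (tK a d m)) =
        (cq f).eval₂ (algebraMap (QQ d) (KK a d (m + 1))) (tK a d (m + 1)) := by
      intro f
      rw [hom_eval₂, ht, cq_eval₂]; rfl
    refine ⟨cq f + X * cq f', cq g + X * cq g', cq_deg hf hf', cq_deg hg hg', ?_⟩
    simp only [map_add, map_mul, he, alg_a, eval₂_add, eval₂_mul, eval₂_X]
    ring

lemma fix_k1 {k L : Type*} [Field k] [Field L] [CharZero k] [CharZero L] [Algebra k L] {ρ : k ≃+* k} {d1 : k} (h : IsQuad ℚ k ρ d1) {τ : L ≃+* L}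
    (hd : τ (algebraMap k L d1) = algebraMap k L d1) (x : k) : τ (algebraMap k L x) = algebraMap k L x := by
  obtain ⟨u, v, rfl⟩ := h.gen x
  simp only [map_add, map_mul, hd, eq_ratCast, map_ratCast]

variable {a0 b0 A B ε0 ε1 : ℤ} [Fact q.Prime] [Fact r.Prime] [Fact s.Prime]

lemma AD.nnorm (M : Nm η q r s a0 b0 A B ε0 ε1) (H : AD η q r s a d) (n : ℕ) {σ : KK a d (n + 1) ≃+* KK a d (n + 1)}
    (hσ : IsQuad (KK a d n) (KK a d (n + 1)) σ (tK a d (n + 1))) : ∃ u : (𝓞 (KK a d n))ˣ, u ∉ nU (KK a d n) σ := by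
  have N := M.ns
  obtain ⟨ρ1, ρ2, ρF, σ1, σ2, τ, HB⟩ := H.bq N
  obtain ⟨x1, w1, X1, w2, u0, -, -, hw, -, -, -, hu, -⟩ := HB.units M
  obtain ⟨α, β, hα⟩ := HB.Q1.gen ((u0 : 𝓞 (KK a d 0)) : KK a d 0)
  have hc : (α * α - β * β * (η * q : ℕ)) * ((w1 : 𝓞 (QQ d)) : QQ d) = (ε1 : QQ d) := by
    apply (algebraMap (QQ d) (KK a d 0)).injective
    rw [map_mul, map_intCast, ← hu, hα, map_add, map_mul, HB.Q1.fix, HB.Q1.fix, HB.Q1.σs, map_sub, map_mul, map_mul, map_mul, map_natCast, ← HB.ha]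
    ring
  obtain ⟨u, hu'⟩ : ∃ u : (𝓞 (KK a d n))ˣ, (((u : 𝓞 (KK a d n)) : KK a d n) : ℝ) = (α : ℝ) + β * a := by
    have : Fact (KK a d 0 ≤ KK a d n) := ⟨KK_zero_le a d n⟩
    obtain ⟨u, hu⟩ := unit_up (E' := KK a d n) u0
    refine ⟨u, ?_⟩
    rw [hu, hα, alg_coe]; rfl
  refine ⟨u, fun hm => ?_⟩
  obtain ⟨z, hz⟩ := mem_nU.1 hm
  obtain ⟨τ, τa, τd, τt⟩ := H.tau1 N (n + 1)
  have hj : ∀ x, algebraMap (QQ d) (KK a d (n + 1)) x = algebraMap (KK a d n) (KK a d (n + 1)) (algebraMap (QQ d) (KK a d n) x) := fun x => IsScalarTower.algebraMap_apply _ _ _ x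
  obtain ⟨f, hf, he⟩ := S11abs (algebraMap (QQ d) (KK a d (n + 1))) (σ := σ) (τ := τ) (t := tK a d (n + 1)) (a := aK a d (n + 1)) (N := 2 ^ (n + 1))
    (α := α) (β := β) (e := (η * q : ℕ)) (fun y => by
      obtain ⟨f, g, h1, -, h3⟩ := H.rep N (n + 1) y
      exact ⟨f, g, h1, h3⟩) two_ne_zero (by rw [map_natCast]; exact Subtype.ext H.ha) (fun x => by rw [hj, hσ.fix]) hσ.σs
      (by rw [← alg_a, hσ.fix]) (fix_k1 HB.q1 τd) τt τa (z := z) (by rw [← hz]; exact lin_coe hu')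
  refine S11core M HB.q1 HB.hd1 hw hc (algebraMap (QQ d) ℝ) (t := tR) tR_zero tR_succ (n := n) ?_ hf ?_
  · intro j _ P hP
    obtain ⟨σ', hσ'⟩ := H.tower N j
    have hj : ∀ x, algebraMap (QQ d) (KK a d (j + 1)) x = algebraMap (KK a d j) (KK a d (j + 1)) (algebraMap (QQ d) (KK a d j) x) := fun x => IsScalarTower.algebraMap_apply _ _ _ x
    exact ev_zero P (fun x => by rw [hj, hσ'.fix]) hσ'.σs hP
  · have e2 : tR n = tR (n + 1) ^ 2 - 2 := by rw [tR_succ]; ring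
    have h4 := ev_two he
    change f.eval₂ (algebraMap (QQ d) ℝ) (tR (n + 1)) * f.eval₂ (algebraMap (QQ d) ℝ) (- tR (n + 1)) = _ at h4
    rw [← h4, eval₂_eq_eval_map, eval₂_eq_eval_map, eval₂_eq_eval_map, ← ph_map, e2, ph_eval]
end
end

section
/-- the primes above `2` and `p` generate the `2`-class group -/
def Gn (K : Type*) [Field K] [NumberField K] (p : ℕ) : Prop :=
  ∀ P b : Ideal (𝓞 K), P.IsPrime → b.IsPrime → (2 : 𝓞 K) ∈ P → (p : 𝓞 K) ∈ b →
    Subgroup.closure {b2 (ClassGroup (𝓞 K)) (cl P), b2 (ClassGroup (𝓞 K)) (cl b)} = ⊤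

lemma Px.ne2 {η q r s N p : ℕ} [Fact q.Prime] [Fact r.Prime] [Fact s.Prime] [Fact p.Prime] (X : Px η q r s N p) : p ≠ 2 := by
  rintro rfl; have := X.h8; omega

section
variable {η q r s n N p : ℕ} [Fact q.Prime] [Fact r.Prime] [Fact s.Prime] [Fact p.Prime]
variable {K L : Type*} [Field K] [NumberField K] [Field L] [NumberField L] [Algebra K L] {σ τ : L ≃+* L} {τK : K ≃+* K}
  {a d x : L} {aK dK xK : K}

lemma gn_norm (HK : Lay η q r s n τK aK dK xK) (HL : Lay η q r s (n + 1) τ a d x) (h : IsQuad K L σ x) (hp : 2 ^ (n + 1 + 2) ∣ p - 1)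
    (G : Gn K p) {P b : Ideal (𝓞 L)} (hP : P.IsPrime) (hb : b.IsPrime) (h2 : (2 : 𝓞 L) ∈ P) (hpb : (p : 𝓞 L) ∈ b) :
    Subgroup.closure {mB (nCl K L) (b2 _ (cl P)), mB (nCl K L) (b2 _ (cl b))} = ⊤ := by
  have hpp : p.Prime := Fact.out
  have hP0 : P ≠ ⊥ := prime_ne_bot (l := 2) two_ne_zero (by exact_mod_cast h2)
  have hb0 : b ≠ ⊥ := prime_ne_bot hpp.ne_zero hpb
  rw [mB_b2, mB_b2, nCl_cl hP0, nCl_cl hb0, HK.relNorm2 HL hP h2, relNorm_p h HL.hx hp hb hpb]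
  refine G _ _ (Ideal.IsPrime.comap _) (Ideal.IsPrime.comap _) ?_ ?_
  · rw [Ideal.mem_comap, map_ofNat]; exact h2
  · rw [Ideal.mem_comap, map_natCast]; exact hpb

lemma gn_surj (HK : Lay η q r s n τK aK dK xK) (HL : Lay η q r s (n + 1) τ a d x) (h : IsQuad K L σ x) (hp : 2 ^ (n + 1 + 2) ∣ p - 1)
    (G : Gn K p) : Function.Surjective (mB (nCl K L)) := by
  obtain ⟨P, hP, -, h2⟩ := exists_prime_over (K := L) Nat.prime_two
  obtain ⟨b, hb, -, hpb⟩ := exists_prime_over (K := L) (Fact.out : p.Prime)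
  have := gn_norm HK HL h hp G hP hb (by exact_mod_cast h2) hpb
  rw [← MonoidHom.range_eq_top, eq_top_iff, ← this, Subgroup.closure_le]
  rintro _ (rfl | rfl) <;> exact ⟨_, rfl⟩

lemma gn_up (HK : Lay η q r s n τK aK dK xK) (HL : Lay η q r s (n + 1) τ a d x) (h : IsQuad K L σ x) (hp : 2 ^ (n + 1 + 2) ∣ p - 1)
    (G : Gn K p) (hk : (mB (nCl K L)).ker = ⊥) : Gn L p := by
  intro P b hP hb h2 hpb
  have := gn_norm HK HL h hp G hP hb h2 hpb
  apply Subgroup.map_injective ((MonoidHom.ker_eq_bot_iff _).1 hk)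
  rw [MonoidHom.map_closure, Set.image_pair, this, Subgroup.map_top_of_surjective _ (gn_surj HK HL h hp G)]

lemma gn_card (HK : Lay η q r s n τK aK dK xK) (HL : Lay η q r s (n + 1) τ a d x) (h : IsQuad K L σ x) (hp : 2 ^ (n + 1 + 2) ∣ p - 1)
    (G : Gn K p) (hk : (mB (nCl K L)).ker = ⊥) : Nat.card (B2 (ClassGroup (𝓞 L))) = Nat.card (B2 (ClassGroup (𝓞 K))) :=
  Nat.card_congr (Equiv.ofBijective _ ⟨(MonoidHom.ker_eq_bot_iff _).1 hk, gn_surj HK HL h hp G⟩)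

lemma gn_ker [IsTotallyReal K] [IsTotallyReal L] (φ : L →+* ℝ) (HK : Lay η q r s n τK aK dK xK) (HL : Lay η q r s (n + 1) τ a d x) (h : IsQuad K L σ x)
    (hp : 2 ^ (n + 1 + 2) ∣ p - 1) (G : Gn K p) {u : (𝓞 K)ˣ} (hu : u ∉ nU K σ) : (mB (nCl K L)).ker = (dmH (mB (aCl σ))).range := by
  refine ker_N _ _ (gn_surj HK HL h hp G) (fun c => ?_) (HK.fix_le HL h φ hu)
  obtain ⟨c, rfl⟩ := b2_surj c
  rw [mB_b2, mB_b2, mB_b2, nCl_aCl h]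

section
variable {a0 b0 A B ε0 ε1 : ℤ}
variable {k1 k2 F : Type*} [Field k1] [Field k2] [Field F] [NumberField k1] [NumberField k2] [NumberField F]
    [Algebra k1 K] [Algebra k2 K] [Algebra F K] {ρ1 : k1 ≃+* k1} {ρ2 : k2 ≃+* k2} {ρF : F ≃+* F} {σ1 σ2 τ0 : K ≃+* K} {d1 : k1} {d2 : k2} {aF : F}
    {a' d' : K} (H : Bq η q r s ρ1 ρ2 ρF σ1 σ2 τ0 d1 d2 aF a' d')
include H

lemma gn_zero [IsTotallyReal k1] [IsTotallyReal F] [IsTotallyReal K] (φ : K →+* ℝ) (M : Nm η q r s a0 b0 A B ε0 ε1)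
    (X : Px η q r s N p) : Gn K p := by
  intro P b hP hb h2 hpb
  have hpp : p.Prime := Fact.out
  have hb0 : b ≠ ⊥ := prime_ne_bot hpp.ne_zero hpb
  refine H.gens φ M hpp.ne_zero X.lr X.ls hP h2 hb0 ?_
  obtain ⟨D, hD, hDD⟩ := intSqrt (d := a' * d') (m := η * q * (r * s)) (by
    have h1 := H.ha
    have h2 := H.hd
    push_cast at h1 h2 ⊢
    linear_combination d' * d' * h1 + η * q * h2)
  rw [relNorm_split H.QF (x := D) (by
    apply RingOfIntegers.ext; rw [sO_coe, v_neg, hD, map_mul, H.τa, H.τd]; ring) hDD X.sqd X.nd X.ne2 hb hpb]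
  refine inert_span H.qF H.haF X.nq X.ne2 (Ideal.IsPrime.comap _) ?_
  rw [Ideal.mem_comap, map_natCast]; exact hpb

lemma step_first [Algebra k2 L] [IsScalarTower k2 K L] [IsTotallyReal k1] [IsTotallyReal F] [IsTotallyReal K] [IsTotallyReal L] (φ : K →+* ℝ) (φL : L →+* ℝ)
    (M : Nm η q r s a0 b0 A B ε0 ε1) (X : Px η q r s N p)
    (HK : Lay η q r s 0 τK aK dK xK) (HL : Lay η q r s 1 τ a d x) (h : IsQuad K L σ x) (hσd : σ d = d) {u : (𝓞 K)ˣ} (hu : u ∉ nU K σ)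
    {k3 Q2 D : Type*} [Field k3] [NumberField k3] [Field Q2] [NumberField Q2] [Field D] [NumberField D]
    [Algebra k3 D] [Algebra Q2 D] [Algebra D L] [Algebra k3 L] [IsScalarTower k3 D L] [Algebra k2 D] [IsScalarTower k2 D L]
    {α β κ : D ≃+* D} {e w w' : D} {ρ' : Q2 ≃+* Q2} {t2 : Q2}
    (hα : IsQuad Q2 D α e) (he : e * e = (η * q * (r * s) : ℕ)) (hκ : IsQuad k3 D κ w) (hβ : ∀ y, β y = κ (α y)) (hβ2 : IsQuad k2 D β w')
    (hσ : ∀ y, σ (algebraMap D L y) = algebraMap D L (β y)) (hQ2 : IsQuad ℚ Q2 ρ' t2) (ht2 : t2 * t2 = (2 : ℕ))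
    (hodd : Odd (Nat.card (ClassGroup (𝓞 Q2))))
    (h3 : ∀ c, mB (jCl k3 L) c = 1) : (mB (nCl K L)).ker = ⊥ := by
  have hpp : p.Prime := Fact.out
  have hp8 : 2 ^ (0 + 1 + 2) ∣ p - 1 := by have := X.h8; omega
  have G := gn_zero H φ M X
  obtain ⟨P, hP, hP0, h2⟩ := exists_prime_over (K := L) Nat.prime_two
  have h2' : (2 : 𝓞 L) ∈ P := by exact_mod_cast h2
  obtain ⟨b, hb, hb0, hpb⟩ := exists_prime_over (K := D) hpp
  obtain ⟨E, hE, hEE⟩ := intSqrt he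
  obtain ⟨E', hE', hEE'⟩ := intSqrt ht2
  have hp2 : ((2 : ℕ) : ZMod p) ≠ 0 := by
    rw [Ne, ZMod.natCast_eq_zero_iff]
    intro h; exact X.ne2 ((Nat.prime_dvd_prime_iff_eq hpp Nat.prime_two).1 h)
  have nb : Ideal.absNorm b = p := by
    rw [← Ideal.absNorm_relNorm (𝓞 Q2) (𝓞 D), relNorm_split hα (x := E) (by
        apply RingOfIntegers.ext; rw [sO_coe, v_neg, hE, hα.σs]) hEE X.sqd X.nd X.ne2 hb hpb,
      ← Ideal.absNorm_relNorm (𝓞 ℚ) (𝓞 Q2), relNorm_split hQ2 (x := E') (by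
        apply RingOfIntegers.ext; rw [sO_coe, v_neg, hE', hQ2.σs]) hEE' X.sq2 hp2 X.ne2 (Ideal.IsPrime.comap _)
        (by rw [Ideal.mem_comap, map_natCast]; exact hpb),
      rat_span hpp (Ideal.IsPrime.comap _) (by rw [Ideal.mem_comap, map_natCast, Ideal.mem_comap, map_natCast]; exact hpb), rat_absNorm_span]
  have hk := gn_ker φL HK HL h hp8 G hu
  have hbL := ext_ne_bot (L := L) hb0
  refine step_zero isTwo_B2 _ (mB (aCl σ)) (fun c => ?_) hk (x := b2 _ (cl P)) (y := b2 _ (cl (b.map (algebraMap (𝓞 D) (𝓞 L))))) ?_ ?_ ?_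
  · obtain ⟨c, rfl⟩ := b2_surj c
    rw [mB_b2, mB_b2, ← aCl_comp (ρ := RingEquiv.refl L) (fun x => (h.invol x).symm), aCl_id (fun x => rfl)]
  · rw [mB_b2, aCl_cl σ hP0, HL.fix2 hσd hP h2']
  · have := sigma_D hα hκ hβ hσ hodd h3 (b2 _ (cl b))
    rwa [mB_b2, jCl_cl hb0] at this
  · rw [mB_b2, mB_b2, nCl_cl hP0, nCl_cl hbL, HK.relNorm2 HL hP h2', relNorm_baseChange hβ2 h hσ]
    have hr0 : Ideal.relNorm (𝓞 k2) b ≠ ⊥ := by rwa [Ne, Ideal.relNorm_eq_bot_iff]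
    refine H.gens φ M hpp.ne_zero X.lr X.ls (Ideal.IsPrime.comap _) ?_ (ext_ne_bot hr0) ?_
    · rw [Ideal.mem_comap, map_ofNat]; exact h2'
    · rw [relNorm_baseChange H.q2 H.QF (fun y => ?_), rat_ideal_of_absNorm hpp (I := Ideal.relNorm (𝓞 ℚ) (Ideal.relNorm (𝓞 k2) b)),
        Ideal.map_span, Set.image_singleton, map_natCast]
      · rw [Ideal.absNorm_relNorm, Ideal.absNorm_relNorm, nb]
      · obtain ⟨y, z, rfl⟩ := H.q2.gen y
        have := H.q2.σs
        simp only [map_add, map_mul, eq_ratCast, map_ratCast, this, H.c2, H.τa, H.τd, map_neg]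
        ring
end
end
end

section
open IntermediateField

instance (a d : ℝ) : Fact (QQ (tR 1) ≤ KK a d 1) := ⟨QQ_le (mem_KKt a d 1)⟩
instance (a d : ℝ) : Fact (DD (tR 1) (a * d) ≤ KK a d (0 + 1)) := inferInstanceAs (Fact (_ ≤ KK a d 1))
instance (a d : ℝ) : Fact (QQ (tR 1 * (a * d)) ≤ KK a d (0 + 1)) := inferInstanceAs (Fact (_ ≤ KK a d 1))

lemma beta_eq {k2 k3 Q2 D : Type*} [Field k2] [Field k3] [Field Q2] [Field D] [CharZero k2] [CharZero D] [Algebra k2 D] [Algebra k3 D] [Algebra Q2 D]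
    {α β κ : D ≃+* D} {e t : D} {e2 : k2} {t2 : Q2} {te : k3} {ρ2 : k2 ≃+* k2} (h2 : IsQuad ℚ k2 ρ2 e2) (hα : IsQuad Q2 D α e) (hβ : IsQuad k2 D β t)
    (hκ : IsQuad k3 D κ t) (c2 : algebraMap k2 D e2 = e) (cQ : algebraMap Q2 D t2 = t) (c3 : algebraMap k3 D te = t * e) (y : D) : β y = κ (α y) := by
  have hκe : κ e = -e := by
    have h1 := hκ.fix te
    rw [c3, map_mul, hκ.σs] at h1
    apply mul_left_cancel₀ hκ.s0
    linear_combination -h1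
  have hαt : α t = t := by rw [← cQ, hα.fix]
  have hu : ∀ u : k2, κ (α (algebraMap k2 D u)) = algebraMap k2 D u := by
    intro u
    obtain ⟨p, q, rfl⟩ := h2.gen u
    simp only [map_add, map_mul, eq_ratCast, map_ratCast, c2, hα.σs, map_neg, hκe, neg_neg]
  obtain ⟨u, v, rfl⟩ := hβ.gen y
  rw [map_add, map_mul, hβ.fix, hβ.fix, hβ.σs, map_add, map_add, map_mul, map_mul, hu, hu, hαt, hκ.σs]

lemma sigma_eq {k2 K D L : Type*} [Field k2] [Field K] [Field D] [Field L] [Algebra k2 D] [Algebra D L] [Algebra k2 K] [Algebra K L] [Algebra k2 L]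
    [IsScalarTower k2 K L] [IsScalarTower k2 D L] {β : D ≃+* D} {t : D} {σ : L ≃+* L} {x : L} (hβ : IsQuad k2 D β t) (h : IsQuad K L σ x)
    (hx : algebraMap D L t = x) (y : D) : σ (algebraMap D L y) = algebraMap D L (β y) := by
  have hu : ∀ u : k2, σ (algebraMap k2 L u) = algebraMap k2 L u := by
    intro u
    rw [IsScalarTower.algebraMap_apply k2 K L, h.fix]
  obtain ⟨u, v, rfl⟩ := hβ.gen y
  rw [show β (algebraMap k2 D u + algebraMap k2 D v * t) = algebraMap k2 D u + algebraMap k2 D v * -t by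
    rw [map_add, map_mul, hβ.fix, hβ.fix, hβ.σs]]
  simp only [map_add, map_mul, ← IsScalarTower.algebraMap_apply k2 D L, hu, hx, h.σs, map_neg]

section
variable {η q r s : ℕ} {a0 b0 A B ε0 ε1 : ℤ} [Fact q.Prime] [Fact r.Prime] [Fact s.Prime]

lemma unit_pair {k L : Type*} [Field k] [NumberField k] [Field L] [NumberField L] [Algebra k L] {ρ : k ≃+* k} {d1 : k} (h : IsQuad ℚ k ρ d1)
    (hd : d1 * d1 = (r * s : ℕ)) (M : Nm η q r s a0 b0 A B ε0 ε1) : ∃ x1 w x2 w' : 𝓞 L, IsUnit w ∧ IsUnit w' ∧ x1 * x1 = r * w ∧ x2 * x2 = s * w' := by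
  obtain ⟨x1, w1, h1, h2, h3, h4, h5⟩ := pell_unit h (m := r) (n := s) hd M.hε0 M.e1
  obtain ⟨x2, w2, g1, g2, g3, g4, g5⟩ := pell_unit h (m := s) (n := r) (a := b0) (b := a0) (ε := -ε0) (by rw [hd, mul_comm])
    (by rcases M.hε0 with h | h <;> rw [h] <;> simp) (by rw [← M.e1]; ring)
  refine ⟨algebraMap (𝓞 k) (𝓞 L) x1, algebraMap (𝓞 k) (𝓞 L) w1, algebraMap (𝓞 k) (𝓞 L) x2, algebraMap (𝓞 k) (𝓞 L) w2, ?_, ?_, ?_, ?_⟩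
  · exact (IsUnit.of_mul_eq_one _ h5).map _
  · exact (IsUnit.of_mul_eq_one _ g5).map _
  · rw [← map_mul, h2, map_mul, map_natCast]
  · rw [← map_mul, g2, map_mul, map_natCast]

variable {a d : ℝ} [IsI a] [IsI d] {p N : ℕ} [Fact p.Prime]

lemma AD.first (M : Nm η q r s a0 b0 A B ε0 ε1) (H : AD η q r s a d) (X : Px η q r s N p)
    {σ : KK a d (0 + 1) ≃+* KK a d (0 + 1)} (h : IsQuad (KK a d 0) (KK a d (0 + 1)) σ (tK a d (0 + 1))) :
    (mB (nCl (KK a d 0) (KK a d (0 + 1)))).ker = ⊥ := by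
  have NN := M.ns
  obtain ⟨ρ1, ρ2, ρF, σ1, σ2, τ, HB⟩ := H.bq NN
  obtain ⟨τ0, L0⟩ := H.lay M 0
  obtain ⟨τ1, L1⟩ := H.lay M (0 + 1)
  obtain ⟨u, hu⟩ := H.nnorm M 0 h
  have := H.tr 0
  have T1 := H.tr 1
  have : IsTotallyReal (KK a d (0 + 1)) := T1
  have : IsTotallyReal (QQ d) := tr_of_le T1
  have : IsTotallyReal (QQ a) := tr_of_le T1
  have : IsTotallyReal (QQ (tR 1)) := tr_of_le T1
  have : IsTotallyReal (QQ (tR 1 * (a * d))) := tr_of_le T1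
  have n4 : ¬ IsSquare (2 * (2 * (η * q * (r * s)))) := by
    rintro ⟨y, hy⟩
    have h2 : 2 ∣ y := by
      have : 2 ∣ y * y := ⟨_, hy.symm⟩
      rcases Nat.prime_two.dvd_mul.1 this with h | h <;> exact h
    obtain ⟨z, rfl⟩ := h2
    exact NN.nd ⟨z, by linarith⟩
  obtain ⟨⟨α, hα⟩, ⟨β, hβ⟩⟩ := quad_D tR1 NN.n2 H.had NN.nd NN.nd2
  obtain ⟨κ, hκ⟩ := quad_D' tR1 NN.n2 H.had NN.nd2 n4
  obtain ⟨ρ', hQ⟩ := quad_Q tR1 NN.n2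
  have h3e : (tR 1 * (a * d)) * (tR 1 * (a * d)) = (2 * η * q * r * s : ℕ) := by
    have h1 := tR1
    have h2 := H.had
    push_cast at *
    linear_combination (a * d) * (a * d) * h1 + 2 * h2
  obtain ⟨ρ3, h3⟩ := quad_Q h3e (by have := NN.nd2; rwa [show 2 * (η * q * (r * s)) = 2 * η * q * r * s by ring] at this)
  obtain ⟨x1, w, x2, w', u1, u2, u3, u4⟩ := unit_pair (L := KK a d (0 + 1)) HB.q1 HB.hd1 M
  refine step_first HB (algebraMap (KK a d 0) ℝ) (algebraMap (KK a d (0 + 1)) ℝ) M X L0 L1 h (by rw [← alg_d, h.fix]) hu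
    (k3 := QQ (tR 1 * (a * d))) (Q2 := QQ (tR 1)) (D := DD (tR 1) (a * d)) hα (Subtype.ext H.had) hκ
    (beta_eq HB.q2 hα hβ hκ (te := ⟨_, mem_QQ _⟩) (t2 := ⟨_, mem_QQ _⟩) rfl rfl rfl) hβ (sigma_eq hβ h rfl) hQ (Subtype.ext tR1)
    (Q2_odd hQ (algebraMap _ ℝ) (Subtype.ext tR1)) (k3_kill h3 (algebraMap _ ℝ) M (Subtype.ext h3e) u1 u2 u3 u4)

lemma AD.main (M : Nm η q r s a0 b0 A B ε0 ε1) (H : AD η q r s a d) (X : Px η q r s N p) (m : ℕ) (hm : m + 3 ≤ N) :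
    Gn (KK a d (m + 1)) p ∧ Nat.card (B2 (ClassGroup (𝓞 (KK a d (m + 1))))) = Nat.card (B2 (ClassGroup (𝓞 (KK a d 0)))) ∧
    ∃ σ, IsQuad (KK a d m) (KK a d (m + 1)) σ (tK a d (m + 1)) ∧ ∀ c, mB (aCl σ) c = c := by
  have NN := M.ns
  induction m with
  | zero =>
    obtain ⟨ρ1, ρ2, ρF, σ1, σ2, τ, HB⟩ := H.bq NN
    obtain ⟨τ0, L0⟩ := H.lay M 0
    obtain ⟨τ1, L1⟩ := H.lay M (0 + 1)
    obtain ⟨σ, hσ⟩ := H.tower NN 0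
    have T := H.tr 0
    have : IsTotallyReal (QQ d) := tr_of_le T
    have : IsTotallyReal (QQ a) := tr_of_le T
    have hp : 2 ^ (0 + 1 + 2) ∣ p - 1 := (pow_dvd_pow 2 hm).trans X.hN
    have G := gn_zero HB (algebraMap (KK a d 0) ℝ) M X
    have hk := H.first M X hσ
    exact ⟨gn_up L0 L1 hσ hp G hk, gn_card L0 L1 hσ hp G hk, σ, hσ, triv_of_ker hσ hk⟩
  | succ m ih =>
    obtain ⟨G, hc, σ, hσ, ht⟩ := ih (by omega)
    obtain ⟨τ0, L0⟩ := H.lay M (m + 1)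
    obtain ⟨τ1, L1⟩ := H.lay M (m + 1 + 1)
    obtain ⟨σ', hσ'⟩ := H.tower NN (m + 1)
    have := H.tr (m + 1)
    have := H.tr (m + 1 + 1)
    obtain ⟨u, hu⟩ := H.nnorm M (m + 1) hσ'
    have hp : 2 ^ (m + 1 + 1 + 2) ∣ p - 1 := (pow_dvd_pow 2 hm).trans X.hN
    obtain ⟨g, g1, g2⟩ := four hσ hσ'
    have hk := step_n hσ' g1 g2 ht (gn_ker (algebraMap (KK a d (m + 1 + 1)) ℝ) L0 L1 hσ' hp G hu)
    exact ⟨gn_up L0 L1 hσ' hp G hk, (gn_card L0 L1 hσ' hp G hk).trans hc, σ', hσ', triv_of_ker hσ' hk⟩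

lemma AD.final (M : Nm η q r s a0 b0 A B ε0 ε1) (H : AD η q r s a d) (n : ℕ) :
    2 * Nat.card (B2 (ClassGroup (𝓞 (KK a d n)))) = Nat.card (B2 (ClassGroup (𝓞 (QQ d)))) * Nat.card (B2 (ClassGroup (𝓞 (QQ (a * d))))) := by
  have NN := M.ns
  obtain ⟨ρ1, ρ2, ρF, σ1, σ2, τ, HB⟩ := H.bq NN
  have T := H.tr 0
  have : IsTotallyReal (QQ d) := tr_of_le T
  have : IsTotallyReal (QQ a) := tr_of_le T
  have : IsTotallyReal (QQ (a * d)) := tr_of_le T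
  rw [← HB.h0 (algebraMap (KK a d 0) ℝ) M]
  cases n with
  | zero => rfl
  | succ m =>
    obtain ⟨p, hp, X⟩ := Px.ex M (m + 3)
    rw [(H.main M X m le_rfl).2.1]
end
end

section
open IntermediateField

lemma leg_etaq {η q r : ℕ} [Fact r.Prime] (hη : η = 1 ∨ η = 2) (hr8 : r % 8 = 5)
    (hqr : legendreSym r q = (-1) ^ (if η = 2 then 1 else 0)) : legendreSym r (η * q : ℕ) = 1 := by
  rw [Nat.cast_mul, legendreSym.mul, hqr]
  rcases hη with rfl | rfl
  · simp
  · rw [Nat.cast_ofNat, leg_two_of_five hr8]; simp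

lemma layer_KK (a d : ℝ) (n : ℕ) : adjoin ℚ {a, d} ⊔ adjoin ℚ {2 * Real.cos (2 * Real.pi / 2 ^ (n + 2))} = KK a d n := by
  rw [← adjoin_union, KK, tR]
  congr 1
  ext x
  simp only [Set.mem_union, Set.mem_insert_iff, Set.mem_singleton_iff, or_assoc]

lemma Nm.concl {η q r s : ℕ} {a0 b0 A B ε0 ε1 : ℤ} [Fact q.Prime] [Fact r.Prime] [Fact s.Prime] (M : Nm η q r s a0 b0 A B ε0 ε1) (n : ℕ) :
    2 * 2 ^ ((Nat.card (ClassGroup (𝓞 (KK √(η * q : ℕ) √(r * s : ℕ) n)))).factorization 2) =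
      2 ^ ((Nat.card (ClassGroup (𝓞 (adjoin ℚ {√(r * s : ℕ)})))).factorization 2) *
      2 ^ ((Nat.card (ClassGroup (𝓞 (adjoin ℚ {√(η * q * r * s : ℕ)})))).factorization 2) := by
  have H : AD η q r s √(η * q : ℕ) √(r * s : ℕ) := ⟨Real.mul_self_sqrt (Nat.cast_nonneg _), Real.mul_self_sqrt (Nat.cast_nonneg _)⟩
  have := H.IsIa
  have := H.IsId
  have h := H.final M n
  rw [card_B2, card_B2, card_B2] at h
  have e : √(η * q * r * s : ℕ) = √(η * q : ℕ) * √(r * s : ℕ) := by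
    rw [← Real.sqrt_mul (Nat.cast_nonneg _), ← Nat.cast_mul, ← mul_assoc]
  rw [e]
  exact h
end
end

theorem statement_12 (η q r s : ℕ) [Fact q.Prime] [Fact r.Prime] [Fact s.Prime]
    (hη : η = 1 ∨ η = 2)
    (hq4 : q % 4 = 3) (hr8 : r % 8 = 5) (hs8 : s % 8 = 5)
    (hqr : legendreSym r q = (-1) ^ (if η = 2 then 1 else 0))
    (hqs : legendreSym s q = (-1) ^ (if η = 2 then 1 else 0))
    (hrs : legendreSym s r = 1)
    (γ γ' : ℤ) (hγ : 0 < γ) (hγ' : 0 < γ')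
    (hPell : γ ^ 2 - (η * q * r * s : ℕ) * γ' ^ 2 = 1)
    (hfund : ∀ a b : ℤ, 0 < a → 0 < b → a ^ 2 - (η * q * r * s : ℕ) * b ^ 2 = 1 → γ ≤ a)
    (hnsq : ¬ ∃ t : ℤ, 2 ^ (if η = 1 then 1 else 0) * (q : ℤ) * (γ - 1) = t ^ 2)
    (hNegPell : ¬ ∃ x y : ℤ, x ^ 2 - (r * s : ℕ) * y ^ 2 = -1) :
    ∀ n : ℕ,
      2 * h2 (layer (IntermediateField.adjoin ℚ
          {Real.sqrt (η * q : ℕ), Real.sqrt (r * s : ℕ)}) n) =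
        h2 (IntermediateField.adjoin ℚ {Real.sqrt (r * s : ℕ)}) *
          h2 (IntermediateField.adjoin ℚ {Real.sqrt (η * q * r * s : ℕ)}) := by
  intro n
  unfold h2 layer
  rw [layer_KK]
  have hne : r ≠ s := by
    rintro rfl
    rw [(legendreSym.eq_zero_iff r _).2 (by simp)] at hrs
    exact zero_ne_one hrs
  have hsr : legendreSym r s = 1 := by rw [← leg_recip hr8 (by omega)]; exact hrs
  lift γ to ℕ using hγ.le
  lift γ' to ℕ using hγ'.le
  have hP : γ ^ 2 = 1 + (η * q * r * s) * γ' ^ 2 := by zify; push_cast at hPell; linear_combination hPell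
  have h1 : 1 < γ := by
    have : 0 < (η * q * r * s) * γ' ^ 2 := by
      have h1 : 0 < η := by omega
      have h2 := (Fact.out : q.Prime).pos
      have h3 := (Fact.out : r.Prime).pos
      have h4 := (Fact.out : s.Prime).pos
      have h5 : 0 < γ' := by exact_mod_cast hγ'
      positivity
    by_contra hc
    have : γ ^ 2 ≤ 1 := by
      have : γ ≤ 1 := by omega
      nlinarith
    omega
  obtain ⟨a0, b0, ε0, hε0, e1⟩ := pell_rs (Fact.out : r.Prime) (Fact.out : s.Prime) hr8 hs8 hne hNegPell
  obtain ⟨A, B, ε1, hε1, e2 | e2⟩ := pell_d_aux η hη hq4 hr8 hs8 hqr hqs hrs γ γ' h1 hP hfund hnsq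
  · exact Nm.concl (⟨hη, hq4, hr8, hs8, hne, leg_etaq hη hr8 hqr, leg_etaq hη hs8 hqs, hsr, hrs, hε0, hε1, e1, e2⟩ : Nm η q r s a0 b0 A B ε0 ε1) n
  · have h := Nm.concl (⟨hη, hq4, hs8, hr8, hne.symm, leg_etaq hη hs8 hqs, leg_etaq hη hr8 hqr, hrs, hsr,
      by rcases hε0 with h | h <;> rw [h] <;> simp, hε1, by linear_combination -e1, e2⟩ : Nm η q s r b0 a0 A B (-ε0) ε1) n
    rw [mul_comm s r, mul_right_comm (η * q) s r] at h
    exact h
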